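/- Let 𝒜 ⊂ 2ℕ be an IP set consisting of even positive integers. Then for any k ≥ 1 there is a finite sequence a_1, a_2, ..., a_k of elements of 𝒜 such that for every pair 1 ≤ i ≤ j ≤ k the sum a_i + a_{i+1} + ... + a_j is a de Polignac number; moreover the a_j can be chosen so that all of these sums (over pairs (i,j) with 1 ≤ i ≤ j ≤ k) are pairwise distinct. -/

import Mathlib

/-- `FS M` is the set of all nonzero finite sums of distinct elements of `M`. -/
def FS (M : Set ℕ) : Set ℕ :=
  {a | a ≠ 0 ∧ ∃ F : Finset ℕ, F.Nonempty ∧ ↑F ⊆ M ∧ ∑ x ∈ F, x = a}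

/-- `A` is an IP set if `A = FS M` for some infinite `M ⊆ ℕ`. -/
def IsIPSet (A : Set ℕ) : Prop :=
  ∃ M : Set ℕ, M.Infinite ∧ (∀ m ∈ M, 0 < m) ∧ A = FS M

/-- `m` is a de Polignac number if `p_{n+1} - p_n = m` for infinitely many `n`. -/
def DePolignac (m : ℕ) : Prop :=
  {n : ℕ | Nat.nth Nat.Prime (n + 1) - Nat.nth Nat.Prime n = m}.Infinite

namespace BG
set_option maxHeartbeats 400000
open Finset Filter Topology
open scoped ArithmeticFunction.vonMangoldt

/-- the weight -/
noncomputable def v (L : ℝ) (i : ℕ) (n : ℕ) : ℝ :=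
  (Real.log n) ^ i / (i.factorial : ℝ) * (n : ℝ) ^ (-(1 + 1 / L))

lemma v_nonneg (L : ℝ) (i n : ℕ) : 0 ≤ v L i n := by
  unfold v
  have : 0 ≤ Real.log n := Real.log_natCast_nonneg n
  positivity

lemma v_zero (L : ℝ) (hL : 0 < L) (i : ℕ) : v L i 0 = 0 := by
  unfold v
  have : (-(1 + 1 / L)) ≠ 0 := by
    have : 0 < 1 / L := by positivity
    linarith
  rw [Nat.cast_zero, Real.zero_rpow this, mul_zero]

lemma log_pow_le (L : ℝ) (hL : 0 < L) (i n : ℕ) (hn : 1 ≤ n) :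
    (Real.log n) ^ i / (i.factorial : ℝ) ≤ L ^ i * (n : ℝ) ^ (1 / L) := by
  have hn' : (0 : ℝ) < n := by exact_mod_cast hn
  have h0 : 0 ≤ Real.log n := Real.log_natCast_nonneg n
  have h := Real.pow_div_factorial_le_exp (Real.log n / L) (by positivity) i
  have e : (n : ℝ) ^ (1 / L) = Real.exp (Real.log n / L) := by
    rw [Real.rpow_def_of_pos hn']; ring_nf
  rw [e]
  calc (Real.log n) ^ i / (i.factorial : ℝ)
      = L ^ i * ((Real.log n / L) ^ i / (i.factorial : ℝ)) := by
        rw [div_pow]; field_simp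
    _ ≤ _ := by gcongr

lemma v_le (L : ℝ) (hL : 0 < L) (i n : ℕ) : v L i n ≤ L ^ i / n := by
  rcases Nat.eq_zero_or_pos n with rfl | hn
  · rw [v_zero L hL]; simp
  have hn' : (0 : ℝ) < n := by exact_mod_cast hn
  unfold v
  calc _ ≤ L ^ i * (n : ℝ) ^ (1 / L) * (n : ℝ) ^ (-(1 + 1 / L)) := by
        gcongr; exact log_pow_le L hL i n hn
    _ = L ^ i / n := by
        rw [mul_assoc, ← Real.rpow_add hn']
        have : 1 / L + -(1 + 1 / L) = -1 := by ring
        rw [this, Real.rpow_neg_one]; rfl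

lemma v_le' (L : ℝ) (hL : 0 < L) (i n : ℕ) : v L i n ≤ (2 * L) ^ i * v (2 * L) 0 n := by
  rcases Nat.eq_zero_or_pos n with rfl | hn
  · rw [v_zero L hL, v_zero (2 * L) (by positivity)]; simp
  have hn' : (0 : ℝ) < n := by exact_mod_cast hn
  unfold v
  calc _ ≤ (2 * L) ^ i * (n : ℝ) ^ (1 / (2 * L)) * (n : ℝ) ^ (-(1 + 1 / L)) := by
        gcongr; exact log_pow_le (2 * L) (by positivity) i n hn
    _ = _ := by
        rw [mul_assoc, ← Real.rpow_add hn']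
        have : 1 / (2 * L) + -(1 + 1 / L) = -(1 + 1 / (2 * L)) := by field_simp; ring
        rw [this]; simp

lemma v_mul (L : ℝ) (hL : 0 < L) (i m k : ℕ) :
    v L i (m * k) = ∑ p ∈ antidiagonal i, v L p.1 m * v L p.2 k := by
  rcases Nat.eq_zero_or_pos m with rfl | hm
  · simp [v_zero L hL]
  rcases Nat.eq_zero_or_pos k with rfl | hk
  · simp [v_zero L hL]
  have hm' : (0 : ℝ) < m := by exact_mod_cast hm
  have hk' : (0 : ℝ) < k := by exact_mod_cast hk
  unfold v
  rw [Nat.cast_mul, Real.log_mul hm'.ne' hk'.ne', Real.mul_rpow hm'.le hk'.le,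
    Finset.Nat.sum_antidiagonal_eq_sum_range_succ
      (f := fun a b => Real.log m ^ a / (a.factorial : ℝ) * (m : ℝ) ^ (-(1 + 1 / L)) *
        (Real.log k ^ b / (b.factorial : ℝ) * (k : ℝ) ^ (-(1 + 1 / L)))),
    add_pow, Finset.sum_div, Finset.sum_mul]
  refine Finset.sum_congr rfl fun a ha => ?_
  have ha' : a ≤ i := by simpa [Nat.lt_succ_iff] using ha
  rw [Nat.cast_choose ℝ ha']
  have := (Nat.factorial_pos a); have := (Nat.factorial_pos (i - a))
  have := (Nat.factorial_pos i)
  field_simp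

lemma v_antitone (L : ℝ) (hL : 0 < L) (i m n : ℕ) (hm : 1 ≤ m) (him : (i : ℝ) ≤ Real.log m)
    (hmn : m ≤ n) : v L i n ≤ v L i m := by
  have hm' : (0 : ℝ) < m := by exact_mod_cast hm
  have hmn' : (m : ℝ) ≤ n := by exact_mod_cast hmn
  have hn' : (0 : ℝ) < n := lt_of_lt_of_le hm' hmn'
  have hlog : Real.log m ≤ Real.log n := Real.log_le_log hm' hmn'
  rcases Nat.eq_zero_or_pos i with rfl | hi
  · unfold v
    simp only [pow_zero, Nat.factorial_zero, Nat.cast_one, div_one, one_mul]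
    apply Real.rpow_le_rpow_of_nonpos hm' hmn'
    have : 0 < 1 / L := by positivity
    linarith
  have hi' : (1 : ℝ) ≤ i := by exact_mod_cast hi
  set t := Real.log m with ht
  set u := Real.log n with hu
  have htpos : 0 < t := by linarith
  have key : u ^ i ≤ t ^ i * Real.exp (u - t) := by
    have h1 : u / t ≤ Real.exp ((u - t) / t) := by
      have := Real.add_one_le_exp ((u - t) / t)
      have e : (u - t) / t + 1 = u / t := by field_simp; ring
      linarith
    have h2 : (u / t) ^ i ≤ Real.exp (u - t) := by
      calc (u / t) ^ i ≤ (Real.exp ((u - t) / t)) ^ i := by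
            gcongr
        _ = Real.exp (i * ((u - t) / t)) := by rw [← Real.exp_nat_mul]
        _ ≤ Real.exp (u - t) := by
            apply Real.exp_le_exp.mpr
            rw [mul_div_assoc', div_le_iff₀ htpos]
            nlinarith
    rw [div_pow, div_le_iff₀ (by positivity)] at h2
    linarith
  unfold v
  rw [← ht, ← hu]
  have e1 : (n : ℝ) ^ (-(1 + 1 / L)) ≤ Real.exp (-(u - t)) * (m : ℝ) ^ (-(1 + 1 / L)) := by
    rw [Real.rpow_def_of_pos hn', Real.rpow_def_of_pos hm', ← Real.exp_add, ← ht, ← hu]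
    apply Real.exp_le_exp.mpr
    have : 0 < 1 / L := by positivity
    nlinarith
  calc u ^ i / (i.factorial : ℝ) * (n : ℝ) ^ (-(1 + 1 / L))
      ≤ (t ^ i * Real.exp (u - t)) / (i.factorial : ℝ) *
          (Real.exp (-(u - t)) * (m : ℝ) ^ (-(1 + 1 / L))) := by gcongr
    _ = t ^ i / (i.factorial : ℝ) * (m : ℝ) ^ (-(1 + 1 / L)) * (Real.exp (u - t) * Real.exp (-(u - t))) := by ring
    _ = _ := by rw [← Real.exp_add]; simp

lemma summable_v (L : ℝ) (hL : 0 < L) (i : ℕ) : Summable (v L i) := by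
  apply Summable.of_nonneg_of_le (v_nonneg L i) (v_le' L hL i)
  apply Summable.mul_left
  unfold v
  simp only [pow_zero, Nat.factorial_zero, Nat.cast_one, div_one, one_mul]
  rw [Real.summable_nat_rpow]
  have : 0 < 1 / (2 * L) := by positivity
  linarith

/-- Abel summation bound. -/
lemma abel_finite (c : ℕ → ℂ) (g : ℕ → ℝ) (B : ℝ) (hg0 : ∀ n, 0 ≤ g n)
    (hg : Antitone g) (hc : ∀ N, ‖∑ n ∈ range N, c n‖ ≤ B) (N : ℕ) :
    ‖∑ n ∈ range N, c n * (g n : ℂ)‖ ≤ B * g 0 := by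
  have key : ∀ N, ∑ n ∈ range N, c n * (g n : ℂ) =
      (g N : ℂ) * ∑ n ∈ range N, c n +
      ∑ n ∈ range N, ((g n - g (n + 1) : ℝ) : ℂ) * ∑ m ∈ range (n + 1), c m := by
    intro N
    induction N with
    | zero => simp
    | succ N ih =>
      rw [sum_range_succ, ih, sum_range_succ _ N, sum_range_succ _ N]
      push_cast
      rw [sum_range_succ]
      ring
  rw [key]
  have h1 : ‖∑ n ∈ range N, ((g n - g (n + 1) : ℝ) : ℂ) * ∑ m ∈ range (n + 1), c m‖ ≤
      ∑ n ∈ range N, (g n - g (n + 1)) * B := by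
    refine (norm_sum_le _ _).trans (sum_le_sum fun n _ => ?_)
    rw [norm_mul, Complex.norm_real, Real.norm_of_nonneg (sub_nonneg.mpr (hg (Nat.le_succ n)))]
    exact mul_le_mul_of_nonneg_left (hc _) (sub_nonneg.mpr (hg (Nat.le_succ n)))
  have h2 : ‖(g N : ℂ) * ∑ n ∈ range N, c n‖ ≤ g N * B := by
    rw [norm_mul, Complex.norm_real, Real.norm_of_nonneg (hg0 N)]
    exact mul_le_mul_of_nonneg_left (hc _) (hg0 N)
  have h3 : ∑ n ∈ range N, (g n - g (n + 1)) * B = (g 0 - g N) * B := by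
    rw [← sum_mul, sum_range_sub']
  refine (norm_add_le _ _).trans ?_
  nlinarith

/-- Abel summation bound for series started at `m0`. -/
lemma abel_tsum (c : ℕ → ℂ) (g : ℕ → ℝ) (B : ℝ) (hB : 0 ≤ B) (m0 : ℕ) (hg0 : ∀ n, 0 ≤ g n)
    (hg : ∀ m n, m0 ≤ m → m ≤ n → g n ≤ g m) (hc : ∀ N, ‖∑ n ∈ range N, c n‖ ≤ B)
    (hc0 : ∀ n < m0, c n = 0) :
    ‖∑' n, c n * (g n : ℂ)‖ ≤ B * g m0 := by
  by_cases hs : Summable (fun n => c n * (g n : ℂ))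
  swap
  · rw [tsum_eq_zero_of_not_summable hs, norm_zero]; exact mul_nonneg hB (hg0 _)
  have h := hs.hasSum.tendsto_sum_nat
  refine le_of_tendsto h.norm (Eventually.of_forall fun N => ?_)
  set g' : ℕ → ℝ := fun n => g (max m0 n) with hg'
  have e : ∑ n ∈ range N, c n * (g n : ℂ) = ∑ n ∈ range N, c n * (g' n : ℂ) := by
    refine sum_congr rfl fun n _ => ?_
    by_cases hn : n < m0
    · rw [hc0 n hn]; simp
    · rw [hg']; simp only; rw [max_eq_right (not_lt.mp hn)]
  rw [e]
  have := abel_finite c g' B (fun n => hg0 _) (fun a b hab => hg _ _ (le_max_left _ _)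
    (max_le_max le_rfl hab)) hc N
  simpa [hg'] using this

/-- weighted sum -/
noncomputable def S (L : ℝ) (i : ℕ) (f : ℕ → ℂ) : ℂ := ∑' n, f n * (v L i n : ℂ)

/-- Tame coefficient sequences -/
def Tame (f : ℕ → ℂ) : Prop := ∀ s : ℝ, 1 < s → LSeriesSummable f s

lemma tame_iff (f : ℕ → ℂ) : Tame f ↔ LSeries.abscissaOfAbsConv f ≤ 1 := by
  constructor
  · intro h
    exact LSeries.abscissaOfAbsConv_le_of_forall_lt_LSeriesSummable (x := 1) h
  · intro h s hs
    apply LSeriesSummable_of_abscissaOfAbsConv_lt_re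
    refine lt_of_le_of_lt h ?_
    simpa using (by exact_mod_cast hs : (1 : EReal) < (s : EReal))

/-- multiplication by log^i/i! -/
noncomputable def lp (i : ℕ) (f : ℕ → ℂ) : ℕ → ℂ :=
  fun n => f n * (((Real.log n) ^ i / (i.factorial : ℝ) : ℝ) : ℂ)

lemma lp_term (L : ℝ) (hL : 0 < L) (i : ℕ) (f : ℕ → ℂ) (n : ℕ) :
    LSeries.term (lp i f) ((1 + 1 / L : ℝ) : ℂ) n = f n * (v L i n : ℂ) := by
  rcases Nat.eq_zero_or_pos n with rfl | hn
  · simp [v_zero L hL]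
  rw [LSeries.term_of_ne_zero hn.ne']
  have hn' : (0 : ℝ) < n := by exact_mod_cast hn
  unfold lp v
  rw [Complex.ofReal_mul, Complex.ofReal_cpow hn'.le, div_eq_mul_inv, ← Complex.cpow_neg]
  push_cast
  ring

lemma Tame.lp {f : ℕ → ℂ} (hf : Tame f) (i : ℕ) : Tame (lp i f) := by
  have h : LSeries.abscissaOfAbsConv (LSeries.logMul^[i] f) ≤ 1 := by
    rw [LSeries.absicssaOfAbsConv_logPowMul]; exact (tame_iff f).mp hf
  have e : ∀ i, ∀ n, (LSeries.logMul^[i] f) n = (Complex.log n) ^ i * f n := by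
    intro i
    induction i with
    | zero => intro n; simp
    | succ i ih =>
      intro n
      rw [Function.iterate_succ_apply', LSeries.logMul, ih]; ring
  have e2 : BG.lp i f = ((i.factorial : ℂ)⁻¹) • (LSeries.logMul^[i] f) := by
    funext n
    rw [Pi.smul_apply, e, BG.lp, smul_eq_mul, ← Complex.natCast_log]
    push_cast; ring
  rw [e2]
  intro s hs
  exact ((tame_iff _).mpr h s hs).smul _

lemma Tame.summable {f : ℕ → ℂ} (hf : Tame f) (L : ℝ) (hL : 0 < L) (i : ℕ) :
    Summable (fun n => f n * (v L i n : ℂ)) := by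
  have h := hf.lp i (1 + 1 / L) (by have : 0 < 1 / L := by positivity
                                    linarith)
  unfold LSeriesSummable at h
  exact h.congr (fun n => (lp_term L hL i f n))

lemma S_eq (L : ℝ) (hL : 0 < L) (i : ℕ) (f : ℕ → ℂ) :
    S L i f = LSeries (lp i f) ((1 + 1 / L : ℝ) : ℂ) := by
  unfold S LSeries
  exact tsum_congr fun n => (lp_term L hL i f n).symm

lemma Tame.conv {f g : ℕ → ℂ} (hf : Tame f) (hg : Tame g) : Tame (LSeries.convolution f g) :=
  fun s hs => (hf s hs).convolution (hg s hs)

lemma Tame.add {f g : ℕ → ℂ} (hf : Tame f) (hg : Tame g) : Tame (f + g) :=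
  fun s hs => (hf s hs).add (hg s hs)

lemma Tame.sub {f g : ℕ → ℂ} (hf : Tame f) (hg : Tame g) : Tame (f - g) :=
  fun s hs => (hf s hs).sub (hg s hs)

lemma Tame.mono {f g : ℕ → ℂ} (hg : Tame g) (h : ∀ n, ‖f n‖ ≤ ‖g n‖) : Tame f := by
  intro s hs
  refine Summable.of_norm_bounded (hg s hs).norm fun n => ?_
  exact LSeries.norm_term_le s (h n)

lemma tame_one : Tame (fun _ => (1 : ℂ)) := by
  rw [tame_iff]
  exact LSeries.abscissaOfAbsConv_le_of_le_const ⟨1, by simp⟩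

lemma tame_log : Tame (fun n => ((Real.log n : ℝ) : ℂ)) := by
  have := tame_one.lp 1
  unfold lp at this
  simpa using this

lemma tame_Lambda : Tame (fun n => ((Λ n : ℝ) : ℂ)) := by
  intro s hs
  exact ArithmeticFunction.LSeriesSummable_vonMangoldt (by simpa using hs)

lemma lp_conv (i : ℕ) (f g : ℕ → ℂ) :
    lp i (LSeries.convolution f g) =
      ∑ p ∈ antidiagonal i, LSeries.convolution (lp p.1 f) (lp p.2 g) := by
  funext n
  rw [Finset.sum_apply]
  simp only [LSeries.convolution_def, lp]
  rw [Finset.sum_comm, Finset.sum_mul]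
  refine Finset.sum_congr rfl fun p hp => ?_
  rw [Nat.mem_divisorsAntidiagonal] at hp
  obtain ⟨hp, hn⟩ := hp
  have h1 : p.1 ≠ 0 := by rintro h; simp [h] at hp; exact hn hp.symm
  have h2 : p.2 ≠ 0 := by rintro h; simp [h] at hp; exact hn hp.symm
  have key := v_mul 1 one_pos i p.1 p.2
  have hm' : (0 : ℝ) < p.1 := by exact_mod_cast Nat.pos_of_ne_zero h1
  have hk' : (0 : ℝ) < p.2 := by exact_mod_cast Nat.pos_of_ne_zero h2
  have : (Real.log n) ^ i / (i.factorial : ℝ) = ∑ q ∈ antidiagonal i,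
      (Real.log p.1) ^ q.1 / (q.1.factorial : ℝ) * ((Real.log p.2) ^ q.2 / (q.2.factorial : ℝ)) := by
    unfold v at key
    rw [Nat.cast_mul, Real.mul_rpow hm'.le hk'.le, ← Nat.cast_mul, hp] at key
    have hx : (p.1 : ℝ) ^ (-(1 + 1 / 1 : ℝ)) * (p.2 : ℝ) ^ (-(1 + 1 / 1 : ℝ)) ≠ 0 := by positivity
    apply mul_right_cancel₀ hx
    rw [key, Finset.sum_mul]
    exact Finset.sum_congr rfl fun q _ => by ring
  rw [this]
  push_cast
  rw [Finset.mul_sum]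
  exact Finset.sum_congr rfl fun q _ => by ring

lemma S_conv (L : ℝ) (hL : 0 < L) (i : ℕ) {f g : ℕ → ℂ} (hf : Tame f) (hg : Tame g) :
    S L i (LSeries.convolution f g) = ∑ p ∈ antidiagonal i, S L p.1 f * S L p.2 g := by
  have hs : 1 < (1 + 1 / L : ℝ) := by
    have : 0 < 1 / L := by positivity
    linarith
  rw [S_eq L hL, lp_conv, LSeries_sum]
  · refine Finset.sum_congr rfl fun p _ => ?_
    rw [LSeries_convolution' ((hf.lp p.1) _ hs) ((hg.lp p.2) _ hs), S_eq L hL, S_eq L hL]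
  · intro p _
    exact ((hf.lp p.1).conv (hg.lp p.2)) _ hs

lemma S_add (L : ℝ) (hL : 0 < L) (i : ℕ) {f g : ℕ → ℂ} (hf : Tame f) (hg : Tame g) :
    S L i (f + g) = S L i f + S L i g := by
  unfold S
  rw [← (hf.summable L hL i).tsum_add (hg.summable L hL i)]
  exact tsum_congr fun n => by simp [add_mul]

lemma S_sub (L : ℝ) (hL : 0 < L) (i : ℕ) {f g : ℕ → ℂ} (hf : Tame f) (hg : Tame g) :
    S L i (f - g) = S L i f - S L i g := by
  unfold S
  rw [← (hf.summable L hL i).tsum_sub (hg.summable L hL i)]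
  exact tsum_congr fun n => by simp [sub_mul]

/-- `log n * v_i = (i+1) v_{i+1}` -/
lemma log_mul_v (L : ℝ) (i n : ℕ) : Real.log n * v L i n = (i + 1) * v L (i + 1) n := by
  unfold v
  rw [Nat.factorial_succ]
  have := Nat.factorial_pos i
  push_cast
  field_simp
  ring

lemma S_log (L : ℝ) (i : ℕ) (f : ℕ → ℂ) :
    S L i (fun n => f n * ((Real.log n : ℝ) : ℂ)) = (i + 1) * S L (i + 1) f := by
  unfold S
  rw [← tsum_mul_left]
  refine tsum_congr fun n => ?_
  have := log_mul_v L i n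
  rw [mul_assoc, ← Complex.ofReal_mul, this]
  push_cast; ring

end BG

namespace BG
set_option maxHeartbeats 400000
open Finset Filter Topology
open scoped ArithmeticFunction.vonMangoldt

/-- Recursion bound for logarithmic derivative coefficients. -/
lemma rec_bound (a b : ℕ → ℂ) (M κ δ : ℝ) (hκ : 0 < κ) (hδ : 0 < δ) (hM : δ ≤ M)
    (hab : ∀ i : ℕ, ((i : ℂ) + 1) * a (i + 1) = ∑ p ∈ antidiagonal i, b p.1 * a p.2)
    (ha : ∀ i, ‖a i‖ ≤ M * κ ^ i) (ha0 : δ ≤ ‖a 0‖) (i : ℕ) :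
    ‖b i‖ ≤ (4 * κ * M / δ) ^ (i + 1) := by
  have hMpos : 0 < M := lt_of_lt_of_le hδ hM
  set x := 4 * M / δ with hx
  have hx4 : 4 ≤ x := by rw [hx, le_div_iff₀ hδ]; linarith
  have hT : 4 * κ * M / δ = κ * x := by rw [hx]; ring
  rw [hT]
  induction i using Nat.strong_induction_on with
  | _ i ih =>
    have h := hab i
    rw [Finset.Nat.sum_antidiagonal_eq_sum_range_succ (f := fun p q => b p * a q),
      sum_range_succ, Nat.sub_self] at h
    have h1 : b i * a 0 = ((i : ℂ) + 1) * a (i + 1) - ∑ l ∈ range i, b l * a (i - l) := by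
      rw [h]; ring
    have h2 : ‖b i‖ * δ ≤ (i + 1) * (M * κ ^ (i + 1)) + ∑ l ∈ range i, (κ * x) ^ (l + 1) * (M * κ ^ (i - l)) := by
      calc ‖b i‖ * δ ≤ ‖b i‖ * ‖a 0‖ := by gcongr
        _ = ‖b i * a 0‖ := (norm_mul _ _).symm
        _ ≤ ‖((i : ℂ) + 1) * a (i + 1)‖ + ‖∑ l ∈ range i, b l * a (i - l)‖ := by
            rw [h1]; exact norm_sub_le _ _
        _ ≤ _ := by
            apply add_le_add
            · rw [norm_mul]
              have : ‖((i : ℂ) + 1)‖ = (i : ℝ) + 1 := by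
                rw [show ((i : ℂ) + 1) = ((i + 1 : ℕ) : ℂ) by push_cast; ring, Complex.norm_natCast]
                push_cast; ring
              rw [this]
              gcongr
              exact ha _
            · refine (norm_sum_le _ _).trans (sum_le_sum fun l hl => ?_)
              rw [norm_mul]
              exact mul_le_mul (ih l (mem_range.mp hl)) (ha _) (norm_nonneg _) (by positivity)
    have h3 : ∑ l ∈ range i, (κ * x) ^ (l + 1) * (M * κ ^ (i - l)) =
        M * κ ^ (i + 1) * ∑ l ∈ range i, x ^ (l + 1) := by
      rw [mul_sum]
      refine sum_congr rfl fun l hl => ?_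
      have : i + 1 = (l + 1) + (i - l) := by have := mem_range.mp hl; omega
      rw [this, pow_add, mul_pow]; ring
    have h4 : ∀ i : ℕ, (i + 1 : ℝ) + ∑ l ∈ range i, x ^ (l + 1) ≤ 4 * x ^ i - 2 := by
      intro i
      induction i with
      | zero => simp; norm_num
      | succ n ihn =>
        rw [sum_range_succ]
        have hp : 1 ≤ x ^ n := one_le_pow₀ (by linarith)
        push_cast
        have : x ^ (n + 1) = x * x ^ n := by ring
        nlinarith
    rw [h3] at h2
    have h5 : ‖b i‖ * δ ≤ M * κ ^ (i + 1) * (4 * x ^ i) := by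
      have hp : 0 ≤ M * κ ^ (i + 1) := by positivity
      nlinarith [h4 i, mul_le_mul_of_nonneg_left (h4 i) hp]
    have h6 : M * κ ^ (i + 1) * (4 * x ^ i) = (κ * x) ^ (i + 1) * δ := by
      rw [mul_pow, pow_succ x]
      have : x * δ = 4 * M := by rw [hx]; field_simp
      calc _ = κ ^ (i + 1) * x ^ i * (4 * M) := by ring
        _ = _ := by rw [← this]; ring
    rw [h6] at h5
    exact le_of_mul_le_mul_right h5 hδ

/-- General Cauchy-estimate asymptotic. -/
lemma S_asymp (f : ℕ → ℂ) (hf : Tame f) (G : ℂ → ℂ) (ρ : ℝ) (hρ : 0 < ρ)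
    (hG : DifferentiableOn ℂ G (Metric.ball 1 (3 * ρ)))
    (hfG : ∀ s : ℂ, 1 < s.re → s ∈ Metric.ball 1 (3 * ρ) → LSeries f s = (s - 1)⁻¹ + G s) :
    ∃ C : ℝ, 0 ≤ C ∧ ∀ L : ℝ, 0 < L → 1 / L < ρ → ∀ i : ℕ,
      ‖S L i f - (L : ℂ) ^ (i + 1)‖ ≤ C / ρ ^ i := by
  have hcomp : IsCompact (Metric.closedBall (1 : ℂ) (2 * ρ)) := isCompact_closedBall _ _
  have hsub : Metric.closedBall (1 : ℂ) (2 * ρ) ⊆ Metric.ball 1 (3 * ρ) :=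
    Metric.closedBall_subset_ball (by linarith)
  obtain ⟨C, hC⟩ := hcomp.exists_bound_of_continuousOn (hG.continuousOn.mono hsub)
  have hC0 : 0 ≤ C := (norm_nonneg _).trans (hC 1 (by simp; linarith))
  refine ⟨C, hC0, fun L hL hLρ i => ?_⟩
  set s : ℂ := ((1 + 1 / L : ℝ) : ℂ) with hs
  have hLpos : 0 < 1 / L := by positivity
  have hsre : 1 < s.re := by rw [hs, Complex.ofReal_re]; linarith
  have hs1 : s - 1 = ((1 / L : ℝ) : ℂ) := by rw [hs]; push_cast; ring
  have hdist : dist s 1 < ρ := by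
    rw [dist_eq_norm, hs1, Complex.norm_real, Real.norm_of_nonneg hLpos.le]; exact hLρ
  have hbsub : Metric.closedBall s ρ ⊆ Metric.closedBall 1 (2 * ρ) := by
    intro w hw
    rw [Metric.mem_closedBall] at *
    have := dist_triangle w s 1
    linarith
  have hcauchy := Complex.norm_iteratedDeriv_le_of_forall_mem_sphere_norm_le (f := G) (c := s)
    (R := ρ) (C := C) i hρ
    (by
      apply DifferentiableOn.diffContOnCl
      rw [closure_ball s hρ.ne']
      exact hG.mono (hbsub.trans hsub))
    (fun w hw => hC w (hbsub (Metric.sphere_subset_closedBall hw)))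
  have hsball : s ∈ Metric.ball (1 : ℂ) (3 * ρ) := by rw [Metric.mem_ball]; linarith
  have hev : LSeries f =ᶠ[𝓝 s] ((fun w : ℂ => (1 * w - 1)⁻¹) + G) := by
    have h1 : ∀ᶠ w in 𝓝 s, 1 < w.re := (isOpen_lt continuous_const Complex.continuous_re).mem_nhds hsre
    have h2 : ∀ᶠ w in 𝓝 s, w ∈ Metric.ball (1 : ℂ) (3 * ρ) := Metric.isOpen_ball.mem_nhds hsball
    filter_upwards [h1, h2] with w hw1 hw2
    rw [hfG w hw1 hw2]; simp
  have hne : s - 1 ≠ 0 := by rw [hs1]; exact_mod_cast hLpos.ne'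
  have hadd : iteratedDeriv i (LSeries f) s = (-1) ^ i * (i.factorial : ℂ) * (L : ℂ) ^ (i + 1) +
      iteratedDeriv i G s := by
    rw [hev.iteratedDeriv_eq, iteratedDeriv_add, iteratedDeriv_eq_iterate, iter_deriv_inv_linear_sub]
    · congr 1
      simp only [one_pow, mul_one, one_mul, hs1]
      congr 1
      have : (-1 - (i : ℤ)) = -((i + 1 : ℕ) : ℤ) := by push_cast; ring
      rw [this, zpow_neg, zpow_natCast, ← inv_pow]
      push_cast
      simp
    · apply ContDiffAt.inv
      · fun_prop
      · simpa using hne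
    · exact (hG.analyticAt (Metric.isOpen_ball.mem_nhds hsball)).contDiffAt
  have hlog : iteratedDeriv i (LSeries f) s = (-1) ^ i * (i.factorial : ℂ) * S L i f := by
    rw [LSeries_iteratedDeriv, S_eq L hL, mul_assoc]
    · congr 1
      have e : ∀ i, ∀ n, (LSeries.logMul^[i] f) n = (Complex.log n) ^ i * f n := by
        intro i
        induction i with
        | zero => intro n; simp
        | succ i ih =>
          intro n
          rw [Function.iterate_succ_apply', LSeries.logMul, ih]; ring
      have e2 : LSeries.logMul^[i] f = ((i.factorial : ℂ)) • lp i f := by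
        funext n
        rw [Pi.smul_apply, e, lp, smul_eq_mul, ← Complex.natCast_log]
        have : (i.factorial : ℂ) ≠ 0 := by exact_mod_cast Nat.factorial_ne_zero i
        push_cast; field_simp
      rw [e2, LSeries_smul]
    · refine lt_of_le_of_lt ((tame_iff f).mp hf) ?_
      exact_mod_cast hsre
  have hfac : (0 : ℝ) < i.factorial := by exact_mod_cast Nat.factorial_pos i
  have : (-1) ^ i * (i.factorial : ℂ) * (S L i f - (L : ℂ) ^ (i + 1)) = iteratedDeriv i G s := by
    rw [mul_sub, ← hlog, hadd]; ring
  have hn : (i.factorial : ℝ) * ‖S L i f - (L : ℂ) ^ (i + 1)‖ = ‖iteratedDeriv i G s‖ := by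
    rw [← this, norm_mul, norm_mul]; simp
  have h2 : (i.factorial : ℝ) * ‖S L i f - (L : ℂ) ^ (i + 1)‖ ≤ i.factorial * (C / ρ ^ i) := by
    rw [hn]; rw [← mul_div_assoc]; exact hcauchy
  exact le_of_mul_le_mul_left h2 hfac

lemma S_one_asymp : ∃ C : ℝ, 0 ≤ C ∧ ∃ ρ : ℝ, 0 < ρ ∧ ∀ L : ℝ, 0 < L → 1 / L < ρ → ∀ i : ℕ,
    ‖S L i (fun _ => 1) - (L : ℂ) ^ (i + 1)‖ ≤ C / ρ ^ i := by
  obtain ⟨C, hC, h⟩ := S_asymp (fun _ => 1) tame_one riemannZeta₀ 1 one_pos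
    differentiable_riemannZeta₀.differentiableOn (by
      intro s hs _
      have : LSeries (fun _ => (1 : ℂ)) s = riemannZeta s := LSeries_one_eq_riemannZeta hs
      rw [this]
      apply riemannZeta_eq_inv_sub_add
      rintro rfl; simp at hs)
  exact ⟨C, hC, 1, one_pos, h⟩

lemma S_Lambda_asymp : ∃ C : ℝ, 0 ≤ C ∧ ∃ ρ : ℝ, 0 < ρ ∧ ∀ L : ℝ, 0 < L → 1 / L < ρ → ∀ i : ℕ,
    ‖S L i (fun n => ((Λ n : ℝ) : ℂ)) - (L : ℂ) ^ (i + 1)‖ ≤ C / ρ ^ i := by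
  obtain ⟨ε, hε, hball⟩ := Metric.eventually_nhds_iff_ball.mp riemannZeta₁_ne_zero_of_near_one
  obtain ⟨C, hC, h⟩ := S_asymp (fun n => ((Λ n : ℝ) : ℂ)) tame_Lambda
    (fun s => - deriv riemannZeta₁ s / riemannZeta₁ s) (ε / 3) (by positivity)
    (by
      have e : 3 * (ε / 3) = ε := by ring
      rw [e]
      apply DifferentiableOn.div
      · exact (differentiable_riemannZeta₁.deriv).neg.differentiableOn
      · exact differentiable_riemannZeta₁.differentiableOn
      · exact hball)
    (by
      have e : 3 * (ε / 3) = ε := by ring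
      rw [e]
      intro s hs hsb
      have hs1 : s ≠ 1 := by rintro rfl; simp at hs
      have hne := hball s hsb
      rw [ArithmeticFunction.LSeries_vonMangoldt_eq_deriv_riemannZeta_div hs]
      have hev : riemannZeta =ᶠ[𝓝 s] fun w => (w - 1)⁻¹ * riemannZeta₁ w := by
        filter_upwards [isOpen_ne.mem_nhds hs1] with w hw
        exact riemannZeta_eq_inv_sub_mul hw
      have hsub : s - 1 ≠ 0 := sub_ne_zero.mpr hs1
      have hd : HasDerivAt (fun w => (w - 1)⁻¹ * riemannZeta₁ w)
          (-1 / (s - 1) ^ 2 * riemannZeta₁ s + (s - 1)⁻¹ * deriv riemannZeta₁ s) s := by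
        apply HasDerivAt.mul
        · exact ((hasDerivAt_id s).sub_const 1).fun_inv hsub
        · exact (differentiable_riemannZeta₁ s).hasDerivAt
      rw [hev.deriv_eq, hd.deriv, riemannZeta_eq_inv_sub_mul hs1]
      field_simp
      ring)
  exact ⟨C, hC, ε / 3, by positivity, h⟩

end BG

namespace BG
set_option maxHeartbeats 400000
open Finset Filter Topology
open scoped ArithmeticFunction.vonMangoldt

lemma sum_inv_le (N : ℕ) : ∑ n ∈ range (N + 1), 1 / (n : ℝ) ≤ 1 + Real.log N := by
  have h := harmonic_le_one_add_log N
  rw [sum_range_succ']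
  unfold harmonic at h
  push_cast at h ⊢
  simpa using h

lemma v_le_log (L : ℝ) (hL : 0 < L) (i n : ℕ) :
    v L i n ≤ (Real.log n) ^ i / (i.factorial : ℝ) * (1 / n) := by
  rcases Nat.eq_zero_or_pos n with rfl | hn
  · rw [v_zero L hL]; simp
  have hn' : (1 : ℝ) ≤ n := by exact_mod_cast hn
  unfold v
  have h0 : 0 ≤ Real.log n := Real.log_natCast_nonneg n
  gcongr
  have e : (1 : ℝ) / n = (n : ℝ) ^ (-1 : ℝ) := by rw [one_div, Real.rpow_neg_one]
  rw [e]
  apply Real.rpow_le_rpow_of_exponent_le hn'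
  have : 0 < 1 / L := by positivity
  linarith

lemma tame_of_bdd (c : ℕ → ℂ) (hc : ∀ n, ‖c n‖ ≤ 1) : Tame c :=
  tame_one.mono (fun n => by simpa using hc n)

lemma a_bound (c : ℕ → ℂ) (hc : ∀ n, ‖c n‖ ≤ 1) (B lam : ℝ) (hlam : 1 ≤ lam)
    (hB : B ≤ Real.exp lam) (hps : ∀ N, ‖∑ n ∈ range N, c n‖ ≤ B) (L : ℝ) (hL : 0 < L) (i : ℕ) :
    ‖S L i c‖ ≤ 40 * lam * (6 * lam) ^ i := by
  have hB0 : 0 ≤ B := (norm_nonneg _).trans (hps 0)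
  set N1 : ℕ := ⌈Real.exp (i + lam)⌉₊ with hN1
  have hge : Real.exp (i + lam) ≤ N1 := Nat.le_ceil _
  have hpos : (0 : ℝ) < N1 := lt_of_lt_of_le (Real.exp_pos _) hge
  have hN1pos : 1 ≤ N1 := by exact_mod_cast hpos
  have hle : (N1 : ℝ) ≤ Real.exp (i + lam + 1) := by
    have h1 : (N1 : ℝ) < Real.exp (i + lam) + 1 := Nat.ceil_lt_add_one (Real.exp_pos _).le
    have h2 : 1 ≤ Real.exp (i + lam) := Real.one_le_exp (by positivity)
    have h3 := Real.add_one_le_exp (1 : ℝ)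
    rw [Real.exp_add (i + lam) 1]
    nlinarith
  have hlog1 : (i : ℝ) ≤ Real.log N1 := by
    rw [Real.le_log_iff_exp_le hpos]
    exact (Real.exp_le_exp.mpr (by linarith)).trans hge
  have hlog2 : Real.log N1 ≤ i + lam + 1 := (Real.log_le_iff_le_exp hpos).mpr hle
  set X := (i + lam + 1) ^ i / (i.factorial : ℝ) with hX
  have hX0 : 0 ≤ X := by positivity
  have hXb : X ≤ lam ^ i * Real.exp (i + 2) := by
    have h := Real.pow_div_factorial_le_exp ((i + lam + 1) / lam) (by positivity) i
    have h1 : (i + lam + 1) / lam ≤ i + 2 := by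
      rw [div_le_iff₀ (by linarith)]
      have : (0 : ℝ) ≤ i := by positivity
      nlinarith
    calc X = lam ^ i * (((i + lam + 1) / lam) ^ i / (i.factorial : ℝ)) := by
          rw [hX, div_pow]; field_simp
      _ ≤ lam ^ i * Real.exp ((i + lam + 1) / lam) := by gcongr
      _ ≤ _ := by gcongr
  have hsplit : S L i c = ∑ n ∈ range N1, c n * (v L i n : ℂ) +
      ∑' n, (if n < N1 then 0 else c n) * (v L i n : ℂ) := by
    have hs := (tame_of_bdd c hc).summable L hL i
    unfold S
    have h1 : ∑ n ∈ range N1, c n * (v L i n : ℂ) =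
        ∑' n, (if n < N1 then c n else 0) * (v L i n : ℂ) := by
      rw [tsum_eq_sum (s := range N1)]
      · exact sum_congr rfl fun n hn => by rw [if_pos (mem_range.mp hn)]
      · intro n hn; rw [if_neg (by simpa using hn)]; simp
    rw [h1, ← Summable.tsum_add]
    · exact tsum_congr fun n => by split_ifs <;> simp
    · exact (tame_of_bdd (fun n => if n < N1 then c n else 0) (fun n => by
        split_ifs; exact hc n; simp)).summable L hL i
    · exact (tame_of_bdd (fun n => if n < N1 then 0 else c n) (fun n => by
        split_ifs; simp; exact hc n)).summable L hL i
  have htail : ‖∑' n, (if n < N1 then 0 else c n) * (v L i n : ℂ)‖ ≤ 2 * B * v L i N1 := by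
    apply abel_tsum _ _ _ (by positivity) N1 (v_nonneg L i)
    · intro m n hm hmn
      refine v_antitone L hL i m n (hN1pos.trans hm) (hlog1.trans ?_) hmn
      exact Real.log_le_log hpos (by exact_mod_cast hm)
    · intro N
      have : ∑ n ∈ range N, (if n < N1 then 0 else c n) =
          ∑ n ∈ range N, c n - ∑ n ∈ range (min N N1), c n := by
        rw [eq_sub_iff_add_eq]
        have e : ∑ n ∈ range (min N N1), c n = ∑ n ∈ range N, (if n < N1 then c n else 0) := by
          rw [← sum_filter]
          congr 1
          ext n; simp
        rw [e, ← sum_add_distrib]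
        exact sum_congr rfl fun n _ => by split_ifs <;> simp
      rw [this]
      refine (norm_sub_le _ _).trans ?_
      linarith [hps N, hps (min N N1)]
    · intro n hn; rw [if_pos hn]
  have hvb : ∀ n ∈ range (N1 + 1), v L i n ≤ X * (1 / n) := by
    intro n hn
    refine (v_le_log L hL i n).trans ?_
    rcases Nat.eq_zero_or_pos n with rfl | hn0
    · simp
    have hl : Real.log n ≤ i + lam + 1 := by
      refine le_trans (Real.log_le_log (by exact_mod_cast hn0) ?_) hlog2
      have := mem_range.mp hn
      exact_mod_cast (by omega : n ≤ N1)
    have hl0 : 0 ≤ Real.log n := Real.log_natCast_nonneg n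
    rw [hX]
    gcongr
  have hhead : ‖∑ n ∈ range N1, c n * (v L i n : ℂ)‖ ≤ X * (i + lam + 2) := by
    calc _ ≤ ∑ n ∈ range N1, v L i n := by
          refine (norm_sum_le _ _).trans (sum_le_sum fun n _ => ?_)
          rw [norm_mul, Complex.norm_real, Real.norm_of_nonneg (v_nonneg L i n)]
          exact mul_le_of_le_one_left (v_nonneg L i n) (hc n)
      _ ≤ ∑ n ∈ range (N1 + 1), v L i n := by
          rw [sum_range_succ]; linarith [v_nonneg L i N1]
      _ ≤ ∑ n ∈ range (N1 + 1), X * (1 / n) := sum_le_sum hvb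
      _ = X * ∑ n ∈ range (N1 + 1), 1 / (n : ℝ) := by rw [mul_sum]
      _ ≤ X * (1 + Real.log N1) := by gcongr; exact sum_inv_le N1
      _ ≤ _ := mul_le_mul_of_nonneg_left (by linarith) hX0
  have htail2 : 2 * B * v L i N1 ≤ 2 * X := by
    have h1 := hvb N1 (by simp)
    have h2 : B / N1 ≤ 1 := by
      rw [div_le_one hpos]
      refine hB.trans (le_trans ?_ hge)
      exact Real.exp_le_exp.mpr (by linarith [(Nat.cast_nonneg i : (0 : ℝ) ≤ i)])
    calc 2 * B * v L i N1 ≤ 2 * B * (X * (1 / N1)) := by gcongr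
      _ = 2 * X * (B / N1) := by ring
      _ ≤ 2 * X * 1 := by gcongr
      _ = _ := by ring
  have hi2 : (i : ℝ) + 1 ≤ 2 ^ i := by
    have : i + 1 ≤ 2 ^ i := Nat.lt_two_pow_self
    exact_mod_cast this
  have htot : ‖S L i c‖ ≤ X * (5 * lam * 2 ^ i) := by
    rw [hsplit]
    refine (norm_add_le _ _).trans ?_
    have h1 : (i : ℝ) + lam + 4 ≤ 5 * lam * 2 ^ i := by nlinarith [one_le_pow₀ (M₀ := ℝ) (a := 2) (by norm_num) (n := i)]
    nlinarith
  refine htot.trans ?_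
  have e1 := Real.exp_one_lt_d9
  calc X * (5 * lam * 2 ^ i) ≤ lam ^ i * Real.exp (i + 2) * (5 * lam * 2 ^ i) := by gcongr
    _ = (Real.exp 1 * Real.exp 1) * 5 * lam * (2 * Real.exp 1 * lam) ^ i := by
        have : Real.exp (i + 2) = (Real.exp 1) ^ i * (Real.exp 1 * Real.exp 1) := by
          rw [← Real.exp_nat_mul, ← Real.exp_add, ← Real.exp_add]; congr 1; ring
        rw [this]; simp only [mul_pow]; ring
    _ ≤ 40 * lam * (6 * lam) ^ i := by
        have h0 := Real.exp_pos 1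
        gcongr
        · nlinarith
        · linarith

/-- periodic sums -/
lemma periodic_sum (f : ℕ → ℂ) (r : ℕ) (hr : 0 < r) (hper : ∀ n, f (n + r) = f n)
    (h0 : ∑ n ∈ range r, f n = 0) (hf : ∀ n, ‖f n‖ ≤ 1) (N : ℕ) :
    ‖∑ n ∈ range N, f n‖ ≤ r := by
  induction N using Nat.strong_induction_on with
  | _ N ih =>
    by_cases hN : N < r
    · refine (norm_sum_le _ _).trans ?_
      calc ∑ n ∈ range N, ‖f n‖ ≤ ∑ n ∈ range N, (1 : ℝ) := sum_le_sum fun n _ => hf n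
        _ = N := by simp
        _ ≤ r := by exact_mod_cast hN.le
    · obtain ⟨M, rfl⟩ := Nat.exists_eq_add_of_le (not_lt.mp hN)
      rw [sum_range_add, h0, zero_add]
      have : ∑ x ∈ range M, f (r + x) = ∑ x ∈ range M, f x :=
        sum_congr rfl fun x _ => by rw [add_comm, hper]
      rw [this]
      exact ih M (by omega)

/-- a character as a sequence -/
noncomputable def cs {r : ℕ} (χ : DirichletCharacter ℂ r) : ℕ → ℂ := fun n => χ (n : ZMod r)

lemma cs_norm_le {r : ℕ} (χ : DirichletCharacter ℂ r) (n : ℕ) : ‖cs χ n‖ ≤ 1 :=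
  χ.norm_le_one _

lemma sum_range_zmod {r : ℕ} [NeZero r] (g : ZMod r → ℂ) :
    ∑ n ∈ range r, g (n : ZMod r) = ∑ a, g a := by
  refine Finset.sum_bij (fun n _ => (n : ZMod r)) (fun _ _ => mem_univ _) ?_ ?_ (fun _ _ => rfl)
  · intro a ha b hb hab
    rw [ZMod.natCast_eq_natCast_iff'] at hab
    rwa [Nat.mod_eq_of_lt (mem_range.mp ha), Nat.mod_eq_of_lt (mem_range.mp hb)] at hab
  · intro a _
    exact ⟨a.val, mem_range.mpr (ZMod.val_lt a), by simp⟩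

lemma cs_sum {r : ℕ} (hr : 0 < r) (χ : DirichletCharacter ℂ r) (hχ : χ ≠ 1) (N : ℕ) :
    ‖∑ n ∈ range N, cs χ n‖ ≤ r := by
  have : NeZero r := ⟨hr.ne'⟩
  apply periodic_sum _ r hr
  · intro n; unfold cs; simp
  · unfold cs
    rw [sum_range_zmod (fun a => χ a)]
    exact MulChar.sum_eq_zero_of_ne_one hχ
  · exact cs_norm_le χ

lemma tame_cs {r : ℕ} (χ : DirichletCharacter ℂ r) : Tame (cs χ) := tame_of_bdd _ (cs_norm_le χ)

/-- twist of Lambda -/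
noncomputable def csL {r : ℕ} (χ : DirichletCharacter ℂ r) : ℕ → ℂ := fun n => cs χ n * ((Λ n : ℝ) : ℂ)

lemma tame_csL {r : ℕ} (χ : DirichletCharacter ℂ r) : Tame (csL χ) :=
  tame_Lambda.mono fun n => by
    unfold csL
    rw [norm_mul]
    exact mul_le_of_le_one_left (norm_nonneg _) (cs_norm_le χ n)

lemma log_deriv_rec {r : ℕ} (χ : DirichletCharacter ℂ r) (L : ℝ) (hL : 0 < L) (i : ℕ) :
    ((i : ℂ) + 1) * S L (i + 1) (cs χ) =
      ∑ p ∈ antidiagonal i, S L p.1 (csL χ) * S L p.2 (cs χ) := by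
  rw [← S_conv L hL i (tame_csL χ) (tame_cs χ), ← S_log]
  congr 1
  have h := DirichletCharacter.convolution_twist_vonMangoldt χ
  funext n
  have := congrFun h n
  rw [LSeries.convolution_def] at this ⊢
  simp only [Pi.mul_apply] at this
  rw [← Complex.natCast_log] at this
  exact this.symm

lemma b_bound {r : ℕ} (hr : 0 < r) (χ : DirichletCharacter ℂ r) (hχ : χ ≠ 1) (L lam δ : ℝ)
    (hL : 0 < L) (hlam : 1 ≤ lam) (hrl : (r : ℝ) ≤ Real.exp lam) (hδ : 0 < δ) (hδ1 : δ ≤ 1)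
    (h0 : δ ≤ ‖S L 0 (cs χ)‖) (i : ℕ) :
    ‖S L i (csL χ)‖ ≤ (1000 * lam ^ 2 / δ) ^ (i + 1) := by
  have h := rec_bound (fun i => S L i (cs χ)) (fun i => S L i (csL χ)) (40 * lam) (6 * lam) δ
    (by linarith) hδ (by linarith) (log_deriv_rec χ L hL)
    (a_bound _ (cs_norm_le χ) r lam hlam hrl (cs_sum hr χ hχ) L hL) h0 i
  refine h.trans (pow_le_pow_left₀ (by positivity) ?_ _)
  apply div_le_div_of_nonneg_right _ hδ.le
  nlinarith

end BG

namespace BG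
set_option maxHeartbeats 400000
open Finset Filter Topology
open scoped ArithmeticFunction.vonMangoldt

/-- polylog versus power -/
lemma ev_log (C B ε : ℝ) (n : ℕ) (hε : 0 < ε) :
    ∀ᶠ L : ℝ in atTop, C * (1 + B * Real.log L) ^ n ≤ L ^ ε := by
  have h1 : (fun L : ℝ => 1 + B * Real.log L) =o[atTop] fun L => L ^ (ε / (n + 1)) := by
    apply Asymptotics.IsLittleO.add
    · apply Asymptotics.isLittleO_const_left.mpr
      right
      refine tendsto_norm_atTop_atTop.comp (tendsto_rpow_atTop (by positivity))
    · exact (isLittleO_log_rpow_atTop (by positivity)).const_mul_left B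
  have h2 : (fun L : ℝ => (1 + B * Real.log L) ^ n) =O[atTop] fun L => (L ^ (ε / (n + 1))) ^ n :=
    h1.isBigO.pow n
  have h3 : (fun L : ℝ => (L ^ (ε / (n + 1))) ^ n) =o[atTop] fun L => L ^ ε := by
    have e : (fun L : ℝ => (L ^ (ε / (n + 1))) ^ n) =ᶠ[atTop] fun L => L ^ (ε / (n + 1) * n) := by
      filter_upwards [eventually_gt_atTop 0] with L hL
      rw [Real.rpow_mul hL.le, Real.rpow_natCast]
    refine e.trans_isLittleO ?_
    have hlt : ε / (n + 1) * n < ε := by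
      rw [div_mul_eq_mul_div, div_lt_iff₀ (by positivity)]
      nlinarith
    refine (Asymptotics.isLittleO_iff_tendsto' ?_).mpr ?_
    · filter_upwards [eventually_gt_atTop 0] with L hL h0
      exact absurd h0 (Real.rpow_pos_of_pos hL _).ne'
    · refine (tendsto_rpow_neg_atTop (y := ε - ε / (n + 1) * n) (by linarith)).congr' ?_
      filter_upwards [eventually_gt_atTop 0] with L hL
      rw [← Real.rpow_sub hL]; congr 1; ring
  have h4 := ((h2.trans_isLittleO h3).const_mul_left C).bound one_pos
  filter_upwards [h4, eventually_gt_atTop 0] with L hL hpos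
  rw [one_mul, Real.norm_of_nonneg (Real.rpow_nonneg hpos.le ε)] at hL
  exact (le_abs_self _).trans hL

lemma S_zero_eq {r : ℕ} (χ : DirichletCharacter ℂ r) (L : ℝ) (hL : 0 < L) :
    S L 0 (cs χ) = LSeries (fun n => χ n) ((1 + 1 / L : ℝ) : ℂ) := by
  rw [S_eq L hL]
  congr 1
  funext n
  simp [lp, cs]

lemma one_lt_re (L : ℝ) (hL : 0 < L) : 1 < (((1 + 1 / L : ℝ) : ℂ)).re := by
  rw [Complex.ofReal_re]
  have : 0 < 1 / L := by positivity
  linarith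

lemma summable_logp {r : ℕ} (χ : DirichletCharacter ℂ r) (L : ℝ) (hL : 0 < L) :
    Summable fun p : Nat.Primes => - Real.log ‖1 - χ p * (p : ℂ) ^ (-((1 + 1 / L : ℝ) : ℂ))‖ := by
  have h := (Complex.hasSum_re
    (DirichletCharacter.summable_neg_log_one_sub_mul_prime_cpow χ (one_lt_re L hL)).hasSum).summable
  simpa [Complex.log_re] using h

lemma norm_S_eq_exp {r : ℕ} (χ : DirichletCharacter ℂ r) (L : ℝ) (hL : 0 < L) :
    ‖S L 0 (cs χ)‖ = Real.exp (∑' p : Nat.Primes,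
      - Real.log ‖1 - χ p * (p : ℂ) ^ (-((1 + 1 / L : ℝ) : ℂ))‖) := by
  rw [S_zero_eq χ L hL, ← DirichletCharacter.LSeries_eulerProduct_exp_log χ (one_lt_re L hL),
    Complex.norm_exp, Complex.re_tsum
      (DirichletCharacter.summable_neg_log_one_sub_mul_prime_cpow χ (one_lt_re L hL))]
  simp [Complex.log_re]

/-- cross character -/
noncomputable def cross {r1 r2 : ℕ} (χ1 : DirichletCharacter ℂ r1) (χ2 : DirichletCharacter ℂ r2) :
    DirichletCharacter ℂ (r1 * r2) :=
  DirichletCharacter.changeLevel (Dvd.intro _ rfl) χ1 *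
    (DirichletCharacter.changeLevel (Dvd.intro_left _ rfl) χ2)⁻¹

lemma cs_changeLevel {r m : ℕ} (h : r ∣ m) (χ : DirichletCharacter ℂ r) (n : ℕ)
    (hn : n.Coprime m) : cs (DirichletCharacter.changeLevel h χ) n = cs χ n := by
  unfold cs
  have := DirichletCharacter.changeLevel_eq_cast_of_dvd' χ h (a := (n : ℤ))
    (by rw [Int.isCoprime_iff_gcd_eq_one]; exact_mod_cast hn)
  simpa using this

lemma cs_eq_zero {r : ℕ} (χ : DirichletCharacter ℂ r) (n : ℕ) (hn : ¬ n.Coprime r) : cs χ n = 0 := by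
  unfold cs
  apply MulChar.map_nonunit
  rwa [ZMod.isUnit_iff_coprime]

lemma cross_apply {r1 r2 : ℕ} (χ1 : DirichletCharacter ℂ r1) (χ2 : DirichletCharacter ℂ r2) (n : ℕ) :
    cs (cross χ1 χ2) n = cs χ1 n * star (cs χ2 n) := by
  by_cases hn : n.Coprime (r1 * r2)
  · have h1 := cs_changeLevel (Dvd.intro _ rfl : r1 ∣ r1 * r2) χ1 n hn
    have h2 := cs_changeLevel (Dvd.intro_left _ rfl : r2 ∣ r1 * r2) χ2 n hn
    rw [← h1, ← h2]
    unfold cs cross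
    rw [MulChar.mul_apply, MulChar.star_apply']
  · rw [cs_eq_zero _ n hn]
    rw [Nat.coprime_mul_iff_right, not_and_or] at hn
    rcases hn with hn | hn
    · rw [cs_eq_zero _ n hn]; simp
    · rw [cs_eq_zero χ2 n hn]; simp

lemma cross_ne_one {r1 r2 : ℕ} (h1 : 0 < r1) (h2 : 0 < r2) (χ1 : DirichletCharacter ℂ r1)
    (χ2 : DirichletCharacter ℂ r2) (hp1 : χ1.IsPrimitive) (hp2 : χ2.IsPrimitive)
    (hne : (⟨r1, χ1⟩ : Σ r, DirichletCharacter ℂ r) ≠ ⟨r2, χ2⟩) : cross χ1 χ2 ≠ 1 := by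
  intro h
  have : NeZero (r1 * r2) := ⟨(Nat.mul_pos h1 h2).ne'⟩
  unfold cross at h
  rw [mul_inv_eq_one] at h
  have hc := congrArg DirichletCharacter.conductor h
  rw [DirichletCharacter.conductor_changeLevel, DirichletCharacter.conductor_changeLevel,
    hp1, hp2] at hc
  subst hc
  apply hne
  rw [DirichletCharacter.changeLevel_injective _ h]

lemma cross_sum {r1 r2 : ℕ} (h1 : 0 < r1) (h2 : 0 < r2) (χ1 : DirichletCharacter ℂ r1)
    (χ2 : DirichletCharacter ℂ r2) (hp1 : χ1.IsPrimitive) (hp2 : χ2.IsPrimitive)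
    (hne : (⟨r1, χ1⟩ : Σ r, DirichletCharacter ℂ r) ≠ ⟨r2, χ2⟩) (N : ℕ) :
    ‖∑ n ∈ range N, cs χ1 n * star (cs χ2 n)‖ ≤ r1 * r2 := by
  have := cs_sum (Nat.mul_pos h1 h2) (cross χ1 χ2) (cross_ne_one h1 h2 χ1 χ2 hp1 hp2 hne) N
  simp only [cross_apply] at this
  exact_mod_cast this

lemma zeta_bound : ∀ᶠ L : ℝ in atTop, ‖S L 0 (fun _ => 1)‖ ≤ 2 * L := by
  obtain ⟨C, hC, ρ, hρ, h⟩ := S_one_asymp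
  filter_upwards [eventually_gt_atTop (1 / ρ), eventually_ge_atTop C, eventually_gt_atTop 0] with L h1 h2 h3
  have := h L h3 (by rw [div_lt_iff₀ h3]; rw [div_lt_iff₀ hρ] at h1; linarith) 0
  have e : S L 0 (fun _ => 1) = (S L 0 (fun _ => 1) - (L : ℂ) ^ (0 + 1)) + L := by ring
  rw [e]
  refine (norm_add_le _ _).trans ?_
  rw [Complex.norm_real, Real.norm_of_nonneg h3.le]
  simp only [pow_zero, div_one] at this
  linarith

lemma S_zero_mono (c : ℕ → ℂ) (hc : ∀ n, ‖c n‖ ≤ 1) (L : ℝ) (hL : 0 < L) :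
    ‖S L 0 c‖ ≤ ‖S L 0 (fun _ => 1)‖ := by
  have hs := summable_v L hL 0
  have e : S L 0 (fun _ => 1) = ((∑' n, v L 0 n : ℝ) : ℂ) := by
    unfold S; rw [Complex.ofReal_tsum]; simp
  rw [e, Complex.norm_real, Real.norm_of_nonneg (tsum_nonneg (v_nonneg L 0))]
  unfold S
  refine tsum_of_norm_bounded hs.hasSum fun n => ?_
  rw [norm_mul, Complex.norm_real, Real.norm_of_nonneg (v_nonneg L 0 n)]
  exact mul_le_of_le_one_left (v_nonneg L 0 n) (hc n)

lemma complex_good (B : ℝ) (hB : 0 ≤ B) : ∀ᶠ L : ℝ in atTop, ∀ r : ℕ, 0 < r → (r : ℝ) ≤ L ^ B →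
    ∀ χ : DirichletCharacter ℂ r, χ ^ 2 ≠ 1 → L ^ (-(4 / 5) : ℝ) ≤ ‖S L 0 (cs χ)‖ := by
  filter_upwards [zeta_bound, ev_log 320 B (1 / 5) 1 (by norm_num), eventually_ge_atTop 1]
    with L hz hlog hL r hr hrL χ hχ
  have hLpos : 0 < L := by linarith
  have hll : 0 ≤ Real.log L := Real.log_nonneg hL
  by_contra! hlt
  have h := DirichletCharacter.norm_LSeries_product_ge_one χ (x := 1 / L) (by positivity) 0
  simp only [Complex.ofReal_zero, mul_zero, add_zero] at h
  have es : (1 + ((1 / L : ℝ) : ℂ)) = ((1 + 1 / L : ℝ) : ℂ) := by push_cast; ring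
  rw [es, ← S_zero_eq _ L hLpos, ← S_zero_eq _ L hLpos] at h
  have e3 : LSeries (fun n : ℕ => (χ ^ 2) (n : ZMod r)) ((1 + 1 / L : ℝ) : ℂ) = S L 0 (cs (χ ^ 2)) :=
    (S_zero_eq _ L hLpos).symm
  rw [e3] at h
  have hb1 : ‖S L 0 (cs (1 : DirichletCharacter ℂ r))‖ ≤ 2 * L :=
    (S_zero_mono _ (cs_norm_le _) L hLpos).trans hz
  have hb2 : ‖S L 0 (cs (χ ^ 2))‖ ≤ 40 * (1 + B * Real.log L) := by
    have := a_bound (cs (χ ^ 2)) (cs_norm_le _) r (1 + B * Real.log L)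
      (by have := mul_nonneg hB hll; linarith) (by
        refine hrL.trans ?_
        rw [Real.rpow_def_of_pos hLpos]
        apply Real.exp_le_exp.mpr
        linarith) (cs_sum hr _ hχ) L hLpos 0
    simpa using this
  rw [norm_mul, norm_mul, norm_pow, norm_pow] at h
  have hA : ‖S L 0 (cs χ)‖ ^ 4 < L ^ (-(16 / 5) : ℝ) := by
    calc ‖S L 0 (cs χ)‖ ^ 4 < (L ^ (-(4 / 5) : ℝ)) ^ 4 := by gcongr
      _ = L ^ (-(16 / 5) : ℝ) := by
        rw [← Real.rpow_natCast, ← Real.rpow_mul hLpos.le]; norm_num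
  rw [pow_one] at hlog
  have hq : 0 < 40 * (1 + B * Real.log L) := by have := mul_nonneg hB hll; linarith
  have : (2 * L) ^ 3 * ‖S L 0 (cs χ)‖ ^ 4 * (40 * (1 + B * Real.log L)) < 1 := by
    calc (2 * L) ^ 3 * ‖S L 0 (cs χ)‖ ^ 4 * (40 * (1 + B * Real.log L))
        < (2 * L) ^ 3 * L ^ (-(16 / 5) : ℝ) * (40 * (1 + B * Real.log L)) := by gcongr
      _ = L ^ 3 * L ^ (-(16 / 5) : ℝ) * (320 * (1 + B * Real.log L)) := by ring
      _ ≤ L ^ 3 * L ^ (-(16 / 5) : ℝ) * L ^ (1 / 5 : ℝ) := by gcongr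
      _ = 1 := by
        rw [← Real.rpow_natCast, ← Real.rpow_add hLpos, ← Real.rpow_add hLpos]; norm_num
  have h5 : ‖S L 0 (cs (1 : DirichletCharacter ℂ r))‖ ^ 3 * ‖S L 0 (cs χ)‖ ^ 4 * ‖S L 0 (cs (χ ^ 2))‖
      ≤ (2 * L) ^ 3 * ‖S L 0 (cs χ)‖ ^ 4 * (40 * (1 + B * Real.log L)) := by gcongr
  linarith

lemma quad_val {r : ℕ} (χ : DirichletCharacter ℂ r) (hχ : χ ^ 2 = 1) (n : ℕ) :
    cs χ n = 0 ∨ cs χ n = 1 ∨ cs χ n = -1 := by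
  by_cases hn : n.Coprime r
  · right
    have h := congrArg (fun ψ : DirichletCharacter ℂ r => ψ (n : ZMod r)) hχ
    simp only [MulChar.pow_apply' _ two_ne_zero] at h
    rw [MulChar.one_apply ((ZMod.isUnit_iff_coprime n r).mpr hn)] at h
    exact mul_self_eq_one_iff.mp (by rw [← sq]; exact h)
  · left; exact cs_eq_zero χ n hn

lemma quad_local (x : ℝ) (hx0 : 0 < x) (hx1 : x < 1) (a b : ℂ) (ha : a = 0 ∨ a = 1 ∨ a = -1)
    (hb : b = 0 ∨ b = 1 ∨ b = -1) :
    0 ≤ - Real.log ‖1 - 1 * (x : ℂ)‖ + - Real.log ‖1 - a * (x : ℂ)‖ + - Real.log ‖1 - b * (x : ℂ)‖ +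
      - Real.log ‖1 - a * star b * (x : ℂ)‖ := by
  have e1 : ‖1 - (x : ℂ)‖ = 1 - x := by
    rw [show (1 - (x : ℂ)) = ((1 - x : ℝ) : ℂ) by push_cast; ring, Complex.norm_real,
      Real.norm_of_nonneg (by linarith)]
  have e2 : ‖1 + (x : ℂ)‖ = 1 + x := by
    rw [show (1 + (x : ℂ)) = ((1 + x : ℝ) : ℂ) by push_cast; ring, Complex.norm_real,
      Real.norm_of_nonneg (by linarith)]
  have l1 : Real.log (1 - x) ≤ 0 := Real.log_nonpos (by linarith) (by linarith)
  have l2 : Real.log (1 - x) + Real.log (1 + x) ≤ 0 := by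
    rw [← Real.log_mul (by linarith) (by linarith)]
    exact Real.log_nonpos (by nlinarith) (by nlinarith)
  rcases ha with rfl | rfl | rfl <;> rcases hb with rfl | rfl | rfl <;>
    simp [e1, e2] <;> linarith

lemma real_two (B : ℝ) (hB : 0 ≤ B) : ∀ᶠ L : ℝ in atTop, ∀ r1 r2 : ℕ, 0 < r1 → 0 < r2 →
    (r1 : ℝ) ≤ L ^ B → (r2 : ℝ) ≤ L ^ B →
    ∀ (χ1 : DirichletCharacter ℂ r1) (χ2 : DirichletCharacter ℂ r2), χ1.IsPrimitive →
    χ2.IsPrimitive → χ1 ^ 2 = 1 → χ2 ^ 2 = 1 →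
    (⟨r1, χ1⟩ : Σ r, DirichletCharacter ℂ r) ≠ ⟨r2, χ2⟩ →
    ‖S L 0 (cs χ1)‖ ≤ L ^ (-(4 / 5) : ℝ) → ‖S L 0 (cs χ2)‖ ≤ L ^ (-(4 / 5) : ℝ) → False := by
  filter_upwards [zeta_bound, ev_log 80 (2 * B) (1 / 5) 1 (by norm_num), eventually_gt_atTop 1]
    with L hz hlog hL1 r1 r2 hr1 hr2 hrL1 hrL2 χ1 χ2 hp1 hp2 hq1 hq2 hne hb1 hb2
  have hL : 1 ≤ L := hL1.le
  have hLpos : 0 < L := by linarith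
  have hll : 0 ≤ Real.log L := Real.log_nonneg hL
  have hBl := mul_nonneg hB hll
  have hcs1 : cs (1 : DirichletCharacter ℂ 1) = fun _ => 1 := by
    funext n; unfold cs; exact MulChar.one_apply (isUnit_of_subsingleton _)
  have hb3 : ‖S L 0 (cs (cross χ1 χ2))‖ ≤ 40 * (1 + 2 * B * Real.log L) := by
    have := a_bound (cs (cross χ1 χ2)) (cs_norm_le _) ((r1 * r2 : ℕ) : ℝ) (1 + 2 * B * Real.log L)
      (by nlinarith) (by
        push_cast
        calc (r1 : ℝ) * r2 ≤ L ^ B * L ^ B := by gcongr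
          _ = Real.exp (2 * B * Real.log L) := by
            rw [← Real.rpow_add hLpos, Real.rpow_def_of_pos hLpos]; congr 1; ring
          _ ≤ _ := by apply Real.exp_le_exp.mpr; linarith)
      (cs_sum (Nat.mul_pos hr1 hr2) _ (cross_ne_one hr1 hr2 χ1 χ2 hp1 hp2 hne)) L hLpos 0
    simpa using this
  have hprod : 1 ≤ ‖S L 0 (cs (1 : DirichletCharacter ℂ 1))‖ * ‖S L 0 (cs χ1)‖ * ‖S L 0 (cs χ2)‖ *
      ‖S L 0 (cs (cross χ1 χ2))‖ := by
    rw [norm_S_eq_exp _ L hLpos, norm_S_eq_exp _ L hLpos, norm_S_eq_exp _ L hLpos,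
      norm_S_eq_exp _ L hLpos, ← Real.exp_add, ← Real.exp_add, ← Real.exp_add]
    have s0 := summable_logp (1 : DirichletCharacter ℂ 1) L hLpos
    have s1 := summable_logp χ1 L hLpos
    have s2 := summable_logp χ2 L hLpos
    have s3 := summable_logp (cross χ1 χ2) L hLpos
    rw [← s0.tsum_add s1, ← (s0.add s1).tsum_add s2, ← ((s0.add s1).add s2).tsum_add s3]
    apply Real.one_le_exp
    apply tsum_nonneg
    intro p
    have hp2' : (1 : ℝ) < (p : ℕ) := by exact_mod_cast p.2.one_lt
    have hppos : (0 : ℝ) < (p : ℕ) := by linarith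
    have ex : ((p : ℕ) : ℂ) ^ (-((1 + 1 / L : ℝ) : ℂ)) = (((p : ℕ) : ℝ) ^ (-(1 + 1 / L)) : ℝ) := by
      rw [Complex.ofReal_cpow hppos.le]; push_cast; rfl
    have hexp : -(1 + 1 / L) < 0 := by
      have : 0 < 1 / L := by positivity
      linarith
    have := quad_local (((p : ℕ) : ℝ) ^ (-(1 + 1 / L))) (by positivity)
      (Real.rpow_lt_one_of_one_lt_of_neg hp2' hexp) (cs χ1 p) (cs χ2 p) (quad_val χ1 hq1 p)
      (quad_val χ2 hq2 p)
    rw [ex]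
    have f0 : (1 : DirichletCharacter ℂ 1) ((p : ℕ) : ZMod 1) = 1 := congrFun hcs1 p
    have f3 : (cross χ1 χ2) ((p : ℕ) : ZMod (r1 * r2)) = cs χ1 p * star (cs χ2 p) := cross_apply χ1 χ2 p
    rw [f0, f3]
    exact this
  rw [hcs1] at hprod
  have : ‖S L 0 (fun _ => 1)‖ * ‖S L 0 (cs χ1)‖ * ‖S L 0 (cs χ2)‖ * ‖S L 0 (cs (cross χ1 χ2))‖ < 1 := by
    calc _ ≤ (2 * L) * L ^ (-(4 / 5) : ℝ) * L ^ (-(4 / 5) : ℝ) * (40 * (1 + 2 * B * Real.log L)) := by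
          gcongr
      _ = L * L ^ (-(4 / 5) : ℝ) * L ^ (-(4 / 5) : ℝ) * (80 * (1 + 2 * B * Real.log L) ^ 1) := by ring
      _ ≤ L * L ^ (-(4 / 5) : ℝ) * L ^ (-(4 / 5) : ℝ) * L ^ (1 / 5 : ℝ) := by gcongr
      _ = L ^ (-(2 / 5) : ℝ) := by
        nth_rewrite 1 [← Real.rpow_one L]
        rw [← Real.rpow_add hLpos, ← Real.rpow_add hLpos, ← Real.rpow_add hLpos]; norm_num
      _ < 1 := Real.rpow_lt_one_of_one_lt_of_neg hL1 (by norm_num)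
  linarith

/-- good scales -/
def GoodScale (B L : ℝ) : Prop := ∀ r : ℕ, 0 < r → (r : ℝ) ≤ L ^ B →
    ∀ χ : DirichletCharacter ℂ r, χ.IsPrimitive → χ ≠ 1 → L ^ (-(4 / 5) : ℝ) ≤ ‖S L 0 (cs χ)‖

lemma exists_equal {r : ℕ} (hr : 0 < r) (χ : DirichletCharacter ℂ r) (hχ : χ ≠ 1) (L1 : ℝ)
    (hL1 : 0 < L1) (hbad : ‖S L1 0 (cs χ)‖ ≤ L1 ^ (-(4 / 5) : ℝ)) :
    ∃ L2 ≥ L1, ‖S L2 0 (cs χ)‖ = L2 ^ (-(4 / 5) : ℝ) := by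
  have : NeZero r := ⟨hr.ne'⟩
  set F : ℝ → ℝ := fun L => ‖χ.LFunction ((1 + 1 / L : ℝ) : ℂ)‖ * L ^ (4 / 5 : ℝ) with hF
  have hFS : ∀ L, 0 < L → F L = ‖S L 0 (cs χ)‖ * L ^ (4 / 5 : ℝ) := by
    intro L hL
    rw [S_zero_eq χ L hL, ← DirichletCharacter.LFunction_eq_LSeries χ (one_lt_re L hL)]
  have hcont : ContinuousOn F (Set.Ici L1) := by
    apply ContinuousOn.mul
    · apply ContinuousOn.norm
      apply (DirichletCharacter.differentiable_LFunction hχ).continuous.comp_continuousOn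
      apply Complex.continuous_ofReal.comp_continuousOn
      apply ContinuousOn.add continuousOn_const
      apply ContinuousOn.div continuousOn_const continuousOn_id
      intro x hx; exact (lt_of_lt_of_le hL1 hx).ne'
    · exact (Real.continuous_rpow_const (by norm_num)).continuousOn
  have htop : Tendsto F atTop atTop := by
    have h1 : Tendsto (fun L : ℝ => ‖χ.LFunction ((1 + 1 / L : ℝ) : ℂ)‖) atTop (𝓝 ‖χ.LFunction 1‖) := by
      apply Tendsto.norm
      apply ((DirichletCharacter.differentiable_LFunction hχ).continuous.tendsto 1).comp
      have : Tendsto (fun L : ℝ => (1 + 1 / L : ℝ)) atTop (𝓝 (1 + 0)) := by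
        refine Tendsto.const_add 1 ?_
        exact tendsto_const_nhds.div_atTop tendsto_id
      have h2 := (Complex.continuous_ofReal.tendsto (1 + 0)).comp this
      simpa [Function.comp_def] using h2
    exact Tendsto.pos_mul_atTop (norm_pos_iff.mpr (DirichletCharacter.LFunction_apply_one_ne_zero hχ)) h1
      (tendsto_rpow_atTop (by norm_num))
  have hF1 : F L1 ≤ 1 := by
    rw [hFS L1 hL1]
    calc _ ≤ L1 ^ (-(4 / 5) : ℝ) * L1 ^ (4 / 5 : ℝ) := by gcongr
      _ = 1 := by rw [← Real.rpow_add hL1]; norm_num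
  obtain ⟨L3, hL3, hL31⟩ := (htop.eventually_ge_atTop 1 |>.and (eventually_ge_atTop L1)).exists
  have := intermediate_value_Icc hL31 (hcont.mono (Set.Icc_subset_Ici_self)) ⟨hF1, hL3⟩
  obtain ⟨L2, ⟨h1, _⟩, h2⟩ := this
  refine ⟨L2, h1, ?_⟩
  have hL2 : 0 < L2 := lt_of_lt_of_le hL1 h1
  rw [hFS L2 hL2] at h2
  rw [Real.rpow_neg hL2.le]
  exact eq_inv_of_mul_eq_one_left h2

lemma exists_good (B : ℝ) (hB : 0 ≤ B) (N : ℝ) : ∃ L ≥ N, GoodScale B L := by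
  obtain ⟨L0, h0⟩ := eventually_atTop.mp
    ((complex_good B hB).and ((real_two B hB).and (eventually_ge_atTop 1)))
  set L1 := max N L0 with hL1
  obtain ⟨hc1, -, h11⟩ := h0 L1 (le_max_right _ _)
  by_cases hg : GoodScale B L1
  · exact ⟨L1, le_max_left _ _, hg⟩
  unfold GoodScale at hg
  push Not at hg
  obtain ⟨r1, hr1, hrL1, χ1, hp1, hχ1, hbad⟩ := hg
  have hq1 : χ1 ^ 2 = 1 := by
    by_contra hne
    exact absurd (hc1 r1 hr1 hrL1 χ1 hne) (not_le.mpr hbad)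
  obtain ⟨L2, hL2, heq⟩ := exists_equal hr1 χ1 hχ1 L1 (by linarith) hbad.le
  refine ⟨L2, (le_max_left _ _).trans hL2, ?_⟩
  obtain ⟨hc2, hr2, h12⟩ := h0 L2 ((le_max_right _ _).trans hL2)
  intro r hr hrL χ hp hχ
  by_contra! hlt
  have hq : χ ^ 2 = 1 := by
    by_contra hne
    exact absurd (hc2 r hr hrL χ hne) (not_le.mpr hlt)
  refine hr2 r1 r hr1 hr (hrL1.trans ?_) hrL χ1 χ hp1 hp hq1 hq ?_ heq.le hlt.le
  · exact Real.rpow_le_rpow (by linarith) hL2 hB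
  · intro h
    rw [Sigma.mk.injEq] at h
    obtain ⟨h1, h2⟩ := h
    subst h1
    rw [heq_eq_eq] at h2
    subst h2
    rw [heq] at hlt
    exact lt_irrefl _ hlt

end BG

namespace BG
set_option maxHeartbeats 400000
open Finset Filter Topology
open scoped ArithmeticFunction.vonMangoldt

lemma summable_bdd {g : ℕ → ℝ} (hg0 : ∀ n, 0 ≤ g n) (hg : Summable g) (f : ℕ → ℂ) (C : ℝ)
    (hf : ∀ n, ‖f n‖ ≤ C) : Summable (fun n => f n * (g n : ℂ)) := by
  refine Summable.of_norm_bounded (g := fun n => C * g n) (hg.mul_left C) ?_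
  intro n
  rw [norm_mul, Complex.norm_real, Real.norm_of_nonneg (hg0 n)]
  exact mul_le_mul_of_nonneg_right (hf n) (hg0 n)

lemma summable_c {g : ℕ → ℝ} (hg0 : ∀ n, 0 ≤ g n) (hg : Summable g) (c : ℕ → ℂ)
    (hc : Summable fun n => ‖c n‖ ^ 2 * g n) (f : ℕ → ℂ) (hf : ∀ n, ‖f n‖ ≤ 1) :
    Summable (fun n => c n * f n * (g n : ℂ)) := by
  refine Summable.of_norm_bounded (g := fun n => ‖c n‖ ^ 2 * g n + g n) (hc.add hg) ?_
  intro n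
  rw [norm_mul, norm_mul, Complex.norm_real, Real.norm_of_nonneg (hg0 n)]
  have h1 : ‖c n‖ * ‖f n‖ ≤ ‖c n‖ ^ 2 + 1 := by
    have := hf n
    have h0 := norm_nonneg (c n)
    have : ‖c n‖ * ‖f n‖ ≤ ‖c n‖ * 1 := by gcongr
    nlinarith [sq_nonneg (‖c n‖ - 1)]
  calc _ ≤ (‖c n‖ ^ 2 + 1) * g n := mul_le_mul_of_nonneg_right h1 (hg0 n)
    _ = _ := by ring

/-- abstract large sieve by duality -/
lemma large_sieve {ι : Type*} (X : Finset ι) (φ : ι → ℕ → ℂ) (hφ : ∀ x n, ‖φ x n‖ ≤ 1)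
    (g : ℕ → ℝ) (hg0 : ∀ n, 0 ≤ g n) (hg : Summable g) (D : ℝ) (hD0 : 0 < D)
    (hD : ∀ x ∈ X, ∑ y ∈ X, ‖∑' n, φ x n * star (φ y n) * (g n : ℂ)‖ ≤ D)
    (c : ℕ → ℂ) (hc : Summable fun n => ‖c n‖ ^ 2 * g n) :
    ∑ x ∈ X, ‖∑' n, c n * φ x n * (g n : ℂ)‖ ^ 2 ≤ D * ∑' n, ‖c n‖ ^ 2 * g n := by
  set a : ι → ℂ := fun x => ∑' n, c n * φ x n * (g n : ℂ) with ha
  set b : ℕ → ℂ := fun n => ∑ x ∈ X, star (a x) * φ x n with hb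
  set E := ∑' n, ‖c n‖ ^ 2 * g n with hE
  set T := ∑ x ∈ X, ‖a x‖ ^ 2 with hT
  have hsym : ∀ x y, ‖∑' n, φ x n * star (φ y n) * (g n : ℂ)‖ = ‖∑' n, φ y n * star (φ x n) * (g n : ℂ)‖ := by
    intro x y
    rw [← norm_star (∑' n, φ y n * star (φ x n) * (g n : ℂ)), tsum_star]
    congr 2
    funext n
    simp [mul_comm]
  have hbb : ∀ n, ‖b n‖ ≤ ∑ x ∈ X, ‖a x‖ := by
    intro n
    refine (norm_sum_le _ _).trans (sum_le_sum fun x _ => ?_)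
    rw [norm_mul, norm_star]
    exact mul_le_of_le_one_right (norm_nonneg _) (hφ x n)
  have sb : Summable fun n => ‖b n‖ ^ 2 * g n := by
    refine Summable.of_nonneg_of_le (fun n => mul_nonneg (sq_nonneg _) (hg0 n)) (fun n => ?_)
      (hg.mul_left ((∑ x ∈ X, ‖a x‖) ^ 2))
    exact mul_le_mul_of_nonneg_right (pow_le_pow_left₀ (norm_nonneg _) (hbb n) 2) (hg0 n)
  -- the sum T as a series
  have h1 : (T : ℂ) = ∑' n, c n * b n * (g n : ℂ) := by
    have : ∀ n, c n * b n * (g n : ℂ) = ∑ x ∈ X, star (a x) * (c n * φ x n * (g n : ℂ)) := by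
      intro n
      rw [hb, mul_sum, sum_mul]
      exact sum_congr rfl fun x _ => by ring
    simp_rw [this]
    rw [Summable.tsum_finsetSum (fun x _ => (summable_c hg0 hg c hc (φ x) (hφ x)).mul_left _)]
    simp_rw [tsum_mul_left]
    rw [hT]
    push_cast
    refine sum_congr rfl fun x _ => ?_
    rw [show (∑' n, c n * φ x n * (g n : ℂ)) = a x from rfl, ← Complex.conj_mul']
    rfl
  have h2 : T ≤ ∑' n, (D * (‖c n‖ ^ 2 * g n) + 1 / D * (‖b n‖ ^ 2 * g n)) / 2 := by
    have hT0 : T = ‖(T : ℂ)‖ := by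
      rw [Complex.norm_real, Real.norm_of_nonneg]
      exact sum_nonneg fun x _ => sq_nonneg _
    rw [hT0, h1]
    have hs := ((hc.mul_left D).add (sb.mul_left (1 / D))).div_const 2
    refine tsum_of_norm_bounded hs.hasSum ?_
    intro n
    rw [norm_mul, norm_mul, Complex.norm_real, Real.norm_of_nonneg (hg0 n)]
    have : ‖c n‖ * ‖b n‖ ≤ (D * ‖c n‖ ^ 2 + 1 / D * ‖b n‖ ^ 2) / 2 := by
      have h := sq_nonneg (D * ‖c n‖ - ‖b n‖)
      have h' : 0 ≤ (D * ‖c n‖ - ‖b n‖) ^ 2 / D := by positivity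
      have e : (D * ‖c n‖ - ‖b n‖) ^ 2 / D = D * ‖c n‖ ^ 2 - 2 * (‖c n‖ * ‖b n‖) + 1 / D * ‖b n‖ ^ 2 := by
        field_simp; ring
      rw [e] at h'; linarith
    calc _ ≤ (D * ‖c n‖ ^ 2 + 1 / D * ‖b n‖ ^ 2) / 2 * g n := mul_le_mul_of_nonneg_right this (hg0 n)
      _ = _ := by ring
  have h3 : ∑' n, ‖b n‖ ^ 2 * g n ≤ D * T := by
    have e1 : ((∑' n, ‖b n‖ ^ 2 * g n : ℝ) : ℂ) =
        ∑ x ∈ X, ∑ y ∈ X, star (a x) * a y * ∑' n, φ x n * star (φ y n) * (g n : ℂ) := by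
      have hs2 : ∀ x y, Summable fun n => φ x n * star (φ y n) * (g n : ℂ) := by
        intro x y
        refine summable_bdd hg0 hg _ 1 fun n => ?_
        rw [norm_mul, norm_star]
        exact mul_le_one₀ (hφ x n) (norm_nonneg _) (hφ y n)
      rw [Complex.ofReal_tsum]
      have : ∀ n, ((‖b n‖ ^ 2 * g n : ℝ) : ℂ) =
          ∑ x ∈ X, ∑ y ∈ X, star (a x) * a y * (φ x n * star (φ y n) * (g n : ℂ)) := by
        intro n
        push_cast
        rw [← Complex.mul_conj', hb]
        simp only [map_sum, map_mul, Complex.star_def, Complex.conj_conj]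
        rw [sum_mul_sum, sum_mul]
        refine sum_congr rfl fun x _ => ?_
        rw [sum_mul]
        exact sum_congr rfl fun y _ => by ring
      simp_rw [this]
      rw [Summable.tsum_finsetSum fun x _ => summable_sum fun y _ => (hs2 x y).mul_left _]
      refine sum_congr rfl fun x _ => ?_
      rw [Summable.tsum_finsetSum fun y _ => (hs2 x y).mul_left _]
      exact sum_congr rfl fun y _ => tsum_mul_left
    have e2 : ∑' n, ‖b n‖ ^ 2 * g n ≤
        ∑ x ∈ X, ∑ y ∈ X, (‖a x‖ ^ 2 + ‖a y‖ ^ 2) / 2 * ‖∑' n, φ x n * star (φ y n) * (g n : ℂ)‖ := by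
      have : ∑' n, ‖b n‖ ^ 2 * g n = ‖((∑' n, ‖b n‖ ^ 2 * g n : ℝ) : ℂ)‖ := by
        rw [Complex.norm_real, Real.norm_of_nonneg]
        exact tsum_nonneg fun n => mul_nonneg (sq_nonneg _) (hg0 n)
      rw [this, e1]
      refine (norm_sum_le _ _).trans (sum_le_sum fun x _ => ?_)
      refine (norm_sum_le _ _).trans (sum_le_sum fun y _ => ?_)
      rw [norm_mul, norm_mul, norm_star]
      refine mul_le_mul_of_nonneg_right ?_ (norm_nonneg _)
      nlinarith [sq_nonneg (‖a x‖ - ‖a y‖)]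
    refine e2.trans ?_
    have e3 : ∑ x ∈ X, ∑ y ∈ X, (‖a x‖ ^ 2 + ‖a y‖ ^ 2) / 2 * ‖∑' n, φ x n * star (φ y n) * (g n : ℂ)‖
        = ∑ x ∈ X, ‖a x‖ ^ 2 * ∑ y ∈ X, ‖∑' n, φ x n * star (φ y n) * (g n : ℂ)‖ := by
      have : ∀ x y, (‖a x‖ ^ 2 + ‖a y‖ ^ 2) / 2 * ‖∑' n, φ x n * star (φ y n) * (g n : ℂ)‖ =
        ‖a x‖ ^ 2 / 2 * ‖∑' n, φ x n * star (φ y n) * (g n : ℂ)‖ +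
        ‖a y‖ ^ 2 / 2 * ‖∑' n, φ y n * star (φ x n) * (g n : ℂ)‖ := by
        intro x y; rw [hsym y x]; ring
      simp_rw [this, sum_add_distrib]
      rw [sum_comm (f := fun x y => ‖a y‖ ^ 2 / 2 * ‖∑' n, φ y n * star (φ x n) * (g n : ℂ)‖),
        ← sum_add_distrib]
      refine sum_congr rfl fun x _ => ?_
      rw [mul_sum, ← sum_add_distrib]
      exact sum_congr rfl fun y _ => by ring
    rw [e3, hT, mul_sum]
    refine sum_le_sum fun x hx => ?_
    rw [mul_comm]
    exact mul_le_mul_of_nonneg_right (hD x hx) (sq_nonneg _)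
  rw [tsum_div_const, (hc.mul_left D).tsum_add (sb.mul_left (1 / D)), tsum_mul_left, tsum_mul_left] at h2
  have h4 : 1 / D * ∑' n, ‖b n‖ ^ 2 * g n ≤ T := by
    rw [one_div, inv_mul_le_iff₀ hD0]; exact h3
  linarith

abbrev Chr := Σ r : ℕ, DirichletCharacter ℂ r

/-- large sieve for primitive characters -/
lemma char_sieve (X : Finset Chr) (Q : ℕ) (hQ : ∀ x ∈ X, 0 < x.1 ∧ x.1 ≤ Q)
    (hX : ∀ x ∈ X, x.2.IsPrimitive) (g : ℕ → ℝ) (hg0 : ∀ n, 0 ≤ g n) (hg : Summable g)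
    (m0 : ℕ) (hgz : ∀ n < m0, g n = 0) (hga : ∀ m n, m0 ≤ m → m ≤ n → g n ≤ g m)
    (c : ℕ → ℂ) (hc : Summable fun n => ‖c n‖ ^ 2 * g n) (D : ℝ) (hD0 : 0 < D)
    (hD : ∑' n, g n + X.card * (2 * (Q : ℝ) ^ 2 * g m0) ≤ D) :
    ∑ x ∈ X, ‖∑' n, c n * cs x.2 n * (g n : ℂ)‖ ^ 2 ≤ D * ∑' n, ‖c n‖ ^ 2 * g n := by
  refine large_sieve X (fun x => cs x.2) (fun x n => cs_norm_le _ n) g hg0 hg D hD0 ?_ c hc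
  intro x hx
  have hoff : ∀ y ∈ X, y ≠ x → ‖∑' n, cs x.2 n * star (cs y.2 n) * (g n : ℂ)‖ ≤ 2 * (Q : ℝ) ^ 2 * g m0 := by
    intro y hy hyx
    have hx1 := hQ x hx
    have hy1 := hQ y hy
    have hcs : ∀ N, ‖∑ n ∈ range N, cs x.2 n * star (cs y.2 n)‖ ≤ (Q : ℝ) ^ 2 := by
      intro N
      refine (cross_sum hx1.1 hy1.1 x.2 y.2 (hX x hx) (hX y hy) (fun h => hyx h.symm) N).trans ?_
      rw [sq]
      have h1 : (x.1 : ℝ) ≤ Q := by exact_mod_cast hx1.2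
      have h2 : (y.1 : ℝ) ≤ Q := by exact_mod_cast hy1.2
      gcongr
    have := abel_tsum (fun n => if n < m0 then 0 else cs x.2 n * star (cs y.2 n)) g (2 * (Q : ℝ) ^ 2)
      (by positivity) m0 hg0 hga (by
        intro N
        rcases le_total N m0 with h | h
        · rw [sum_eq_zero]
          · simp
          · intro n hn; rw [if_pos]; rw [mem_range] at hn; omega
        · have : ∑ n ∈ range N, (if n < m0 then 0 else cs x.2 n * star (cs y.2 n)) =
            ∑ n ∈ range N, cs x.2 n * star (cs y.2 n) - ∑ n ∈ range m0, cs x.2 n * star (cs y.2 n) := by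
            rw [← sum_range_add_sum_Ico _ h, ← sum_range_add_sum_Ico _ h]
            rw [sum_eq_zero (s := range m0), zero_add, add_sub_cancel_left]
            · refine sum_congr rfl fun n hn => ?_
              rw [mem_Ico] at hn; rw [if_neg (by omega)]
            · intro n hn; rw [mem_range] at hn; rw [if_pos hn]
          rw [this]
          refine (norm_sub_le _ _).trans ?_
          linarith [hcs N, hcs m0]) (by intro n hn; simp [hn])
    refine le_of_eq_of_le ?_ this
    congr 2
    funext n
    split_ifs with h
    · rw [hgz n h]; simp
    · rfl
  have hdiag : ‖∑' n, cs x.2 n * star (cs x.2 n) * (g n : ℂ)‖ ≤ ∑' n, g n := by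
    refine tsum_of_norm_bounded hg.hasSum fun n => ?_
    rw [norm_mul, norm_mul, norm_star, Complex.norm_real, Real.norm_of_nonneg (hg0 n)]
    exact mul_le_of_le_one_left (hg0 n) (mul_le_one₀ (cs_norm_le _ n) (norm_nonneg _) (cs_norm_le _ n))
  classical
  rw [← add_sum_erase _ _ hx]
  refine le_trans (add_le_add hdiag ?_) hD
  refine (sum_le_card_nsmul _ _ _ fun y hy => hoff y (mem_of_mem_erase hy) (ne_of_mem_erase hy)).trans ?_
  rw [nsmul_eq_mul]
  have : 0 ≤ 2 * (Q : ℝ) ^ 2 * g m0 := mul_nonneg (by positivity) (hg0 _)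
  refine mul_le_mul_of_nonneg_right ?_ this
  exact_mod_cast card_erase_le

end BG

namespace BG
set_option maxHeartbeats 400000
open Finset Filter Topology
open scoped ArithmeticFunction.vonMangoldt

/-- Dirichlet convolution in plain form -/
def dc (f g : ℕ → ℝ) (n : ℕ) : ℝ := ∑ p ∈ n.divisorsAntidiagonal, f p.1 * g p.2

lemma dc_sum_le (f g : ℕ → ℝ) (hf : ∀ n, 0 ≤ f n) (hg : ∀ n, 0 ≤ g n) (N : ℕ) :
    ∑ n ∈ Icc 1 N, dc f g n / n ≤ (∑ n ∈ Icc 1 N, f n / n) * ∑ n ∈ Icc 1 N, g n / n := by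
  rw [sum_mul_sum, ← sum_product']
  have : ∀ n ∈ Icc 1 N, dc f g n / n = ∑ p ∈ (Icc 1 N ×ˢ Icc 1 N).filter (fun p => p.1 * p.2 = n),
      f p.1 / p.1 * (g p.2 / p.2) := by
    intro n hn
    rw [mem_Icc] at hn
    have e : (Icc 1 N ×ˢ Icc 1 N).filter (fun p : ℕ × ℕ => p.1 * p.2 = n) = n.divisorsAntidiagonal := by
      ext ⟨a, b⟩
      simp only [mem_filter, mem_product, mem_Icc, Nat.mem_divisorsAntidiagonal]
      constructor
      · rintro ⟨_, h⟩; exact ⟨h, by omega⟩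
      · rintro ⟨h, _⟩
        have ha : 0 < a := Nat.pos_of_ne_zero (by rintro rfl; simp at h; omega)
        have hb : 0 < b := Nat.pos_of_ne_zero (by rintro rfl; simp at h; omega)
        refine ⟨⟨⟨ha, ?_⟩, ⟨hb, ?_⟩⟩, h⟩
        · nlinarith
        · nlinarith
    rw [e, dc, sum_div]
    refine sum_congr rfl fun p hp => ?_
    rw [Nat.mem_divisorsAntidiagonal] at hp
    rw [← hp.1]; push_cast
    rw [div_mul_div_comm]
  rw [sum_congr rfl this, sum_fiberwise_eq_sum_filter]
  refine sum_le_sum_of_subset_of_nonneg (filter_subset _ _) fun p _ _ => ?_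
  exact mul_nonneg (div_nonneg (hf _) (Nat.cast_nonneg _)) (div_nonneg (hg _) (Nat.cast_nonneg _))

lemma sum_inv_Icc (N : ℕ) : ∑ n ∈ Icc 1 N, 1 / (n : ℝ) ≤ 1 + Real.log N := by
  have := sum_inv_le N
  rw [range_eq_Ico, sum_eq_sum_Ico_succ_bot (by omega)] at this
  simp only [Nat.cast_zero, div_zero, zero_add] at this
  exact this

noncomputable def om (n : ℕ) : ℕ := n.primeFactors.card

lemma om_step (K : ℕ) (m : ℕ) (hm : m ≠ 0) : ((K : ℝ) + 1) ^ om m ≤ dc (fun n => (K : ℝ) ^ om n) (fun _ => 1) m := by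
  unfold dc
  simp only [mul_one]
  rw [Nat.sum_divisorsAntidiagonal (fun a _ => (K : ℝ) ^ om a), om,
    ← Finset.sum_pow_mul_eq_add_pow]
  simp only [one_pow, mul_one]
  have hp : ∀ t ∈ m.primeFactors.powerset, (∏ p ∈ t, p).primeFactors = t := by
    intro t ht
    rw [mem_powerset] at ht
    exact Nat.primeFactors_prod fun p hp => Nat.prime_of_mem_primeFactors (ht hp)
  have hinj : Set.InjOn (fun t : Finset ℕ => ∏ p ∈ t, p) (m.primeFactors.powerset : Set (Finset ℕ)) := by
    intro t ht t' ht' h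
    rw [← hp t ht, ← hp t' ht']
    exact congrArg _ h
  have e : ∑ t ∈ m.primeFactors.powerset, (K : ℝ) ^ t.card =
      ∑ d ∈ m.primeFactors.powerset.image (fun t : Finset ℕ => ∏ p ∈ t, p), (K : ℝ) ^ om d := by
    rw [sum_image hinj]
    exact sum_congr rfl fun t ht => by rw [om, hp t ht]
  rw [e]
  refine sum_le_sum_of_subset_of_nonneg ?_ fun _ _ _ => by positivity
  intro d hd
  rw [mem_image] at hd
  obtain ⟨t, ht, rfl⟩ := hd
  rw [mem_powerset] at ht
  rw [Nat.mem_divisors]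
  exact ⟨(prod_dvd_prod_of_subset _ _ _ ht).trans (Nat.prod_primeFactors_dvd m), hm⟩

lemma om_sum (K : ℕ) (N : ℕ) : ∑ m ∈ Icc 1 N, (K : ℝ) ^ om m / m ≤ (1 + Real.log N) ^ K := by
  induction K with
  | zero =>
    rcases Nat.eq_zero_or_pos N with rfl | hN
    · simp
    rw [sum_eq_single_of_mem 1 (by simp; omega)]
    · simp [om]
    · intro b hb hb1
      rw [mem_Icc] at hb
      have : om b ≠ 0 := by
        unfold om
        rw [Finset.card_ne_zero]
        exact Nat.nonempty_primeFactors.mpr (by omega)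
      simp [this]
  | succ K ih =>
    have h0 : ∀ m ∈ Icc 1 N, (((K + 1 : ℕ) : ℝ)) ^ om m / m ≤ dc (fun n => (K : ℝ) ^ om n) (fun _ => 1) m / m := by
      intro m hm
      rw [mem_Icc] at hm
      push_cast
      exact div_le_div_of_nonneg_right (om_step K m (by omega)) (by positivity)
    refine (sum_le_sum h0).trans ((dc_sum_le _ _ (fun n => by positivity) (fun _ => zero_le_one) N).trans ?_)
    have hl := Real.log_natCast_nonneg N
    rw [pow_succ]
    exact mul_le_mul ih (sum_inv_Icc N) (sum_nonneg fun _ _ => by positivity) (by positivity)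

lemma totient_lower (m : ℕ) : (m : ℝ) ≤ m.totient * 2 ^ om m := by
  have h : (m.totient : ℝ) = m * ∏ p ∈ m.primeFactors, (1 - (p : ℝ)⁻¹) := by
    have := Nat.totient_eq_mul_prod_factors m
    have h2 := congrArg (fun x : ℚ => (x : ℝ)) this
    push_cast at h2
    exact h2
  rw [h, mul_assoc, om, ← prod_const, ← prod_mul_distrib]
  refine le_mul_of_one_le_right (Nat.cast_nonneg _) ?_
  refine le_of_eq_of_le (prod_const_one (s := m.primeFactors)).symm ?_
  refine prod_le_prod (fun _ _ => zero_le_one) fun p hp => ?_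
  have hp2 : (2 : ℝ) ≤ p := by exact_mod_cast (Nat.prime_of_mem_primeFactors hp).two_le
  have : (p : ℝ)⁻¹ ≤ 2⁻¹ := inv_anti₀ (by norm_num) hp2
  linarith

lemma om_totient (K m : ℕ) (hm : 0 < m) : (K : ℝ) ^ om m / m.totient ≤ ((2 * K : ℕ) : ℝ) ^ om m / m := by
  have h1 : (0 : ℝ) < m := by exact_mod_cast hm
  have h2 : (0 : ℝ) < m.totient := by exact_mod_cast Nat.totient_pos.mpr hm
  rw [div_le_div_iff₀ h2 h1]
  push_cast
  rw [mul_pow]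
  calc (K : ℝ) ^ om m * m ≤ (K : ℝ) ^ om m * (m.totient * 2 ^ om m) := by gcongr; exact totient_lower m
    _ = _ := by ring

lemma om_totient_sum (K N : ℕ) : ∑ m ∈ Icc 1 N, (K : ℝ) ^ om m / m.totient ≤ (1 + Real.log N) ^ (2 * K) := by
  refine le_trans (sum_le_sum fun m hm => ?_) (om_sum (2 * K) N)
  rw [mem_Icc] at hm
  exact om_totient K m hm.1

lemma om_sqrt (M : ℕ) (hM : 1 ≤ M) (r : ℕ) (hr : 0 < r) : (M : ℝ) ^ om r ≤ (M : ℝ) ^ (M ^ 2) * Real.sqrt r := by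
  have hM' : (1 : ℝ) ≤ M := by exact_mod_cast hM
  have h1 : (M : ℝ) ^ om r = ∏ p ∈ r.primeFactors, (M : ℝ) := by rw [prod_const, om]
  rw [h1, ← prod_filter_mul_prod_filter_not r.primeFactors (fun p => p ≤ M ^ 2)]
  refine mul_le_mul ?_ ?_ (by positivity) (by positivity)
  · rw [prod_const]
    refine pow_le_pow_right₀ hM' ?_
    have : r.primeFactors.filter (fun p => p ≤ M ^ 2) ⊆ Icc 1 (M ^ 2) := by
      intro p hp
      rw [mem_filter] at hp
      rw [mem_Icc]
      exact ⟨(Nat.prime_of_mem_primeFactors hp.1).one_le, hp.2⟩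
    simpa using card_le_card this
  · have h2 : ∏ p ∈ r.primeFactors.filter (fun p => ¬ p ≤ M ^ 2), (M : ℝ) ≤
        ∏ p ∈ r.primeFactors.filter (fun p => ¬ p ≤ M ^ 2), Real.sqrt p := by
      refine prod_le_prod (fun _ _ => by positivity) fun p hp => ?_
      rw [mem_filter] at hp
      apply Real.le_sqrt_of_sq_le
      exact_mod_cast (not_le.mp hp.2).le
    refine h2.trans ?_
    have h3 : ∏ p ∈ r.primeFactors.filter (fun p => ¬ p ≤ M ^ 2), Real.sqrt p ≤ ∏ p ∈ r.primeFactors, Real.sqrt p := by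
      rw [← prod_filter_mul_prod_filter_not r.primeFactors (fun p => p ≤ M ^ 2) (fun p => Real.sqrt p)]
      refine le_mul_of_one_le_left (by positivity) ?_
      refine le_of_eq_of_le (prod_const_one (s := r.primeFactors.filter (fun p => p ≤ M ^ 2))).symm ?_
      refine prod_le_prod (fun _ _ => zero_le_one) fun p hp => ?_
      rw [mem_filter] at hp
      rw [Real.one_le_sqrt]
      exact_mod_cast (Nat.prime_of_mem_primeFactors hp.1).one_le
    refine h3.trans ?_
    rw [← Real.sqrt_prod]
    · apply Real.sqrt_le_sqrt
      rw [← Nat.cast_prod]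
      exact_mod_cast Nat.le_of_dvd hr (Nat.prod_primeFactors_dvd r)
    · intros; positivity

noncomputable def tau (n : ℕ) : ℝ := n.divisors.card

lemma tau_mul (a b : ℕ) : tau (a * b) ≤ tau a * tau b := by
  unfold tau
  rw [Nat.divisors_mul]
  exact_mod_cast card_mul_le

lemma tau_sq (n : ℕ) : tau n ^ 2 ≤ dc tau tau n := by
  unfold dc
  have h : tau n ^ 2 = ∑ p ∈ n.divisorsAntidiagonal, tau n := by
    rw [sum_const, nsmul_eq_mul, sq]
    congr 1
    rw [← Nat.map_div_right_divisors, card_map]; rfl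
  rw [h]
  refine sum_le_sum fun p hp => ?_
  rw [Nat.mem_divisorsAntidiagonal] at hp
  rw [← hp.1]
  exact tau_mul _ _

lemma tau_eq (n : ℕ) : tau n = dc (fun _ => 1) (fun _ => 1) n := by
  simp [dc, tau, ← Nat.map_div_right_divisors]

lemma tau_nonneg (n : ℕ) : 0 ≤ tau n := by unfold tau; positivity

lemma tau_sq_sum (N : ℕ) : ∑ n ∈ Icc 1 N, tau n ^ 2 / n ≤ (1 + Real.log N) ^ 4 := by
  have hl := Real.log_natCast_nonneg N
  have h1 : ∑ n ∈ Icc 1 N, tau n / n ≤ (1 + Real.log N) ^ 2 := by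
    simp_rw [tau_eq]
    refine (dc_sum_le _ _ (fun _ => zero_le_one) (fun _ => zero_le_one) N).trans ?_
    rw [sq]
    exact mul_le_mul (sum_inv_Icc N) (sum_inv_Icc N) (sum_nonneg fun _ _ => by positivity) (by positivity)
  have h2 : ∑ n ∈ Icc 1 N, tau n ^ 2 / n ≤ ∑ n ∈ Icc 1 N, dc tau tau n / n :=
    sum_le_sum fun n _ => div_le_div_of_nonneg_right (tau_sq n) (Nat.cast_nonneg _)
  refine h2.trans ((dc_sum_le _ _ tau_nonneg tau_nonneg N).trans ?_)
  rw [show (1 + Real.log N) ^ 4 = (1 + Real.log N) ^ 2 * (1 + Real.log N) ^ 2 by ring]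
  exact mul_le_mul h1 h1 (sum_nonneg fun n _ => div_nonneg (tau_nonneg n) (Nat.cast_nonneg _)) (by positivity)

end BG

namespace BG
set_option maxHeartbeats 400000
open Finset Filter Topology
open scoped ArithmeticFunction.vonMangoldt ArithmeticFunction.Moebius ArithmeticFunction.zeta

lemma cs_mul {r : ℕ} (χ : DirichletCharacter ℂ r) (a b : ℕ) : cs χ (a * b) = cs χ a * cs χ b := by
  simp [cs]

lemma dvd_sum {r : ℕ} (hr : 0 < r) (χ : DirichletCharacter ℂ r) (hχ : χ ≠ 1) (d : ℕ) (hd : 0 < d) (N : ℕ) :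
    ‖∑ n ∈ range N, (if d ∣ n then cs χ n else 0)‖ ≤ r := by
  rw [← sum_filter]
  have e : (range N).filter (fun n => d ∣ n) = (range ((N + d - 1) / d)).image (fun m => d * m) := by
    ext n
    simp only [mem_filter, mem_range, mem_image]
    constructor
    · rintro ⟨hn, m, rfl⟩
      refine ⟨m, ?_, rfl⟩
      rw [Nat.lt_div_iff_mul_lt hd]
      have : d * m = m * d := mul_comm _ _
      omega
    · rintro ⟨m, hm, rfl⟩
      refine ⟨?_, dvd_mul_right _ _⟩
      rw [Nat.lt_div_iff_mul_lt hd] at hm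
      have : d * m = m * d := mul_comm _ _
      omega
  rw [e, sum_image (fun a _ b _ h => Nat.eq_of_mul_eq_mul_left hd h)]
  simp_rw [cs_mul]
  rw [← mul_sum, norm_mul]
  calc _ ≤ 1 * (r : ℝ) := mul_le_mul (cs_norm_le _ _) (cs_sum hr χ hχ _) (norm_nonneg _) zero_le_one
    _ = r := one_mul _

/-- partial sums after cutting off the start -/
lemma cut_partial (c : ℕ → ℂ) (B : ℝ) (hB : 0 ≤ B) (hc : ∀ N, ‖∑ n ∈ range N, c n‖ ≤ B) (m0 N : ℕ) :
    ‖∑ n ∈ range N, (if m0 < n then c n else 0)‖ ≤ 2 * B := by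
  rcases le_total N (m0 + 1) with h | h
  · rw [sum_eq_zero]
    · simp [hB]
    · intro n hn; rw [if_neg]; rw [mem_range] at hn; omega
  · have : ∑ n ∈ range N, (if m0 < n then c n else 0) =
      ∑ n ∈ range N, c n - ∑ n ∈ range (m0 + 1), c n := by
      rw [← sum_range_add_sum_Ico _ h, ← sum_range_add_sum_Ico _ h]
      rw [sum_eq_zero (s := range (m0 + 1)), zero_add, add_sub_cancel_left]
      · refine sum_congr rfl fun n hn => ?_
        rw [mem_Ico] at hn; rw [if_pos (by omega)]
      · intro n hn; rw [mem_range] at hn; rw [if_neg (by omega)]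
    rw [this]
    refine (norm_sub_le _ _).trans ?_
    linarith [hc N, hc (m0 + 1)]

lemma typeI {r : ℕ} (hr : 0 < r) (χ : DirichletCharacter ℂ r) (hχ : χ ≠ 1) (L : ℝ) (hL : 0 < L)
    (i y : ℕ) (hy : (i : ℝ) ≤ Real.log ((y + 1 : ℕ) : ℝ)) (h : ℕ → ℝ) (D0 : ℕ) (H : ℝ) (hH0 : 0 ≤ H)
    (hH : ∀ d ∈ Icc 1 D0, |h d| ≤ H) :
    ‖S L i (fun n => if y < n then cs χ n * ((∑ d ∈ Icc 1 D0, if d ∣ n then h d else 0 : ℝ) : ℂ) else 0)‖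
      ≤ D0 * H * (2 * r) * (L ^ i / (y + 1)) := by
  unfold S
  have e : ∀ n, (if y < n then cs χ n * ((∑ d ∈ Icc 1 D0, if d ∣ n then h d else 0 : ℝ) : ℂ) else 0) * (v L i n : ℂ)
      = ∑ d ∈ Icc 1 D0, (h d : ℂ) * ((if y < n then (if d ∣ n then cs χ n else 0) else 0) * (v L i n : ℂ)) := by
    intro n
    split_ifs with hn
    · push_cast
      rw [mul_sum, sum_mul]
      refine sum_congr rfl fun d _ => ?_
      split_ifs
      · ring
      · simp
    · simp
  simp_rw [e]
  have hs : ∀ d, Summable fun n => (if y < n then (if d ∣ n then cs χ n else 0) else 0) * (v L i n : ℂ) := by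
    intro d
    refine summable_bdd (v_nonneg L i) (summable_v L hL i) _ 1 fun n => ?_
    split_ifs <;> simp [cs_norm_le]
  rw [Summable.tsum_finsetSum fun d _ => (hs d).mul_left _]
  refine (norm_sum_le _ _).trans ?_
  have hterm : ∀ d ∈ Icc 1 D0, ‖∑' n, (h d : ℂ) * ((if y < n then (if d ∣ n then cs χ n else 0) else 0) * (v L i n : ℂ))‖
      ≤ H * (2 * r * (L ^ i / (y + 1))) := by
    intro d hd
    rw [tsum_mul_left, norm_mul, Complex.norm_real]
    refine mul_le_mul (hH d hd) ?_ (norm_nonneg _) hH0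
    have := abel_tsum (fun n => if y < n then (if d ∣ n then cs χ n else 0) else 0) (v L i) (2 * r)
      (by positivity) (y + 1) (v_nonneg L i)
      (fun m n hm hn => v_antitone L hL i m n (by omega) (hy.trans (by
        apply Real.log_le_log
        · positivity
        · exact_mod_cast hm)) hn)
      (cut_partial _ r (by positivity) (dvd_sum hr χ hχ d (mem_Icc.mp hd).1) y)
      (fun n hn => by rw [if_neg (by omega)])
    refine this.trans ?_
    gcongr
    have := v_le L hL i (y + 1)
    push_cast at this
    exact this
  refine (sum_le_card_nsmul _ _ _ hterm).trans ?_
  rw [nsmul_eq_mul, Nat.card_Icc]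
  simp only [Nat.add_sub_cancel]
  rw [← mul_assoc, ← mul_assoc]

/-- truncated Moebius -/
noncomputable def Mu (U : ℕ) : ArithmeticFunction ℝ :=
  ⟨fun n => if n ≤ U then ((μ n : ℤ) : ℝ) else 0, by simp⟩
noncomputable def La (U : ℕ) : ArithmeticFunction ℝ := ⟨fun n => if n ≤ U then Λ n else 0, by simp⟩
noncomputable def Lb (U : ℕ) : ArithmeticFunction ℝ := Λ - La U
noncomputable def TT (U : ℕ) : ArithmeticFunction ℝ := (ζ : ArithmeticFunction ℝ) * Mu U - 1
noncomputable def cc (U : ℕ) : ArithmeticFunction ℝ := Lb U * TT U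

lemma vaughan (U : ℕ) : (Λ : ArithmeticFunction ℝ) =
    La U + ArithmeticFunction.log * Mu U - (ζ : ArithmeticFunction ℝ) * (Mu U * La U) - cc U := by
  have h : (Λ : ArithmeticFunction ℝ) * (ζ : ArithmeticFunction ℝ) = ArithmeticFunction.log :=
    ArithmeticFunction.vonMangoldt_mul_zeta
  rw [← h, cc, Lb, TT]
  ring

lemma Lb_apply (U n : ℕ) : Lb U n = if n ≤ U then 0 else Λ n := by
  have : Lb U n = Λ n - (if n ≤ U then Λ n else 0) := rfl
  rw [this]; split_ifs <;> simp

lemma Mu_abs (U n : ℕ) : |Mu U n| ≤ 1 := by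
  have : Mu U n = if n ≤ U then ((μ n : ℤ) : ℝ) else 0 := rfl
  rw [this]
  split_ifs
  · exact_mod_cast ArithmeticFunction.abs_moebius_le_one
  · simp

lemma Mu_zero (U n : ℕ) (h : U < n) : Mu U n = 0 := by
  have : Mu U n = if n ≤ U then ((μ n : ℤ) : ℝ) else 0 := rfl
  rw [this, if_neg (by omega)]

lemma TT_zero (U n : ℕ) (h : n ≤ U) : TT U n = 0 := by
  have h1 : (TT U) n = ((ζ : ArithmeticFunction ℝ) * Mu U) n - (1 : ArithmeticFunction ℝ) n := rfl
  rcases Nat.eq_zero_or_pos n with rfl | hn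
  · simp
  have h2 : (ζ : ArithmeticFunction ℝ) * ((μ : ArithmeticFunction ℤ) : ArithmeticFunction ℝ) = 1 :=
    ArithmeticFunction.coe_zeta_mul_coe_moebius
  rw [h1, ← h2, ArithmeticFunction.coe_zeta_mul_apply, ArithmeticFunction.coe_zeta_mul_apply, sub_eq_zero]
  refine sum_congr rfl fun d hd => ?_
  have hd' : d ≤ U := (Nat.divisor_le hd).trans h
  have : Mu U d = if d ≤ U then ((μ d : ℤ) : ℝ) else 0 := rfl
  rw [this, if_pos hd']
  rfl

lemma TT_abs (U n : ℕ) : |TT U n| ≤ tau n := by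
  have h1 : (TT U) n = ((ζ : ArithmeticFunction ℝ) * Mu U) n - (1 : ArithmeticFunction ℝ) n := rfl
  rcases Nat.eq_zero_or_pos U with rfl | hU
  · have h0 : ∀ d, Mu 0 d = 0 := by
      intro d
      rcases Nat.eq_zero_or_pos d with rfl | h
      · simp
      · exact Mu_zero 0 d h
    rw [h1, ArithmeticFunction.coe_zeta_mul_apply, sum_eq_zero fun d _ => h0 d]
    rcases Nat.eq_zero_or_pos n with rfl | hn
    · simp [tau]
    · by_cases h : n = 1
      · subst h; simp [tau]
      · rw [ArithmeticFunction.one_apply_ne h]; simp [tau_nonneg]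
  by_cases hn : n ≤ U
  · rw [TT_zero U n hn]; simp [tau_nonneg]
  · rw [h1, ArithmeticFunction.one_apply_ne (by omega), sub_zero, ArithmeticFunction.coe_zeta_mul_apply]
    refine (abs_sum_le_sum_abs _ _).trans ?_
    refine (sum_le_card_nsmul _ _ 1 fun d _ => Mu_abs U d).trans ?_
    simp [tau]

lemma La_nonneg (U n : ℕ) : 0 ≤ La U n := by
  have : La U n = if n ≤ U then Λ n else 0 := rfl
  rw [this]; split_ifs; exacts [ArithmeticFunction.vonMangoldt_nonneg, le_rfl]

lemma La_le (U n : ℕ) : La U n ≤ Λ n := by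
  have : La U n = if n ≤ U then Λ n else 0 := rfl
  rw [this]; split_ifs; exacts [le_rfl, ArithmeticFunction.vonMangoldt_nonneg]

lemma Lb_nonneg (U n : ℕ) : 0 ≤ Lb U n := by
  rw [Lb_apply]; split_ifs; exacts [le_rfl, ArithmeticFunction.vonMangoldt_nonneg]

lemma Lb_le (U n : ℕ) : Lb U n ≤ Λ n := by
  rw [Lb_apply]; split_ifs; exacts [ArithmeticFunction.vonMangoldt_nonneg, le_rfl]

lemma Lambda_anti (n : ℕ) : ∑ p ∈ n.divisorsAntidiagonal, Λ p.1 = Real.log n := by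
  rw [Nat.sum_divisorsAntidiagonal (fun a _ => Λ a), ArithmeticFunction.vonMangoldt_sum]

lemma cc_abs (U n : ℕ) : |cc U n| ≤ tau n * Real.log n := by
  rw [cc, ArithmeticFunction.mul_apply, ← Lambda_anti, mul_sum]
  refine (abs_sum_le_sum_abs _ _).trans (sum_le_sum fun p hp => ?_)
  rw [abs_mul, abs_of_nonneg (Lb_nonneg _ _), mul_comm]
  refine mul_le_mul ((TT_abs _ _).trans ?_) (Lb_le _ _) (Lb_nonneg _ _) (tau_nonneg _)
  rw [Nat.mem_divisorsAntidiagonal] at hp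
  unfold tau
  exact_mod_cast card_le_card (Nat.divisors_subset_of_dvd hp.2 ⟨p.1, by rw [← hp.1, mul_comm]⟩)

lemma cc_zero (U n : ℕ) (h : n ≤ U ^ 2) : cc U n = 0 := by
  rw [cc, ArithmeticFunction.mul_apply]
  refine sum_eq_zero fun p hp => ?_
  rw [Nat.mem_divisorsAntidiagonal] at hp
  by_cases h1 : p.1 ≤ U
  · rw [Lb_apply, if_pos h1, zero_mul]
  by_cases h2 : p.2 ≤ U
  · rw [TT_zero U _ h2, mul_zero]
  exfalso
  nlinarith [hp.1]

lemma ML_abs (U n : ℕ) : |(Mu U * La U) n| ≤ Real.log n := by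
  rw [mul_comm, ArithmeticFunction.mul_apply, ← Lambda_anti]
  refine (abs_sum_le_sum_abs _ _).trans (sum_le_sum fun p hp => ?_)
  rw [abs_mul, abs_of_nonneg (La_nonneg _ _)]
  calc _ ≤ Λ p.1 * 1 := mul_le_mul (La_le _ _) (Mu_abs _ _) (abs_nonneg _) ArithmeticFunction.vonMangoldt_nonneg
    _ = _ := mul_one _

lemma ML_zero (U n : ℕ) (h : U ^ 2 < n) : (Mu U * La U) n = 0 := by
  rw [ArithmeticFunction.mul_apply]
  refine sum_eq_zero fun p hp => ?_
  rw [Nat.mem_divisorsAntidiagonal] at hp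
  by_cases h1 : p.1 ≤ U
  · by_cases h2 : p.2 ≤ U
    · exfalso; nlinarith [hp.1]
    · have : La U p.2 = if p.2 ≤ U then Λ p.2 else 0 := rfl
      rw [this, if_neg h2, mul_zero]
  · rw [Mu_zero U _ (by omega), zero_mul]

lemma zeta_mul_trunc (f : ArithmeticFunction ℝ) (D0 : ℕ) (hf : ∀ n, D0 < n → f n = 0) (n : ℕ) (hn : 0 < n) :
    ((ζ : ArithmeticFunction ℝ) * f) n = ∑ d ∈ Icc 1 D0, if d ∣ n then f d else 0 := by
  rw [ArithmeticFunction.coe_zeta_mul_apply, ← sum_filter]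
  symm
  apply sum_subset_zero_on_sdiff
  · intro d hd
    rw [mem_filter] at hd
    rw [Nat.mem_divisors]; exact ⟨hd.2, by omega⟩
  · intro d hd
    rw [Finset.mem_sdiff, Nat.mem_divisors, mem_filter, mem_Icc] at hd
    apply hf
    by_contra hc
    exact hd.2 ⟨⟨Nat.pos_of_dvd_of_pos hd.1.1 hn, by omega⟩, hd.1.1⟩
  · intros; rfl

lemma log_mul_Mu (U n : ℕ) (hn : 0 < n) : (ArithmeticFunction.log * Mu U : ArithmeticFunction ℝ) n =
    Real.log n * (∑ d ∈ Icc 1 U, if d ∣ n then Mu U d else 0) -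
      ∑ d ∈ Icc 1 U, if d ∣ n then Mu U d * Real.log d else 0 := by
  rw [← zeta_mul_trunc (Mu U) U (fun m hm => Mu_zero U m hm) n hn]
  have h2 := zeta_mul_trunc (ArithmeticFunction.pmul (Mu U) ArithmeticFunction.log) U
    (fun m hm => by rw [ArithmeticFunction.pmul_apply, Mu_zero U m hm, zero_mul]) n hn
  simp only [ArithmeticFunction.pmul_apply, ArithmeticFunction.log_apply] at h2
  rw [← h2, ArithmeticFunction.coe_zeta_mul_apply, ArithmeticFunction.coe_zeta_mul_apply, mul_comm,
    ArithmeticFunction.mul_apply, Nat.sum_divisorsAntidiagonal (fun a b => Mu U a * ArithmeticFunction.log b),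
    mul_sum, ← sum_sub_distrib]
  refine sum_congr rfl fun d hd => ?_
  rw [Nat.mem_divisors] at hd
  have hd0 : 0 < d := Nat.pos_of_dvd_of_pos hd.1 hn
  simp only [ArithmeticFunction.pmul_apply, ArithmeticFunction.log_apply]
  rw [Nat.cast_div hd.1 (by positivity), Real.log_div (by positivity) (by positivity)]
  ring

end BG

namespace BG
set_option maxHeartbeats 400000
open Finset Filter Topology
open scoped ArithmeticFunction.vonMangoldt ArithmeticFunction.Moebius ArithmeticFunction.zeta

lemma conv_dc (f g : ℕ → ℝ) (n : ℕ) :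
    LSeries.convolution (fun n => (f n : ℂ)) (fun n => (g n : ℂ)) n = ((dc f g n : ℝ) : ℂ) := by
  rw [LSeries.convolution_def, dc]; push_cast; rfl

lemma tame_tau : Tame (fun n => ((tau n : ℝ) : ℂ)) := by
  have := Tame.conv tame_one tame_one
  have e : (fun n => ((tau n : ℝ) : ℂ)) = LSeries.convolution (fun _ => (1 : ℂ)) (fun _ => (1 : ℂ)) := by
    funext n
    have := conv_dc (fun _ => 1) (fun _ => 1) n
    rw [← tau_eq] at this
    simpa using this.symm
  rw [e]; exact this

lemma tame_tau_sq : Tame (fun n => ((tau n ^ 2 : ℝ) : ℂ)) := by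
  refine (Tame.conv tame_tau tame_tau).mono fun n => ?_
  rw [conv_dc, Complex.norm_real, Complex.norm_real, Real.norm_of_nonneg (by positivity),
    Real.norm_of_nonneg ((sq_nonneg _).trans (tau_sq n))]
  exact tau_sq n

lemma tame_TT {r : ℕ} (χ : DirichletCharacter ℂ r) (U : ℕ) : Tame (fun n => cs χ n * ((TT U n : ℝ) : ℂ)) := by
  refine tame_tau.mono fun n => ?_
  rw [norm_mul, Complex.norm_real, Complex.norm_real, Real.norm_eq_abs, Real.norm_of_nonneg (tau_nonneg n)]
  calc _ ≤ 1 * tau n := mul_le_mul (cs_norm_le _ _) (TT_abs _ _) (abs_nonneg _) zero_le_one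
    _ = _ := one_mul _

lemma tame_Lb {r : ℕ} (χ : DirichletCharacter ℂ r) (U : ℕ) : Tame (fun n => cs χ n * ((Lb U n : ℝ) : ℂ)) := by
  refine tame_Lambda.mono fun n => ?_
  rw [norm_mul, Complex.norm_real, Complex.norm_real, Real.norm_of_nonneg (Lb_nonneg _ _),
    Real.norm_of_nonneg ArithmeticFunction.vonMangoldt_nonneg]
  calc _ ≤ 1 * Λ n := mul_le_mul (cs_norm_le _ _) (Lb_le _ _) (Lb_nonneg _ _) zero_le_one
    _ = _ := one_mul _

lemma cs_cc {r : ℕ} (χ : DirichletCharacter ℂ r) (U : ℕ) : (fun n => cs χ n * ((cc U n : ℝ) : ℂ)) =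
    LSeries.convolution (fun n => cs χ n * ((Lb U n : ℝ) : ℂ)) (fun n => cs χ n * ((TT U n : ℝ) : ℂ)) := by
  funext n
  rw [LSeries.convolution_def, cc, ArithmeticFunction.mul_apply]
  push_cast
  rw [mul_sum]
  refine sum_congr rfl fun p hp => ?_
  rw [Nat.mem_divisorsAntidiagonal] at hp
  rw [← hp.1, cs_mul]; ring

lemma tame_cc {r : ℕ} (χ : DirichletCharacter ℂ r) (U : ℕ) : Tame (fun n => cs χ n * ((cc U n : ℝ) : ℂ)) := by
  rw [cs_cc]; exact (tame_Lb χ U).conv (tame_TT χ U)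

lemma lambda_split {r : ℕ} (hr : 0 < r) (χ : DirichletCharacter ℂ r) (hχ : χ ≠ 1) (L : ℝ) (hL : 0 < L)
    (J y U : ℕ) (hU : 0 < U) (hUy : U ^ 2 ≤ y) (hy : ((J + 1 : ℕ) : ℝ) ≤ Real.log ((y + 1 : ℕ) : ℝ)) :
    ‖S L J (fun n => if y < n then csL χ n else 0)‖ ≤
      (U : ℝ) ^ 2 * (2 * r) / (y + 1) * ((J + 1) * L ^ (J + 1) + 2 * Real.log ((U : ℝ) ^ 2) * L ^ J)
      + ‖S L J (fun n => cs χ n * ((cc U n : ℝ) : ℂ))‖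
      + ‖S L J (fun n => if n ≤ y then cs χ n * ((cc U n : ℝ) : ℂ) else 0)‖ := by
  have hU1 : (1 : ℝ) ≤ U := by exact_mod_cast hU
  have hy' : (J : ℝ) ≤ Real.log ((y + 1 : ℕ) : ℝ) := le_trans (by push_cast; linarith) hy
  set F1 : ℕ → ℂ := fun n => if y < n then cs χ n * ((∑ d ∈ Icc 1 U, if d ∣ n then Mu U d else 0 : ℝ) : ℂ) else 0 with hF1
  set F2 : ℕ → ℂ := fun n => if y < n then cs χ n * ((∑ d ∈ Icc 1 U, if d ∣ n then Mu U d * Real.log d else 0 : ℝ) : ℂ) else 0 with hF2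
  set F3 : ℕ → ℂ := fun n => if y < n then cs χ n * ((∑ d ∈ Icc 1 (U ^ 2), if d ∣ n then (Mu U * La U) d else 0 : ℝ) : ℂ) else 0 with hF3
  set F4 : ℕ → ℂ := fun n => cs χ n * ((cc U n : ℝ) : ℂ) with hF4
  set F5 : ℕ → ℂ := fun n => if n ≤ y then cs χ n * ((cc U n : ℝ) : ℂ) else 0 with hF5
  have hbd : ∀ (h : ℕ → ℝ) (D0 : ℕ), Tame (fun n => if y < n then cs χ n * ((∑ d ∈ Icc 1 D0, if d ∣ n then h d else 0 : ℝ) : ℂ) else 0) := by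
    intro h D0
    have h1 : Tame (fun n => ((∑ d ∈ Icc 1 D0, |h d| : ℝ) : ℂ)) := by
      intro s hs
      have := (tame_one s hs).smul ((∑ d ∈ Icc 1 D0, |h d| : ℝ) : ℂ)
      convert this using 1
      funext n; simp
    refine h1.mono fun n => ?_
    rw [Complex.norm_real, Real.norm_of_nonneg (sum_nonneg fun _ _ => abs_nonneg _)]
    split_ifs
    · rw [norm_mul, Complex.norm_real, Real.norm_eq_abs]
      have h3 : |∑ d ∈ Icc 1 D0, if d ∣ n then h d else 0| ≤ ∑ d ∈ Icc 1 D0, |h d| := by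
        refine (abs_sum_le_sum_abs _ _).trans (sum_le_sum fun d _ => ?_)
        split_ifs
        · exact le_rfl
        · simp
      calc _ ≤ 1 * ∑ d ∈ Icc 1 D0, |h d| := mul_le_mul (cs_norm_le _ _) h3 (abs_nonneg _) zero_le_one
        _ = _ := one_mul _
    · simp; exact sum_nonneg fun _ _ => abs_nonneg _
  have t1 : Tame F1 := hbd _ _
  have t2 : Tame F2 := hbd _ _
  have t3 : Tame F3 := hbd _ _
  have t4 : Tame F4 := tame_cc χ U
  have t5 : Tame F5 := t4.mono fun n => by
    simp only [hF5, hF4]; split_ifs <;> simp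
    positivity
  have t1l : Tame (fun n => F1 n * ((Real.log n : ℝ) : ℂ)) := by
    have := t1.lp 1
    refine this.mono fun n => ?_
    simp [lp, mul_comm]
  have key : (fun n => if y < n then csL χ n else 0) =
      (((fun n => F1 n * ((Real.log n : ℝ) : ℂ)) - F2) - F3) - (F4 - F5) := by
    funext n
    simp only [Pi.sub_apply, hF1, hF2, hF3, hF4, hF5, csL]
    by_cases hn : y < n
    · simp only [if_pos hn, if_neg (not_le.mpr hn), sub_zero]
      have hn0 : 0 < n := by omega
      have e : Λ n = La U n + (ArithmeticFunction.log * Mu U : ArithmeticFunction ℝ) n -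
          ((ζ : ArithmeticFunction ℝ) * (Mu U * La U)) n - cc U n :=
        congrArg (fun f : ArithmeticFunction ℝ => f n) (vaughan U)
      have e0 : La U n = 0 := by
        have h : La U n = if n ≤ U then Λ n else 0 := rfl
        rw [h, if_neg]
        nlinarith
      rw [e0, log_mul_Mu U n hn0, zeta_mul_trunc _ (U ^ 2) (fun m hm => ML_zero U m hm) n hn0] at e
      rw [e]
      push_cast
      ring
    · simp only [if_neg hn, if_pos (not_lt.mp hn)]; ring
  have hS : S L J (fun n => if y < n then csL χ n else 0) =
      (J + 1) * S L (J + 1) F1 - S L J F2 - S L J F3 - (S L J F4 - S L J F5) := by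
    rw [key, S_sub L hL J ((t1l.sub t2).sub t3) (t4.sub t5), S_sub L hL J (t1l.sub t2) t3,
      S_sub L hL J t1l t2, S_sub L hL J t4 t5, S_log]
  have b1 := typeI hr χ hχ L hL (J + 1) y hy (Mu U) U 1 zero_le_one (fun d _ => Mu_abs U d)
  have hlU : 0 ≤ Real.log ((U : ℝ) ^ 2) := Real.log_nonneg (one_le_pow₀ hU1)
  have b2 := typeI hr χ hχ L hL J y hy' (fun d => Mu U d * Real.log d) U (Real.log ((U : ℝ) ^ 2)) hlU (by
    intro d hd
    rw [mem_Icc] at hd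
    have hd1 : (1 : ℝ) ≤ d := by exact_mod_cast hd.1
    have hdU : (d : ℝ) ≤ U := by exact_mod_cast hd.2
    rw [abs_mul, abs_of_nonneg (Real.log_nonneg hd1)]
    calc _ ≤ 1 * Real.log d := mul_le_mul_of_nonneg_right (Mu_abs U d) (Real.log_nonneg hd1)
      _ = Real.log d := one_mul _
      _ ≤ _ := Real.log_le_log (by linarith) (by nlinarith))
  have b3 := typeI hr χ hχ L hL J y hy' (fun d => (Mu U * La U) d) (U ^ 2) (Real.log ((U : ℝ) ^ 2)) hlU (by
    intro d hd
    rw [mem_Icc] at hd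
    have hd1 : (0 : ℝ) < d := by exact_mod_cast hd.1
    refine (ML_abs U d).trans (Real.log_le_log hd1 ?_)
    exact_mod_cast hd.2)
  rw [hS]
  have n1 : ‖((J : ℂ) + 1) * S L (J + 1) F1‖ = (J + 1) * ‖S L (J + 1) F1‖ := by
    rw [norm_mul]; congr 1
    rw [show (J : ℂ) + 1 = ((J + 1 : ℕ) : ℂ) by push_cast; rfl, Complex.norm_natCast]; push_cast; rfl
  have tri : ‖((J : ℂ) + 1) * S L (J + 1) F1 - S L J F2 - S L J F3 - (S L J F4 - S L J F5)‖ ≤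
      (J + 1) * ‖S L (J + 1) F1‖ + ‖S L J F2‖ + ‖S L J F3‖ + ‖S L J F4‖ + ‖S L J F5‖ := by
    rw [← n1]
    refine (norm_sub_le _ _).trans ?_
    have := norm_sub_le (((J : ℂ) + 1) * S L (J + 1) F1 - S L J F2) (S L J F3)
    have := norm_sub_le (((J : ℂ) + 1) * S L (J + 1) F1) (S L J F2)
    have := norm_sub_le (S L J F4) (S L J F5)
    linarith
  refine tri.trans ?_
  have hUU : (U : ℝ) ≤ (U : ℝ) ^ 2 := by nlinarith
  have c1 : (J + 1) * ‖S L (J + 1) F1‖ ≤ (J + 1) * ((U : ℝ) ^ 2 * 1 * (2 * r) * (L ^ (J + 1) / (y + 1))) := by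
    refine mul_le_mul_of_nonneg_left (b1.trans ?_) (by positivity)
    gcongr
  have c2 : ‖S L J F2‖ ≤ (U : ℝ) ^ 2 * Real.log ((U : ℝ) ^ 2) * (2 * r) * (L ^ J / (y + 1)) := by
    refine b2.trans ?_
    gcongr
  have c3 : ‖S L J F3‖ ≤ (U : ℝ) ^ 2 * Real.log ((U : ℝ) ^ 2) * (2 * r) * (L ^ J / (y + 1)) := by
    refine b3.trans (le_of_eq ?_)
    push_cast; ring
  have e : (U : ℝ) ^ 2 * (2 * r) / (y + 1) * ((J + 1) * L ^ (J + 1) + 2 * Real.log ((U : ℝ) ^ 2) * L ^ J) =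
      (J + 1) * ((U : ℝ) ^ 2 * 1 * (2 * r) * (L ^ (J + 1) / (y + 1))) +
      2 * ((U : ℝ) ^ 2 * Real.log ((U : ℝ) ^ 2) * (2 * r) * (L ^ J / (y + 1))) := by ring
  rw [e]
  linarith

/-- V bound -/
lemma V_bound : ∃ L0 : ℝ, 1 ≤ L0 ∧ ∀ L ≥ L0, ∀ i, ∑' n, v L i n ≤ 2 * L ^ (i + 1) := by
  obtain ⟨C, hC, ρ, hρ, h⟩ := S_one_asymp
  refine ⟨max (max 1 (2 / ρ)) C, (le_max_left _ _).trans (le_max_left _ _), fun L hL i => ?_⟩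
  have h1 : 1 ≤ L := le_trans ((le_max_left _ _).trans (le_max_left _ _)) hL
  have h2 : 2 / ρ ≤ L := le_trans ((le_max_right _ _).trans (le_max_left _ _)) hL
  have h3 : C ≤ L := le_trans (le_max_right _ _) hL
  have hLp : 0 < L := by linarith
  have hρL : 2 ≤ L * ρ := by rwa [div_le_iff₀ hρ] at h2
  have := h L hLp (by rw [div_lt_iff₀ hLp]; linarith) i
  have e : S L i (fun _ => 1) = ((∑' n, v L i n : ℝ) : ℂ) := by
    unfold S; rw [Complex.ofReal_tsum]; simp
  rw [e, ← Complex.ofReal_pow, ← Complex.ofReal_sub, Complex.norm_real] at this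
  have h4 := (le_abs_self _).trans this
  have h5 : C / ρ ^ i ≤ L ^ (i + 1) := by
    rw [div_le_iff₀ (by positivity)]
    calc C ≤ L * 1 := by linarith
      _ ≤ L * (L * ρ) ^ i := by gcongr; exact one_le_pow₀ (by linarith)
      _ = _ := by rw [mul_pow]; ring
  linarith

lemma tsum_tau_sq (L : ℝ) (hL : 0 < L) (i : ℕ) : Summable (fun n => tau n ^ 2 * v L i n) ∧
    ∑' n, tau n ^ 2 * v L i n ≤ (2 * L) ^ i * (∑' n, v (2 * L) 0 n) ^ 4 := by
  have hs : ∀ L : ℝ, 0 < L → ∀ i, Summable (fun n => tau n ^ 2 * v L i n) := by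
    intro L hL i
    have := (tame_tau_sq.summable L hL i)
    have h2 : Summable (fun n => ((tau n ^ 2 * v L i n : ℝ) : ℂ)) := by
      refine this.congr fun n => ?_
      push_cast; ring
    exact Complex.summable_ofReal.mp h2
  refine ⟨hs L hL i, ?_⟩
  have h2L : 0 < 2 * L := by linarith
  have e1 : ∑' n, tau n ^ 2 * v L i n ≤ (2 * L) ^ i * ∑' n, tau n ^ 2 * v (2 * L) 0 n := by
    rw [← tsum_mul_left]
    refine (hs L hL i).tsum_le_tsum (fun n => ?_) ((hs _ h2L 0).mul_left _)
    calc _ ≤ tau n ^ 2 * ((2 * L) ^ i * v (2 * L) 0 n) := mul_le_mul_of_nonneg_left (v_le' L hL i n) (sq_nonneg _)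
      _ = _ := by ring
  refine e1.trans (mul_le_mul_of_nonneg_left ?_ (by positivity))
  have e2 : S (2 * L) 0 (LSeries.convolution (fun n => ((tau n : ℝ) : ℂ)) (fun n => ((tau n : ℝ) : ℂ))) =
      (((∑' n, v (2 * L) 0 n) ^ 4 : ℝ) : ℂ) := by
    have o : S (2 * L) 0 (fun _ => 1) = ((∑' n, v (2 * L) 0 n : ℝ) : ℂ) := by
      unfold S; rw [Complex.ofReal_tsum]; simp
    have t : S (2 * L) 0 (fun n => ((tau n : ℝ) : ℂ)) = ((∑' n, v (2 * L) 0 n : ℝ) : ℂ) ^ 2 := by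
      have e : (fun n => ((tau n : ℝ) : ℂ)) = LSeries.convolution (fun _ => (1 : ℂ)) (fun _ => (1 : ℂ)) := by
        funext n
        have := conv_dc (fun _ => 1) (fun _ => 1) n
        rw [← tau_eq] at this
        simpa using this.symm
      rw [e, S_conv _ h2L 0 tame_one tame_one]
      simp [o, sq]
    rw [S_conv _ h2L 0 tame_tau tame_tau]
    simp [t]; ring
  have e3 : S (2 * L) 0 (LSeries.convolution (fun n => ((tau n : ℝ) : ℂ)) (fun n => ((tau n : ℝ) : ℂ))) =
      ((∑' n, dc tau tau n * v (2 * L) 0 n : ℝ) : ℂ) := by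
    unfold S
    rw [Complex.ofReal_tsum]
    congr 1; funext n
    rw [conv_dc]; push_cast; rfl
  have hsum : Summable (fun n => dc tau tau n * v (2 * L) 0 n) := by
    have := ((Tame.conv tame_tau tame_tau).summable (2 * L) h2L 0)
    have h2 : Summable (fun n => ((dc tau tau n * v (2 * L) 0 n : ℝ) : ℂ)) := by
      refine this.congr fun n => ?_
      rw [conv_dc]; push_cast; rfl
    exact Complex.summable_ofReal.mp h2
  rw [e2] at e3
  rw [Complex.ofReal_inj.mp e3]
  exact (hs _ h2L 0).tsum_le_tsum (fun n => mul_le_mul_of_nonneg_right (tau_sq n) (v_nonneg _ _ _)) hsum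

lemma tsum_log_sq (L : ℝ) (hL : 0 < L) (i : ℕ) : Summable (fun n : ℕ => Real.log n ^ 2 * v L i n) ∧
    ∑' n : ℕ, Real.log n ^ 2 * v L i n = (i + 1) * (i + 2) * ∑' n, v L (i + 2) n := by
  have e : (fun n : ℕ => Real.log n ^ 2 * v L i n) = fun n => (((i : ℝ) + 1) * (i + 2)) * v L (i + 2) n := by
    funext n
    have h1 := log_mul_v L i n
    have h2 := log_mul_v L (i + 1) n
    push_cast at h2
    rw [sq, mul_assoc, h1, mul_left_comm, h2]
    ring
  rw [e, tsum_mul_left]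
  exact ⟨(summable_v L hL _).mul_left _, rfl⟩

end BG

namespace BG
set_option maxHeartbeats 400000
open Finset Filter Topology
open scoped ArithmeticFunction.vonMangoldt ArithmeticFunction.Moebius ArithmeticFunction.zeta

/-- admissible finite family of primitive characters -/
structure Fam (X : Finset Chr) (Q : ℕ) : Prop where
  pos : ∀ x ∈ X, 0 < x.1
  le : ∀ x ∈ X, x.1 ≤ Q
  prim : ∀ x ∈ X, x.2.IsPrimitive
  ne : ∀ x ∈ X, x.2 ≠ 1
  card : (X.card : ℝ) ≤ (Q : ℝ) ^ 2

lemma fam_bound {X : Finset Chr} {Q : ℕ} (hX : Fam X Q) (L : ℝ) (hL : 1 ≤ L) (i : ℕ)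
    (hV : ∑' n, v L i n ≤ 2 * L ^ (i + 1)) (m0 : ℕ) (hm1 : 1 ≤ m0) (hm : 2 * (Q : ℝ) ^ 4 ≤ m0)
    (hi : (i : ℝ) ≤ Real.log m0) (f : ℕ → ℝ) (hf0 : ∀ n < m0, f n = 0) (E : ℝ)
    (hs : Summable fun n => f n ^ 2 * v L i n) (hE : ∑' n, f n ^ 2 * v L i n ≤ E) :
    ∑ x ∈ X, ‖S L i (fun n => cs x.2 n * ((f n : ℝ) : ℂ))‖ ^ 2 ≤ 3 * L ^ (i + 1) * E := by
  have hLp : 0 < L := by linarith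
  have hm1' : (1 : ℝ) ≤ m0 := by exact_mod_cast hm1
  set g : ℕ → ℝ := fun n => if n < m0 then 0 else v L i n with hg
  have hg0 : ∀ n, 0 ≤ g n := fun n => by simp only [hg]; split_ifs; exacts [le_rfl, v_nonneg _ _ _]
  have hgv : ∀ n, g n ≤ v L i n := fun n => by simp only [hg]; split_ifs; exacts [v_nonneg _ _ _, le_rfl]
  have hgs : Summable g := Summable.of_nonneg_of_le hg0 hgv (summable_v L hLp i)
  have hfg : ∀ n, f n ^ 2 * v L i n = ‖((f n : ℝ) : ℂ)‖ ^ 2 * g n := by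
    intro n
    rw [Complex.norm_real, Real.norm_eq_abs, sq_abs]
    by_cases h : n < m0
    · simp [hf0 n h]
    · simp [hg, h]
  simp_rw [hfg] at hs hE
  have hE0 : 0 ≤ ∑' n, ‖((f n : ℝ) : ℂ)‖ ^ 2 * g n := tsum_nonneg fun n => mul_nonneg (sq_nonneg _) (hg0 n)
  have := char_sieve X Q (fun x hx => ⟨hX.pos x hx, hX.le x hx⟩) hX.prim g hg0 hgs m0
    (fun n hn => by simp [hg, hn]) (fun m n hm hn => by
      simp only [hg]
      rw [if_neg (by omega), if_neg (by omega)]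
      exact v_antitone L hLp i m n (by omega) (hi.trans (Real.log_le_log (by linarith) (by exact_mod_cast hm))) hn)
    (fun n => ((f n : ℝ) : ℂ)) hs (3 * L ^ (i + 1)) (by positivity) (by
      have h1 : ∑' n, g n ≤ 2 * L ^ (i + 1) := (hgs.tsum_le_tsum hgv (summable_v L hLp i)).trans hV
      have h2 : (X.card : ℝ) * (2 * (Q : ℝ) ^ 2 * g m0) ≤ L ^ (i + 1) := by
        have : g m0 ≤ L ^ i / m0 := (hgv m0).trans (v_le L hLp i m0)
        calc (X.card : ℝ) * (2 * (Q : ℝ) ^ 2 * g m0) ≤ (Q : ℝ) ^ 2 * (2 * (Q : ℝ) ^ 2 * (L ^ i / m0)) := by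
              have := hX.card
              have := hg0 m0
              gcongr
          _ = 2 * (Q : ℝ) ^ 4 * (L ^ i / m0) := by ring
          _ ≤ m0 * (L ^ i / m0) := by gcongr
          _ = L ^ i := by field_simp
          _ ≤ L ^ (i + 1) := pow_le_pow_right₀ hL (by omega)
      linarith)
  refine le_trans (le_of_eq ?_) (this.trans (mul_le_mul_of_nonneg_left hE (by positivity)))
  refine sum_congr rfl fun x _ => ?_
  unfold S
  congr 3
  funext n
  by_cases h : n < m0
  · simp [hf0 n h]
  · simp only [hg, h, if_false]; ring

lemma typeII_full {X : Finset Chr} {Q : ℕ} (hX : Fam X Q) (L : ℝ) (hL : 1 ≤ L)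
    (hV : ∀ i, ∑' n, v L i n ≤ 2 * L ^ (i + 1)) (hV2 : ∑' n, v (2 * L) 0 n ≤ 2 * (2 * L) ^ (0 + 1))
    (J U : ℕ) (hU : 2 * (Q : ℝ) ^ 4 ≤ U) (hJ : (J : ℝ) ≤ Real.log ((U + 1 : ℕ) : ℝ)) :
    ∑ x ∈ X, ‖S L J (fun n => cs x.2 n * ((cc U n : ℝ) : ℂ))‖ ≤
      (J + 1) * (68 * 2 ^ J * (J + 2) * L ^ (J + 5)) := by
  have hLp : 0 < L := by linarith
  have h1 : ∀ x ∈ X, ‖S L J (fun n => cs x.2 n * ((cc U n : ℝ) : ℂ))‖ ≤ ∑ p ∈ antidiagonal J,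
      ‖S L p.1 (fun n => cs x.2 n * ((Lb U n : ℝ) : ℂ))‖ * ‖S L p.2 (fun n => cs x.2 n * ((TT U n : ℝ) : ℂ))‖ := by
    intro x _
    rw [cs_cc, S_conv L hLp J (tame_Lb _ U) (tame_TT _ U)]
    refine (norm_sum_le _ _).trans (le_of_eq ?_)
    exact sum_congr rfl fun p _ => norm_mul _ _
  refine (sum_le_sum h1).trans ?_
  rw [sum_comm]
  have h2 : ∀ p ∈ antidiagonal J, ∑ x ∈ X, ‖S L p.1 (fun n => cs x.2 n * ((Lb U n : ℝ) : ℂ))‖ *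
      ‖S L p.2 (fun n => cs x.2 n * ((TT U n : ℝ) : ℂ))‖ ≤ 68 * 2 ^ J * (J + 2) * L ^ (J + 5) := by
    intro p hp
    rw [Finset.HasAntidiagonal.mem_antidiagonal] at hp
    have hU' : 2 * (Q : ℝ) ^ 4 ≤ ((U + 1 : ℕ) : ℝ) := by push_cast; linarith
    have hp1 : (p.1 : ℝ) ≤ Real.log ((U + 1 : ℕ) : ℝ) := le_trans (by exact_mod_cast (by omega)) hJ
    have hp2 : (p.2 : ℝ) ≤ Real.log ((U + 1 : ℕ) : ℝ) := le_trans (by exact_mod_cast (by omega)) hJ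
    obtain ⟨sl, el⟩ := tsum_log_sq L hLp p.1
    obtain ⟨st, et⟩ := tsum_tau_sq L hLp p.2
    have hLb : ∀ n, Lb U n ^ 2 * v L p.1 n ≤ Real.log n ^ 2 * v L p.1 n := by
      intro n
      refine mul_le_mul_of_nonneg_right ?_ (v_nonneg _ _ _)
      exact pow_le_pow_left₀ (Lb_nonneg _ _) ((Lb_le U n).trans ArithmeticFunction.vonMangoldt_le_log) 2
    have hTT : ∀ n, TT U n ^ 2 * v L p.2 n ≤ tau n ^ 2 * v L p.2 n := by
      intro n
      refine mul_le_mul_of_nonneg_right ?_ (v_nonneg _ _ _)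
      rw [← sq_abs]
      exact pow_le_pow_left₀ (abs_nonneg _) (TT_abs U n) 2
    have sLb : Summable fun n => Lb U n ^ 2 * v L p.1 n :=
      Summable.of_nonneg_of_le (fun n => mul_nonneg (sq_nonneg _) (v_nonneg _ _ _)) hLb sl
    have sTT : Summable fun n => TT U n ^ 2 * v L p.2 n :=
      Summable.of_nonneg_of_le (fun n => mul_nonneg (sq_nonneg _) (v_nonneg _ _ _)) hTT st
    have b1 := fam_bound hX L hL p.1 (hV _) (U + 1) (by omega) hU' hp1 (fun n => Lb U n)
      (fun n hn => by rw [Lb_apply, if_pos (by omega)]) ((J + 2) ^ 2 * (2 * L ^ (p.1 + 2 + 1))) sLb (by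
        refine (sLb.tsum_le_tsum hLb sl).trans ?_
        rw [el]
        have hpJ : (p.1 : ℝ) ≤ J := by exact_mod_cast (by omega)
        have := hV (p.1 + 2)
        calc _ ≤ ((p.1 : ℝ) + 1) * (p.1 + 2) * (2 * L ^ (p.1 + 2 + 1)) := by gcongr
          _ ≤ (J + 2) * (J + 2) * (2 * L ^ (p.1 + 2 + 1)) := by gcongr; linarith
          _ = _ := by ring)
    have b2 := fam_bound hX L hL p.2 (hV _) (U + 1) (by omega) hU' hp2 (fun n => TT U n)
      (fun n hn => TT_zero U n (by omega)) ((2 * L) ^ p.2 * (2 * (2 * L) ^ (0 + 1)) ^ 4) sTT (by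
        refine (sTT.tsum_le_tsum hTT st).trans (et.trans ?_)
        have : 0 ≤ ∑' n, v (2 * L) 0 n := tsum_nonneg fun n => v_nonneg _ _ _
        gcongr)
    set a : Chr → ℝ := fun x => ‖S L p.1 (fun n => cs x.2 n * ((Lb U n : ℝ) : ℂ))‖
    set b : Chr → ℝ := fun x => ‖S L p.2 (fun n => cs x.2 n * ((TT U n : ℝ) : ℂ))‖
    refine (sq_le_sq₀ (sum_nonneg fun _ _ => by positivity) (by positivity)).mp ?_
    refine (sum_mul_sq_le_sq_mul_sq X a b).trans ?_
    have hJp : J = p.1 + p.2 := by omega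
    calc (∑ x ∈ X, a x ^ 2) * ∑ x ∈ X, b x ^ 2 ≤ (3 * L ^ (p.1 + 1) * ((J + 2) ^ 2 * (2 * L ^ (p.1 + 2 + 1)))) *
          (3 * L ^ (p.2 + 1) * ((2 * L) ^ p.2 * (2 * (2 * L) ^ (0 + 1)) ^ 4)) :=
          mul_le_mul b1 b2 (sum_nonneg fun _ _ => sq_nonneg _) (by positivity)
      _ = 4608 * 2 ^ p.2 * (J + 2) ^ 2 * L ^ (2 * p.1 + 2 * p.2 + 9) := by
          rw [mul_pow]; ring
      _ ≤ 4624 * (2 ^ J) ^ 2 * (J + 2) ^ 2 * L ^ (2 * p.1 + 2 * p.2 + 10) := by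
          have : (2 : ℝ) ^ p.2 ≤ (2 ^ J) ^ 2 := by
            rw [← pow_mul]; exact pow_le_pow_right₀ (by norm_num) (by omega)
          have : L ^ (2 * p.1 + 2 * p.2 + 9) ≤ L ^ (2 * p.1 + 2 * p.2 + 10) := pow_le_pow_right₀ hL (by omega)
          gcongr
          norm_num
      _ = _ := by
          have : 2 * p.1 + 2 * p.2 + 10 = 2 * (J + 5) := by omega
          rw [this]; ring
  refine (sum_le_card_nsmul _ _ _ h2).trans ?_
  rw [nsmul_eq_mul, Finset.Nat.card_antidiagonal]
  push_cast
  exact le_rfl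

lemma typeII_cut {X : Finset Chr} {Q : ℕ} (hX : Fam X Q) (L : ℝ) (hL : 1 ≤ L)
    (J U y : ℕ) (hU0 : 0 < U) (hU : 2 * (Q : ℝ) ^ 4 ≤ U) (hJ : (J : ℝ) ≤ Real.log U) (hUy : U ^ 2 < y) :
    ∑ x ∈ X, ‖S L J (fun n => if n ≤ y then cs x.2 n * ((cc U n : ℝ) : ℂ) else 0)‖ ^ 2 ≤
      2 * (Real.log y ^ J / J.factorial) ^ 2 * (1 + Real.log y) ^ 7 := by
  have hLp : 0 < L := by linarith
  have hU1 : (1 : ℝ) ≤ U := by exact_mod_cast hU0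
  have hy1 : 1 < y := lt_of_le_of_lt (Nat.one_le_pow _ _ hU0) hUy
  have hy1' : (1 : ℝ) < y := by exact_mod_cast hy1
  have hly : 0 < Real.log y := Real.log_pos hy1'
  set P : ℝ := Real.log y ^ J / J.factorial with hP
  have hP0 : 0 < P := by positivity
  set g : ℕ → ℝ := fun n => if U ^ 2 < n ∧ n ≤ y then v L J n else 0 with hg
  have hg0 : ∀ n, 0 ≤ g n := fun n => by simp only [hg]; split_ifs; exacts [v_nonneg _ _ _, le_rfl]
  have hgP : ∀ n ∈ Icc 1 y, g n ≤ P * (1 / n) := by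
    intro n hn
    rw [mem_Icc] at hn
    have h1 : (1 : ℝ) ≤ n := by exact_mod_cast hn.1
    have h2 : (n : ℝ) ≤ y := by exact_mod_cast hn.2
    have : v L J n ≤ P * (1 / n) := by
      refine (v_le_log L hLp J n).trans ?_
      have := Real.log_nonneg h1
      have := Real.log_le_log (by linarith) h2
      rw [hP]; gcongr
    simp only [hg]; split_ifs
    · exact this
    · positivity
  have hgsupp : ∀ n ∉ Icc 1 y, g n = 0 := by
    intro n hn
    simp only [hg]; rw [if_neg]
    rintro ⟨h1, h2⟩; exact hn (mem_Icc.mpr ⟨by omega, h2⟩)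
  have hgs : Summable g := summable_of_ne_finset_zero (s := Icc 1 y) hgsupp
  have hcs : Summable fun n => ‖((cc U n : ℝ) : ℂ)‖ ^ 2 * g n :=
    summable_of_ne_finset_zero (s := Icc 1 y) fun n hn => by rw [hgsupp n hn, mul_zero]
  have hm0 : g (U ^ 2 + 1) ≤ P * (1 / U) := by
    refine (hgP (U ^ 2 + 1) (mem_Icc.mpr ⟨by omega, by omega⟩)).trans ?_
    gcongr
    push_cast
    nlinarith
  have := char_sieve X Q (fun x hx => ⟨hX.pos x hx, hX.le x hx⟩) hX.prim g hg0 hgs (U ^ 2 + 1)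
    (fun n hn => by simp only [hg]; rw [if_neg]; rintro ⟨h, _⟩; omega) (fun m n hm hn => by
      have hv : v L J n ≤ v L J m := v_antitone L hLp J m n (by omega) (hJ.trans (Real.log_le_log (by linarith)
        (by
          have : U ≤ m := le_trans (by nlinarith) hm
          exact_mod_cast this))) hn
      simp only [hg]
      by_cases h : n ≤ y
      · rw [if_pos ⟨by omega, h⟩, if_pos ⟨by omega, by omega⟩]; exact hv
      · rw [if_neg (by tauto)]; exact hg0 m)
    (fun n => ((cc U n : ℝ) : ℂ)) hcs (2 * P * (1 + Real.log y)) (by positivity) (by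
      have h1 : ∑' n, g n ≤ P * (1 + Real.log y) := by
        rw [tsum_eq_sum hgsupp]
        refine (sum_le_sum hgP).trans ?_
        rw [← mul_sum]
        exact mul_le_mul_of_nonneg_left (sum_inv_Icc y) hP0.le
      have h2 : (X.card : ℝ) * (2 * (Q : ℝ) ^ 2 * g (U ^ 2 + 1)) ≤ P := by
        calc (X.card : ℝ) * (2 * (Q : ℝ) ^ 2 * g (U ^ 2 + 1)) ≤ (Q : ℝ) ^ 2 * (2 * (Q : ℝ) ^ 2 * (P * (1 / U))) := by
              have := hX.card
              have := hg0 (U ^ 2 + 1)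
              gcongr
          _ = 2 * (Q : ℝ) ^ 4 * (P * (1 / U)) := by ring
          _ ≤ U * (P * (1 / U)) := by gcongr
          _ = P := by field_simp
      nlinarith)
  have hE : ∑' n, ‖((cc U n : ℝ) : ℂ)‖ ^ 2 * g n ≤ Real.log y ^ 2 * P * (1 + Real.log y) ^ 4 := by
    rw [tsum_eq_sum (s := Icc 1 y) fun n hn => by rw [hgsupp n hn, mul_zero]]
    calc _ ≤ ∑ n ∈ Icc 1 y, Real.log y ^ 2 * P * (tau n ^ 2 / n) := by
          refine sum_le_sum fun n hn => ?_
          have hb := hgP n hn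
          rw [mem_Icc] at hn
          have h1 : (1 : ℝ) ≤ n := by exact_mod_cast hn.1
          have h2 : (n : ℝ) ≤ y := by exact_mod_cast hn.2
          have hc : ‖((cc U n : ℝ) : ℂ)‖ ≤ tau n * Real.log y := by
            rw [Complex.norm_real, Real.norm_eq_abs]
            refine (cc_abs U n).trans ?_
            have := tau_nonneg n
            have := Real.log_le_log (by linarith) h2
            gcongr
          calc _ ≤ (tau n * Real.log y) ^ 2 * (P * (1 / n)) :=
                mul_le_mul (pow_le_pow_left₀ (norm_nonneg _) hc 2) hb (hg0 n) (sq_nonneg _)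
            _ = _ := by ring
      _ = Real.log y ^ 2 * P * ∑ n ∈ Icc 1 y, tau n ^ 2 / n := by rw [mul_sum]
      _ ≤ _ := mul_le_mul_of_nonneg_left (tau_sq_sum y) (by positivity)
  have fin : 2 * P * (1 + Real.log y) * ∑' n, ‖((cc U n : ℝ) : ℂ)‖ ^ 2 * g n ≤ 2 * P ^ 2 * (1 + Real.log y) ^ 7 := by
    calc _ ≤ 2 * P * (1 + Real.log y) * (Real.log y ^ 2 * P * (1 + Real.log y) ^ 4) := by gcongr
      _ ≤ 2 * P * (1 + Real.log y) * ((1 + Real.log y) ^ 2 * P * (1 + Real.log y) ^ 4) := by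
        gcongr; linarith
      _ = _ := by ring
  refine le_trans (le_of_eq ?_) (this.trans fin)
  refine sum_congr rfl fun x _ => ?_
  unfold S
  congr 3
  funext n
  by_cases h : n ≤ U ^ 2
  · simp [cc_zero U n h]
  · by_cases h2 : n ≤ y
    · simp only [hg, h2, if_true, not_le.mp h, and_true]; ring
    · simp [hg, h2]

end BG

namespace BG
set_option maxHeartbeats 400000
open Finset Filter Topology
open scoped ArithmeticFunction.vonMangoldt ArithmeticFunction.Moebius ArithmeticFunction.zeta

/-- prime sum twisted by a character -/
noncomputable def th {r : ℕ} (χ : DirichletCharacter ℂ r) (L : ℝ) (j y : ℕ) : ℂ :=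
  S L j (fun n => if n.Prime ∧ y < n then cs χ n else 0)

lemma norm_S_le (L : ℝ) (i : ℕ) (f : ℕ → ℂ) (g : ℕ → ℝ) (hg : Summable fun n => g n * v L i n)
    (h : ∀ n, ‖f n‖ ≤ g n) : ‖S L i f‖ ≤ ∑' n, g n * v L i n := by
  unfold S
  refine tsum_of_norm_bounded hg.hasSum fun n => ?_
  rw [norm_mul, Complex.norm_real, Real.norm_eq_abs, abs_of_nonneg (v_nonneg _ _ _)]
  exact mul_le_mul_of_nonneg_right (h n) (v_nonneg _ _ _)

lemma tail_sq (F : Finset ℕ) (T : ℕ) (hF : ∀ s ∈ F, T < s) : ∑ s ∈ F, 1 / (s : ℝ) ^ 2 ≤ 2 / ((T : ℝ) + 1) := by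
  have h : F ⊆ Ioo T (F.sup id + 1) := fun s hs => mem_Ioo.mpr
    ⟨hF s hs, Nat.lt_succ_of_le (Finset.le_sup (f := id) hs)⟩
  refine (sum_le_sum_of_subset_of_nonneg h fun _ _ _ => by positivity).trans ?_
  have := sum_Ioo_inv_sq_le (α := ℝ) T (F.sup id + 1)
  simpa only [one_div] using this

/-- reciprocal sum over proper prime powers beyond `T^3` -/
lemma ppow_sum (F : Finset ℕ) (T : ℕ) (hF : ∀ n ∈ F, IsPrimePow n ∧ ¬ n.Prime ∧ T ^ 3 < n) :
    ∑ n ∈ F, 1 / (n : ℝ) ≤ 4 / (T + 1) := by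
  classical
  have key : ∀ n ∈ F, ∃ s, T < s ∧ (n = s ^ 2 ∨ n = s ^ 2 * s.minFac) := by
    intro n hn
    obtain ⟨hp, hnp, hT⟩ := hF n hn
    obtain ⟨p, k, pp, hk, rfl⟩ := (isPrimePow_nat_iff n).mp hp
    have hk2 : 2 ≤ k := by
      rcases Nat.lt_or_ge k 2 with h | h
      · exact absurd (by rw [show k = 1 by omega, pow_one]; exact pp) hnp
      · exact h
    have hp0 : p ^ (k / 2) ≠ 1 := by
      refine (Nat.one_lt_pow (by omega) pp.one_lt).ne'
    have hcube : p ^ k ≤ (p ^ (k / 2)) ^ 3 := by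
      rw [← pow_mul]; exact Nat.pow_le_pow_right pp.pos (by omega)
    refine ⟨p ^ (k / 2), lt_of_pow_lt_pow_left' 3 (hT.trans_le hcube), ?_⟩
    rcases Nat.even_or_odd' k with ⟨c, rfl | rfl⟩
    · left; rw [← pow_mul]; congr 1; omega
    · right
      rw [Nat.Prime.pow_minFac pp (by omega), ← pow_mul, ← pow_succ]; congr 1; omega
  choose! f hf1 hf2 using key
  set F1 := F.filter fun n => n = f n ^ 2
  set F2 := F.filter fun n => ¬ n = f n ^ 2
  have e1 : ∑ n ∈ F1, 1 / (n : ℝ) ≤ 2 / (T + 1) := by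
    have inj : Set.InjOn f F1 := by
      intro a ha b hb hab
      rw [(mem_filter.mp ha).2, (mem_filter.mp hb).2, hab]
    refine le_trans (le_of_eq ?_) (tail_sq (F1.image f) T ?_)
    · rw [sum_image inj]
      refine sum_congr rfl fun n hn => ?_
      rw [← Nat.cast_pow, ← (mem_filter.mp hn).2]
    · intro s hs
      obtain ⟨n, hn, rfl⟩ := mem_image.mp hs
      exact hf1 n (mem_filter.mp hn).1
  have e2 : ∑ n ∈ F2, 1 / (n : ℝ) ≤ 2 / (T + 1) := by
    have hh : ∀ n ∈ F2, n = f n ^ 2 * (f n).minFac := fun n hn =>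
      (hf2 n (mem_filter.mp hn).1).resolve_left (mem_filter.mp hn).2
    have inj : Set.InjOn f F2 := by
      intro a ha b hb hab
      rw [hh a ha, hh b hb, hab]
    refine le_trans ?_ (tail_sq (F2.image f) T ?_)
    · rw [sum_image inj]
      refine sum_le_sum fun n hn => ?_
      have h1 := hf1 n (mem_filter.mp hn).1
      have h2 : f n ^ 2 ≤ n := by
        conv_rhs => rw [hh n hn]
        exact Nat.le_mul_of_pos_right _ (Nat.minFac_pos _)
      have h3 : (0 : ℝ) < (f n : ℝ) ^ 2 := by
        have : (0 : ℝ) < f n := by exact_mod_cast (by omega : 0 < f n)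
        positivity
      exact one_div_le_one_div_of_le h3 (by exact_mod_cast h2)
    · intro s hs
      obtain ⟨n, hn, rfl⟩ := mem_image.mp hs
      exact hf1 n (mem_filter.mp hn).1
  rw [← sum_filter_add_sum_filter_not F (fun n => n = f n ^ 2)]
  calc _ ≤ 2 / ((T : ℝ) + 1) + 2 / (T + 1) := add_le_add e1 e2
    _ = _ := by ring

lemma summable_log_v (L : ℝ) (hL : 0 < L) (J : ℕ) : Summable fun n : ℕ => Real.log n * v L J n := by
  simp_rw [log_mul_v]
  exact (summable_v L hL _).mul_left _

lemma ppow_tail (L : ℝ) (hL : 0 < L) (J T y : ℕ) (hy : T ^ 3 ≤ y) (c : ℕ → ℂ) (hc : ∀ n, ‖c n‖ ≤ 1) :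
    ‖S L J (fun n => if y < n ∧ ¬ n.Prime then c n * ((Λ n : ℝ) : ℂ) else 0)‖ ≤
      (J + 1) * L ^ (J + 1) * (4 / (T + 1)) := by
  set g : ℕ → ℝ := fun n => if y < n ∧ ¬ n.Prime then Λ n else 0 with hg
  have hg0 : ∀ n, 0 ≤ g n := fun n => by
    simp only [hg]; split_ifs; exacts [ArithmeticFunction.vonMangoldt_nonneg, le_rfl]
  have hgl : ∀ n, g n ≤ Real.log n := fun n => by
    simp only [hg]; split_ifs; exacts [ArithmeticFunction.vonMangoldt_le_log, Real.log_natCast_nonneg _]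
  have hs : Summable fun n => g n * v L J n := Summable.of_nonneg_of_le
    (fun n => mul_nonneg (hg0 n) (v_nonneg _ _ _))
    (fun n => mul_le_mul_of_nonneg_right (hgl n) (v_nonneg _ _ _)) (summable_log_v L hL J)
  refine (norm_S_le L J _ g hs fun n => ?_).trans ?_
  · simp only [hg]
    split_ifs
    · rw [norm_mul, Complex.norm_real, Real.norm_eq_abs, abs_of_nonneg ArithmeticFunction.vonMangoldt_nonneg]
      exact mul_le_of_le_one_left ArithmeticFunction.vonMangoldt_nonneg (hc n)
    · simp
  · refine hs.tsum_le_of_sum_le fun F => ?_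
    have h1 : ∑ n ∈ F, g n * v L J n = ∑ n ∈ F.filter (fun n => IsPrimePow n ∧ ¬ n.Prime ∧ y < n), g n * v L J n := by
      rw [sum_filter_of_ne]
      intro n _ hne
      have : g n ≠ 0 := left_ne_zero_of_mul hne
      simp only [hg] at this
      split_ifs at this with h
      · exact ⟨ArithmeticFunction.vonMangoldt_ne_zero_iff.mp this, h.2, h.1⟩
      · exact absurd rfl this
    rw [h1]
    have h2 := ppow_sum (F.filter (fun n => IsPrimePow n ∧ ¬ n.Prime ∧ y < n)) T (fun n hn => by
      have := (mem_filter.mp hn).2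
      exact ⟨this.1, this.2.1, lt_of_le_of_lt hy this.2.2⟩)
    refine le_trans (sum_le_sum (g := fun n : ℕ => (J + 1) * L ^ (J + 1) * (1 / (n : ℝ))) fun n _ => ?_) ?_
    · calc g n * v L J n ≤ Real.log n * v L J n := mul_le_mul_of_nonneg_right (hgl n) (v_nonneg _ _ _)
        _ = (J + 1) * v L (J + 1) n := log_mul_v _ _ _
        _ ≤ (J + 1) * (L ^ (J + 1) / n) := by gcongr; exact v_le L hL _ _
        _ = _ := by ring
    · rw [← mul_sum]; gcongr

lemma small_part (L : ℝ) (hL : 0 < L) (J y : ℕ) (c : ℕ → ℂ) (hc : ∀ n, ‖c n‖ ≤ 1) :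
    ‖S L J (fun n => if n ≤ y then c n * ((Λ n : ℝ) : ℂ) else 0)‖ ≤
      (J + 1) * (Real.log y ^ (J + 1) / (J + 1).factorial) * (1 + Real.log y) := by
  set g : ℕ → ℝ := fun n => if n ≤ y then Real.log n else 0 with hg
  have hsupp : ∀ n ∉ Icc 1 y, g n * v L J n = 0 := fun n hn => by
    rw [mem_Icc] at hn
    by_cases h : n ≤ y
    · have : n = 0 := by omega
      subst this; simp [hg]
    · simp [hg, h]
  have hs : Summable fun n => g n * v L J n := summable_of_ne_finset_zero hsupp
  refine (norm_S_le L J _ g hs fun n => ?_).trans ?_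
  · simp only [hg]
    split_ifs
    · rw [norm_mul, Complex.norm_real, Real.norm_eq_abs, abs_of_nonneg ArithmeticFunction.vonMangoldt_nonneg]
      exact (mul_le_of_le_one_left ArithmeticFunction.vonMangoldt_nonneg (hc n)).trans
        ArithmeticFunction.vonMangoldt_le_log
    · simp
  · rw [tsum_eq_sum hsupp]
    calc _ ≤ ∑ n ∈ Icc 1 y, (J + 1) * (Real.log y ^ (J + 1) / (J + 1).factorial) * (1 / (n : ℝ)) := by
          refine sum_le_sum fun n hn => ?_
          rw [mem_Icc] at hn
          simp only [hg, hn.2, if_true]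
          rw [log_mul_v, mul_assoc]
          have hn1 : (1 : ℝ) ≤ n := by exact_mod_cast hn.1
          have hl : Real.log n ≤ Real.log y := Real.log_le_log (by linarith) (by exact_mod_cast hn.2)
          have := v_le_log L hL (J + 1) n
          have h0 := Real.log_nonneg hn1
          refine mul_le_mul_of_nonneg_left (this.trans ?_) (by positivity)
          gcongr
      _ ≤ _ := by
          rw [← mul_sum]
          have : 0 ≤ Real.log y := Real.log_natCast_nonneg _
          exact mul_le_mul_of_nonneg_left (sum_inv_Icc y) (by positivity)

lemma th_le {r : ℕ} (χ : DirichletCharacter ℂ r) (L : ℝ) (hL : 0 < L) (J T y : ℕ) (hy : T ^ 3 ≤ y) :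
    ((J : ℝ) + 1) * ‖th χ L (J + 1) y‖ ≤ ‖S L J (fun n => if y < n then csL χ n else 0)‖ +
      (J + 1) * L ^ (J + 1) * (4 / (T + 1)) := by
  have h1 : ((J : ℂ) + 1) * th χ L (J + 1) y = S L J (fun n => if y < n then csL χ n else 0) -
      S L J (fun n => if y < n ∧ ¬ n.Prime then cs χ n * ((Λ n : ℝ) : ℂ) else 0) := by
    rw [← S_sub L hL J ((tame_csL χ).mono fun n => by split_ifs <;> simp)
      ((tame_csL χ).mono fun n => by split_ifs <;> simp [csL] <;> positivity)]
    unfold th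
    rw [← S_log]
    unfold S
    congr 1; funext n; congr 1
    by_cases hn : y < n
    · by_cases hp : n.Prime
      · simp [hn, hp, csL, ArithmeticFunction.vonMangoldt_apply_prime hp]
      · simp [hn, hp, csL]
    · simp [hn]
  have h2 : ((J : ℝ) + 1) * ‖th χ L (J + 1) y‖ = ‖((J : ℂ) + 1) * th χ L (J + 1) y‖ := by
    rw [norm_mul]; congr 1
    rw [← Nat.cast_succ, ← Nat.cast_succ, Complex.norm_natCast]
  rw [h2, h1]
  exact (norm_sub_le _ _).trans (add_le_add le_rfl (ppow_tail L hL J T y hy _ (cs_norm_le χ)))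

lemma split_y {r : ℕ} (χ : DirichletCharacter ℂ r) (L : ℝ) (hL : 0 < L) (J y : ℕ) :
    ‖S L J (fun n => if y < n then csL χ n else 0)‖ ≤ ‖S L J (csL χ)‖ +
      (J + 1) * (Real.log y ^ (J + 1) / (J + 1).factorial) * (1 + Real.log y) := by
  have h1 : S L J (fun n => if y < n then csL χ n else 0) = S L J (csL χ) -
      S L J (fun n => if n ≤ y then cs χ n * ((Λ n : ℝ) : ℂ) else 0) := by
    rw [← S_sub L hL J (tame_csL χ) ((tame_csL χ).mono fun n => by split_ifs <;> simp [csL] <;> positivity)]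
    congr 1; funext n
    by_cases hn : y < n
    · simp [hn, not_le.mpr hn, csL]
    · simp [hn, not_lt.mp hn, csL]
  rw [h1]
  exact (norm_sub_le _ _).trans (add_le_add le_rfl (small_part L hL J y _ (cs_norm_le χ)))

lemma pow_fact (x : ℝ) (hx : 0 ≤ x) (j : ℕ) (hj : 0 < j) : x ^ j / j.factorial ≤ (x / j) ^ j * Real.exp j := by
  have hj' : (0 : ℝ) < j := by exact_mod_cast hj
  have := Real.pow_div_factorial_le_exp (x := (j : ℝ)) hj'.le j
  calc x ^ j / j.factorial = (x / j) ^ j * ((j : ℝ) ^ j / j.factorial) := by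
        rw [div_pow]; field_simp
    _ ≤ _ := by gcongr

open Classical in
/-- primitive nonprincipal characters of modulus `r` -/
noncomputable def prs (r : ℕ) : Finset (DirichletCharacter ℂ r) :=
  (Set.toFinite {χ : DirichletCharacter ℂ r | χ.IsPrimitive ∧ χ ≠ 1}).toFinset

lemma mem_prs {r : ℕ} (χ : DirichletCharacter ℂ r) : χ ∈ prs r ↔ χ.IsPrimitive ∧ χ ≠ 1 := by
  simp [prs]

lemma prs_card (r : ℕ) (hr : 0 < r) : (prs r).card ≤ r.totient := by
  have : NeZero r := ⟨hr.ne'⟩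
  have h := DirichletCharacter.card_eq_totient_of_hasEnoughRootsOfUnity ℂ r
  rw [← h, Nat.card_eq_fintype_card]
  exact Finset.card_le_univ _

/-- all primitive nonprincipal characters with conductor in `(a, b]` -/
noncomputable def fam (a b : ℕ) : Finset Chr := (Ioc a b).sigma prs

lemma mem_fam (a b : ℕ) (x : Chr) : x ∈ fam a b ↔ (a < x.1 ∧ x.1 ≤ b) ∧ x.2.IsPrimitive ∧ x.2 ≠ 1 := by
  simp [fam, mem_prs]

lemma fam_sum (a b : ℕ) (f : ℕ → ℝ) (hf : ∀ r, 0 ≤ f r) :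
    ∑ x ∈ fam a b, f x.1 ≤ ∑ r ∈ Ioc a b, r.totient * f r := by
  unfold fam
  rw [sum_sigma]
  refine sum_le_sum fun r hr => ?_
  simp only [sum_const, nsmul_eq_mul]
  have : (((prs r).card : ℕ) : ℝ) ≤ r.totient := by exact_mod_cast prs_card r (by simp at hr; omega)
  exact mul_le_mul_of_nonneg_right this (hf r)

lemma fam_Fam (a b : ℕ) : Fam (fam a b) b where
  pos := fun x hx => by have := (mem_fam a b x).mp hx; omega
  le := fun x hx => ((mem_fam a b x).mp hx).1.2
  prim := fun x hx => ((mem_fam a b x).mp hx).2.1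
  ne := fun x hx => ((mem_fam a b x).mp hx).2.2
  card := by
    have := fam_sum a b (fun _ => 1) (fun _ => zero_le_one)
    simp only [sum_const, nsmul_eq_mul, mul_one] at this
    refine this.trans ?_
    calc ∑ r ∈ Ioc a b, (r.totient : ℝ) ≤ ∑ r ∈ Ioc a b, (b : ℝ) := by
          refine sum_le_sum fun r hr => ?_
          exact_mod_cast (Nat.totient_le r).trans (mem_Ioc.mp hr).2
      _ ≤ _ := by
          rw [sum_const, nsmul_eq_mul, Nat.card_Ioc, sq]
          gcongr
          exact_mod_cast Nat.sub_le _ _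

end BG

namespace BG
set_option maxHeartbeats 400000
open Finset Filter Topology
open scoped ArithmeticFunction.vonMangoldt ArithmeticFunction.Moebius ArithmeticFunction.zeta

/-- parameters; `j = J + 1`, `y = z^60`, `U = z^20`, `Q = z^3` -/
structure Par (C1 K : ℕ) (L : ℝ) (J z : ℕ) : Prop where
  hL : 1000 ≤ L
  hV : ∀ i, ∑' n, v L i n ≤ 2 * L ^ (i + 1)
  hV2 : ∑' n, v (2 * L) 0 n ≤ 2 * (2 * L) ^ (0 + 1)
  jL : (J : ℝ) + 2 ≤ L
  e4 : Real.exp (-(4 * (J + 1))) ≤ 1 / L ^ (40 * C1)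
  two : (2 : ℝ) ^ J ≤ L ^ (7 * C1)
  lz : Real.log z ≤ (J + 1) * L / 10000
  lz' : (J + 1) * L / 20000 ≤ Real.log z
  zL : L ^ (40 * C1 + 10) ≤ z
  ly : 1 + 60 * Real.log z ≤ L ^ 2
  T : (1000 * (1 + 20 * C1 * Real.log L) ^ 2 / L ^ (-(4 / 5) : ℝ)) ^ (J + 1) ≤ L ^ (J + 1) / L ^ (40 * C1)
  cK : ((2 * K : ℕ) : ℝ) ^ ((2 * K) ^ 2) ≤ L
  K1 : 1 ≤ K
  C1 : K ^ 2 + 20 ≤ C1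

variable {C1 K J z : ℕ} {L : ℝ}

lemma Par.z2 (h : Par C1 K L J z) : 2 ≤ z := by
  have h1 := h.zL
  have h2 : (2 : ℝ) ≤ L ^ (40 * C1 + 10) := by
    have := h.hL
    calc (2 : ℝ) ≤ L ^ 1 := by linarith
      _ ≤ _ := pow_le_pow_right₀ (by linarith) (by omega)
  exact_mod_cast h2.trans h1

lemma Par.LY (_ : Par C1 K L J z) : Real.log ((z ^ 60 : ℕ) : ℝ) = 60 * Real.log z := by
  push_cast; rw [Real.log_pow]; norm_num

lemma Par.LU (_ : Par C1 K L J z) : Real.log ((z ^ 20 : ℕ) : ℝ) = 20 * Real.log z := by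
  push_cast; rw [Real.log_pow]; norm_num

lemma Par.lpos (h : Par C1 K L J z) : (J : ℝ) + 1 ≤ 20 * Real.log z := by
  have h1 := h.lz'
  have h2 := h.hL
  have : ((J : ℝ) + 1) * 1000 ≤ (J + 1) * L := by gcongr
  linarith

lemma Par.PY (h : Par C1 K L J z) : (60 * Real.log z) ^ (J + 1) / (J + 1).factorial ≤ L ^ (J + 1) / L ^ (40 * C1) := by
  have hL := h.hL
  have hlp := h.lpos
  have hx : 0 ≤ 60 * Real.log z := by have : (0 : ℝ) ≤ J := by positivity
                                      linarith
  refine (pow_fact _ hx (J + 1) (by omega)).trans ?_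
  have h1 : 60 * Real.log z / ((J + 1 : ℕ) : ℝ) ≤ L * Real.exp (-5) := by
    rw [div_le_iff₀ (by positivity)]
    have h2 := h.lz
    have h3 : (60 : ℝ) / 10000 ≤ Real.exp (-5) := by
      rw [Real.exp_neg, le_inv_comm₀ (by norm_num) (Real.exp_pos _)]
      have : Real.exp 5 = Real.exp 1 ^ 5 := by rw [← Real.exp_nat_mul]; norm_num
      rw [this]
      calc Real.exp 1 ^ 5 ≤ 2.7182818286 ^ 5 := by gcongr; exact Real.exp_one_lt_d9.le
        _ ≤ _ := by norm_num
    calc 60 * Real.log z ≤ L * (60 / 10000) * (J + 1) := by linarith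
      _ ≤ L * Real.exp (-5) * (J + 1) := by gcongr
      _ = _ := by push_cast; ring
  calc _ ≤ (L * Real.exp (-5)) ^ (J + 1) * Real.exp ((J + 1 : ℕ) : ℝ) := by
        gcongr
    _ = L ^ (J + 1) * Real.exp (-(4 * (J + 1))) := by
        rw [mul_pow, ← Real.exp_nat_mul, mul_assoc, ← Real.exp_add]; push_cast; ring_nf
    _ ≤ L ^ (J + 1) * (1 / L ^ (40 * C1)) := by gcongr; exact h.e4
    _ = _ := by ring

lemma Par.PJ (h : Par C1 K L J z) : (60 * Real.log z) ^ J / J.factorial ≤ L ^ (J + 1) / L ^ (40 * C1) := by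
  refine le_trans ?_ h.PY
  have hlp := h.lpos
  have h0 : (0 : ℝ) ≤ J := by positivity
  have hx : ((J + 1 : ℕ) : ℝ) ≤ 60 * Real.log z := by push_cast; linarith
  have hx0 : 0 < 60 * Real.log z := by linarith
  rw [Nat.factorial_succ, pow_succ]
  push_cast at hx ⊢
  rw [div_le_div_iff₀ (by positivity) (by positivity)]
  have : 0 < (60 * Real.log z) ^ J * (J.factorial : ℝ) := by positivity
  nlinarith

lemma pdiv (hL : 1 ≤ L) (a b c : ℕ) (h : a + c ≤ b) (X : ℝ) (hX : 0 ≤ X) : X * L ^ a / L ^ b ≤ X / L ^ c := by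
  have hLp : 0 < L := by linarith
  rw [div_le_div_iff₀ (by positivity) (by positivity)]
  calc X * L ^ a * L ^ c = X * L ^ (a + c) := by ring
    _ ≤ _ := by gcongr

/-- weight -/
noncomputable def wt (K r : ℕ) : ℝ := (K : ℝ) ^ om r / r.totient

lemma wt_nonneg (K r : ℕ) : 0 ≤ wt K r := by unfold wt; positivity

lemma wt_le (K : ℕ) (hK : 1 ≤ K) (r : ℕ) (hr : 0 < r) :
    wt K r ≤ ((2 * K : ℕ) : ℝ) ^ ((2 * K) ^ 2) / Real.sqrt r := by
  have hr' : (0 : ℝ) < r := by exact_mod_cast hr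
  refine (om_totient K r hr).trans ?_
  have := om_sqrt (2 * K) (by omega) r hr
  rw [div_le_div_iff₀ hr' (Real.sqrt_pos.mpr hr')]
  calc _ ≤ ((2 * K : ℕ) : ℝ) ^ ((2 * K) ^ 2) * Real.sqrt r * Real.sqrt r := by gcongr
    _ = _ := by rw [mul_assoc, Real.mul_self_sqrt hr'.le]

lemma Par.ppow (h : Par C1 K L J z) : (J + 1) * L ^ (J + 1) * (4 / (((z ^ 20 : ℕ) : ℝ) + 1)) ≤ 4 * (L ^ (J + 1) / L ^ (40 * C1)) := by
  have hL := h.hL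
  have h1 := h.jL
  have hz : L ^ (40 * C1 + 1) ≤ ((z ^ 20 : ℕ) : ℝ) + 1 := by
    have := h.z2
    calc L ^ (40 * C1 + 1) ≤ L ^ (40 * C1 + 10) := pow_le_pow_right₀ (by linarith) (by omega)
      _ ≤ z := h.zL
      _ ≤ ((z ^ 20 : ℕ) : ℝ) := by exact_mod_cast Nat.le_self_pow (by norm_num) z
      _ ≤ _ := by linarith
  calc _ ≤ L * L ^ (J + 1) * (4 / L ^ (40 * C1 + 1)) := by gcongr; linarith
    _ = _ := by rw [pow_succ L (40 * C1)]; field_simp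

/-- small conductors -/
lemma Par.small (h : Par C1 K L J z) (hg : GoodScale ((20 * C1 : ℕ) : ℝ) L) {r : ℕ} (hr : 0 < r)
    (hr2 : (r : ℝ) ≤ L ^ (20 * C1)) (χ : DirichletCharacter ℂ r) (hp : χ.IsPrimitive) (h1 : χ ≠ 1) :
    (J + 1) * ‖th χ L (J + 1) (z ^ 60)‖ ≤ L ^ (J + 1) * L ^ 4 / L ^ (40 * C1) := by
  have hL := h.hL
  have hLp : 0 < L := by linarith
  have hlog : 0 ≤ Real.log L := Real.log_nonneg (by linarith)
  refine (th_le χ L hLp J (z ^ 20) (z ^ 60) (by rw [← pow_mul])).trans ?_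
  have a1 := split_y χ L hLp J (z ^ 60)
  rw [h.LY] at a1
  have hδ : L ^ (-(4 / 5) : ℝ) ≤ 1 := Real.rpow_le_one_of_one_le_of_nonpos (by linarith) (by norm_num)
  have a2 := b_bound hr χ h1 L (1 + 20 * C1 * Real.log L) (L ^ (-(4 / 5) : ℝ)) hLp
    (by have : 0 ≤ 20 * C1 * Real.log L := by positivity
        linarith)
    (by
      refine hr2.trans ?_
      rw [← Real.exp_log (show 0 < L ^ (20 * C1) by positivity), Real.log_pow]
      apply Real.exp_le_exp.mpr
      push_cast; linarith) (by positivity) hδ (hg r hr (by rw [Real.rpow_natCast]; exact hr2) χ hp h1) J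
  have a3 := h.PY
  have a4 := h.ly
  have a5 := h.jL
  have a6 := h.T
  have a7 := h.ppow
  have hlz : 0 ≤ Real.log z := Real.log_natCast_nonneg z
  set D := L ^ (J + 1) / L ^ (40 * C1) with hD
  have hD0 : 0 < D := by positivity
  have a8 : (J + 1) * ((60 * Real.log z) ^ (J + 1) / (J + 1).factorial) * (1 + 60 * Real.log z) ≤ L * D * L ^ 2 := by
    gcongr; linarith
  have : L ^ (J + 1) * L ^ 4 / L ^ (40 * C1) = D * L ^ 4 := by rw [hD]; ring
  rw [this]
  have h5 : D * 1 + L * D * L ^ 2 + 4 * D ≤ D * L ^ 4 := by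
    have : (1 : ℝ) + L ^ 3 + 4 ≤ L ^ 4 := by
      have : 1 ≤ L ^ 3 := one_le_pow₀ (by linarith)
      nlinarith
    nlinarith
  linarith

lemma Par.small_sum (h : Par C1 K L J z) (hg : GoodScale ((20 * C1 : ℕ) : ℝ) L) :
    ∑ x ∈ fam 0 ⌊L ^ (20 * C1)⌋₊, wt K x.1 * ((J + 1) * ‖th x.2 L (J + 1) (z ^ 60)‖) ≤ L ^ (J + 1) / L ^ C1 := by
  have hL := h.hL
  have hL1 : 1 ≤ L := by linarith
  have hLp : 0 < L := by linarith
  have hfl : (⌊L ^ (20 * C1)⌋₊ : ℝ) ≤ L ^ (20 * C1) := Nat.floor_le (by positivity)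
  have h1 : ∀ x ∈ fam 0 ⌊L ^ (20 * C1)⌋₊, wt K x.1 * ((J + 1) * ‖th x.2 L (J + 1) (z ^ 60)‖) ≤
      wt K x.1 * (L ^ (J + 1) * L ^ 4 / L ^ (40 * C1)) := by
    intro x hx
    obtain ⟨⟨hx1, hx2⟩, hx3, hx4⟩ := (mem_fam _ _ x).mp hx
    exact mul_le_mul_of_nonneg_left (h.small hg hx1 (le_trans (by exact_mod_cast hx2) hfl) x.2 hx3 hx4) (wt_nonneg _ _)
  refine (sum_le_sum h1).trans ?_
  rw [← sum_mul]
  have h2 : ∑ x ∈ fam 0 ⌊L ^ (20 * C1)⌋₊, wt K x.1 ≤ L ^ (30 * C1 + 1) := by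
    refine (fam_sum _ _ (wt K) (wt_nonneg K)).trans ?_
    have h3 : ∀ r ∈ Ioc 0 ⌊L ^ (20 * C1)⌋₊, (r.totient : ℝ) * wt K r ≤ L * L ^ (10 * C1) := by
      intro r hr
      rw [mem_Ioc] at hr
      have ht : (0 : ℝ) < r.totient := by exact_mod_cast Nat.totient_pos.mpr hr.1
      have e : (r.totient : ℝ) * wt K r = (K : ℝ) ^ om r := by unfold wt; field_simp
      rw [e]
      have hr0 : (r : ℝ) ≤ L ^ (20 * C1) := le_trans (by exact_mod_cast hr.2) hfl
      have hs : Real.sqrt r ≤ L ^ (10 * C1) := by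
        rw [Real.sqrt_le_left (by positivity)]
        calc (r : ℝ) ≤ _ := hr0
          _ = _ := by rw [← pow_mul]; congr 1; ring
      calc (K : ℝ) ^ om r ≤ ((2 * K : ℕ) : ℝ) ^ om r := by gcongr; omega
        _ ≤ ((2 * K : ℕ) : ℝ) ^ ((2 * K) ^ 2) * Real.sqrt r := om_sqrt _ (by have := h.K1; omega) r hr.1
        _ ≤ _ := by gcongr; exact h.cK
    refine (sum_le_card_nsmul _ _ _ h3).trans ?_
    rw [nsmul_eq_mul, Nat.card_Ioc, Nat.sub_zero]
    calc _ ≤ L ^ (20 * C1) * (L * L ^ (10 * C1)) := by gcongr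
      _ = _ := by ring
  calc _ ≤ L ^ (30 * C1 + 1) * (L ^ (J + 1) * L ^ 4 / L ^ (40 * C1)) := by gcongr
    _ = L ^ (J + 1) * L ^ (30 * C1 + 5) / L ^ (40 * C1) := by ring
    _ ≤ _ := pdiv hL1 _ _ _ (by have := h.C1; omega) _ (by positivity)

lemma Par.large_sum (h : Par C1 K L J z) :
    ∑ x ∈ fam ⌊L ^ (20 * C1)⌋₊ (z ^ 3), wt K x.1 * ((J + 1) * ‖th x.2 L (J + 1) (z ^ 60)‖) ≤ 4 * (L ^ (J + 1) / L ^ C1) := by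
  have hL := h.hL
  have hL1 : 1 ≤ L := by linarith
  have hLp : 0 < L := by linarith
  have hz2 := h.z2
  have hz1 : (1 : ℝ) ≤ z := by exact_mod_cast (by omega : 1 ≤ z)
  have hlz : 0 ≤ Real.log z := Real.log_natCast_nonneg z
  have hC1 := h.C1
  have hjL := h.jL
  have hly := h.ly
  have hF := fam_Fam ⌊L ^ (20 * C1)⌋₊ (z ^ 3)
  set X := fam ⌊L ^ (20 * C1)⌋₊ (z ^ 3) with hX
  have hU : 2 * ((z ^ 3 : ℕ) : ℝ) ^ 4 ≤ ((z ^ 20 : ℕ) : ℝ) := by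
    have : 2 * (z ^ 3) ^ 4 ≤ z ^ 20 := by
      calc 2 * (z ^ 3) ^ 4 ≤ z * (z ^ 3) ^ 4 := Nat.mul_le_mul_right _ hz2
        _ = z ^ 13 := by ring
        _ ≤ z ^ 20 := Nat.pow_le_pow_right (by omega) (by norm_num)
    exact_mod_cast this
  have hJ0 : (J : ℝ) ≤ Real.log ((z ^ 20 : ℕ) : ℝ) := by rw [h.LU]; linarith [h.lpos]
  have hpos20 : 0 < z ^ 20 := by positivity
  have hJ1 : (J : ℝ) ≤ Real.log ((z ^ 20 + 1 : ℕ) : ℝ) :=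
    hJ0.trans (Real.log_le_log (by exact_mod_cast hpos20) (by push_cast; linarith))
  have hy : ((J + 1 : ℕ) : ℝ) ≤ Real.log ((z ^ 60 + 1 : ℕ) : ℝ) := by
    refine le_trans ?_ (Real.log_le_log (x := ((z ^ 60 : ℕ) : ℝ)) (by positivity) (by push_cast; linarith))
    rw [h.LY]; push_cast; linarith [h.lpos]
  -- weights
  have hw : ∀ x ∈ X, wt K x.1 ≤ L / L ^ (10 * C1) := by
    intro x hx
    obtain ⟨⟨hx1, hx2⟩, hx3, hx4⟩ := (mem_fam _ _ x).mp hx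
    have hx0 : L ^ (20 * C1) < x.1 := (Nat.floor_lt (by positivity)).mp hx1
    refine (wt_le K h.K1 x.1 (by omega)).trans ?_
    have : L ^ (10 * C1) ≤ Real.sqrt x.1 := by
      apply Real.le_sqrt_of_sq_le
      rw [← pow_mul, show 10 * C1 * 2 = 20 * C1 by ring]; exact hx0.le
    exact div_le_div₀ hLp.le h.cK (by positivity) this
  have hw1 : ∀ x ∈ X, wt K x.1 ≤ L := fun x hx => (hw x hx).trans
    (div_le_self hLp.le (one_le_pow₀ hL1))
  set E := L ^ (J + 1) / L ^ C1 with hE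
  have hE0 : 0 < E := by positivity
  -- pieces
  set a : Chr → ℝ := fun x => ‖S L J (fun n => cs x.2 n * ((cc (z ^ 20) n : ℝ) : ℂ))‖ with ha
  set b : Chr → ℝ := fun x => ‖S L J (fun n => if n ≤ z ^ 60 then cs x.2 n * ((cc (z ^ 20) n : ℝ) : ℂ) else 0)‖ with hb
  set I : ℝ := 4 * (L ^ (J + 1) * L ^ 4) / z ^ 17 with hI
  have hpt : ∀ x ∈ X, (J + 1) * ‖th x.2 L (J + 1) (z ^ 60)‖ ≤ I + a x + b x := by
    intro x hx
    have hx1 := hF.pos x hx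
    have hxQ : (x.1 : ℝ) ≤ (z : ℝ) ^ 3 := by exact_mod_cast hF.le x hx
    have t1 := th_le x.2 L hLp J (z ^ 20) (z ^ 60) (by rw [← pow_mul])
    have t2 := lambda_split hx1 x.2 (hF.ne x hx) L hLp J (z ^ 60) (z ^ 20) hpos20
      (by rw [← pow_mul]; exact Nat.pow_le_pow_right (by omega) (by norm_num)) hy
    have t3 : ((z ^ 20 : ℕ) : ℝ) ^ 2 * (2 * x.1) / (((z ^ 60 : ℕ) : ℝ) + 1) *
        ((J + 1) * L ^ (J + 1) + 2 * Real.log (((z ^ 20 : ℕ) : ℝ) ^ 2) * L ^ J) ≤ 2 * (L ^ (J + 1) * L ^ 4) / z ^ 17 := by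
      rw [Real.log_pow, h.LU]
      have e1 : (J + 1) * L ^ (J + 1) + 2 * ((2 : ℕ) * (20 * Real.log z)) * L ^ J ≤ L ^ (J + 1) * L ^ 4 := by
        have : 2 * ((2 : ℕ) * (20 * Real.log z)) ≤ 2 * L ^ 2 := by push_cast; linarith
        calc _ ≤ L * L ^ (J + 1) + 2 * L ^ 2 * L ^ J := by gcongr; linarith
          _ = L ^ (J + 1) * (3 * L) := by ring
          _ ≤ L ^ (J + 1) * L ^ 4 := by
              gcongr
              calc 3 * L ≤ L * L := by gcongr; linarith
                _ = L ^ 2 := by ring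
                _ ≤ L ^ 4 := pow_le_pow_right₀ hL1 (by norm_num)
      have e2 : ((z ^ 20 : ℕ) : ℝ) ^ 2 * (2 * x.1) / (((z ^ 60 : ℕ) : ℝ) + 1) ≤ 2 / z ^ 17 := by
        push_cast
        rw [div_le_div_iff₀ (by positivity) (by positivity)]
        calc ((z : ℝ) ^ 20) ^ 2 * (2 * x.1) * (z : ℝ) ^ 17 ≤ ((z : ℝ) ^ 20) ^ 2 * (2 * (z : ℝ) ^ 3) * (z : ℝ) ^ 17 := by gcongr
          _ = 2 * (z : ℝ) ^ 60 := by ring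
          _ ≤ 2 * ((z : ℝ) ^ 60 + 1) := by linarith
      calc _ ≤ 2 / (z : ℝ) ^ 17 * (L ^ (J + 1) * L ^ 4) :=
            mul_le_mul e2 e1 (by positivity) (by positivity)
        _ = _ := by ring
    have t4 : (J + 1) * L ^ (J + 1) * (4 / (((z ^ 20 : ℕ) : ℝ) + 1)) ≤ 2 * (L ^ (J + 1) * L ^ 4) / z ^ 17 := by
      have : 4 / (((z ^ 20 : ℕ) : ℝ) + 1) ≤ 4 / z ^ 17 := by
        gcongr
        push_cast
        have : (z : ℝ) ^ 17 ≤ z ^ 20 := pow_le_pow_right₀ hz1 (by norm_num)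
        linarith
      calc _ ≤ L * L ^ (J + 1) * (4 / z ^ 17) := by gcongr; linarith
        _ = L ^ (J + 1) * (4 * L) / z ^ 17 := by ring
        _ ≤ L ^ (J + 1) * (2 * L ^ 4) / z ^ 17 := by
            have : 4 * L ≤ 2 * L ^ 4 := by
              calc 4 * L ≤ 2 * (L * L) := by nlinarith
                _ = 2 * L ^ 2 := by ring
                _ ≤ 2 * L ^ 4 := by gcongr <;> norm_num
            exact div_le_div_of_nonneg_right (mul_le_mul_of_nonneg_left this (by positivity)) (by positivity)
        _ = _ := by ring
    have : I = 2 * (L ^ (J + 1) * L ^ 4) / z ^ 17 + 2 * (L ^ (J + 1) * L ^ 4) / z ^ 17 := by rw [hI]; ring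
    rw [this]
    linarith
  have s1 : ∑ x ∈ X, wt K x.1 * I ≤ E := by
    have : ∑ x ∈ X, wt K x.1 * I ≤ ∑ x ∈ X, L * I :=
      sum_le_sum fun x hx => mul_le_mul_of_nonneg_right (hw1 x hx) (by positivity)
    refine this.trans ?_
    rw [sum_const, nsmul_eq_mul]
    have hc : (X.card : ℝ) ≤ z ^ 6 := hF.card.trans (by push_cast; rw [← pow_mul])
    have hz17 : (z : ℝ) ^ 6 * L ^ (C1 + 6) ≤ z ^ 17 := by
      calc (z : ℝ) ^ 6 * L ^ (C1 + 6) ≤ (z : ℝ) ^ 6 * L ^ (40 * C1 + 10) := by gcongr <;> omega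
        _ ≤ (z : ℝ) ^ 6 * z := by gcongr; exact h.zL
        _ = (z : ℝ) ^ 7 := by ring
        _ ≤ _ := pow_le_pow_right₀ hz1 (by norm_num)
    calc (X.card : ℝ) * (L * I) ≤ (z : ℝ) ^ 6 * (L * I) := by gcongr
      _ = L ^ (J + 1) * (4 * L ^ 5 * (z : ℝ) ^ 6) / (z : ℝ) ^ 17 := by rw [hI]; ring
      _ ≤ L ^ (J + 1) * (L * L ^ 5 * (z : ℝ) ^ 6) / (z : ℝ) ^ 17 := by
          gcongr
          linarith
      _ ≤ E := by
          rw [hE, div_le_div_iff₀ (by positivity) (by positivity)]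
          calc _ = L ^ (J + 1) * ((z : ℝ) ^ 6 * L ^ (C1 + 6)) := by ring
            _ ≤ _ := by gcongr
  have s2 : ∑ x ∈ X, wt K x.1 * a x ≤ E := by
    have : ∑ x ∈ X, wt K x.1 * a x ≤ ∑ x ∈ X, L / L ^ (10 * C1) * a x :=
      sum_le_sum fun x hx => mul_le_mul_of_nonneg_right (hw x hx) (norm_nonneg _)
    refine this.trans ?_
    rw [← mul_sum]
    have t := typeII_full hF L hL1 h.hV h.hV2 J (z ^ 20) hU hJ1
    calc _ ≤ L / L ^ (10 * C1) * ((J + 1) * (68 * 2 ^ J * (J + 2) * L ^ (J + 5))) := by gcongr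
      _ ≤ L / L ^ (10 * C1) * (L * (L * L ^ (7 * C1) * L * L ^ (J + 5))) := by
          gcongr
          · linarith
          · linarith
          · exact h.two
      _ = L ^ (J + 1) * L ^ (7 * C1 + 8) / L ^ (10 * C1) := by ring
      _ ≤ E := pdiv hL1 _ _ _ (by omega) _ (by positivity)
  have s3 : ∑ x ∈ X, wt K x.1 * b x ≤ E := by
    have t := typeII_cut hF L hL1 J (z ^ 20) (z ^ 60) hpos20 hU hJ0
      (by rw [← pow_mul]; exact Nat.pow_lt_pow_right (by omega) (by norm_num))
    rw [h.LY] at t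
    refine (sq_le_sq₀ (sum_nonneg fun x _ => mul_nonneg (wt_nonneg _ _) (norm_nonneg _)) hE0.le).mp ?_
    refine (sum_mul_sq_le_sq_mul_sq X _ b).trans ?_
    have hw2 : ∑ x ∈ X, wt K x.1 ^ 2 ≤ L ^ (4 * K ^ 2) := by
      refine (fam_sum _ _ (fun r => wt K r ^ 2) (fun r => sq_nonneg _)).trans ?_
      calc _ ≤ ∑ r ∈ Icc 1 (z ^ 3), ((K ^ 2 : ℕ) : ℝ) ^ om r / r.totient := by
            refine (sum_le_sum fun r hr => ?_).trans (sum_le_sum_of_subset_of_nonneg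
              (fun r hr => ?_) fun r _ _ => by positivity)
            · rw [mem_Ioc] at hr
              have ht : (0 : ℝ) < r.totient := by exact_mod_cast Nat.totient_pos.mpr (by omega)
              unfold wt
              apply le_of_eq
              push_cast
              rw [div_pow, ← pow_mul, ← pow_mul]
              field_simp
              rw [mul_comm]
            · rw [mem_Ioc] at hr; rw [mem_Icc]; omega
        _ ≤ (1 + Real.log ((z ^ 3 : ℕ) : ℝ)) ^ (2 * K ^ 2) := om_totient_sum _ _
        _ ≤ (L ^ 2) ^ (2 * K ^ 2) := by
            have e : Real.log ((z ^ 3 : ℕ) : ℝ) = 3 * Real.log z := by push_cast; rw [Real.log_pow]; norm_num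
            rw [e]
            gcongr
            linarith
        _ = _ := by rw [← pow_mul]; congr 1; ring
    have hP := h.PJ
    calc _ ≤ L ^ (4 * K ^ 2) * (2 * ((60 * Real.log z) ^ J / J.factorial) ^ 2 * (1 + 60 * Real.log z) ^ 7) :=
          mul_le_mul hw2 t (sum_nonneg fun _ _ => sq_nonneg _) (by positivity)
      _ ≤ L ^ (4 * K ^ 2) * (L ^ 2 * (L ^ (J + 1) / L ^ (40 * C1)) ^ 2 * (L ^ 2) ^ 7) := by
          gcongr
          nlinarith
      _ = (L ^ (J + 1) * L ^ (2 * K ^ 2 + 8) / L ^ (40 * C1)) ^ 2 := by ring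
      _ ≤ E ^ 2 := by
          gcongr
          exact pdiv hL1 _ _ _ (by omega) _ (by positivity)
  calc _ ≤ ∑ x ∈ X, wt K x.1 * (I + a x + b x) :=
        sum_le_sum fun x hx => mul_le_mul_of_nonneg_left (hpt x hx) (wt_nonneg _ _)
    _ = ∑ x ∈ X, wt K x.1 * I + ∑ x ∈ X, wt K x.1 * a x + ∑ x ∈ X, wt K x.1 * b x := by
        rw [← sum_add_distrib, ← sum_add_distrib]; exact sum_congr rfl fun x _ => by ring
    _ ≤ _ := by linarith

lemma Par.prim_sum (h : Par C1 K L J z) (hg : GoodScale ((20 * C1 : ℕ) : ℝ) L) :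
    ∑ x ∈ fam 0 (z ^ 3), wt K x.1 * ‖th x.2 L (J + 1) (z ^ 60)‖ ≤ 5 * (L ^ (J + 1) / L ^ C1) := by
  classical
  have hsub : fam 0 (z ^ 3) ⊆ fam 0 ⌊L ^ (20 * C1)⌋₊ ∪ fam ⌊L ^ (20 * C1)⌋₊ (z ^ 3) := by
    intro x hx
    rw [mem_union, mem_fam, mem_fam]
    rw [mem_fam] at hx
    rcases Nat.lt_or_ge ⌊L ^ (20 * C1)⌋₊ x.1 with h | h
    · exact Or.inr ⟨⟨h, hx.1.2⟩, hx.2⟩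
    · exact Or.inl ⟨⟨hx.1.1, h⟩, hx.2⟩
  set f : Chr → ℝ := fun x => wt K x.1 * ((J + 1) * ‖th x.2 L (J + 1) (z ^ 60)‖) with hf
  have hf0 : ∀ x, 0 ≤ f x := fun x => mul_nonneg (wt_nonneg _ _) (by positivity)
  calc _ ≤ ∑ x ∈ fam 0 (z ^ 3), f x := by
        refine sum_le_sum fun x _ => mul_le_mul_of_nonneg_left ?_ (wt_nonneg _ _)
        exact le_mul_of_one_le_left (norm_nonneg _) (by have : (0 : ℝ) ≤ J := by positivity
                                                        linarith)
    _ ≤ ∑ x ∈ fam 0 ⌊L ^ (20 * C1)⌋₊ ∪ fam ⌊L ^ (20 * C1)⌋₊ (z ^ 3), f x :=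
        sum_le_sum_of_subset_of_nonneg hsub fun x _ _ => hf0 x
    _ ≤ _ := by
        have e := sum_union_inter (s₁ := fam 0 ⌊L ^ (20 * C1)⌋₊) (s₂ := fam ⌊L ^ (20 * C1)⌋₊ (z ^ 3)) (f := f)
        have e2 : 0 ≤ ∑ x ∈ fam 0 ⌊L ^ (20 * C1)⌋₊ ∩ fam ⌊L ^ (20 * C1)⌋₊ (z ^ 3), f x :=
          sum_nonneg fun x _ => hf0 x
        have e3 := h.small_sum hg
        have e4 := h.large_sum
        linarith

end BG

namespace BG
set_option maxHeartbeats 400000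
open Finset Filter Topology
open scoped ArithmeticFunction.vonMangoldt ArithmeticFunction.Moebius ArithmeticFunction.zeta

/-- nonprincipal characters mod `q` -/
noncomputable def chs (q : ℕ) : Finset (DirichletCharacter ℂ q) :=
  (Set.toFinite {χ : DirichletCharacter ℂ q | χ ≠ 1}).toFinset

lemma mem_chs {q : ℕ} (χ : DirichletCharacter ℂ q) : χ ∈ chs q ↔ χ ≠ 1 := by simp [chs]

/-- bound for the error in progressions mod `q` -/
noncomputable def Eh (L : ℝ) (j y q : ℕ) : ℝ := (∑ χ ∈ chs q, ‖th χ L j y‖) / q.totient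

lemma Eh_nonneg (L : ℝ) (j y q : ℕ) : 0 ≤ Eh L j y q := by unfold Eh; positivity

/-- total prime mass -/
noncomputable def tm (L : ℝ) (j y : ℕ) : ℝ := ∑' n : ℕ, if n.Prime ∧ y < n then v L j n else 0

lemma th_prim {q : ℕ} (hq : 0 < q) (χ : DirichletCharacter ℂ q) (L : ℝ) (j y : ℕ) (hy : q ≤ y) :
    th χ L j y = th χ.primitiveCharacter L j y := by
  unfold th S
  congr 1; funext n
  by_cases h : n.Prime ∧ y < n
  · simp only [h, and_self, if_true]
    congr 1
    have hco : n.Coprime q := (Nat.coprime_primes_or n q h.1 hq (by omega))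
    conv_lhs => rw [← χ.changeLevel_primitiveCharacter]
    exact cs_changeLevel _ _ n hco
  · simp [h]
where
  Nat.coprime_primes_or (n q : ℕ) (hn : n.Prime) (hq : 0 < q) (h : q < n) : n.Coprime q :=
    (Nat.Prime.coprime_iff_not_dvd hn).mpr fun hd => absurd (Nat.le_of_dvd hq hd) (by omega)

lemma prime_coprime (n q : ℕ) (hn : n.Prime) (hq : 0 < q) (h : q < n) : n.Coprime q :=
    (Nat.Prime.coprime_iff_not_dvd hn).mpr fun hd => absurd (Nat.le_of_dvd hq hd) (by omega)

lemma wt_mul (K : ℕ) (hK : 1 ≤ K) (r m : ℕ) (hr : 0 < r) (hm : 0 < m) : wt K (r * m) ≤ wt K r * wt K m := by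
  unfold wt
  have h1 : om (r * m) ≤ om r + om m := by
    unfold om
    rw [Nat.primeFactors_mul hr.ne' hm.ne']
    exact card_union_le _ _
  have h2 : ((r.totient * m.totient : ℕ) : ℝ) ≤ (r * m).totient := by
    exact_mod_cast Nat.totient_super_multiplicative r m
  have hr' : (0 : ℝ) < r.totient := by exact_mod_cast Nat.totient_pos.mpr hr
  have hm' : (0 : ℝ) < m.totient := by exact_mod_cast Nat.totient_pos.mpr hm
  rw [div_mul_div_comm, ← pow_add]
  push_cast at h2
  have hK' : (1 : ℝ) ≤ K := by exact_mod_cast hK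
  gcongr

lemma ch_sum_le (q : ℕ) (hq : 0 < q) (L : ℝ) (j y : ℕ) (hy : q ≤ y) :
    ∑ χ ∈ chs q, ‖th χ L j y‖ ≤ ∑ x ∈ (fam 0 q).filter (fun x => x.1 ∣ q), ‖th x.2 L j y‖ := by
  classical
  have : NeZero q := ⟨hq.ne'⟩
  set f : DirichletCharacter ℂ q → Chr := fun χ => ⟨χ.conductor, χ.primitiveCharacter⟩ with hf
  set g : Chr → DirichletCharacter ℂ q := fun x => if h : x.1 ∣ q then DirichletCharacter.changeLevel h x.2 else 1 with hg
  have hgf : ∀ χ, g (f χ) = χ := by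
    intro χ
    simp only [hg, hf]
    rw [dif_pos χ.conductor_dvd_level]
    exact χ.changeLevel_primitiveCharacter
  have hinj : Function.Injective f := Function.LeftInverse.injective hgf
  calc _ = ∑ χ ∈ chs q, ‖th (f χ).2 L j y‖ := sum_congr rfl fun χ _ => by rw [th_prim hq χ L j y hy]
    _ = ∑ x ∈ (chs q).image f, ‖th x.2 L j y‖ := by rw [sum_image hinj.injOn]
    _ ≤ _ := by
      refine sum_le_sum_of_subset_of_nonneg (fun x hx => ?_) fun _ _ _ => norm_nonneg _
      obtain ⟨χ, hχ, rfl⟩ := mem_image.mp hx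
      rw [mem_filter, mem_fam]
      refine ⟨⟨⟨Nat.pos_of_ne_zero χ.conductor_ne_zero, Nat.le_of_dvd hq χ.conductor_dvd_level⟩,
        χ.primitiveCharacter_isPrimitive, fun h1 => (mem_chs χ).mp hχ ?_⟩, χ.conductor_dvd_level⟩
      rw [← χ.changeLevel_primitiveCharacter]
      change χ.primitiveCharacter = 1 at h1
      rw [h1]; exact map_one _

lemma bv_reduce (K : ℕ) (hK : 1 ≤ K) (L : ℝ) (j y Q : ℕ) (hy : Q ≤ y) :
    ∑ q ∈ Icc 1 Q, (K : ℝ) ^ om q * Eh L j y q ≤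
      (∑ x ∈ fam 0 Q, wt K x.1 * ‖th x.2 L j y‖) * ∑ m ∈ Icc 1 Q, wt K m := by
  classical
  calc _ ≤ ∑ q ∈ Icc 1 Q, ∑ x ∈ fam 0 Q, if x.1 ∣ q then wt K q * ‖th x.2 L j y‖ else 0 := by
        refine sum_le_sum fun q hq => ?_
        rw [mem_Icc] at hq
        have h1 := ch_sum_le q (by omega) L j y (by omega)
        have h2 : (fam 0 q).filter (fun x => x.1 ∣ q) ⊆ (fam 0 Q).filter (fun x => x.1 ∣ q) := by
          intro x hx
          rw [mem_filter, mem_fam] at hx ⊢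
          exact ⟨⟨⟨hx.1.1.1, by omega⟩, hx.1.2⟩, hx.2⟩
        calc (K : ℝ) ^ om q * Eh L j y q = wt K q * ∑ χ ∈ chs q, ‖th χ L j y‖ := by unfold Eh wt; ring
          _ ≤ wt K q * ∑ x ∈ (fam 0 Q).filter (fun x => x.1 ∣ q), ‖th x.2 L j y‖ :=
            mul_le_mul_of_nonneg_left (h1.trans (sum_le_sum_of_subset_of_nonneg h2 fun _ _ _ => norm_nonneg _))
              (wt_nonneg _ _)
          _ = _ := by rw [mul_sum, sum_filter]
    _ = ∑ x ∈ fam 0 Q, (∑ q ∈ (Icc 1 Q).filter (fun q => x.1 ∣ q), wt K q) * ‖th x.2 L j y‖ := by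
        rw [sum_comm]
        refine sum_congr rfl fun x _ => ?_
        rw [← sum_filter, sum_mul]
    _ ≤ _ := by
        rw [sum_mul]
        refine sum_le_sum fun x hx => ?_
        have hx0 : 0 < x.1 := ((mem_fam _ _ x).mp hx).1.1
        have : ∑ q ∈ (Icc 1 Q).filter (fun q => x.1 ∣ q), wt K q ≤ wt K x.1 * ∑ m ∈ Icc 1 Q, wt K m := by
          rw [mul_sum]
          have hsub : (Icc 1 Q).filter (fun q => x.1 ∣ q) ⊆ (Icc 1 Q).image (fun m => x.1 * m) := by
            intro q hq
            rw [mem_filter, mem_Icc] at hq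
            obtain ⟨⟨h1, h2⟩, m, rfl⟩ := hq
            refine mem_image.mpr ⟨m, mem_Icc.mpr ⟨Nat.pos_of_mul_pos_left h1, ?_⟩, rfl⟩
            exact le_trans (Nat.le_mul_of_pos_left m hx0) h2
          refine (sum_le_sum_of_subset_of_nonneg hsub fun _ _ _ => wt_nonneg _ _).trans ?_
          rw [sum_image (fun a _ b _ hab => Nat.eq_of_mul_eq_mul_left hx0 hab)]
          exact sum_le_sum fun m hm => wt_mul K hK x.1 m hx0 (mem_Icc.mp hm).1
        calc _ ≤ (wt K x.1 * ∑ m ∈ Icc 1 Q, wt K m) * ‖th x.2 L j y‖ :=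
              mul_le_mul_of_nonneg_right this (norm_nonneg _)
          _ = _ := by ring

lemma th_one {q : ℕ} (hq : 0 < q) (L : ℝ) (j y : ℕ) (hy : q ≤ y) :
    th (1 : DirichletCharacter ℂ q) L j y = ((tm L j y : ℝ) : ℂ) := by
  unfold th S tm
  rw [Complex.ofReal_tsum]
  congr 1; funext n
  by_cases h : n.Prime ∧ y < n
  · have hco := prime_coprime n q h.1 hq (by omega)
    have : cs (1 : DirichletCharacter ℂ q) n = 1 :=
      MulChar.one_apply ((ZMod.isUnit_iff_coprime n q).mpr hco)
    simp [h, this]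
  · simp [h]

lemma progression {q : ℕ} (hq : 0 < q) (a : ℕ) (ha : a.Coprime q) (L : ℝ) (hL : 0 < L) (j y : ℕ) (hy : q ≤ y) :
    |(∑' n : ℕ, if (n.Prime ∧ y < n) ∧ n ≡ a [MOD q] then v L j n else 0) - tm L j y / q.totient| ≤ Eh L j y q := by
  classical
  have : NeZero q := ⟨hq.ne'⟩
  have hu : IsUnit (a : ZMod q) := (ZMod.isUnit_iff_coprime a q).mpr ha
  have hphi : (0 : ℝ) < q.totient := by exact_mod_cast Nat.totient_pos.mpr hq
  set P : ℝ := ∑' n : ℕ, if (n.Prime ∧ y < n) ∧ n ≡ a [MOD q] then v L j n else 0 with hP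
  have hsum : ∀ χ : DirichletCharacter ℂ q, Summable fun n => (if n.Prime ∧ y < n then cs χ n else 0) * (v L j n : ℂ) :=
    fun χ => ((tame_cs χ).mono fun n => by split_ifs <;> simp).summable L hL j
  have key : ∑ χ : DirichletCharacter ℂ q, χ (a : ZMod q)⁻¹ * th χ L j y = ((q.totient * P : ℝ) : ℂ) := by
    unfold th S
    simp_rw [← tsum_mul_left]
    rw [← Summable.tsum_finsetSum (fun χ _ => (hsum χ).mul_left _)]
    rw [hP, ← tsum_mul_left, Complex.ofReal_tsum]
    congr 1; funext n
    by_cases h : n.Prime ∧ y < n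
    · simp only [h, and_self, if_true, true_and]
      have := DirichletCharacter.sum_char_inv_mul_char_eq ℂ hu (n : ZMod q)
      have e : ∑ χ : DirichletCharacter ℂ q, χ (a : ZMod q)⁻¹ * (cs χ n * (v L j n : ℂ)) =
          (∑ χ : DirichletCharacter ℂ q, χ (a : ZMod q)⁻¹ * χ (n : ZMod q)) * (v L j n : ℂ) := by
        rw [sum_mul]; exact sum_congr rfl fun χ _ => by unfold cs; ring
      rw [e, this]
      by_cases hm : n ≡ a [MOD q]
      · have : (a : ZMod q) = n := ((ZMod.natCast_eq_natCast_iff n a q).mpr hm).symm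
        simp [this, hm]
      · have : ¬ (a : ZMod q) = n := fun h => hm ((ZMod.natCast_eq_natCast_iff n a q).mp h.symm)
        simp [this, hm]
    · simp [h]
  have split : ∑ χ : DirichletCharacter ℂ q, χ (a : ZMod q)⁻¹ * th χ L j y =
      ((tm L j y : ℝ) : ℂ) + ∑ χ ∈ chs q, χ (a : ZMod q)⁻¹ * th χ L j y := by
    rw [← Finset.add_sum_erase _ _ (mem_univ (1 : DirichletCharacter ℂ q)), th_one hq L j y hy]
    congr 1
    · rw [MulChar.one_apply, one_mul]
      exact IsUnit.of_mul_eq_one _ (ZMod.inv_mul_of_unit _ hu)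
    · refine sum_congr ?_ fun _ _ => rfl
      ext χ; rw [mem_chs]; simp
  have e1 : P - tm L j y / q.totient = (q.totient * P - tm L j y) / q.totient := by field_simp
  have e2 : ((q.totient * P - tm L j y : ℝ) : ℂ) = ∑ χ ∈ chs q, χ (a : ZMod q)⁻¹ * th χ L j y := by
    have := key.symm.trans split
    rw [Complex.ofReal_sub, this]; ring
  rw [e1, abs_div, abs_of_pos hphi, Eh]
  gcongr
  rw [← Real.norm_eq_abs, ← Complex.norm_real, e2]
  refine (norm_sum_le _ _).trans (sum_le_sum fun χ _ => ?_)
  rw [norm_mul]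
  exact mul_le_of_le_one_left (norm_nonneg _) (DirichletCharacter.norm_le_one χ _)

/-- lower bound for prime mass -/
lemma tm_lower (C1 K : ℕ) : ∃ L0 : ℝ, ∀ L ≥ L0, ∀ J z, Par C1 K L J z →
    L ^ (J + 1) / (2 * (J + 1)) ≤ tm L (J + 1) (z ^ 60) := by
  obtain ⟨C, hC, ρ, hρ, hS⟩ := S_Lambda_asymp
  refine ⟨max (8 * C + 1) (1 / ρ + 1), fun L hLL J z h => ?_⟩
  have hL := h.hL
  have hLp : 0 < L := by linarith
  have hL1 : 1 ≤ L := by linarith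
  have a1 : 8 * C ≤ L := by have := (le_max_left _ _).trans hLL; linarith
  have a2 : 1 / ρ < L := by have := (le_max_right _ _).trans hLL; linarith
  have a3 : 1 / L < ρ := by rw [div_lt_iff₀ hLp]; rw [div_lt_iff₀ hρ] at a2; linarith
  have b1 := hS L hLp a3 J
  have b2 : C / ρ ^ J ≤ L ^ (J + 1) / 8 := by
    have : (1 / ρ) ^ J ≤ L ^ J := by gcongr
    calc C / ρ ^ J = C * (1 / ρ) ^ J := by rw [div_pow, one_pow]; ring
      _ ≤ L / 8 * L ^ J := by gcongr; linarith
      _ = _ := by ring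
  -- use the trivial character of modulus one
  set χ : DirichletCharacter ℂ 1 := 1
  have hcs : ∀ n, cs χ n = 1 := fun n => by
    have : IsUnit ((n : ℕ) : ZMod 1) := by
      rw [Subsingleton.elim ((n : ℕ) : ZMod 1) 1]; exact isUnit_one
    exact MulChar.one_apply this
  have hone : th χ L (J + 1) (z ^ 60) = ((tm L (J + 1) (z ^ 60) : ℝ) : ℂ) :=
    th_one one_pos L _ _ (Nat.one_le_pow _ _ (by have := h.z2; omega))
  have e1 : ((J : ℂ) + 1) * th χ L (J + 1) (z ^ 60) = S L J (csL χ) -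
      S L J (fun n => if n ≤ z ^ 60 then cs χ n * ((Λ n : ℝ) : ℂ) else 0) -
      S L J (fun n => if z ^ 60 < n ∧ ¬ n.Prime then cs χ n * ((Λ n : ℝ) : ℂ) else 0) := by
    have t1 : Tame (fun n => if n ≤ z ^ 60 then cs χ n * ((Λ n : ℝ) : ℂ) else 0) :=
      (tame_csL χ).mono fun n => by split_ifs <;> simp [csL]; positivity
    have t2 : Tame (fun n => if z ^ 60 < n ∧ ¬ n.Prime then cs χ n * ((Λ n : ℝ) : ℂ) else 0) :=
      (tame_csL χ).mono fun n => by split_ifs <;> simp [csL]; positivity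
    rw [← S_sub L hLp J (tame_csL χ) t1, ← S_sub L hLp J ((tame_csL χ).sub t1) t2]
    unfold th
    rw [← S_log]
    unfold S
    congr 1; funext n; congr 1
    by_cases hn : z ^ 60 < n
    · by_cases hp : n.Prime
      · simp [hn, hp, not_le.mpr hn, csL, ArithmeticFunction.vonMangoldt_apply_prime hp]
      · simp [hn, hp, not_le.mpr hn, csL]
    · simp [hn, not_lt.mp hn, csL]
  have c1 := small_part L hLp J (z ^ 60) (cs χ) (cs_norm_le χ)
  have c2 := ppow_tail L hLp J (z ^ 20) (z ^ 60) (by rw [← pow_mul]) (cs χ) (cs_norm_le χ)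
  rw [h.LY] at c1
  have c3 := h.PY
  have c4 := h.ppow
  have hC20 := h.C1
  have hly := h.ly
  have hjL := h.jL
  have hlz : 0 ≤ Real.log z := Real.log_natCast_nonneg z
  have hD : L ^ (J + 1) / L ^ (40 * C1) ≤ L ^ (J + 1) / L ^ 4 := by
    gcongr
    omega
  have hF0 : 0 ≤ (60 * Real.log z) ^ (J + 1) / ((J + 1).factorial : ℝ) := by positivity
  have hF1 := c3.trans hD
  have d1 : (J + 1) * ((60 * Real.log z) ^ (J + 1) / (J + 1).factorial) * (1 + 60 * Real.log z) ≤ L ^ (J + 1) / 8 := by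
    generalize (60 * Real.log z) ^ (J + 1) / ((J + 1).factorial : ℝ) = F at hF0 hF1 ⊢
    have hj1 : (J : ℝ) + 1 ≤ L := by linarith
    calc _ ≤ L * (L ^ (J + 1) / L ^ 4) * L ^ 2 := by
          gcongr
      _ = L ^ (J + 1) / L := by field_simp
      _ ≤ _ := by gcongr; linarith
  have d2 : 4 * (L ^ (J + 1) / L ^ (40 * C1)) ≤ L ^ (J + 1) / 8 := by
    calc _ ≤ 4 * (L ^ (J + 1) / L ^ 4) := by gcongr
      _ ≤ 4 * (L ^ (J + 1) / 32) := by
          gcongr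
          calc (32 : ℝ) ≤ L ^ 1 := by linarith
            _ ≤ L ^ 4 := pow_le_pow_right₀ hL1 (by norm_num)
      _ = _ := by ring
  have hcl : csL χ = fun n => ((Λ n : ℝ) : ℂ) := by funext n; simp [csL, hcs]
  rw [hone, hcl] at e1
  set s1 := S L J (fun n => if n ≤ z ^ 60 then cs χ n * ((Λ n : ℝ) : ℂ) else 0)
  set s2 := S L J (fun n => if z ^ 60 < n ∧ ¬ n.Prime then cs χ n * ((Λ n : ℝ) : ℂ) else 0)
  set s0 := S L J (fun n => ((Λ n : ℝ) : ℂ))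
  have e2 : ((L ^ (J + 1) - (J + 1) * tm L (J + 1) (z ^ 60) : ℝ) : ℂ) = -(s0 - (L : ℂ) ^ (J + 1)) + s1 + s2 := by
    push_cast
    rw [e1]; ring
  have e3 : |L ^ (J + 1) - (J + 1) * tm L (J + 1) (z ^ 60)| ≤ L ^ (J + 1) / 8 + L ^ (J + 1) / 8 + L ^ (J + 1) / 8 := by
    rw [← Real.norm_eq_abs, ← Complex.norm_real, e2]
    refine (norm_add_le _ _).trans (add_le_add ((norm_add_le _ _).trans (add_le_add ?_ (c1.trans d1))) ((c2.trans c4).trans d2))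
    rw [norm_neg]; exact b1.trans b2
  have e4 := (abs_le.mp e3).2
  have : 0 < L ^ (J + 1) := by positivity
  rw [div_le_iff₀ (by positivity)]
  linarith

end BG

namespace BG
set_option maxHeartbeats 400000
open Finset Filter Topology
open scoped ArithmeticFunction.vonMangoldt ArithmeticFunction.Moebius ArithmeticFunction.zeta

lemma ev_par (C1 K : ℕ) (hK : 1 ≤ K) (hC : K ^ 2 + 20 ≤ C1) :
    ∀ᶠ L : ℝ in atTop, ∃ J z : ℕ, Par C1 K L J z := by
  obtain ⟨L0, hL01, hV⟩ := V_bound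
  filter_upwards [eventually_ge_atTop (100000 : ℝ), eventually_ge_atTop L0,
    eventually_ge_atTop (((2 * K : ℕ) : ℝ) ^ ((2 * K) ^ 2)),
    ev_log 1000 (20 * C1) (1 / 10) 2 (by norm_num), ev_log 2 (10 * C1) (1 / 2) 1 (by norm_num),
    Real.tendsto_log_atTop.eventually_ge_atTop 40] with L h1 h2 h3 h4 h5 h6
  have hLp : 0 < L := by linarith
  have hL1 : 1 ≤ L := by linarith
  have hC0 : (1 : ℝ) ≤ C1 := by exact_mod_cast (by omega : 1 ≤ C1)
  set c := 10 * (C1 : ℝ) * Real.log L with hc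
  have hcb : 400 * (C1 : ℝ) ≤ c := by rw [hc]; nlinarith
  have hc1 : 400 ≤ c := by linarith
  set J := ⌈c⌉₊ - 1 with hJ
  have hcpos : 0 < ⌈c⌉₊ := Nat.ceil_pos.mpr (by linarith)
  have hJ1 : ((J : ℝ) + 1) = (⌈c⌉₊ : ℝ) := by
    have : J + 1 = ⌈c⌉₊ := by omega
    rw [← this]; push_cast; ring
  have j1 : c ≤ (J : ℝ) + 1 := by rw [hJ1]; exact Nat.le_ceil c
  have j2 : (J : ℝ) ≤ c := by
    have := Nat.ceil_lt_add_one (show 0 ≤ c by linarith)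
    linarith
  have jL : (J : ℝ) + 2 ≤ L := by
    have h7 : L ^ (1 / 2 : ℝ) ≤ L := by
      calc _ ≤ L ^ (1 : ℝ) := Real.rpow_le_rpow_of_exponent_le hL1 (by norm_num)
        _ = L := Real.rpow_one L
    rw [pow_one] at h5
    nlinarith
  set X := ((J : ℝ) + 1) * L / 10000 with hX
  have X1 : 10 * c ≤ X := by
    rw [hX, le_div_iff₀ (by norm_num)]
    nlinarith
  have X2 : 100 * C1 * Real.log L ≤ X := by rw [hc] at X1; linarith
  have hz : ∃ z : ℕ, z = ⌊Real.exp X⌋₊ := ⟨_, rfl⟩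
  obtain ⟨z, hz⟩ := hz
  have z1 : (z : ℝ) ≤ Real.exp X := by rw [hz]; exact Nat.floor_le (Real.exp_pos X).le
  have z2 : Real.exp (X / 2) ≤ z := by
    have : Real.exp X < z + 1 := by rw [hz]; exact Nat.lt_floor_add_one _
    have e : Real.exp X = Real.exp (X / 2) * Real.exp (X / 2) := by rw [← Real.exp_add]; ring_nf
    have e2 : X / 2 + 1 ≤ Real.exp (X / 2) := Real.add_one_le_exp _
    nlinarith
  have zp : (0 : ℝ) < z := lt_of_lt_of_le (Real.exp_pos _) z2
  have lz : Real.log z ≤ X := by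
    have := Real.log_le_log zp z1
    rwa [Real.log_exp] at this
  have lz2 : X / 2 ≤ Real.log z := by
    rw [Real.le_log_iff_exp_le zp]; exact z2
  refine ⟨J, z, ⟨by linarith, hV L h2, hV (2 * L) (by linarith) 0, jL, ?_, ?_, lz, ?_, ?_, ?_, ?_, h3, hK, hC⟩⟩
  · rw [one_div, ← Real.exp_log (pow_pos hLp (40 * C1)), ← Real.exp_neg, Real.exp_le_exp, Real.log_pow]
    push_cast
    nlinarith
  · rw [← Real.rpow_natCast, ← Real.rpow_natCast, ← Real.log_le_log_iff (by positivity) (by positivity),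
      Real.log_rpow (by norm_num), Real.log_rpow hLp]
    have := Real.log_two_lt_d9
    push_cast
    have h0 : 0 < Real.log 2 := Real.log_pos (by norm_num)
    calc (J : ℝ) * Real.log 2 ≤ c * 0.7 := by
          apply mul_le_mul j2 (by linarith) h0.le (by linarith)
      _ = _ := by rw [hc]; ring
  · refine le_trans (le_of_eq ?_) lz2
    rw [hX]; ring
  · refine le_trans ?_ z2
    rw [← Real.exp_log (pow_pos hLp (40 * C1 + 10)), Real.exp_le_exp, Real.log_pow]
    push_cast
    nlinarith
  · have : X ≤ L ^ 2 / 10000 := by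
      rw [hX]; gcongr; nlinarith
    nlinarith
  · have hb : 1000 * (1 + 20 * C1 * Real.log L) ^ 2 / L ^ (-(4 / 5) : ℝ) ≤ L ^ (9 / 10 : ℝ) := by
      rw [Real.rpow_neg hLp.le, div_inv_eq_mul]
      calc _ ≤ L ^ (1 / 10 : ℝ) * L ^ (4 / 5 : ℝ) := by gcongr
        _ = _ := by rw [← Real.rpow_add hLp]; norm_num
    calc _ ≤ (L ^ (9 / 10 : ℝ)) ^ (J + 1) := by gcongr
      _ = L ^ ((9 / 10 : ℝ) * (J + 1)) := by rw [← Real.rpow_natCast, ← Real.rpow_mul hLp.le]; push_cast; rfl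
      _ ≤ L ^ (((J + 1 : ℕ) : ℝ) - ((40 * C1 : ℕ) : ℝ)) := by
          apply Real.rpow_le_rpow_of_exponent_le hL1
          push_cast; nlinarith
      _ = _ := by rw [Real.rpow_sub hLp, Real.rpow_natCast, Real.rpow_natCast]

/-- The Bombieri--Vinogradov type input. -/
theorem bv_main (A K : ℕ) (hK : 1 ≤ K) : ∃ C1 : ℕ, ∀ N : ℝ, ∃ L ≥ N, ∃ J z : ℕ, Par C1 K L J z ∧
    L ^ (J + 1) / (2 * (J + 1)) ≤ tm L (J + 1) (z ^ 60) ∧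
    ∑ q ∈ Icc 1 (z ^ 3), (K : ℝ) ^ om q * Eh L (J + 1) (z ^ 60) q ≤ L ^ (J + 1) / L ^ A := by
  set C1 := A + K ^ 2 + 4 * K + 21 with hC1
  refine ⟨C1, fun N => ?_⟩
  obtain ⟨L0, h0⟩ := eventually_atTop.mp (ev_par C1 K hK (by omega))
  obtain ⟨L2, h2⟩ := tm_lower C1 K
  obtain ⟨L, hL, hg⟩ := exists_good ((20 * C1 : ℕ) : ℝ) (by positivity) (max N (max L0 L2))
  have hLa : N ≤ L := (le_max_left _ _).trans hL
  have hLb : L0 ≤ L := (le_max_left _ _).trans ((le_max_right _ _).trans hL)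
  have hLc : L2 ≤ L := (le_max_right _ _).trans ((le_max_right _ _).trans hL)
  obtain ⟨J, z, h⟩ := h0 L hLb
  refine ⟨L, hLa, J, z, h, h2 L hLc J z h, ?_⟩
  have hz := h.z2
  have hL1 : 1 ≤ L := by linarith [h.hL]
  refine (bv_reduce K hK L (J + 1) (z ^ 60) (z ^ 3) (Nat.pow_le_pow_right (by omega) (by norm_num))).trans ?_
  have a1 := h.prim_sum hg
  have a2 : ∑ m ∈ Icc 1 (z ^ 3), wt K m ≤ L ^ (4 * K) := by
    refine (om_totient_sum K (z ^ 3)).trans ?_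
    rw [show 4 * K = 2 * (2 * K) by ring, pow_mul L 2]
    have hlz : 0 ≤ Real.log z := Real.log_natCast_nonneg z
    have := h.ly
    have h3 : Real.log ((z ^ 3 : ℕ) : ℝ) = 3 * Real.log z := by push_cast; rw [Real.log_pow]; push_cast; ring
    rw [h3]
    gcongr
    linarith
  calc _ ≤ 5 * (L ^ (J + 1) / L ^ C1) * L ^ (4 * K) := by
        apply mul_le_mul a1 a2 (sum_nonneg fun m _ => wt_nonneg K m) (by positivity)
    _ ≤ (L * L ^ (J + 1)) * L ^ (4 * K) / L ^ C1 := by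
        rw [mul_div_assoc', div_mul_eq_mul_div]
        gcongr; linarith [h.hL]
    _ ≤ (L * L ^ (J + 1)) / L ^ (A + 1) := pdiv hL1 _ _ _ (by omega) _ (by positivity)
    _ = _ := by rw [mul_comm L, pow_succ L A, mul_div_mul_right _ _ (by linarith)]

end BG

namespace BG
set_option maxHeartbeats 400000
open Finset Filter Topology

lemma sum_cons {α : Type*} [Fintype α] {n : ℕ} (f : (Fin (n + 1) → α) → ℝ) :
    ∑ r, f r = ∑ a, ∑ r : Fin n → α, f (Fin.cons a r) := by
  rw [← Fintype.sum_prod_type']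
  exact (Equiv.sum_comp (Fin.consEquiv fun _ => α) f).symm

lemma tens {α β γ : Type*} [Fintype α] [Fintype β] [Fintype γ] (n : ℕ) :
    ∀ (μ : Fin n → β → ℝ) (ψ : Fin n → α → β → ℝ) (ν : Fin n → γ → ℝ) (T : Fin n → α → γ → ℝ),
    (∀ t b, 0 ≤ μ t b) → (∀ t b, 0 ≤ ν t b) →
    (∀ t (x : α → ℝ), ∑ b, μ t b * (∑ a, x a * ψ t a b) ^ 2 ≤ ∑ g, ν t g * (∑ a, x a * T t a g) ^ 2) →
    ∀ c : (Fin n → α) → ℝ,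
    ∑ w : Fin n → β, (∏ t, μ t (w t)) * (∑ r : Fin n → α, c r * ∏ t, ψ t (r t) (w t)) ^ 2 ≤
      ∑ s : Fin n → γ, (∏ t, ν t (s t)) * (∑ r : Fin n → α, c r * ∏ t, T t (r t) (s t)) ^ 2 := by
  induction n with
  | zero => intro μ ψ ν T _ _ _ c; simp
  | succ n ih =>
    intro μ ψ ν T hμ hν h c
    have e1 : ∑ w : Fin (n + 1) → β, (∏ t, μ t (w t)) * (∑ r : Fin (n + 1) → α, c r * ∏ t, ψ t (r t) (w t)) ^ 2 =
        ∑ w : Fin n → β, (∏ t : Fin n, μ t.succ (w t)) * ∑ b, μ 0 b *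
          (∑ a, (∑ r : Fin n → α, c (Fin.cons a r) * ∏ t : Fin n, ψ t.succ (r t) (w t)) * ψ 0 a b) ^ 2 := by
      rw [sum_cons, sum_comm]
      refine sum_congr rfl fun w _ => ?_
      rw [mul_sum]
      refine sum_congr rfl fun b _ => ?_
      rw [sum_cons]
      simp only [Fin.prod_univ_succ, Fin.cons_zero, Fin.cons_succ]
      have : ∀ a, ∑ r : Fin n → α, c (Fin.cons a r) * (ψ 0 a b * ∏ t : Fin n, ψ t.succ (r t) (w t)) =
          (∑ r : Fin n → α, c (Fin.cons a r) * ∏ t : Fin n, ψ t.succ (r t) (w t)) * ψ 0 a b := by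
        intro a; rw [sum_mul]; exact sum_congr rfl fun r _ => by ring
      simp only [this]
      ring
    have e2 : ∑ w : Fin (n + 1) → γ, (∏ t, ν t (w t)) * (∑ r : Fin (n + 1) → α, c r * ∏ t, T t (r t) (w t)) ^ 2 =
        ∑ g, ν 0 g * ∑ w : Fin n → γ, (∏ t : Fin n, ν t.succ (w t)) *
          (∑ r : Fin n → α, (∑ a, c (Fin.cons a r) * T 0 a g) * ∏ t : Fin n, T t.succ (r t) (w t)) ^ 2 := by
      rw [sum_cons]
      refine sum_congr rfl fun g _ => ?_
      rw [mul_sum]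
      refine sum_congr rfl fun w _ => ?_
      rw [sum_cons]
      simp only [Fin.prod_univ_succ, Fin.cons_zero, Fin.cons_succ]
      rw [sum_comm]
      have : ∀ r : Fin n → α, ∑ a, c (Fin.cons a r) * (T 0 a g * ∏ t : Fin n, T t.succ (r t) (w t)) =
          (∑ a, c (Fin.cons a r) * T 0 a g) * ∏ t : Fin n, T t.succ (r t) (w t) := by
        intro r; rw [sum_mul]; exact sum_congr rfl fun a _ => by ring
      simp only [this]
      ring
    rw [e1, e2]
    calc _ ≤ ∑ w : Fin n → β, (∏ t : Fin n, μ t.succ (w t)) * ∑ g, ν 0 g *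
          (∑ a, (∑ r : Fin n → α, c (Fin.cons a r) * ∏ t : Fin n, ψ t.succ (r t) (w t)) * T 0 a g) ^ 2 := by
          refine sum_le_sum fun w _ => mul_le_mul_of_nonneg_left (h 0 _) (prod_nonneg fun t _ => hμ _ _)
      _ = ∑ g, ν 0 g * ∑ w : Fin n → β, (∏ t : Fin n, μ t.succ (w t)) *
          (∑ r : Fin n → α, (∑ a, c (Fin.cons a r) * T 0 a g) * ∏ t : Fin n, ψ t.succ (r t) (w t)) ^ 2 := by
          simp only [mul_sum]
          rw [sum_comm]
          refine sum_congr rfl fun g _ => sum_congr rfl fun w _ => ?_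
          have : ∑ a, (∑ r : Fin n → α, c (Fin.cons a r) * ∏ t : Fin n, ψ t.succ (r t) (w t)) * T 0 a g =
              ∑ r : Fin n → α, (∑ a, c (Fin.cons a r) * T 0 a g) * ∏ t : Fin n, ψ t.succ (r t) (w t) := by
            simp only [sum_mul]
            rw [sum_comm]
            exact sum_congr rfl fun r _ => sum_congr rfl fun a _ => by ring
          rw [this]; ring
      _ ≤ _ := by
          refine sum_le_sum fun g _ => mul_le_mul_of_nonneg_left ?_ (hν _ _)
          exact ih _ _ _ _ (fun t b => hμ _ _) (fun t b => hν _ _) (fun t x => h t.succ x) _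

variable {k : ℕ}

/-- sieve factor -/
noncomputable def psi (p : ℕ) (a b : Option (Fin k)) : ℝ :=
  match a with
  | none => 1
  | some i => if b = some i then 2 - (p : ℝ) else 1

/-- divisibility indicator -/
noncomputable def chi (d b : Option (Fin k)) : ℝ :=
  match d with
  | none => 1
  | some i => if b = some i then 1 else 0

/-- expansion coefficients -/
noncomputable def Tm (p : ℕ) (a d : Option (Fin k)) : ℝ :=
  match a, d with
  | none, none => 1
  | none, some _ => 0
  | some _, none => 1
  | some i, some i' => if i = i' then 1 - (p : ℝ) else 0

lemma psi_exp (p : ℕ) (a b : Option (Fin k)) : psi p a b = ∑ d, Tm p a d * chi d b := by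
  rw [Fintype.sum_option]
  rcases a with _ | i
  · simp [psi, Tm, chi]
  · simp only [psi, Tm, chi, ite_mul, zero_mul, sum_ite_eq, mem_univ, if_true]
    split_ifs <;> ring

lemma sum_some_ite (f : Fin k → ℝ) (i : Fin k) (x : ℝ) :
    ∑ i', f i' * (if (some i : Option (Fin k)) = some i' then x else 1) = ∑ i', f i' + (x - 1) * f i := by
  have : ∀ i', f i' * (if (some i : Option (Fin k)) = some i' then x else 1) =
      f i' + if i = i' then (x - 1) * f i' else 0 := by
    intro i'
    by_cases h : i = i'
    · subst h; simp; ring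
    · simp [h]
  simp only [this, sum_add_distrib, sum_ite_eq, mem_univ, if_true]

/-- model weights for S1 -/
noncomputable def mu1 (k p : ℕ) (b : Option (Fin k)) : ℝ :=
  match b with
  | none => 1 - (k : ℝ) / p
  | some _ => 1 / (p : ℝ)

/-- model weights for S2 -/
noncomputable def mu2 (m : Fin k) (p : ℕ) (b : Option (Fin k)) : ℝ :=
  match b with
  | none => 1 - ((k : ℝ) - 1) / ((p : ℝ) - 1)
  | some i => if i = m then 0 else 1 / ((p : ℝ) - 1)

noncomputable def nu1 (p : ℕ) (b : Option (Fin k)) : ℝ :=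
  match b with
  | none => 1 + 2 / (p : ℝ) ^ 2
  | some _ => (1 + 2 / (p : ℝ) ^ 2) * p

noncomputable def nu2 (m : Fin k) (p : ℕ) (b : Option (Fin k)) : ℝ :=
  match b with
  | none => 1
  | some i => if i = m then 0 else (p : ℝ) - k

/-- transfer matrix for S2 -/
noncomputable def T2 (m : Fin k) (a g : Option (Fin k)) : ℝ :=
  match g with
  | none => if a = none ∨ a = some m then 1 else 0
  | some i => if a = some i then 1 else 0

lemma local1 (p : ℕ) (hp : 4 ≤ p) (x : Option (Fin k) → ℝ) :
    ∑ b, mu1 k p b * (∑ a, x a * psi p a b) ^ 2 ≤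
      ∑ g, nu1 p g * (∑ a, x a * (if a = g then 1 else 0)) ^ 2 := by
  have hp' : (4 : ℝ) ≤ p := by exact_mod_cast hp
  simp only [Fintype.sum_option, mu1, psi, nu1, sum_some_ite, mul_one, reduceCtorEq, if_false, if_true]
  simp only [mul_ite, mul_one, mul_zero, sum_const_zero, add_zero, zero_add, Option.some.injEq, sum_ite_eq', mem_univ, if_true]
  set s := ∑ i, x (some i)
  set q := ∑ i, x (some i) ^ 2 with hq
  have hq0 : 0 ≤ q := sum_nonneg fun i _ => sq_nonneg _
  have e1 : ∑ i, 1 / (p : ℝ) * (x none + (s + (2 - p - 1) * x (some i))) ^ 2 =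
      1 / (p : ℝ) * (k * (x none + s) ^ 2 - 2 * (p - 1) * (x none + s) * s + (p - 1) ^ 2 * q) := by
    rw [← mul_sum]
    congr 1
    have : ∀ i, (x none + (s + (2 - (p : ℝ) - 1) * x (some i))) ^ 2 =
      (x none + s) ^ 2 - 2 * (p - 1) * (x none + s) * x (some i) + (p - 1) ^ 2 * x (some i) ^ 2 := fun i => by ring
    simp only [this, sum_add_distrib, sum_sub_distrib, ← mul_sum]
    rw [sum_const, nsmul_eq_mul, card_univ, Fintype.card_fin]
  have e2 : ∑ i, (1 + 2 / (p : ℝ) ^ 2) * p * x (some i) ^ 2 = (1 + 2 / (p : ℝ) ^ 2) * p * q := by rw [← mul_sum]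
  rw [e1, e2]
  have hp0 : (0 : ℝ) < p := by linarith
  have e3 : (1 - (k : ℝ) / p) * (x none + s) ^ 2 + 1 / (p : ℝ) * (k * (x none + s) ^ 2 - 2 * (p - 1) * (x none + s) * s + (p - 1) ^ 2 * q)
      = x none ^ 2 + 2 / p * x none * s - (1 - 2 / p) * s ^ 2 + (p - 1) ^ 2 / p * q := by
    field_simp; ring
  rw [e3]
  have e4 : ((p : ℝ) - 1) ^ 2 / p * q ≤ (1 + 2 / (p : ℝ) ^ 2) * p * q := by
    apply mul_le_mul_of_nonneg_right _ hq0
    have : (0 : ℝ) ≤ 2 / (p : ℝ) ^ 2 * p := by positivity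
    have : ((p : ℝ) - 1) ^ 2 / p ≤ p := by rw [div_le_iff₀ hp0]; nlinarith
    linarith
  have e5 : x none ^ 2 + 2 / p * x none * s - (1 - 2 / p) * s ^ 2 ≤ (1 + 2 / (p : ℝ) ^ 2) * x none ^ 2 := by
    have h2 : 2 / (p : ℝ) ≤ 1 / 2 := by rw [div_le_iff₀ hp0]; linarith
    set u := x none / (p : ℝ) with hu
    have h3 : 2 / (p : ℝ) * x none * s = 2 * u * s := by rw [hu]; ring
    have h4 : 2 / (p : ℝ) ^ 2 * x none ^ 2 = 2 * u ^ 2 := by rw [hu]; ring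
    rw [add_mul, h3, h4]
    nlinarith [sq_nonneg (2 * u - s), sq_nonneg s]
  linarith

lemma local2 (m : Fin k) (p : ℕ) (hp : k < p) (x : Option (Fin k) → ℝ) :
    ∑ g, nu2 m p g * (∑ a, x a * T2 m a g) ^ 2 ≤ ∑ b, mu2 m p b * (∑ a, x a * psi p a b) ^ 2 := by
  have hk : 1 ≤ k := by have := m.isLt; omega
  have hk' : (1 : ℝ) ≤ k := by exact_mod_cast hk
  have hp' : (k : ℝ) + 1 ≤ p := by exact_mod_cast hp
  simp only [Fintype.sum_option, mu2, psi, nu2, T2, sum_some_ite, mul_one, reduceCtorEq, if_false, if_true, false_or, true_or]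
  simp only [mul_ite, mul_one, mul_zero, ite_mul, zero_mul, zero_add, Option.some.injEq, sum_ite_eq', mem_univ, if_true, one_mul]
  set S := ∑ i, x (some i)
  have hS : S = x (some m) + ∑ i ∈ univ.erase m, x (some i) := (add_sum_erase _ _ (mem_univ m)).symm
  set s := ∑ i ∈ univ.erase m, x (some i)
  set q := ∑ i ∈ univ.erase m, x (some i) ^ 2 with hq
  have er : ∀ f : Fin k → ℝ, ∑ i, (if i = m then 0 else f i) = ∑ i ∈ univ.erase m, f i := by
    intro f
    rw [← add_sum_erase _ _ (mem_univ m), if_pos rfl, zero_add]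
    exact sum_congr rfl fun i hi => if_neg (ne_of_mem_erase hi)
  rw [er, er]
  have hcard : ((univ.erase m : Finset (Fin k)).card : ℝ) = k - 1 := by
    rw [card_erase_of_mem (mem_univ m), card_univ, Fintype.card_fin, Nat.cast_sub hk]; simp
  have hcs : s ^ 2 ≤ (k - 1) * q := by rw [← hcard]; exact sq_sum_le_card_mul_sum_sq
  have e1 : ∑ i ∈ univ.erase m, 1 / ((p : ℝ) - 1) * (x none + (S + (2 - p - 1) * x (some i))) ^ 2 =
      1 / ((p : ℝ) - 1) * ((k - 1) * (x none + S) ^ 2 - 2 * (p - 1) * (x none + S) * s + (p - 1) ^ 2 * q) := by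
    rw [← mul_sum]
    congr 1
    have : ∀ i, (x none + (S + (2 - (p : ℝ) - 1) * x (some i))) ^ 2 =
      (x none + S) ^ 2 - 2 * (p - 1) * (x none + S) * x (some i) + (p - 1) ^ 2 * x (some i) ^ 2 := fun i => by ring
    simp only [this, sum_add_distrib, sum_sub_distrib, ← mul_sum]
    rw [sum_const, nsmul_eq_mul, hcard]
  have hp0 : (0 : ℝ) < (p : ℝ) - 1 := by linarith
  have e3 : (1 - ((k : ℝ) - 1) / (p - 1)) * (x none + S) ^ 2 + 1 / ((p : ℝ) - 1) * ((k - 1) * (x none + S) ^ 2 - 2 * (p - 1) * (x none + S) * s + (p - 1) ^ 2 * q)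
      = (x none + S) ^ 2 - 2 * (x none + S) * s + (p - 1) * q := by
    field_simp; ring
  rw [e1, e3, ← mul_sum, ← hq, hS]
  nlinarith

lemma mu1_nonneg (p : ℕ) (hp : k < p) (b : Option (Fin k)) : 0 ≤ mu1 k p b := by
  have hp' : (k : ℝ) ≤ p := by exact_mod_cast hp.le
  rcases b with _ | i
  · simp only [mu1]
    have := div_le_one_of_le₀ hp' (by positivity)
    linarith
  · simp only [mu1]; positivity

lemma mu2_nonneg (m : Fin k) (p : ℕ) (hp : k < p) (b : Option (Fin k)) : 0 ≤ mu2 m p b := by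
  have hk : 1 ≤ k := by have := m.isLt; omega
  have hk' : (1 : ℝ) ≤ k := by exact_mod_cast hk
  have hp' : (k : ℝ) + 1 ≤ p := by exact_mod_cast hp
  have hp0 : (0 : ℝ) < (p : ℝ) - 1 := by linarith
  rcases b with _ | i
  · simp only [mu2]
    have : ((k : ℝ) - 1) / (p - 1) ≤ 1 := by rw [div_le_one hp0]; linarith
    linarith
  · simp only [mu2]; split_ifs <;> positivity

lemma nu1_nonneg (p : ℕ) (b : Option (Fin k)) : 0 ≤ nu1 p b := by
  rcases b with _ | i <;> simp only [nu1] <;> positivity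

lemma nu2_nonneg (m : Fin k) (p : ℕ) (hp : k < p) (b : Option (Fin k)) : 0 ≤ nu2 m p b := by
  have hp' : (k : ℝ) ≤ p := by exact_mod_cast hp.le
  rcases b with _ | i
  · simp [nu2]
  · simp only [nu2]; split_ifs
    · exact le_rfl
    · linarith

variable {n : ℕ}

/-- the sieve function on colourings -/
noncomputable def Phi (p : Fin n → ℕ) (c : (Fin n → Option (Fin k)) → ℝ) (w : Fin n → Option (Fin k)) : ℝ :=
  ∑ r, c r * ∏ t, psi (p t) (r t) (w t)

noncomputable def lam (p : Fin n → ℕ) (c : (Fin n → Option (Fin k)) → ℝ) (d : Fin n → Option (Fin k)) : ℝ :=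
  ∑ r, c r * ∏ t, Tm (p t) (r t) (d t)

lemma Phi_exp (p : Fin n → ℕ) (c : (Fin n → Option (Fin k)) → ℝ) (w : Fin n → Option (Fin k)) :
    Phi p c w = ∑ d, lam p c d * ∏ t, chi (d t) (w t) := by
  classical
  unfold Phi lam
  simp only [psi_exp, prod_univ_sum, Fintype.piFinset_univ, mul_sum, sum_mul]
  rw [sum_comm]
  exact sum_congr rfl fun d _ => sum_congr rfl fun r _ => by rw [prod_mul_distrib]; ring

lemma Phi_sq (p : Fin n → ℕ) (c : (Fin n → Option (Fin k)) → ℝ) (w : Fin n → Option (Fin k)) :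
    Phi p c w ^ 2 = ∑ d, ∑ e, lam p c d * lam p c e * ∏ t, (chi (d t) (w t) * chi (e t) (w t)) := by
  rw [Phi_exp, sq, sum_mul_sum]
  exact sum_congr rfl fun d _ => sum_congr rfl fun r _ => by rw [prod_mul_distrib]; ring

lemma main1 (p : Fin n → ℕ) (hp : ∀ t, 4 ≤ p t) (hk : ∀ t, k < p t) (c : (Fin n → Option (Fin k)) → ℝ) :
    ∑ w, (∏ t, mu1 k (p t) (w t)) * Phi p c w ^ 2 ≤ ∑ s, (∏ t, nu1 (p t) (s t)) * c s ^ 2 := by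
  refine (tens n (fun t => mu1 k (p t)) (fun t => psi (p t)) (fun t => nu1 (p t)) (fun _ a g => if a = g then 1 else 0)
    (fun t b => mu1_nonneg _ (hk t) b) (fun t b => nu1_nonneg _ b) (fun t x => local1 _ (hp t) x) c).trans (le_of_eq ?_)
  refine sum_congr rfl fun s _ => ?_
  congr 2
  rw [sum_eq_single s]
  · simp
  · intro r _ hr
    obtain ⟨t, ht⟩ := Function.ne_iff.mp hr
    rw [prod_eq_zero (mem_univ t) (if_neg ht), mul_zero]
  · simp

lemma main2 (m : Fin k) (p : Fin n → ℕ) (hk : ∀ t, k < p t) (c : (Fin n → Option (Fin k)) → ℝ) :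
    ∑ s : Fin n → Option (Fin k), (∏ t, nu2 m (p t) (s t)) * (∑ r, c r * ∏ t, T2 m (r t) (s t)) ^ 2 ≤
    ∑ w, (∏ t, mu2 m (p t) (w t)) * Phi p c w ^ 2 :=
  tens n (fun t => nu2 m (p t)) (fun _ => T2 m) (fun t => mu2 m (p t)) (fun t => psi (p t))
    (fun t b => nu2_nonneg _ _ (hk t) b) (fun t b => mu2_nonneg _ _ (hk t) b) (fun t x => local2 m _ (hk t) x) c

/-- comparison of an actual sum with the model -/
lemma compare (p : Fin n → ℕ) (c : (Fin n → Option (Fin k)) → ℝ) (wn : ℕ → ℝ) (hw : Summable wn)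
    (X : ℕ → Fin n → Option (Fin k)) (μ : Fin n → Option (Fin k) → ℝ) (M : ℝ)
    (B : (Fin n → Option (Fin k)) → (Fin n → Option (Fin k)) → ℝ)
    (hB : ∀ d e, lam p c d ≠ 0 → lam p c e ≠ 0 →
      |∑' N, wn N * ∏ t, (chi (d t) (X N t) * chi (e t) (X N t)) -
        M * ∏ t, ∑ b, μ t b * (chi (d t) b * chi (e t) b)| ≤ B d e) :
    |∑' N, wn N * Phi p c (X N) ^ 2 - M * ∑ w, (∏ t, μ t (w t)) * Phi p c w ^ 2| ≤
      ∑ d, ∑ e, |lam p c d| * |lam p c e| * B d e := by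
  classical
  have hchi : ∀ d b : Option (Fin k), 0 ≤ chi d b ∧ chi d b ≤ 1 := by
    intro d b
    rcases d with _ | i <;> simp only [chi]
    · norm_num
    · split_ifs <;> norm_num
  have hs : ∀ d e : Fin n → Option (Fin k), Summable fun N => wn N * ∏ t, (chi (d t) (X N t) * chi (e t) (X N t)) := by
    intro d e
    refine Summable.of_norm_bounded hw.norm fun N => ?_
    rw [norm_mul]
    refine mul_le_of_le_one_right (norm_nonneg _) ?_
    have h0 : 0 ≤ ∏ t, (chi (d t) (X N t) * chi (e t) (X N t)) :=
      prod_nonneg fun t _ => mul_nonneg (hchi _ _).1 (hchi _ _).1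
    rw [Real.norm_of_nonneg h0]
    exact prod_le_one (fun t _ => mul_nonneg (hchi _ _).1 (hchi _ _).1)
      fun t _ => mul_le_one₀ (hchi _ _).2 (hchi _ _).1 (hchi _ _).2
  have e1 : ∑' N, wn N * Phi p c (X N) ^ 2 = ∑ d, ∑ e, lam p c d * lam p c e *
      ∑' N, wn N * ∏ t, (chi (d t) (X N t) * chi (e t) (X N t)) := by
    have : ∀ N, wn N * Phi p c (X N) ^ 2 = ∑ d, ∑ e, lam p c d * lam p c e *
      (wn N * ∏ t, (chi (d t) (X N t) * chi (e t) (X N t))) := by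
      intro N
      rw [Phi_sq, mul_sum]
      refine sum_congr rfl fun d _ => ?_
      rw [mul_sum]
      exact sum_congr rfl fun e _ => by ring
    simp only [this]
    rw [Summable.tsum_finsetSum fun d _ => summable_sum fun e _ => (hs d e).mul_left _]
    refine sum_congr rfl fun d _ => ?_
    rw [Summable.tsum_finsetSum fun e _ => (hs d e).mul_left _]
    exact sum_congr rfl fun e _ => tsum_mul_left
  have e2 : M * ∑ w, (∏ t, μ t (w t)) * Phi p c w ^ 2 = ∑ d, ∑ e, lam p c d * lam p c e *
      (M * ∏ t, ∑ b, μ t b * (chi (d t) b * chi (e t) b)) := by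
    simp only [prod_univ_sum, Fintype.piFinset_univ, Phi_sq, mul_sum]
    rw [sum_comm]
    refine sum_congr rfl fun d _ => ?_
    rw [sum_comm]
    refine sum_congr rfl fun e _ => sum_congr rfl fun w _ => ?_
    rw [prod_mul_distrib (f := fun t => μ t (w t))]; ring
  rw [e1, e2, ← sum_sub_distrib]
  refine (abs_sum_le_sum_abs _ _).trans (sum_le_sum fun d _ => ?_)
  rw [← sum_sub_distrib]
  refine (abs_sum_le_sum_abs _ _).trans (sum_le_sum fun e _ => ?_)
  rw [← mul_sub, abs_mul, abs_mul]
  by_cases hd : lam p c d = 0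
  · simp [hd]
  by_cases he : lam p c e = 0
  · simp [he]
  exact mul_le_mul_of_nonneg_left (hB d e hd he) (by positivity)

end BG

namespace BG
set_option maxHeartbeats 400000
open Finset Filter Topology

variable {n k : ℕ}

/-- norm of a coloured function -/
def Nm {β : Type*} [DecidableEq β] (o : β) (p : Fin n → ℕ) (r : Fin n → β) : ℕ :=
  ∏ t ∈ univ.filter (fun t => r t ≠ o), p t

lemma Nm_pos {β : Type*} [DecidableEq β] (o : β) (p : Fin n → ℕ) (hp : ∀ t, (p t).Prime) (r : Fin n → β) :
    0 < Nm o p r := prod_pos fun t _ => (hp t).pos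

lemma primeFactors_prod' (p : Fin n → ℕ) (hp : ∀ t, (p t).Prime) (T : Finset (Fin n)) :
    (∏ t ∈ T, p t).primeFactors = T.image p := by
  ext q
  rw [Nat.mem_primeFactors, mem_image]
  constructor
  · rintro ⟨hq, hd, -⟩
    obtain ⟨t, ht, hdt⟩ := (Prime.dvd_finset_prod_iff hq.prime _).mp hd
    exact ⟨t, ht, ((Nat.prime_dvd_prime_iff_eq hq (hp t)).mp hdt).symm⟩
  · rintro ⟨t, ht, rfl⟩
    exact ⟨hp t, dvd_prod_of_mem _ ht, (prod_pos fun t _ => (hp t).pos).ne'⟩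

lemma prod_inj (p : Fin n → ℕ) (hp : ∀ t, (p t).Prime) (hi : Function.Injective p) :
    Function.Injective (fun T : Finset (Fin n) => ∏ t ∈ T, p t) := by
  intro T T' h
  have := congrArg Nat.primeFactors h
  simp only [primeFactors_prod' p hp] at this
  exact image_injective hi this

lemma Nm_card {β : Type*} [Fintype β] [DecidableEq β] (o : β) (p : Fin n → ℕ) (hp : ∀ t, (p t).Prime)
    (hi : Function.Injective p) (q : ℕ) :
    (univ.filter fun r : Fin n → β => Nm o p r = q).card ≤ (Fintype.card β - 1) ^ om q := by
  rcases (univ.filter fun r : Fin n → β => Nm o p r = q).eq_empty_or_nonempty with h | ⟨r0, h0⟩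
  · rw [h]; simp
  · rw [mem_filter] at h0
    set T := univ.filter fun t => r0 t ≠ o with hT
    have hom : om q = T.card := by
      rw [← h0.2]
      unfold om Nm
      rw [primeFactors_prod' p hp, card_image_of_injective _ hi]
    have hsub : (univ.filter fun r : Fin n → β => Nm o p r = q) ⊆
        Fintype.piFinset fun t => if t ∈ T then univ.erase o else {o} := by
      intro r hr
      rw [mem_filter] at hr
      have hs : (univ.filter fun t => r t ≠ o) = T := prod_inj p hp hi (hr.2.trans h0.2.symm)
      rw [Fintype.mem_piFinset]
      intro t
      split_ifs with ht
      · rw [← hs, mem_filter] at ht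
        simpa using ht.2
      · rw [← hs, mem_filter] at ht
        simpa using ht
    refine (card_le_card hsub).trans ?_
    rw [Fintype.card_piFinset, hom]
    have : ∀ t, (if t ∈ T then (univ : Finset β).erase o else {o}).card = if t ∈ T then Fintype.card β - 1 else 1 := by
      intro t; split_ifs <;> simp
    simp only [this]
    rw [prod_ite_mem, univ_inter, prod_const]

lemma cnt {β : Type*} [Fintype β] [DecidableEq β] (o : β) (p : Fin n → ℕ) (hp : ∀ t, (p t).Prime)
    (hi : Function.Injective p) (F : ℕ → ℝ) (hF : ∀ q, 0 ≤ F q) (X : ℕ) :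
    ∑ r ∈ univ.filter (fun r : Fin n → β => Nm o p r ≤ X), F (Nm o p r) ≤
      ∑ q ∈ Icc 1 X, ((Fintype.card β - 1 : ℕ) : ℝ) ^ om q * F q := by
  rw [← sum_fiberwise_of_maps_to (g := fun r => Nm o p r) (t := Icc 1 X)]
  · refine sum_le_sum fun q _ => ?_
    rw [sum_congr rfl (g := fun _ => F q) (fun r hr => by rw [(mem_filter.mp hr).2]), sum_const, nsmul_eq_mul]
    refine mul_le_mul_of_nonneg_right ?_ (hF q)
    refine le_trans (Nat.cast_le.mpr (card_le_card ?_)) (b := (((univ.filter fun r : Fin n → β => Nm o p r = q).card : ℕ) : ℝ)) ?_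
    · intro r hr
      rw [mem_filter] at hr ⊢
      exact ⟨mem_univ _, hr.2⟩
    · exact_mod_cast Nm_card o p hp hi q
  · intro r hr
    rw [mem_filter] at hr
    exact mem_Icc.mpr ⟨Nm_pos o p hp r, hr.2⟩

/-- d is contained in r -/
def Sub (d r : Fin n → Option (Fin k)) : Prop := ∀ t, d t ≠ none → r t = d t

lemma Tm_sub (p : Fin n → ℕ) (d r : Fin n → Option (Fin k)) (h : ∏ t, Tm (p t) (r t) (d t) ≠ 0) : Sub d r := by
  intro t ht
  rw [prod_ne_zero_iff] at h
  have := h t (mem_univ t)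
  rcases hd : d t with _ | i
  · exact absurd hd ht
  · rcases hr : r t with _ | i'
    · rw [hd, hr] at this; simp [Tm] at this
    · rw [hd, hr] at this
      by_cases e : i' = i
      · rw [e]
      · simp [Tm, e] at this

lemma Tm_le (p : Fin n → ℕ) (hp : ∀ t, (p t).Prime) (d r : Fin n → Option (Fin k)) :
    |∏ t, Tm (p t) (r t) (d t)| ≤ Nm none p d := by
  rw [abs_prod]
  unfold Nm
  rw [Nat.cast_prod, prod_filter]
  refine prod_le_prod (fun t _ => abs_nonneg _) fun t _ => ?_
  have h1 : (1 : ℝ) ≤ p t := by exact_mod_cast (hp t).one_lt.le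
  rcases hd : d t with _ | i <;> rcases hr : r t with _ | i' <;> simp [Tm]
  split_ifs
  · rw [abs_le]; constructor <;> linarith
  · simp

lemma Sub.le {d r : Fin n → Option (Fin k)} (p : Fin n → ℕ) (hp : ∀ t, (p t).Prime) (h : Sub d r) :
    Nm none p d ≤ Nm none p r := by
  refine Nat.le_of_dvd (Nm_pos _ p hp r) (prod_dvd_prod_of_subset _ _ _ fun t ht => ?_)
  rw [mem_filter] at ht ⊢
  exact ⟨mem_univ _, by rw [h t ht.2]; exact ht.2⟩

/-- difference of colourings -/
def dif (d r : Fin n → Option (Fin k)) : Fin n → Option (Fin k) := fun t => if d t = none then r t else none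

lemma Sub.mul {d r : Fin n → Option (Fin k)} (p : Fin n → ℕ) (h : Sub d r) :
    Nm none p r = Nm none p d * Nm none p (dif d r) := by
  unfold Nm
  simp only [prod_filter, ← prod_mul_distrib]
  refine prod_congr rfl fun t _ => ?_
  by_cases hd : d t = none
  · simp [dif, hd]
  · simp [dif, hd, h t hd]

variable {p : Fin n → ℕ} {c : (Fin n → Option (Fin k)) → ℝ} {R : ℕ}

lemma lam_supp (hp : ∀ t, (p t).Prime) (hc0 : ∀ r, R < Nm none p r → c r = 0)
    (d : Fin n → Option (Fin k)) (h : lam p c d ≠ 0) : Nm none p d ≤ R := by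
  unfold lam at h
  obtain ⟨r, -, hr⟩ := exists_ne_zero_of_sum_ne_zero h
  have h1 := Tm_sub p d r (right_ne_zero_of_mul hr)
  have h2 : Nm none p r ≤ R := by
    by_contra h3
    exact left_ne_zero_of_mul hr (hc0 r (not_le.mp h3))
  exact (h1.le p hp).trans h2

lemma lam_bound (hp : ∀ t, (p t).Prime) (hi : Function.Injective p) (hc0 : ∀ r, R < Nm none p r → c r = 0)
    (hc : ∀ r, |c r| ≤ 1 / Nm none p r) (d : Fin n → Option (Fin k)) :
    |lam p c d| ≤ (1 + Real.log R) ^ k := by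
  classical
  have hpos : ∀ r : Fin n → Option (Fin k), (0 : ℝ) < Nm none p r := fun r => by exact_mod_cast Nm_pos none p hp r
  set A := univ.filter fun r : Fin n → Option (Fin k) => Sub d r ∧ Nm none p r ≤ R with hA
  have h1 : lam p c d = ∑ r ∈ A, c r * ∏ t, Tm (p t) (r t) (d t) := by
    unfold lam
    refine (sum_subset (subset_univ A) fun r _ hr => ?_).symm
    by_contra hne
    refine hr (mem_filter.mpr ⟨mem_univ _, Tm_sub p d r (right_ne_zero_of_mul hne), ?_⟩)
    by_contra h3
    exact left_ne_zero_of_mul hne (hc0 r (not_le.mp h3))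
  have hinj : Set.InjOn (dif d) (A : Set (Fin n → Option (Fin k))) := by
    intro r hr r' hr' e
    rw [mem_coe, mem_filter] at hr hr'
    funext t
    by_cases hd : d t = none
    · have := congrFun e t
      simpa [dif, hd] using this
    · rw [hr.2.1 t hd, hr'.2.1 t hd]
  calc |lam p c d| ≤ ∑ r ∈ A, |c r * ∏ t, Tm (p t) (r t) (d t)| := by rw [h1]; exact abs_sum_le_sum_abs _ _
    _ ≤ ∑ r ∈ A, 1 / (Nm none p (dif d r) : ℝ) := by
        refine sum_le_sum fun r hr => ?_
        rw [mem_filter] at hr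
        rw [abs_mul]
        calc _ ≤ 1 / (Nm none p r : ℝ) * Nm none p d :=
              mul_le_mul (hc r) (Tm_le p hp d r) (abs_nonneg _) (by positivity)
          _ = _ := by
              rw [hr.2.1.mul p]
              push_cast
              have := hpos d
              have := hpos (dif d r)
              field_simp
    _ = ∑ r ∈ A.image (dif d), 1 / (Nm none p r : ℝ) := by rw [sum_image hinj]
    _ ≤ ∑ r ∈ univ.filter (fun r : Fin n → Option (Fin k) => Nm none p r ≤ R), 1 / (Nm none p r : ℝ) := by
        refine sum_le_sum_of_subset_of_nonneg (fun r hr => ?_) fun r _ _ => by positivity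
        obtain ⟨r', hr', rfl⟩ := mem_image.mp hr
        rw [mem_filter] at hr' ⊢
        refine ⟨mem_univ _, le_trans ?_ hr'.2.2⟩
        rw [hr'.2.1.mul p]
        exact Nat.le_mul_of_pos_left _ (Nm_pos none p hp d)
    _ ≤ ∑ q ∈ Icc 1 R, ((Fintype.card (Option (Fin k)) - 1 : ℕ) : ℝ) ^ om q * (1 / (q : ℝ)) :=
        cnt none p hp hi (fun q => 1 / (q : ℝ)) (fun q => by positivity) R
    _ = ∑ q ∈ Icc 1 R, (k : ℝ) ^ om q / q := by simp [div_eq_mul_inv]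
    _ ≤ _ := om_sum k R

lemma lam_sum (hp : ∀ t, (p t).Prime) (hi : Function.Injective p) (hc0 : ∀ r, R < Nm none p r → c r = 0)
    (hc : ∀ r, |c r| ≤ 1 / Nm none p r) : ∑ d, |lam p c d| ≤ R * (1 + Real.log R) ^ (2 * k) := by
  classical
  have hl : 0 ≤ Real.log R := Real.log_natCast_nonneg R
  calc ∑ d, |lam p c d| = ∑ d ∈ univ.filter (fun r : Fin n → Option (Fin k) => Nm none p r ≤ R), |lam p c d| := by
        refine (sum_subset (subset_univ _) fun r _ hr => ?_).symm
        by_contra hne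
        exact hr (mem_filter.mpr ⟨mem_univ _, lam_supp hp hc0 r (abs_ne_zero.mp hne)⟩)
    _ ≤ ∑ d ∈ univ.filter (fun r : Fin n → Option (Fin k) => Nm none p r ≤ R), (1 + Real.log R) ^ k :=
        sum_le_sum fun d _ => lam_bound hp hi hc0 hc d
    _ ≤ ∑ q ∈ Icc 1 R, ((Fintype.card (Option (Fin k)) - 1 : ℕ) : ℝ) ^ om q * (1 + Real.log R) ^ k :=
        cnt none p hp hi (fun q => (1 + Real.log R) ^ k) (fun q => by positivity) R
    _ ≤ ∑ q ∈ Icc 1 R, (k : ℝ) ^ om q / q * (R * (1 + Real.log R) ^ k) := by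
        refine sum_le_sum fun q hq => ?_
        rw [mem_Icc] at hq
        have h0 : (0 : ℝ) < q := by exact_mod_cast hq.1
        have h2 : (q : ℝ) ≤ R := by exact_mod_cast hq.2
        simp only [Fintype.card_option, Fintype.card_fin, Nat.add_sub_cancel]
        rw [div_mul_eq_mul_div, le_div_iff₀ h0]
        have : 0 ≤ (k : ℝ) ^ om q * (1 + Real.log R) ^ k := by positivity
        nlinarith
    _ ≤ (1 + Real.log R) ^ k * (R * (1 + Real.log R) ^ k) := by
        rw [← sum_mul]
        exact mul_le_mul_of_nonneg_right (om_sum k R) (by positivity)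
    _ = _ := by ring

/-- pair norm -/
def N2 (p : Fin n → ℕ) (d e : Fin n → Option (Fin k)) : ℕ :=
  Nm ((none, none) : Option (Fin k) × Option (Fin k)) p (fun t => (d t, e t))

lemma N2_le (hp : ∀ t, (p t).Prime) (d e : Fin n → Option (Fin k)) : N2 p d e ≤ Nm none p d * Nm none p e := by
  unfold N2 Nm
  simp only [prod_filter, ← prod_mul_distrib]
  refine prod_le_prod' fun t _ => ?_
  have := (hp t).one_lt.le
  by_cases h1 : d t = none <;> by_cases h2 : e t = none <;> simp [h1, h2]
  exact Nat.le_mul_of_pos_left _ (by omega)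

lemma lam_pair (hp : ∀ t, (p t).Prime) (hi : Function.Injective p) (hc0 : ∀ r, R < Nm none p r → c r = 0)
    (hc : ∀ r, |c r| ≤ 1 / Nm none p r) (F : ℕ → ℝ) (hF : ∀ q, 0 ≤ F q) :
    ∑ d, ∑ e, |lam p c d| * |lam p c e| * F (N2 p d e) ≤
      (1 + Real.log R) ^ (2 * k) * ∑ q ∈ Icc 1 (R ^ 2), (((k + 1) ^ 2 - 1 : ℕ) : ℝ) ^ om q * F q := by
  classical
  have hl : 0 ≤ Real.log R := Real.log_natCast_nonneg R
  have e1 : ∑ d, ∑ e, |lam p c d| * |lam p c e| * F (N2 p d e) =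
      ∑ r : Fin n → Option (Fin k) × Option (Fin k), |lam p c fun t => (r t).1| * |lam p c fun t => (r t).2| *
        F (Nm (none, none) p r) := by
    rw [← Fintype.sum_prod_type']
    exact (Equiv.sum_comp (Equiv.arrowProdEquivProdArrow (Fin n) (fun _ => Option (Fin k)) (fun _ => Option (Fin k)))
      (fun x => |lam p c x.1| * |lam p c x.2| * F (N2 p x.1 x.2))).symm
  rw [e1]
  calc _ = ∑ r ∈ univ.filter (fun r : Fin n → Option (Fin k) × Option (Fin k) => Nm (none, none) p r ≤ R ^ 2),
        |lam p c fun t => (r t).1| * |lam p c fun t => (r t).2| * F (Nm (none, none) p r) := by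
        refine (sum_subset (subset_univ _) fun r _ hr => ?_).symm
        by_contra hne
        have h1 := left_ne_zero_of_mul hne
        have h2 := lam_supp hp hc0 _ (abs_ne_zero.mp (left_ne_zero_of_mul h1))
        have h3 := lam_supp hp hc0 _ (abs_ne_zero.mp (right_ne_zero_of_mul h1))
        refine hr (mem_filter.mpr ⟨mem_univ _, (N2_le hp (fun t => (r t).1) (fun t => (r t).2)).trans ?_⟩)
        rw [sq]; exact Nat.mul_le_mul h2 h3
    _ ≤ ∑ r ∈ univ.filter (fun r : Fin n → Option (Fin k) × Option (Fin k) => Nm (none, none) p r ≤ R ^ 2),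
        (1 + Real.log R) ^ (2 * k) * F (Nm (none, none) p r) := by
        refine sum_le_sum fun r _ => mul_le_mul_of_nonneg_right ?_ (hF _)
        rw [two_mul, pow_add]
        exact mul_le_mul (lam_bound hp hi hc0 hc _) (lam_bound hp hi hc0 hc _) (abs_nonneg _) (by positivity)
    _ ≤ _ := by
        rw [← mul_sum]
        refine mul_le_mul_of_nonneg_left ?_ (by positivity)
        have := cnt ((none, none) : Option (Fin k) × Option (Fin k)) p hp hi F hF (R ^ 2)
        simp only [Fintype.card_prod, Fintype.card_option, Fintype.card_fin, ← sq] at this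
        exact this

end BG

namespace BG
set_option maxHeartbeats 400000
open Finset Filter Topology

variable {n k : ℕ}

lemma anti_prog (g : ℕ → ℝ) (hg : Antitone g) (h0 : ∀ i, 0 ≤ g i) (hs : Summable g) (q : ℕ) (hq : 0 < q) (a b : ℕ) :
    |(∑' i, if i + b ≡ a [MOD q] then g i else 0) - (∑' i, g i) / q| ≤ g 0 := by
  have : NeZero q := ⟨hq.ne'⟩
  have hsr : ∀ r, Summable fun m => g (r + q * m) := fun r =>
    hs.comp_injective fun m m' h => by
      have : q * m = q * m' := by simpa using h
      exact Nat.eq_of_mul_eq_mul_left hq this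
  have hle : ∀ r r', r ≤ r' → ∑' m, g (r' + q * m) ≤ ∑' m, g (r + q * m) := fun r r' h =>
    (hsr r').tsum_le_tsum (fun m => hg (by omega)) (hsr r)
  have hle2 : ∀ r r', r' ≤ r + q → ∑' m, g (r + q * m) ≤ g 0 + ∑' m, g (r' + q * m) := by
    intro r r' h
    rw [(hsr r).tsum_eq_zero_add]
    refine add_le_add (hg (Nat.zero_le _)) (Summable.tsum_le_tsum (fun m => hg ?_) ((summable_nat_add_iff 1).mpr (hsr r)) (hsr r'))
    ring_nf; omega
  have hd : ∀ r r', r < q → r' < q → |∑' m, g (r + q * m) - ∑' m, g (r' + q * m)| ≤ g 0 := by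
    intro r r' h h'
    have := h0 0
    rw [abs_le]
    rcases le_total r r' with hr | hr
    · have := hle r r' hr; have := hle2 r r' (by omega); constructor <;> linarith
    · have := hle r' r hr; have := hle2 r' r (by omega); constructor <;> linarith
  set j0 : ZMod q := (a : ZMod q) - b with hj0
  have e1 : (∑' i, if i + b ≡ a [MOD q] then g i else 0) = ∑' m, g (j0.val + q * m) := by
    have hsF : Summable fun i => if i + b ≡ a [MOD q] then g i else 0 :=
      Summable.of_nonneg_of_le (fun i => by split_ifs <;> simp [h0]) (fun i => by split_ifs <;> simp [h0]) hs
    rw [Nat.sumByResidueClasses hsF q, sum_eq_single j0]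
    · refine tsum_congr fun m => if_pos ?_
      rw [← ZMod.natCast_eq_natCast_iff]
      push_cast
      rw [ZMod.natCast_zmod_val]; simp [hj0]
    · intro j _ hj
      rw [tsum_congr (g := fun _ => (0 : ℝ)) fun m => if_neg ?_, tsum_zero]
      rw [← ZMod.natCast_eq_natCast_iff]
      push_cast
      rw [ZMod.natCast_zmod_val]
      intro h
      apply hj
      rw [hj0, ← h]; simp
    · simp
  have e2 : ∑' i, g i = ∑ j : ZMod q, ∑' m, g (j.val + q * m) := Nat.sumByResidueClasses hs q
  have hq' : (0 : ℝ) < q := by exact_mod_cast hq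
  have e3 : (∑' m, g (j0.val + q * m)) - (∑' i, g i) / q =
      (∑ j : ZMod q, ((∑' m, g (j0.val + q * m)) - ∑' m, g (j.val + q * m))) / q := by
    rw [sum_sub_distrib, ← e2, sum_const, card_univ, ZMod.card, nsmul_eq_mul]
    field_simp
  rw [e1, e3, abs_div, abs_of_pos hq', div_le_iff₀ hq']
  calc _ ≤ ∑ j : ZMod q, |(∑' m, g (j0.val + q * m)) - ∑' m, g (j.val + q * m)| := abs_sum_le_sum_abs _ _
    _ ≤ ∑ j : ZMod q, g 0 := sum_le_sum fun j _ => hd _ _ (ZMod.val_lt _) (ZMod.val_lt _)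
    _ = _ := by rw [sum_const, card_univ, ZMod.card, nsmul_eq_mul]; ring

lemma v_prog (L : ℝ) (hL : 0 < L) (j Y : ℕ) (hY : (j : ℝ) ≤ Real.log (Y + 1 : ℕ)) (q : ℕ) (hq : 0 < q) (a : ℕ) :
    |(∑' N, if Y < N ∧ N ≡ a [MOD q] then v L j N else 0) - (∑' N, if Y < N then v L j N else 0) / q| ≤ L ^ j / (Y + 1 : ℕ) := by
  have hshift : ∀ F : ℕ → ℝ, (∀ N, N ≤ Y → F N = 0) → ∑' N, F N = ∑' i, F (i + (Y + 1)) := by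
    intro F hF
    refine (Function.Injective.tsum_eq (f := F) (g := fun i => i + (Y + 1)) (fun a b h => by simpa using h) ?_).symm
    intro N hN
    have : ¬ N ≤ Y := fun h => hN (hF N h)
    exact ⟨N - (Y + 1), by simp; omega⟩
  rw [hshift _ fun N hN => if_neg (by omega), hshift (fun N => if Y < N then v L j N else 0) fun N hN => if_neg (by omega)]
  have e : ∀ i, Y < i + (Y + 1) := fun i => by omega
  simp only [e, true_and, if_true]
  refine (anti_prog (fun i => v L j (i + (Y + 1))) (fun i i' h => v_antitone L hL j _ _ (by omega) ?_ (by omega))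
    (fun i => v_nonneg L j _) ((summable_nat_add_iff (Y + 1)).mpr (summable_v L hL j)) q hq a (Y + 1)).trans ?_
  · refine hY.trans (Real.log_le_log (by positivity) ?_)
    exact_mod_cast (by omega : Y + 1 ≤ i + (Y + 1))
  · simpa using v_le L hL j (Y + 1)

/-- hypotheses on sieve moduli -/
structure Sv (W : ℕ) (h : Fin k → ℕ) (p : Fin n → ℕ) : Prop where
  hp : ∀ t, (p t).Prime
  hi : Function.Injective p
  pW : ∀ t, (p t).Coprime W
  hlt : ∀ i t, h i < p t
  hinj : Function.Injective h
  W0 : 0 < W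
  kp : ∀ t, k < p t
  p4 : ∀ t, 4 ≤ p t

open Classical in
/-- colour of an integer -/
noncomputable def Xc (p : Fin n → ℕ) (h : Fin k → ℕ) (N : ℕ) (t : Fin n) : Option (Fin k) :=
  if H : ∃ i, p t ∣ N + h i then some H.choose else none

variable {W : ℕ} {h : Fin k → ℕ} {p : Fin n → ℕ}

lemma Sv.uniq (S : Sv W h p) {N : ℕ} {t : Fin n} {i i' : Fin k} (h1 : p t ∣ N + h i) (h2 : p t ∣ N + h i') : i = i' := by
  apply S.hinj
  have h3 : N + h i ≡ N + h i' [MOD p t] := ((Nat.modEq_zero_iff_dvd).mpr h1).trans ((Nat.modEq_zero_iff_dvd).mpr h2).symm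
  have h4 : h i ≡ h i' [MOD p t] := Nat.ModEq.add_left_cancel' N h3
  exact Nat.ModEq.eq_of_lt_of_lt h4 (S.hlt i t) (S.hlt i' t)

lemma Sv.Xc_iff (S : Sv W h p) (N : ℕ) (t : Fin n) (i : Fin k) : Xc p h N t = some i ↔ p t ∣ N + h i := by
  classical
  unfold Xc
  constructor
  · intro hX
    split_ifs at hX with H
    have := Option.some.inj hX
    rw [← this]; exact H.choose_spec
  · intro hd
    have H : ∃ i, p t ∣ N + h i := ⟨i, hd⟩
    rw [dif_pos H, S.uniq H.choose_spec hd]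

lemma crt (W : ℕ) (v0 : ℕ) (p : Fin n → ℕ) (u : Fin n → ℕ) (hp : ∀ t, (p t).Prime) (hi : Function.Injective p)
    (hW : ∀ t, (p t).Coprime W) (T : Finset (Fin n)) :
    ∃ a, ∀ N, (N ≡ v0 [MOD W] ∧ ∀ t ∈ T, N ≡ u t [MOD p t]) ↔ N ≡ a [MOD W * ∏ t ∈ T, p t] := by
  classical
  induction T using Finset.induction_on with
  | empty => exact ⟨v0, fun N => by simp⟩
  | insert t T ht ih =>
    obtain ⟨a, ha⟩ := ih
    have hcop : Nat.Coprime (W * ∏ t ∈ T, p t) (p t) := by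
      refine Nat.Coprime.mul_left (hW t).symm ?_
      refine Nat.Coprime.prod_left fun s hs => (Nat.coprime_primes (hp s) (hp t)).mpr fun e => ht (hi e ▸ hs)
    obtain ⟨b, hb1, hb2⟩ := Nat.chineseRemainder hcop a (u t)
    refine ⟨b, fun N => ?_⟩
    rw [prod_insert ht, mul_comm (p t), ← mul_assoc, ← Nat.modEq_and_modEq_iff_modEq_mul hcop]
    constructor
    · rintro ⟨h1, h2⟩
      refine ⟨((ha N).mp ⟨h1, fun s hs => h2 s (mem_insert_of_mem hs)⟩).trans hb1.symm, (h2 t (mem_insert_self _ _)).trans hb2.symm⟩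
    · rintro ⟨h1, h2⟩
      obtain ⟨h3, h4⟩ := (ha N).mpr (h1.trans hb1)
      refine ⟨h3, fun s hs => ?_⟩
      rcases mem_insert.mp hs with rfl | hs
      · exact h2.trans hb2
      · exact h4 s hs

lemma Sv.crt (S : Sv W h p) (v0 : ℕ) (f : Fin n → Option (Fin k)) :
    ∃ a, ∀ N, (N ≡ v0 [MOD W] ∧ ∀ t i, f t = some i → p t ∣ N + h i) ↔ N ≡ a [MOD W * Nm none p f] := by
  obtain ⟨a, ha⟩ := BG.crt W v0 p (fun t => match f t with | none => 0 | some i => (p t - 1) * h i) S.hp S.hi S.pW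
    (univ.filter fun t => f t ≠ none)
  refine ⟨a, fun N => ?_⟩
  unfold Nm
  rw [← ha N]
  refine and_congr_right fun _ => ⟨fun H t ht => ?_, fun H t i hf => ?_⟩
  · rw [mem_filter] at ht
    obtain ⟨i, hf⟩ := Option.ne_none_iff_exists'.mp ht.2
    have h1 := H t i hf
    simp only [hf]
    apply Nat.ModEq.add_right_cancel' (h i)
    refine ((Nat.modEq_zero_iff_dvd).mpr h1).trans ((Nat.modEq_zero_iff_dvd).mpr ?_).symm
    have := (S.hp t).pos
    refine ⟨h i, ?_⟩
    nth_rw 2 [← Nat.sub_add_cancel this]; ring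
  · have h1 := H t (mem_filter.mpr ⟨mem_univ _, by rw [hf]; simp⟩)
    simp only [hf] at h1
    have h2 := h1.add_right (h i)
    rw [← Nat.modEq_zero_iff_dvd]
    refine h2.trans ((Nat.modEq_zero_iff_dvd).mpr ?_)
    have := (S.hp t).pos
    refine ⟨h i, ?_⟩
    nth_rw 2 [← Nat.sub_add_cancel this]; ring

open Classical in
lemma Sv.chi_prod (S : Sv W h p) (f : Fin n → Option (Fin k)) (N : ℕ) :
    ∏ t, chi (f t) (Xc p h N t) = if ∀ t i, f t = some i → p t ∣ N + h i then 1 else 0 := by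
  split_ifs with H
  · refine prod_eq_one fun t _ => ?_
    rcases hf : f t with _ | i
    · rfl
    · simp only [chi, (S.Xc_iff N t i).mpr (H t i hf), if_true]
  · push Not at H
    obtain ⟨t, i, hf, hd⟩ := H
    refine prod_eq_zero (mem_univ t) ?_
    rw [hf]
    simp only [chi]
    exact if_neg fun e => hd ((S.Xc_iff N t i).mp e)

/-- union of colourings -/
def un (d e : Fin n → Option (Fin k)) : Fin n → Option (Fin k) := fun t => if d t = none then e t else d t

lemma N2_eq (p : Fin n → ℕ) (d e : Fin n → Option (Fin k)) : Nm none p (un d e) = N2 p d e := by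
  unfold N2 Nm
  refine prod_congr ?_ fun _ _ => rfl
  ext t
  rw [mem_filter, mem_filter]
  by_cases hd : d t = none <;> simp [un, hd]

lemma chi_none (b : Option (Fin k)) : chi none b = 1 := rfl

lemma chi_un (d e : Fin n → Option (Fin k)) (hc : ∀ t, d t ≠ none → e t ≠ none → d t = e t) (t : Fin n) (b : Option (Fin k)) :
    chi (d t) b * chi (e t) b = chi (un d e t) b := by
  unfold un
  by_cases hd : d t = none
  · rw [if_pos hd, hd, chi_none, one_mul]
  · rw [if_neg hd]
    by_cases he : e t = none
    · rw [he, chi_none, mul_one]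
    · rw [← hc t hd he]
      obtain ⟨i, hi⟩ := Option.ne_none_iff_exists'.mp hd
      rw [hi]; simp only [chi]; split_ifs <;> norm_num

lemma chi_conf (d e : Fin n → Option (Fin k)) (t : Fin n) (hd : d t ≠ none) (he : e t ≠ none) (hc : d t ≠ e t) (b : Option (Fin k)) :
    chi (d t) b * chi (e t) b = 0 := by
  obtain ⟨i, hi⟩ := Option.ne_none_iff_exists'.mp hd
  obtain ⟨i', hi'⟩ := Option.ne_none_iff_exists'.mp he
  rw [hi, hi'] at hc ⊢
  simp only [chi]
  by_cases h1 : b = some i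
  · rw [if_neg (c := b = some i') (by rw [h1]; exact hc), mul_zero]
  · rw [if_neg h1, zero_mul]

/-- reduce pair comparison to single colourings -/
lemma pair_red (wn : ℕ → ℝ) (X : ℕ → Fin n → Option (Fin k)) (μ : Fin n → Option (Fin k) → ℝ) (M : ℝ)
    (B : ℕ → ℝ) (hB0 : ∀ q, 0 ≤ B q) (d e : Fin n → Option (Fin k))
    (hB : ∀ f, Nm none p f = N2 p d e → |∑' N, wn N * ∏ t, chi (f t) (X N t) - M * ∏ t, ∑ b, μ t b * chi (f t) b| ≤ B (Nm none p f)) :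
    |∑' N, wn N * ∏ t, (chi (d t) (X N t) * chi (e t) (X N t)) -
        M * ∏ t, ∑ b, μ t b * (chi (d t) b * chi (e t) b)| ≤ B (N2 p d e) := by
  by_cases hc : ∀ t, d t ≠ none → e t ≠ none → d t = e t
  · simp only [chi_un d e hc]
    have := hB (un d e) (N2_eq p d e)
    rwa [N2_eq] at this
  · push Not at hc
    obtain ⟨t, hd, he, hne⟩ := hc
    have h1 : ∀ N, ∏ t, (chi (d t) (X N t) * chi (e t) (X N t)) = 0 := fun N =>
      prod_eq_zero (mem_univ t) (chi_conf d e t hd he hne _)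
    have h2 : ∏ t, ∑ b, μ t b * (chi (d t) b * chi (e t) b) = 0 := by
      refine prod_eq_zero (mem_univ t) (sum_eq_zero fun b _ => ?_)
      rw [chi_conf d e t hd he hne, mul_zero]
    simp only [h1, h2]
    simpa using hB0 _

lemma mu_chi (μ : Option (Fin k) → ℝ) (i : Fin k) : ∑ b, μ b * chi (some i) b = μ (some i) := by
  simp [chi]

lemma mu1_sum (q : ℕ) (hq : 0 < q) : ∑ b, mu1 k q b = 1 := by
  rw [Fintype.sum_option]
  have : (0 : ℝ) < q := by exact_mod_cast hq
  simp [mu1]; field_simp; ring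

lemma mu2_sum (m : Fin k) (q : ℕ) (hq : 1 < q) : ∑ b, mu2 m q b = 1 := by
  rw [Fintype.sum_option]
  have h1 : (0 : ℝ) < (q : ℝ) - 1 := by have : (1 : ℝ) < q := by exact_mod_cast hq
                                        linarith
  have hk : 1 ≤ k := by have := m.isLt; omega
  simp only [mu2]
  rw [← add_sum_erase _ _ (mem_univ m), if_pos rfl, zero_add,
    sum_congr rfl fun i hi => if_neg (ne_of_mem_erase hi), sum_const, card_erase_of_mem (mem_univ m), card_univ, Fintype.card_fin,
    nsmul_eq_mul, Nat.cast_sub hk]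
  field_simp; simp

lemma Sv.mod1 (S : Sv W h p) (f : Fin n → Option (Fin k)) :
    ∏ t, ∑ b, mu1 k (p t) b * chi (f t) b = 1 / (Nm none p f : ℝ) := by
  unfold Nm
  rw [Nat.cast_prod, prod_filter, one_div, ← prod_inv_distrib]
  refine prod_congr rfl fun t _ => ?_
  rcases hf : f t with _ | i
  · simp only [chi_none, mul_one, mu1_sum _ (S.hp t).pos]; simp
  · rw [mu_chi]; simp [mu1]

lemma Sv.mod2 (S : Sv W h p) (m : Fin k) (f : Fin n → Option (Fin k)) (hf : ∀ t, f t ≠ some m) :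
    ∏ t, ∑ b, mu2 m (p t) b * chi (f t) b = 1 / ((Nm none p f).totient : ℝ) := by
  have e : (Nm none p f).totient = ∏ t ∈ univ.filter (fun t => f t ≠ none), (p t - 1) := by
    unfold Nm
    classical
    generalize (univ.filter fun t => f t ≠ none) = T
    induction T using Finset.induction_on with
    | empty => simp
    | insert t T ht ih =>
      rw [prod_insert ht, prod_insert ht, Nat.totient_mul, ih, Nat.totient_prime (S.hp t)]
      exact Nat.Coprime.prod_right fun s hs => (Nat.coprime_primes (S.hp t) (S.hp s)).mpr fun e => ht (S.hi e ▸ hs)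
  rw [e, Nat.cast_prod, prod_filter, one_div, ← prod_inv_distrib]
  refine prod_congr rfl fun t _ => ?_
  rcases hft : f t with _ | i
  · simp only [chi_none, mul_one, mu2_sum _ _ (S.hp t).one_lt]; simp
  · have : i ≠ m := fun e => hf t (by rw [hft, e])
    rw [mu_chi]; simp [mu2, this, Nat.cast_sub (S.hp t).pos]

end BG

namespace BG
set_option maxHeartbeats 400000
open Finset Filter Topology

variable {n k : ℕ} {W : ℕ} {h : Fin k → ℕ} {p : Fin n → ℕ} {c : (Fin n → Option (Fin k)) → ℝ} {R : ℕ}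

lemma wn_sum (P : ℕ → Prop) [DecidablePred P] (L : ℝ) (hL : 0 < L) (j : ℕ) : Summable fun N => if P N then v L j N else 0 :=
  Summable.of_nonneg_of_le (fun i => by split_ifs <;> simp [v_nonneg]) (fun i => by split_ifs <;> simp [v_nonneg]) (summable_v L hL j)

lemma S1_cmp (S : Sv W h p) (hc0 : ∀ r, R < Nm none p r → c r = 0) (hc : ∀ r, |c r| ≤ 1 / Nm none p r)
    (L : ℝ) (hL : 0 < L) (j Y : ℕ) (hY : (j : ℝ) ≤ Real.log (Y + 1 : ℕ)) (v0 : ℕ) :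
    ∑' N, (if Y < N ∧ N ≡ v0 [MOD W] then v L j N else 0) * Phi p c (Xc p h N) ^ 2 ≤
      (∑' N, if Y < N then v L j N else 0) / W * ∑ s, (∏ t, nu1 (p t) (s t)) * c s ^ 2 +
      (R * (1 + Real.log R) ^ (2 * k)) ^ 2 * (L ^ j / (Y + 1 : ℕ)) := by
  classical
  set B : ℕ → ℝ := fun _ => L ^ j / (Y + 1 : ℕ) with hBdef
  have hB0 : ∀ q, 0 ≤ B q := fun q => by rw [hBdef]; positivity
  set M : ℝ := (∑' N, if Y < N then v L j N else 0) / W with hM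
  have hM0 : 0 ≤ M := div_nonneg (tsum_nonneg fun N => by split_ifs <;> simp [v_nonneg]) (by positivity)
  have key := compare p c (fun N => if Y < N ∧ N ≡ v0 [MOD W] then v L j N else 0) (wn_sum _ L hL j) (Xc p h)
    (fun t => mu1 k (p t)) M (fun d e => B (N2 p d e)) (fun d e _ _ => by
      refine pair_red (p := p) _ _ _ _ B hB0 d e fun f _ => ?_
      obtain ⟨a, ha⟩ := S.crt v0 f
      have hq : 0 < W * Nm none p f := Nat.mul_pos S.W0 (Nm_pos none p S.hp f)
      have h1 := v_prog L hL j Y hY _ hq a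
      have e1 : ∀ N, (if Y < N ∧ N ≡ v0 [MOD W] then v L j N else 0) * ∏ t, chi (f t) (Xc p h N t) =
          if Y < N ∧ N ≡ a [MOD W * Nm none p f] then v L j N else 0 := by
        intro N
        rw [S.chi_prod]
        simp only [← ha N]
        by_cases h1 : Y < N <;> by_cases h2 : N ≡ v0 [MOD W] <;>
          by_cases h3 : ∀ t i, f t = some i → p t ∣ N + h i <;> simp [h1, h2, h3]
      simp only [e1]
      have e2 : M * ∏ t, ∑ b, mu1 k (p t) b * chi (f t) b = (∑' N, if Y < N then v L j N else 0) / (W * Nm none p f : ℕ) := by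
        rw [S.mod1, hM]; push_cast; rw [div_mul_div_comm, mul_one]
      rw [e2]
      exact h1)
  have h2 : ∑ d, ∑ e, |lam p c d| * |lam p c e| * B (N2 p d e) ≤ (R * (1 + Real.log R) ^ (2 * k)) ^ 2 * (L ^ j / (Y + 1 : ℕ)) := by
    have hl := lam_sum S.hp S.hi hc0 hc
    have e3 : ∑ d, ∑ e, |lam p c d| * |lam p c e| * B (N2 p d e) = (∑ d, |lam p c d|) ^ 2 * (L ^ j / (Y + 1 : ℕ)) := by
      rw [sq, sum_mul_sum, sum_mul]
      refine sum_congr rfl fun d _ => ?_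
      rw [sum_mul]
    rw [e3]
    have : 0 ≤ ∑ d, |lam p c d| := sum_nonneg fun _ _ => abs_nonneg _
    gcongr
  have h3 := main1 p S.p4 S.kp c
  have h4 := (abs_le.mp key).2
  have h5 := mul_le_mul_of_nonneg_left h3 hM0
  linarith

lemma S2_cmp (S : Sv W h p) (hc0 : ∀ r, R < Nm none p r → c r = 0) (hc : ∀ r, |c r| ≤ 1 / Nm none p r)
    (L : ℝ) (hL : 0 < L) (j y : ℕ) (v0 : ℕ) (m : Fin k) (hv : (v0 + h m).Coprime W) (hy : W * R ^ 2 ≤ y)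
    (hpy : ∀ t, p t ≤ y) (hmy : h m ≤ y) :
    tm L j y / (W.totient : ℝ) * ∑ s : Fin n → Option (Fin k), (∏ t, nu2 m (p t) (s t)) * (∑ r, c r * ∏ t, T2 m (r t) (s t)) ^ 2 -
      (1 + Real.log R) ^ (2 * k) * ∑ q ∈ Icc 1 (R ^ 2), (((k + 1) ^ 2 - 1 : ℕ) : ℝ) ^ om q * Eh L j y (W * q) ≤
    ∑' N, (if (N.Prime ∧ y < N) ∧ N ≡ v0 + h m [MOD W] then v L j N else 0) * Phi p c (Xc p h (N - h m)) ^ 2 := by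
  classical
  set B : ℕ → ℝ := fun q => Eh L j y (W * q) with hBdef
  have hB0 : ∀ q, 0 ≤ B q := fun q => Eh_nonneg _ _ _ _
  set M : ℝ := tm L j y / (W.totient : ℝ) with hM
  have hM0 : 0 ≤ M := div_nonneg (tsum_nonneg fun N => by split_ifs <;> simp [v_nonneg]) (by positivity)
  have key := compare p c (fun N => if (N.Prime ∧ y < N) ∧ N ≡ v0 + h m [MOD W] then v L j N else 0) (wn_sum _ L hL j)
    (fun N => Xc p h (N - h m))
    (fun t => mu2 m (p t)) M (fun d e => B (N2 p d e)) (fun d e hd he => by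
      refine pair_red (p := p) _ _ _ _ B hB0 d e fun f hfq => ?_
      by_cases hfm : ∃ t, f t = some m
      · obtain ⟨t, ht⟩ := hfm
        have e1 : ∀ N, (if (N.Prime ∧ y < N) ∧ N ≡ v0 + h m [MOD W] then v L j N else 0) *
            ∏ t, chi (f t) (Xc p h (N - h m) t) = 0 := by
          intro N
          rw [S.chi_prod]
          by_cases h1 : (N.Prime ∧ y < N) ∧ N ≡ v0 + h m [MOD W]
          · rw [if_neg (c := ∀ t i, f t = some i → p t ∣ N - h m + h i), mul_zero]
            intro H
            have h2 := H t m ht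
            rw [Nat.sub_add_cancel (by omega)] at h2
            have h3 := (Nat.prime_dvd_prime_iff_eq (S.hp t) h1.1.1).mp h2
            have := hpy t
            omega
          · rw [if_neg h1, zero_mul]
        have e2 : ∏ t, ∑ b, mu2 m (p t) b * chi (f t) b = 0 := by
          refine prod_eq_zero (mem_univ t) ?_
          rw [ht, mu_chi]; simp [mu2]
        simp only [e1, e2]
        simpa using hB0 _
      · push Not at hfm
        obtain ⟨a, ha⟩ := S.crt v0 f
        have hq : 0 < W * Nm none p f := Nat.mul_pos S.W0 (Nm_pos none p S.hp f)
        obtain ⟨ha1, ha2⟩ := (ha a).mpr (Nat.ModEq.refl _)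
        have hcop1 : (a + h m).Coprime W := by
          have := (ha1.add_right (h m)).gcd_eq
          rw [Nat.Coprime, this]; exact hv
        have hcop2 : (a + h m).Coprime (Nm none p f) := by
          refine Nat.Coprime.prod_right fun t ht => ?_
          obtain ⟨i, hfi⟩ := Option.ne_none_iff_exists'.mp (mem_filter.mp ht).2
          rw [Nat.coprime_comm, Nat.Prime.coprime_iff_not_dvd (S.hp t)]
          intro hdv
          have := S.uniq hdv (ha2 t i hfi)
          exact hfm t (by rw [hfi, this])
        have hcop3 : W.Coprime (Nm none p f) := Nat.Coprime.prod_right fun t _ => (S.pW t).symm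
        have hle : W * Nm none p f ≤ y := by
          refine le_trans (Nat.mul_le_mul_left _ ?_) hy
          rw [hfq, sq]
          exact (N2_le S.hp d e).trans (Nat.mul_le_mul (lam_supp S.hp hc0 d hd) (lam_supp S.hp hc0 e he))
        have h1 := progression hq (a + h m) (hcop1.mul_right hcop2) L hL j y hle
        have e1 : ∀ N, (if (N.Prime ∧ y < N) ∧ N ≡ v0 + h m [MOD W] then v L j N else 0) *
            ∏ t, chi (f t) (Xc p h (N - h m) t) =
            if (N.Prime ∧ y < N) ∧ N ≡ a + h m [MOD W * Nm none p f] then v L j N else 0 := by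
          intro N
          rw [S.chi_prod]
          by_cases h1 : N.Prime ∧ y < N
          · have hN : N - h m + h m = N := Nat.sub_add_cancel (by omega)
            have h2 : N ≡ v0 + h m [MOD W] ↔ N - h m ≡ v0 [MOD W] := by
              nth_rw 1 [← hN]
              exact ⟨fun H => Nat.ModEq.add_right_cancel' _ H, fun H => H.add_right _⟩
            have h3 : N ≡ a + h m [MOD W * Nm none p f] ↔ N - h m ≡ a [MOD W * Nm none p f] := by
              nth_rw 1 [← hN]
              exact ⟨fun H => Nat.ModEq.add_right_cancel' _ H, fun H => H.add_right _⟩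
            simp only [h2, h3, ← ha (N - h m)]
            by_cases h4 : N - h m ≡ v0 [MOD W] <;>
              by_cases h5 : ∀ t i, f t = some i → p t ∣ N - h m + h i <;> simp [h1, h4, h5]
          · simp [h1]
        simp only [e1]
        have e2 : M * ∏ t, ∑ b, mu2 m (p t) b * chi (f t) b = tm L j y / ((W * Nm none p f).totient : ℝ) := by
          rw [S.mod2 m f hfm, hM, Nat.totient_mul hcop3]; push_cast; rw [div_mul_div_comm, mul_one]
        rw [e2]
        exact h1)
  have h2 := lam_pair S.hp S.hi hc0 hc B hB0
  have h3 := main2 m p S.kp c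
  have h4 := (abs_le.mp key).1
  have h5 := mul_le_mul_of_nonneg_left h3 hM0
  simp only [hBdef] at h2 h4
  linarith

lemma om_mul_le (W q : ℕ) (hW : 0 < W) (hq : 0 < q) : om q ≤ om (W * q) :=
  card_le_card (Nat.primeFactors_mono (dvd_mul_left q W) (Nat.mul_pos hW hq).ne')

lemma err2 (K : ℕ) (hK : 1 ≤ K) (L : ℝ) (hL : 0 < L) (j y W z : ℕ) (hW : 0 < W) (hWz : W ≤ z) :
    ∑ q ∈ Icc 1 (z ^ 2), (K : ℝ) ^ om q * Eh L j y (W * q) ≤ ∑ q ∈ Icc 1 (z ^ 3), (K : ℝ) ^ om q * Eh L j y q := by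
  have hK' : (1 : ℝ) ≤ K := by exact_mod_cast hK
  calc _ ≤ ∑ q ∈ Icc 1 (z ^ 2), (K : ℝ) ^ om (W * q) * Eh L j y (W * q) := by
        refine sum_le_sum fun q hq => mul_le_mul_of_nonneg_right ?_ (Eh_nonneg _ _ _ _)
        exact pow_le_pow_right₀ hK' (om_mul_le W q hW (mem_Icc.mp hq).1)
    _ = ∑ q ∈ (Icc 1 (z ^ 2)).image (W * ·), (K : ℝ) ^ om q * Eh L j y q := by
        rw [sum_image]
        intro a _ b _ hab
        exact Nat.eq_of_mul_eq_mul_left hW hab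
    _ ≤ _ := by
        refine sum_le_sum_of_subset_of_nonneg ?_ fun q _ _ => mul_nonneg (by positivity) (Eh_nonneg _ _ _ _)
        intro q hq
        obtain ⟨q', hq', rfl⟩ := mem_image.mp hq
        rw [mem_Icc] at hq' ⊢
        refine ⟨Nat.mul_pos hW hq'.1, ?_⟩
        calc W * q' ≤ z * z ^ 2 := Nat.mul_le_mul hWz hq'.2
          _ = z ^ 3 := by ring

end BG

namespace BG
set_option maxHeartbeats 400000
open Finset Filter Topology

variable {n k : ℕ}

/-- product over a set of primes -/
def Pr (p : Fin n → ℕ) (T : Finset (Fin n)) : ℕ := ∏ t ∈ T, p t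

/-- colour class -/
def cl (r : Fin n → Option (Fin k)) (i : Fin k) : Finset (Fin n) := univ.filter fun t => r t = some i

lemma mem_cl (r : Fin n → Option (Fin k)) (i : Fin k) (t : Fin n) : t ∈ cl r i ↔ r t = some i := by simp [cl]

lemma cl_inj : Function.Injective (cl : (Fin n → Option (Fin k)) → Fin k → Finset (Fin n)) := by
  intro r r' h
  have h1 : ∀ t i, r t = some i ↔ r' t = some i := fun t i => by rw [← mem_cl, ← mem_cl, h]
  funext t
  exact Option.ext fun i => by simpa using h1 t i

lemma Nm_cl {M : Type*} [CommMonoid M] (F : Fin n → M) (r : Fin n → Option (Fin k)) :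
    ∏ t ∈ univ.filter (fun t => r t ≠ none), F t = ∏ i, ∏ t ∈ cl r i, F t := by
  simp only [cl, prod_filter]
  symm
  rw [Finset.prod_comm]
  symm
  refine prod_congr rfl fun t _ => ?_
  rcases hr : r t with _ | i
  · simp
  · simp

lemma Nm_Pr (p : Fin n → ℕ) (r : Fin n → Option (Fin k)) : Nm none p r = ∏ i, Pr p (cl r i) := Nm_cl p r

lemma Pr_pos (p : Fin n → ℕ) (hp : ∀ t, (p t).Prime) (T : Finset (Fin n)) : 0 < Pr p T := prod_pos fun t _ => (hp t).pos

open Classical in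
/-- colouring from disjoint classes -/
lemma cl_surj (U : Fin k → Finset (Fin n)) (hU : ∀ i i' t, t ∈ U i → t ∈ U i' → i = i') : ∃ r, cl r = U := by
  refine ⟨fun t => if H : ∃ i, t ∈ U i then some H.choose else none, ?_⟩
  funext i
  ext t
  rw [mem_cl]
  constructor
  · intro hX
    split_ifs at hX with H
    have := Option.some.inj hX
    rw [← this]; exact H.choose_spec
  · intro hd
    have H : ∃ i, t ∈ U i := ⟨i, hd⟩
    rw [dif_pos H, hU _ _ t H.choose_spec hd]

/-- sieve weights -/
noncomputable def yy (p : Fin n → ℕ) (g : ℕ → ℝ) (z : ℕ) (r : Fin n → Option (Fin k)) : ℝ :=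
  if Nm none p r ≤ z then ∏ i, g (Pr p (cl r i)) else 0

/-- sieve coefficients -/
noncomputable def cz (p : Fin n → ℕ) (g : ℕ → ℝ) (z : ℕ) (r : Fin n → Option (Fin k)) : ℝ := yy p g z r / Nm none p r

variable {p : Fin n → ℕ} {g : ℕ → ℝ} {z : ℕ}

lemma cz_nonneg (hg0 : ∀ a, 0 ≤ g a) (r : Fin n → Option (Fin k)) : 0 ≤ cz p g z r := by
  unfold cz yy
  refine div_nonneg ?_ (by positivity)
  split_ifs
  · exact prod_nonneg fun i _ => hg0 _
  · exact le_rfl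

lemma cz_supp (r : Fin n → Option (Fin k)) (h : z < Nm none p r) : cz p g z r = 0 := by
  unfold cz yy
  rw [if_neg (by omega), zero_div]

lemma cz_le (hg0 : ∀ a, 0 ≤ g a) (hg1 : ∀ a, g a ≤ 1) (r : Fin n → Option (Fin k)) : |cz p g z r| ≤ 1 / Nm none p r := by
  rw [abs_of_nonneg (cz_nonneg hg0 r)]
  unfold cz yy
  refine div_le_div_of_nonneg_right ?_ (by positivity)
  split_ifs
  · exact prod_le_one (fun i _ => hg0 _) fun i _ => hg1 _
  · exact zero_le_one

/-- first moment sum -/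
noncomputable def A1 (p : Fin n → ℕ) (g : ℕ → ℝ) : ℝ := ∑ T, g (Pr p T) / Pr p T
/-- second moment sum -/
noncomputable def A2 (p : Fin n → ℕ) (g : ℕ → ℝ) : ℝ := ∑ T, g (Pr p T) ^ 2 / Pr p T
/-- logarithmic second moment sum -/
noncomputable def A3 (p : Fin n → ℕ) (g : ℕ → ℝ) : ℝ := ∑ T, g (Pr p T) ^ 2 / Pr p T * Real.log (Pr p T)

lemma sum_tuples {α : Type*} [Fintype α] [DecidableEq α] (F : Fin k → α → ℝ) : ∑ U : Fin k → α, ∏ i, F i (U i) = ∏ i, ∑ T, F i T := by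
  rw [prod_univ_sum, Fintype.piFinset_univ]

lemma MT1 (hg0 : ∀ a, 0 ≤ g a) (hp : ∀ t, (p t).Prime) :
    ∑ s : Fin n → Option (Fin k), (∏ t, nu1 (p t) (s t)) * cz p g z s ^ 2 ≤ (∏ t, (1 + 2 / (p t : ℝ) ^ 2)) * A2 p g ^ k := by
  have h1 : ∀ s : Fin n → Option (Fin k), (∏ t, nu1 (p t) (s t)) * cz p g z s ^ 2 ≤
      (∏ t, (1 + 2 / (p t : ℝ) ^ 2)) * ∏ i, (g (Pr p (cl s i)) ^ 2 / Pr p (cl s i)) := by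
    intro s
    have e1 : ∏ t, nu1 (p t) (s t) = (∏ t, (1 + 2 / (p t : ℝ) ^ 2)) * Nm none p s := by
      unfold Nm
      rw [Nat.cast_prod, prod_filter, ← prod_mul_distrib]
      refine prod_congr rfl fun t _ => ?_
      rcases s t with _ | i <;> simp [nu1]
    rw [e1, mul_assoc]
    refine mul_le_mul_of_nonneg_left ?_ (prod_nonneg fun t _ => by positivity)
    have hN : (0 : ℝ) < Nm none p s := by exact_mod_cast Nm_pos none p hp s
    have e2 : (Nm none p s : ℝ) * cz p g z s ^ 2 = yy p g z s ^ 2 / Nm none p s := by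
      unfold cz; field_simp
    rw [e2, prod_div_distrib, ← Nat.cast_prod, ← Nm_Pr, prod_pow]
    refine div_le_div_of_nonneg_right ?_ hN.le
    unfold yy
    split_ifs
    · exact le_rfl
    · rw [zero_pow two_ne_zero]; positivity
  refine (sum_le_sum fun s _ => h1 s).trans ?_
  rw [← mul_sum]
  refine mul_le_mul_of_nonneg_left ?_ (prod_nonneg fun t _ => by positivity)
  have e3 : A2 p g ^ k = ∑ U : Fin k → Finset (Fin n), ∏ i, (g (Pr p (U i)) ^ 2 / Pr p (U i)) := by
    rw [sum_tuples (fun _ T => g (Pr p T) ^ 2 / Pr p T)]; simp [A2]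
  rw [e3, ← sum_image (f := fun U : Fin k → Finset (Fin n) => ∏ i, (g (Pr p (U i)) ^ 2 / Pr p (U i))) (g := cl) (s := univ) cl_inj.injOn]
  exact sum_le_sum_of_subset_of_nonneg (subset_univ _) fun U _ _ => prod_nonneg fun i _ => by positivity

/-- removing a prime -/
lemma sum_mem_le (F : ℕ → ℝ) (hF0 : ∀ a, 0 ≤ F a) (hF : ∀ a b, a ≤ b → F b ≤ F a) (hp : ∀ t, (p t).Prime) (t : Fin n) :
    ∑ T, (if t ∈ T then F (Pr p T) / Pr p T else 0) ≤ (1 / p t) * ∑ T, F (Pr p T) / Pr p T := by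
  rw [← sum_filter, mul_sum]
  have hpos : (0 : ℝ) < p t := by exact_mod_cast (hp t).pos
  have h1 : ∀ T ∈ univ.filter (fun T : Finset (Fin n) => t ∈ T), F (Pr p T) / Pr p T ≤ 1 / p t * (F (Pr p (T.erase t)) / Pr p (T.erase t)) := by
    intro T hT
    have hT := (mem_filter.mp hT).2
    have e : Pr p T = p t * Pr p (T.erase t) := by unfold Pr; rw [mul_prod_erase _ _ hT]
    have hq : (0 : ℝ) < Pr p (T.erase t) := by exact_mod_cast Pr_pos p hp _
    have h2 : F (Pr p T) ≤ F (Pr p (T.erase t)) := hF _ _ (by rw [e]; exact Nat.le_mul_of_pos_left _ (hp t).pos)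
    have e2 : (Pr p T : ℝ) = p t * Pr p (T.erase t) := by exact_mod_cast e
    rw [e2, one_div_mul_eq_div, div_div, mul_comm (Pr p (T.erase t) : ℝ)]
    exact div_le_div_of_nonneg_right h2 (by positivity)
  refine (sum_le_sum h1).trans ?_
  rw [← sum_image (f := fun T => 1 / (p t : ℝ) * (F (Pr p T) / Pr p T)) (g := fun T : Finset (Fin n) => T.erase t)]
  · exact sum_le_sum_of_subset_of_nonneg (subset_univ _) fun T _ _ => mul_nonneg (by positivity) (div_nonneg (hF0 _) (by positivity))
  · intro T hT T' hT' h
    have hT := (mem_filter.mp hT).2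
    have hT' := (mem_filter.mp hT').2
    simp only at h
    rw [← insert_erase hT, h, insert_erase hT']

lemma prod_one_sub {ι : Type*} (S : Finset ι) (x : ι → ℝ) (h0 : ∀ i ∈ S, 0 ≤ x i) (h1 : ∀ i ∈ S, x i ≤ 1) :
    1 - ∑ i ∈ S, x i ≤ ∏ i ∈ S, (1 - x i) := by
  classical
  induction S using Finset.induction_on with
  | empty => simp
  | insert a S ha ih =>
    rw [sum_insert ha, prod_insert ha]
    have h2 := ih (fun i hi => h0 i (mem_insert_of_mem hi)) (fun i hi => h1 i (mem_insert_of_mem hi))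
    have h3 : 0 ≤ ∑ i ∈ S, x i := sum_nonneg fun i hi => h0 i (mem_insert_of_mem hi)
    have h4 := h0 a (mem_insert_self _ _)
    have h5 := h1 a (mem_insert_self _ _)
    nlinarith

end BG

namespace BG
set_option maxHeartbeats 400000
open Finset Filter Topology

variable {n k : ℕ} {p : Fin n → ℕ} {g : ℕ → ℝ} {z : ℕ}

/-- extend a colouring by colour m on a -/
def ext (m : Fin k) (s : Fin n → Option (Fin k)) (a : Finset (Fin n)) : Fin n → Option (Fin k) :=
  fun t => if t ∈ a then some m else s t

lemma cl_ext (m : Fin k) (s : Fin n → Option (Fin k)) (a : Finset (Fin n)) (hs : ∀ t, s t ≠ some m)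
    (ha : ∀ t ∈ a, s t = none) (i : Fin k) : cl (ext m s a) i = if i = m then a else cl s i := by
  ext t
  rw [mem_cl]
  unfold ext
  by_cases hi : i = m
  · subst hi
    simp only [if_true]
    by_cases ht : t ∈ a
    · simp [ht]
    · simp [ht, hs t]
  · rw [if_neg hi, mem_cl]
    by_cases ht : t ∈ a
    · simp [ht, ha t ht, Ne.symm hi]
    · simp [ht]

lemma Nm_ext (m : Fin k) (s : Fin n → Option (Fin k)) (a : Finset (Fin n)) (hs : ∀ t, s t ≠ some m)
    (ha : ∀ t ∈ a, s t = none) : Nm none p (ext m s a) = Nm none p s * Pr p a := by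
  have hm : cl s m = ∅ := by ext t; simp [mem_cl, hs t]
  rw [Nm_Pr, Nm_Pr, ← mul_prod_erase _ _ (mem_univ m), ← mul_prod_erase _ (fun i => Pr p (cl s i)) (mem_univ m)]
  rw [cl_ext m s a hs ha m, if_pos rfl, hm]
  have : ∏ i ∈ univ.erase m, Pr p (cl (ext m s a) i) = ∏ i ∈ univ.erase m, Pr p (cl s i) := by
    refine prod_congr rfl fun i hi => ?_
    rw [cl_ext m s a hs ha i, if_neg (ne_of_mem_erase hi)]
  rw [this]
  simp [Pr]; ring

lemma A1_half (hg0 : ∀ a, 0 ≤ g a) (hg : ∀ a b, a ≤ b → g b ≤ g a) (hp : ∀ t, (p t).Prime) (Q : Finset (Fin n))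
    (hQ : ∑ t ∈ Q, 1 / (p t : ℝ) ≤ 1 / 2) : A1 p g / 2 ≤ ∑ a ∈ univ.filter (fun a => Disjoint a Q), g (Pr p a) / Pr p a := by
  classical
  have h0 : ∀ a : Finset (Fin n), 0 ≤ g (Pr p a) / Pr p a := fun a => div_nonneg (hg0 _) (by positivity)
  have hA : 0 ≤ A1 p g := sum_nonneg fun a _ => h0 a
  have h1 : A1 p g = ∑ a ∈ univ.filter (fun a => Disjoint a Q), g (Pr p a) / Pr p a +
      ∑ a ∈ univ.filter (fun a => ¬ Disjoint a Q), g (Pr p a) / Pr p a := by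
    rw [sum_filter_add_sum_filter_not]; rfl
  have h2 : ∑ a ∈ univ.filter (fun a => ¬ Disjoint a Q), g (Pr p a) / Pr p a ≤
      ∑ t ∈ Q, ∑ a, (if t ∈ a then g (Pr p a) / Pr p a else 0) := by
    rw [sum_comm, sum_filter]
    refine sum_le_sum fun a _ => ?_
    by_cases hd : ¬ Disjoint a Q
    · rw [if_pos hd]
      obtain ⟨t, ht, htQ⟩ := not_disjoint_iff.mp hd
      refine le_trans ?_ (single_le_sum (f := fun t => if t ∈ a then g (Pr p a) / Pr p a else 0) (fun t _ => ?_) htQ)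
      · simp [ht]
      · split_ifs
        · exact h0 a
        · exact le_rfl
    · rw [if_neg hd]
      exact sum_nonneg fun t _ => by split_ifs; exacts [h0 a, le_rfl]
  have h3 : ∑ t ∈ Q, ∑ a, (if t ∈ a then g (Pr p a) / Pr p a else 0) ≤ (∑ t ∈ Q, 1 / (p t : ℝ)) * A1 p g := by
    rw [sum_mul]
    exact sum_le_sum fun t _ => sum_mem_le g hg0 hg hp t
  have h4 := mul_le_mul_of_nonneg_right hQ hA
  linarith

/-- good m-free colourings -/
def good (p : Fin n → ℕ) (z : ℕ) (m : Fin k) (s : Fin n → Option (Fin k)) : Prop :=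
  (∀ t, s t ≠ some m) ∧ Nm none p s ^ 2 ≤ z ∧ ∑ t ∈ univ.filter (fun t => s t ≠ none), (k : ℝ) / p t ≤ 1 / 2

/-- tuple weights -/
noncomputable def GG (p : Fin n → ℕ) (g : ℕ → ℝ) (m i : Fin k) (T : Finset (Fin n)) : ℝ :=
  if i = m then (if T = ∅ then 1 else 0) else g (Pr p T) ^ 2 / Pr p T

lemma GG_nonneg (m i : Fin k) (T : Finset (Fin n)) : 0 ≤ GG p g m i T := by
  unfold GG
  split_ifs <;> positivity

lemma good_term (hg0 : ∀ a, 0 ≤ g a) (hg : ∀ a b, a ≤ b → g b ≤ g a) (hgz : ∀ a, g a ≠ 0 → a ^ 2 ≤ z)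
    (hp : ∀ t, (p t).Prime) (hk : ∀ t, k < p t) (m : Fin k) (s : Fin n → Option (Fin k)) (hs : good p z m s) :
    A1 p g ^ 2 / 8 * ∏ i, GG p g m i (cl s i) ≤ (∏ t, nu2 m (p t) (s t)) * (∑ r, cz p g z r * ∏ t, T2 m (r t) (s t)) ^ 2 := by
  classical
  obtain ⟨hsm, hsz, hsk⟩ := hs
  have hN : (0 : ℝ) < Nm none p s := by exact_mod_cast Nm_pos none p hp s
  have hpp : ∀ t, (0 : ℝ) < p t := fun t => by exact_mod_cast (hp t).pos
  have hm : cl s m = ∅ := by ext t; simp [mem_cl, hsm t]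
  have hk1 : (1 : ℝ) ≤ k := by exact_mod_cast (by have := m.isLt; omega : 1 ≤ k)
  set Q : ℝ := ∏ i, (if i = m then 1 else g (Pr p (cl s i))) with hQ
  have hQ0 : 0 ≤ Q := prod_nonneg fun i _ => by split_ifs; exacts [zero_le_one, hg0 _]
  have hA : 0 ≤ A1 p g := sum_nonneg fun a _ => div_nonneg (hg0 _) (by positivity)
  -- nu2 product
  have h1 : (Nm none p s : ℝ) / 2 ≤ ∏ t, nu2 m (p t) (s t) := by
    have e1 : ∏ t, nu2 m (p t) (s t) = Nm none p s * ∏ t ∈ univ.filter (fun t => s t ≠ none), (1 - (k : ℝ) / p t) := by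
      unfold Nm
      rw [Nat.cast_prod, ← prod_mul_distrib, prod_filter]
      refine prod_congr rfl fun t _ => ?_
      rcases hst : s t with _ | i
      · simp [nu2]
      · have : i ≠ m := fun e => hsm t (by rw [hst, e])
        have := hpp t
        simp [nu2, *]
        field_simp
    rw [e1]
    have h2 := prod_one_sub (univ.filter (fun t => s t ≠ none)) (fun t => (k : ℝ) / p t) (fun t _ => by positivity)
      (fun t _ => by rw [div_le_one (hpp t)]; exact_mod_cast (hk t).le)
    have h3 : (1 : ℝ) / 2 ≤ ∏ t ∈ univ.filter (fun t => s t ≠ none), (1 - (k : ℝ) / p t) := by linarith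
    have := mul_le_mul_of_nonneg_left h3 hN.le
    linarith
  -- inner sum
  have h2 : Q / Nm none p s * (A1 p g / 2) ≤ ∑ r, cz p g z r * ∏ t, T2 m (r t) (s t) := by
    have h3 : A1 p g / 2 ≤ ∑ a ∈ univ.filter (fun a => Disjoint a (univ.filter fun t => s t ≠ none)), g (Pr p a) / Pr p a := by
      refine A1_half hg0 hg hp _ (le_trans (sum_le_sum fun t _ => ?_) hsk)
      have := hpp t
      gcongr
    refine (mul_le_mul_of_nonneg_left h3 (by positivity)).trans ?_
    rw [mul_sum]
    have hdisj : ∀ a ∈ univ.filter (fun a => Disjoint a (univ.filter fun t => s t ≠ none)), ∀ t ∈ a, s t = none := by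
      intro a ha t hta
      by_contra hne
      exact disjoint_left.mp (mem_filter.mp ha).2 hta (mem_filter.mpr ⟨mem_univ _, hne⟩)
    have h4 : ∀ a ∈ univ.filter (fun a => Disjoint a (univ.filter fun t => s t ≠ none)),
        Q / Nm none p s * (g (Pr p a) / Pr p a) = cz p g z (ext m s a) * ∏ t, T2 m (ext m s a t) (s t) := by
      intro a ha
      have hda := hdisj a ha
      have e1 : ∏ t, T2 m (ext m s a t) (s t) = 1 := by
        refine prod_eq_one fun t _ => ?_
        unfold ext
        by_cases hta : t ∈ a
        · rw [if_pos hta, hda t hta]; simp [T2]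
        · rw [if_neg hta]
          rcases s t with _ | i <;> simp [T2]
      have e2 : ∏ i, g (Pr p (cl (ext m s a) i)) = g (Pr p a) * Q := by
        rw [hQ, ← mul_prod_erase _ _ (mem_univ m), ← mul_prod_erase _ (fun i => if i = m then 1 else g (Pr p (cl s i))) (mem_univ m),
          cl_ext m s a hsm hda m, if_pos rfl, if_pos rfl, one_mul]
        congr 1
        refine prod_congr rfl fun i hi => ?_
        rw [cl_ext m s a hsm hda i, if_neg (ne_of_mem_erase hi), if_neg (ne_of_mem_erase hi)]
      rw [e1, mul_one]
      unfold cz yy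
      rw [e2, Nm_ext m s a hsm hda]
      by_cases hga : g (Pr p a) = 0
      · simp [hga]
      · have h5 := hgz _ hga
        have h6 : Nm none p s * Pr p a ≤ z := by
          by_contra hlt
          push Not at hlt
          have h7 : (Nm none p s * Pr p a) ^ 2 ≤ z ^ 2 := by
            rw [mul_pow, sq z]; exact Nat.mul_le_mul hsz h5
          exact absurd (Nat.pow_lt_pow_left hlt two_ne_zero) (by omega)
        rw [if_pos h6]; push_cast
        rw [div_mul_div_comm, mul_comm Q]
    rw [sum_congr rfl h4, ← sum_image (f := fun r => cz p g z r * ∏ t, T2 m (r t) (s t)) (g := ext m s)]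
    · refine sum_le_sum_of_subset_of_nonneg (subset_univ _) fun r _ _ => mul_nonneg (cz_nonneg hg0 r) (prod_nonneg fun t _ => ?_)
      rcases s t with _ | i <;> simp only [T2] <;> split_ifs <;> norm_num
    · intro a ha b hb hab
      have := cl_ext m s a hsm (hdisj a ha) m
      rw [hab, cl_ext m s b hsm (hdisj b hb) m, if_pos rfl, if_pos rfl] at this
      exact this.symm
  have h3 : 0 ≤ Q / Nm none p s * (A1 p g / 2) := by positivity
  have e4 : ∏ i, GG p g m i (cl s i) = Q ^ 2 / Nm none p s := by
    rw [Nm_Pr, hQ, Nat.cast_prod, ← prod_pow, ← prod_div_distrib]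
    refine prod_congr rfl fun i _ => ?_
    unfold GG
    by_cases hi : i = m
    · subst hi; simp [hm, Pr]
    · rw [if_neg hi, if_neg hi]
  calc A1 p g ^ 2 / 8 * ∏ i, GG p g m i (cl s i) = (Nm none p s : ℝ) / 2 * (Q / Nm none p s * (A1 p g / 2)) ^ 2 := by
        rw [e4]; field_simp; ring
    _ ≤ _ := mul_le_mul h1 (pow_le_pow_left₀ h3 h2 2) (sq_nonneg _) (le_trans (by positivity) h1)

lemma tuple_exp (m : Fin k) (φ : Fin k → Finset (Fin n) → ℝ) (κ : Fin k → ℝ) (hφ : ∀ i T, 0 ≤ φ i T)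
    (h : ∀ i, ∑ T, GG p g m i T * φ i T ≤ κ i * ∑ T, GG p g m i T) :
    ∑ U : Fin k → Finset (Fin n), (∏ i, GG p g m i (U i)) * ∏ i, φ i (U i) ≤ (∏ i, κ i) * ∏ i, ∑ T, GG p g m i T := by
  simp only [← prod_mul_distrib]
  rw [sum_tuples (fun i T => GG p g m i T * φ i T)]
  exact prod_le_prod (fun i _ => sum_nonneg fun T _ => mul_nonneg (GG_nonneg _ _ _) (hφ _ _)) fun i _ => h i

lemma exp1 (m i0 : Fin k) (ψ : Finset (Fin n) → ℝ) (κ : ℝ) (hψ : ∀ T, 0 ≤ ψ T)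
    (h : ∑ T, GG p g m i0 T * ψ T ≤ κ * ∑ T, GG p g m i0 T) :
    ∑ U : Fin k → Finset (Fin n), (∏ i, GG p g m i (U i)) * ψ (U i0) ≤ κ * ∏ i, ∑ T, GG p g m i T := by
  have := tuple_exp (p := p) (g := g) m (fun i T => if i = i0 then ψ T else 1) (fun i => if i = i0 then κ else 1)
    (fun i T => by split_ifs; exacts [hψ T, zero_le_one]) (fun i => by
      by_cases hi : i = i0
      · subst hi; simpa using h
      · simp [hi])
  simpa using this

lemma GG_mem (hg0 : ∀ a, 0 ≤ g a) (hg : ∀ a b, a ≤ b → g b ≤ g a) (hp : ∀ t, (p t).Prime) (m i : Fin k) (t : Fin n) :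
    ∑ T, GG p g m i T * (if t ∈ T then 1 else 0) ≤ 1 / p t * ∑ T, GG p g m i T := by
  by_cases hi : i = m
  · have : ∀ T : Finset (Fin n), GG p g m i T * (if t ∈ T then 1 else 0) = 0 := by
      intro T
      unfold GG
      rw [if_pos hi]
      by_cases hT : T = ∅
      · simp [hT]
      · simp [hT]
    rw [sum_congr rfl fun T _ => this T, sum_const_zero]
    exact mul_nonneg (by positivity) (sum_nonneg fun T _ => GG_nonneg _ _ _)
  · have := sum_mem_le (p := p) (fun a => g a ^ 2) (fun a => sq_nonneg _) (fun a b hab => pow_le_pow_left₀ (hg0 _) (hg a b hab) 2) hp t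
    simp only [GG, if_neg hi, mul_ite, mul_one, mul_zero]
    exact this

lemma exp2 (hg0 : ∀ a, 0 ≤ g a) (hg : ∀ a b, a ≤ b → g b ≤ g a) (hp : ∀ t, (p t).Prime) (m i0 i1 : Fin k) (hne : i0 ≠ i1) (t : Fin n) :
    ∑ U : Fin k → Finset (Fin n), (∏ i, GG p g m i (U i)) * ((if t ∈ U i0 then 1 else 0) * (if t ∈ U i1 then 1 else 0)) ≤
      1 / (p t : ℝ) ^ 2 * ∏ i, ∑ T, GG p g m i T := by
  have := tuple_exp (p := p) (g := g) m (fun i T => if i ∈ ({i0, i1} : Finset (Fin k)) then (if t ∈ T then 1 else 0) else 1)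
    (fun i => if i ∈ ({i0, i1} : Finset (Fin k)) then 1 / (p t : ℝ) else 1)
    (fun i T => by split_ifs <;> norm_num) (fun i => by
      by_cases hi : i ∈ ({i0, i1} : Finset (Fin k))
      · simp only [hi, if_true]; exact GG_mem hg0 hg hp m i t
      · simp [hi])
  have e : ∀ F : Fin k → ℝ, (∏ i, if i ∈ ({i0, i1} : Finset (Fin k)) then F i else 1) = F i0 * F i1 := by
    intro F
    rw [← prod_filter, filter_mem_eq_inter, univ_inter, prod_pair hne]
  rw [e (fun _ => 1 / (p t : ℝ))] at this
  have e2 : ∀ U : Fin k → Finset (Fin n), (∏ i, if i ∈ ({i0, i1} : Finset (Fin k)) then (if t ∈ U i then (1 : ℝ) else 0) else 1) =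
    (if t ∈ U i0 then 1 else 0) * (if t ∈ U i1 then 1 else 0) := fun U => e (fun i => if t ∈ U i then 1 else 0)
  simp only [e2] at this
  calc _ ≤ _ := this
    _ = _ := by ring

lemma GG_tot (m : Fin k) : ∏ i, ∑ T, GG p g m i T = A2 p g ^ (k - 1) := by
  rw [← mul_prod_erase _ _ (mem_univ m)]
  have e1 : ∑ T, GG p g m m T = 1 := by simp [GG]
  rw [e1, one_mul, prod_congr rfl (g := fun _ => A2 p g), prod_const, card_erase_of_mem (mem_univ m), card_univ, Fintype.card_fin]
  intro i hi
  unfold A2 GG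
  simp only [if_neg (ne_of_mem_erase hi)]

open Classical in
lemma good_mass (hg0 : ∀ a, 0 ≤ g a) (hg : ∀ a b, a ≤ b → g b ≤ g a)
    (hp : ∀ t, (p t).Prime) (hz : 2 ≤ z) (h1 : 3 * (k : ℝ) ^ 2 * ∑ t, 1 / (p t : ℝ) ^ 2 ≤ 1 / 4) (κ : ℝ) (hκ : 0 ≤ κ)
    (h2 : A3 p g ≤ κ * A2 p g) (h3 : 8 * k * κ ≤ Real.log z) (m : Fin k) :
    A2 p g ^ (k - 1) / 2 ≤ ∑ s ∈ univ.filter (good p z m), ∏ i, GG p g m i (cl s i) := by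
  have hlz : 0 < Real.log z := Real.log_pos (by exact_mod_cast (by omega : 1 < z))
  have hlP : ∀ T, 0 ≤ Real.log (Pr p T) := fun T => Real.log_natCast_nonneg _
  set F : (Fin k → Finset (Fin n)) → ℝ := fun U => ∏ i, GG p g m i (U i) with hF
  have hF0 : ∀ U, 0 ≤ F U := fun U => prod_nonneg fun i _ => GG_nonneg _ _ _
  set tot : ℝ := ∏ i, ∑ T, GG p g m i T with htot
  have htot0 : 0 ≤ tot := prod_nonneg fun i _ => sum_nonneg fun T _ => GG_nonneg _ _ _
  set X1 : (Fin k → Finset (Fin n)) → ℝ := fun U => ∑ x ∈ (univ : Finset (Fin k)).offDiag, ∑ t,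
    ((if t ∈ U x.1 then 1 else 0) * (if t ∈ U x.2 then 1 else 0)) with hX1
  set X2 : (Fin k → Finset (Fin n)) → ℝ := fun U => ∑ i, ∑ t, 2 * (k : ℝ) / p t * (if t ∈ U i then 1 else 0) with hX2
  set X3 : (Fin k → Finset (Fin n)) → ℝ := fun U => ∑ i, 2 / Real.log z * Real.log (Pr p (U i)) with hX3
  have hX1n : ∀ U, 0 ≤ X1 U := fun U => sum_nonneg fun x _ => sum_nonneg fun t _ => by positivity
  have hX2n : ∀ U, 0 ≤ X2 U := fun U => sum_nonneg fun x _ => sum_nonneg fun t _ => by positivity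
  have hX3n : ∀ U, 0 ≤ X3 U := fun U => sum_nonneg fun x _ => mul_nonneg (by positivity) (hlP _)
  set σ : ℝ := ∑ t, 1 / (p t : ℝ) ^ 2 with hσ
  have hσ0 : 0 ≤ σ := sum_nonneg fun t _ => by positivity
  have b1 : ∑ U, F U * X1 U ≤ (k : ℝ) ^ 2 * σ * tot := by
    simp only [hX1, mul_sum]
    rw [sum_comm]
    have : ∀ x ∈ (univ : Finset (Fin k)).offDiag, ∑ U, ∑ t, F U * ((if t ∈ U x.1 then 1 else 0) * (if t ∈ U x.2 then 1 else 0)) ≤ σ * tot := by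
      intro x hx
      rw [sum_comm, hσ, sum_mul]
      exact sum_le_sum fun t _ => exp2 hg0 hg hp m x.1 x.2 (mem_offDiag.mp hx).2.2 t
    refine (sum_le_sum this).trans ?_
    rw [sum_const, nsmul_eq_mul, mul_assoc]
    refine mul_le_mul_of_nonneg_right ?_ (by positivity)
    rw [offDiag_card, card_univ, Fintype.card_fin]
    have : k * k - k ≤ k ^ 2 := by rw [sq]; exact Nat.sub_le _ _
    exact_mod_cast this
  have b2 : ∑ U, F U * X2 U ≤ 2 * (k : ℝ) ^ 2 * σ * tot := by
    simp only [hX2, mul_sum]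
    rw [sum_comm]
    have : ∀ i ∈ (univ : Finset (Fin k)), ∑ U, ∑ t, F U * (2 * (k : ℝ) / p t * (if t ∈ U i then 1 else 0)) ≤ 2 * k * σ * tot := by
      intro i _
      rw [sum_comm, hσ, mul_sum, sum_mul]
      refine sum_le_sum fun t _ => ?_
      have h5 := exp1 (p := p) (g := g) m i (fun T => if t ∈ T then 1 else 0) (1 / p t) (fun T => by positivity) (GG_mem hg0 hg hp m i t)
      calc _ = 2 * (k : ℝ) / p t * ∑ U, F U * (if t ∈ U i then 1 else 0) := by
            rw [mul_sum]; exact sum_congr rfl fun U _ => by ring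
        _ ≤ 2 * (k : ℝ) / p t * (1 / p t * tot) := mul_le_mul_of_nonneg_left h5 (by positivity)
        _ = _ := by ring
    refine (sum_le_sum this).trans ?_
    rw [sum_const, nsmul_eq_mul, card_univ, Fintype.card_fin]
    exact le_of_eq (by ring)
  have b3 : ∑ U, F U * X3 U ≤ tot / 4 := by
    simp only [hX3, mul_sum]
    rw [sum_comm]
    have : ∀ i ∈ (univ : Finset (Fin k)), ∑ U, F U * (2 / Real.log z * Real.log (Pr p (U i))) ≤ 2 / Real.log z * (κ * tot) := by
      intro i _
      have h5 := exp1 (p := p) (g := g) m i (fun T => Real.log (Pr p T)) κ hlP (by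
        by_cases hi : i = m
        · subst hi
          have : ∑ T, GG p g i i T * Real.log (Pr p T) = 0 := by
            refine sum_eq_zero fun T _ => ?_
            unfold GG
            by_cases hT : T = ∅ <;> simp [hT, Pr]
          rw [this]
          exact mul_nonneg hκ (sum_nonneg fun T _ => GG_nonneg _ _ _)
        · simp only [GG, if_neg hi]; exact h2)
      calc _ = 2 / Real.log z * ∑ U, F U * Real.log (Pr p (U i)) := by
            rw [mul_sum]; exact sum_congr rfl fun U _ => by ring
        _ ≤ _ := mul_le_mul_of_nonneg_left h5 (by positivity)
    refine (sum_le_sum this).trans ?_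
    rw [sum_const, nsmul_eq_mul, card_univ, Fintype.card_fin]
    have h6 : (k : ℝ) * (2 / Real.log z * (κ * tot)) = (8 * k * κ) / Real.log z * (tot / 4) := by ring
    rw [h6]
    have h7 : (8 * k * κ) / Real.log z ≤ 1 := by rw [div_le_one hlz]; exact h3
    have := mul_le_mul_of_nonneg_right h7 (by positivity : 0 ≤ tot / 4)
    linarith
  have b0 : ∑ U, F U = tot := sum_tuples _
  have main : ∑ U, F U * (1 - X1 U - X2 U - X3 U) ≤ ∑ s ∈ univ.filter (good p z m), F (cl s) := by
    rw [← sum_image (f := F) (g := cl) cl_inj.injOn, ← sum_filter_add_sum_filter_not univ (· ∈ (univ.filter (good p z m)).image cl)]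
    have c1 : ∑ U ∈ univ.filter (· ∈ (univ.filter (good p z m)).image cl), F U * (1 - X1 U - X2 U - X3 U) ≤
        ∑ U ∈ (univ.filter (good p z m)).image cl, F U := by
      rw [filter_mem_eq_inter, univ_inter]
      refine sum_le_sum fun U _ => mul_le_of_le_one_right (hF0 U) ?_
      have := hX1n U; have := hX2n U; have := hX3n U
      linarith
    have c2 : ∑ U ∈ univ.filter (· ∉ (univ.filter (good p z m)).image cl), F U * (1 - X1 U - X2 U - X3 U) ≤ 0 := by
      refine sum_nonpos fun U hU => ?_
      have hU := (mem_filter.mp hU).2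
      have n1 := hX1n U
      have n2 := hX2n U
      have n3 := hX3n U
      by_cases hFU : F U = 0
      · rw [hFU, zero_mul]
      refine mul_nonpos_of_nonneg_of_nonpos (hF0 U) ?_
      by_cases hdis : ∀ i i' t, t ∈ U i → t ∈ U i' → i = i'
      · obtain ⟨s, hs⟩ := cl_surj U hdis
        have hUm : U m = ∅ := by
          by_contra hne
          apply hFU
          refine prod_eq_zero (mem_univ m) ?_
          simp [GG, hne]
        have hng : ¬ good p z m s := fun hgd => hU (mem_image.mpr ⟨s, mem_filter.mpr ⟨mem_univ _, hgd⟩, hs⟩)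
        have hsm : ∀ t, s t ≠ some m := by
          intro t ht
          have : t ∈ U m := by rw [← hs, mem_cl]; exact ht
          rw [hUm] at this
          simp at this
        by_cases hN : Nm none p s ^ 2 ≤ z
        · have hbig : 1 / 2 < ∑ t ∈ univ.filter (fun t => s t ≠ none), (k : ℝ) / p t := by
            by_contra hle
            exact hng ⟨hsm, hN, not_lt.mp hle⟩
          have e : ∑ t ∈ univ.filter (fun t => s t ≠ none), (k : ℝ) / p t ≤ ∑ i, ∑ t ∈ U i, (k : ℝ) / p t := by
            have := Nm_cl (fun t => Multiplicative.ofAdd ((k : ℝ) / p t)) s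
            rw [← ofAdd_sum, prod_congr rfl fun i _ => (ofAdd_sum _ _).symm, ← ofAdd_sum] at this
            have := Multiplicative.ofAdd.injective this
            rw [this, hs]
          have e2 : X2 U = 2 * ∑ i, ∑ t ∈ U i, (k : ℝ) / p t := by
            simp only [hX2, mul_sum]
            refine sum_congr rfl fun i _ => ?_
            simp only [mul_ite, mul_one, mul_zero]
            rw [← sum_filter, filter_mem_eq_inter, univ_inter]
            exact sum_congr rfl fun t _ => by ring
          linarith
        · have e : X3 U = 2 / Real.log z * Real.log (Nm none p s) := by
            rw [Nm_Pr, Nat.cast_prod, Real.log_prod, hs, mul_sum]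
            intro i _
            have := Pr_pos p hp (cl s i)
            positivity
          have h5 : Real.log z ≤ 2 * Real.log (Nm none p s) := by
            have : Real.log ((z : ℕ) : ℝ) ≤ Real.log ((Nm none p s : ℝ) ^ 2) := by
              refine Real.log_le_log (by exact_mod_cast (by omega : 0 < z)) ?_
              exact_mod_cast (not_le.mp hN).le
            rwa [Real.log_pow] at this
          have h6 : 1 ≤ X3 U := by
            rw [e, div_mul_eq_mul_div, le_div_iff₀ hlz]; linarith
          linarith
      · push Not at hdis
        obtain ⟨i, i', t, ht, ht', hne⟩ := hdis
        have h5 : 1 ≤ X1 U := by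
          refine le_trans ?_ (single_le_sum (f := fun x : Fin k × Fin k => ∑ t, ((if t ∈ U x.1 then (1 : ℝ) else 0) * (if t ∈ U x.2 then 1 else 0)))
            (fun x _ => sum_nonneg fun t _ => by positivity) (show ((i, i') : Fin k × Fin k) ∈ (univ : Finset (Fin k)).offDiag by simp [hne]))
          refine le_trans ?_ (single_le_sum (f := fun t => ((if t ∈ U i then (1 : ℝ) else 0) * (if t ∈ U i' then 1 else 0)))
            (fun t _ => by positivity) (mem_univ t))
          simp [ht, ht']
        linarith
    linarith
  have e9 : ∑ U, F U * (1 - X1 U - X2 U - X3 U) = ∑ U, F U - ∑ U, F U * X1 U - ∑ U, F U * X2 U - ∑ U, F U * X3 U := by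
    rw [← sum_sub_distrib, ← sum_sub_distrib, ← sum_sub_distrib]
    exact sum_congr rfl fun U _ => by ring
  rw [← GG_tot (p := p) (g := g) m]
  have h9 := mul_le_mul_of_nonneg_right h1 htot0
  change tot / 2 ≤ _
  have h10 : ∑ s ∈ univ.filter (good p z m), F (cl s) = ∑ s ∈ univ.filter (good p z m), ∏ i, GG p g m i (cl s i) := rfl
  rw [← h10]
  nlinarith

lemma MT2 (hg0 : ∀ a, 0 ≤ g a) (hg : ∀ a b, a ≤ b → g b ≤ g a) (hgz : ∀ a, g a ≠ 0 → a ^ 2 ≤ z)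
    (hp : ∀ t, (p t).Prime) (hk : ∀ t, k < p t)
    (hz : 2 ≤ z) (h1 : 3 * (k : ℝ) ^ 2 * ∑ t, 1 / (p t : ℝ) ^ 2 ≤ 1 / 4) (κ : ℝ) (hκ : 0 ≤ κ)
    (h2 : A3 p g ≤ κ * A2 p g) (h3 : 8 * k * κ ≤ Real.log z) (m : Fin k) :
    A1 p g ^ 2 / 16 * A2 p g ^ (k - 1) ≤
      ∑ s : Fin n → Option (Fin k), (∏ t, nu2 m (p t) (s t)) * (∑ r, cz p g z r * ∏ t, T2 m (r t) (s t)) ^ 2 := by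
  classical
  have h4 := good_mass hg0 hg hp hz h1 κ hκ h2 h3 m
  have h5 : ∑ s ∈ univ.filter (good p z m), A1 p g ^ 2 / 8 * ∏ i, GG p g m i (cl s i) ≤
      ∑ s : Fin n → Option (Fin k), (∏ t, nu2 m (p t) (s t)) * (∑ r, cz p g z r * ∏ t, T2 m (r t) (s t)) ^ 2 := by
    refine (sum_le_sum fun s hs => good_term hg0 hg hgz hp hk m s (mem_filter.mp hs).2).trans ?_
    refine sum_le_sum_of_subset_of_nonneg (subset_univ _) fun s _ _ => mul_nonneg (prod_nonneg fun t _ => nu2_nonneg m _ (hk t) _) (sq_nonneg _)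
  rw [← mul_sum] at h5
  have := mul_le_mul_of_nonneg_left h4 (by positivity : 0 ≤ A1 p g ^ 2 / 8)
  linarith

end BG

namespace BG
set_option maxHeartbeats 400000
open Finset Filter Topology

/-- rough harmonic sum over a range -/
noncomputable def Bh (W N : ℕ) : ℝ := ∑ a ∈ (range N).filter (fun a => W.Coprime a), 1 / (a : ℝ)

lemma Bh_succ (W m : ℕ) : Bh W (m * W + W) = Bh W (m * W) + ∑ a ∈ (Ico (m * W) (m * W + W)).filter (fun a => W.Coprime a), 1 / (a : ℝ) := by
  unfold Bh
  rw [range_eq_Ico, range_eq_Ico, sum_filter, sum_filter, sum_filter, sum_Ico_consecutive _ (Nat.zero_le _) (Nat.le_add_right _ _)]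

lemma Bh_lower (W : ℕ) (hW : 2 ≤ W) (q : ℕ) : (W.totient : ℝ) / W * ∑ m ∈ range q, 1 / ((m : ℝ) + 1) ≤ Bh W (q * W) := by
  have hW' : (0 : ℝ) < W := by exact_mod_cast (by omega : 0 < W)
  induction q with
  | zero => simp [Bh]
  | succ q ih =>
    rw [sum_range_succ, mul_add, Nat.succ_mul, Bh_succ]
    refine add_le_add ih ?_
    have h1 : ∀ a ∈ (Ico (q * W) (q * W + W)).filter (fun a => W.Coprime a), 1 / (((q : ℝ) + 1) * W) ≤ 1 / (a : ℝ) := by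
      intro a ha
      rw [mem_filter, mem_Ico] at ha
      rcases Nat.eq_zero_or_pos a with h0 | h0
      · have : W = 1 := by have := ha.2; rw [h0] at this; simpa using this
        omega
      · have : (0 : ℝ) < a := by exact_mod_cast h0
        refine one_div_le_one_div_of_le this ?_
        have : (a : ℝ) ≤ (q * W + W : ℕ) := by exact_mod_cast ha.1.2.le
        push_cast at this; linarith
    have h2 := sum_le_sum h1
    rw [sum_const, Nat.filter_coprime_Ico_eq_totient, nsmul_eq_mul] at h2
    refine le_trans (le_of_eq ?_) h2
    field_simp

lemma Bh_upper (W : ℕ) (hW : 2 ≤ W) (q : ℕ) : Bh W ((q + 1) * W) ≤ W + (W.totient : ℝ) / W * ∑ m ∈ Icc 1 q, 1 / (m : ℝ) := by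
  have hW' : (0 : ℝ) < W := by exact_mod_cast (by omega : 0 < W)
  induction q with
  | zero =>
    simp only [zero_add, one_mul, Bh]
    have h1 : ∀ a ∈ (range W).filter (fun a => W.Coprime a), 1 / (a : ℝ) ≤ 1 := by
      intro a _
      rcases Nat.eq_zero_or_pos a with h0 | h0
      · simp [h0]
      · rw [div_le_one (by exact_mod_cast h0)]; exact_mod_cast h0
    have h2 := sum_le_sum h1
    have h3 : ((range W).filter (fun a => W.Coprime a)).card ≤ W := (card_filter_le _ _).trans (by simp)
    simp only [sum_const, nsmul_eq_mul, mul_one] at h2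
    have : (((range W).filter (fun a => W.Coprime a)).card : ℝ) ≤ W := by exact_mod_cast h3
    simp only [Icc_eq_empty (by omega : ¬ 1 ≤ 0), sum_empty, mul_zero, add_zero]
    linarith
  | succ q ih =>
    rw [sum_Icc_succ_top (by omega), mul_add, Nat.succ_mul, Bh_succ, ← add_assoc]
    refine add_le_add ih ?_
    have h1 : ∀ a ∈ (Ico ((q + 1) * W) ((q + 1) * W + W)).filter (fun a => W.Coprime a), 1 / (a : ℝ) ≤ 1 / (((q + 1 : ℕ) : ℝ) * W) := by
      intro a ha
      rw [mem_filter, mem_Ico] at ha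
      refine one_div_le_one_div_of_le (by positivity) ?_
      exact_mod_cast ha.1.1
    have h2 := sum_le_sum h1
    rw [sum_const, Nat.filter_coprime_Ico_eq_totient, nsmul_eq_mul] at h2
    refine h2.trans (le_of_eq ?_)
    push_cast
    field_simp

/-- rough harmonic sum -/
noncomputable def Hr (W X : ℕ) : ℝ := ∑ a ∈ (Icc 1 X).filter (fun a => W.Coprime a), 1 / (a : ℝ)

/-- squarefree rough harmonic sum -/
noncomputable def Hs (W X : ℕ) : ℝ := ∑ a ∈ (Icc 1 X).filter (fun a => Squarefree a ∧ W.Coprime a), 1 / (a : ℝ)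

lemma Hr_ge (W X : ℕ) (hW : 2 ≤ W) : (W.totient : ℝ) / W * (Real.log X - Real.log W) ≤ Hr W X := by
  have hW' : (0 : ℝ) < W := by exact_mod_cast (by omega : 0 < W)
  rcases Nat.eq_zero_or_pos X with h0 | h0
  · subst h0
    have : 0 ≤ Real.log W := Real.log_natCast_nonneg _
    simp [Hr]
    exact mul_nonneg (by positivity) this
  set q := X / W with hq
  have h1 := Bh_lower W hW q
  have h2 := log_add_one_le_harmonic q
  have e2 : ((harmonic q : ℚ) : ℝ) = ∑ m ∈ range q, 1 / ((m : ℝ) + 1) := by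
    rw [harmonic]; push_cast; exact sum_congr rfl fun m _ => by rw [one_div]
  rw [e2] at h2
  have h3 : Bh W (q * W) ≤ Hr W X := by
    unfold Bh Hr
    have : ∑ a ∈ (range (q * W)).filter (fun a => W.Coprime a), 1 / (a : ℝ) =
        ∑ a ∈ ((range (q * W)).filter (fun a => W.Coprime a)).filter (fun a => a ≠ 0), 1 / (a : ℝ) := by
      symm
      refine sum_filter_of_ne fun a _ hne h => hne (by simp [h])
    rw [this]
    refine sum_le_sum_of_subset_of_nonneg ?_ fun _ _ _ => by positivity
    intro a ha
    simp only [mem_filter, mem_range, mem_Icc] at ha ⊢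
    have := Nat.div_mul_le_self X W
    refine ⟨⟨by omega, ?_⟩, ha.1.2⟩
    rw [← hq] at this; omega
  have h4 : Real.log X - Real.log W ≤ Real.log ((q + 1 : ℕ) : ℝ) := by
    rw [← Real.log_div (by positivity) hW'.ne']
    refine Real.log_le_log (by positivity) ?_
    rw [div_le_iff₀ hW']
    have : X < W * (X / W + 1) := Nat.lt_mul_div_succ X (by omega)
    rw [← hq] at this
    have h5 : X ≤ (q + 1) * W := by linarith
    exact_mod_cast h5
  push_cast at h4 h2
  exact (mul_le_mul_of_nonneg_left (h4.trans h2) (by positivity)).trans (h1.trans h3)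

lemma Hr_le (W X : ℕ) (hW : 2 ≤ W) (hX : 1 ≤ X) : Hr W X ≤ W + (W.totient : ℝ) / W * (1 + Real.log X) := by
  have hW' : (0 : ℝ) < W := by exact_mod_cast (by omega : 0 < W)
  set q := X / W with hq
  have h1 := Bh_upper W hW q
  have h2 := sum_inv_Icc q
  have h3 : Hr W X ≤ Bh W ((q + 1) * W) := by
    unfold Bh Hr
    refine sum_le_sum_of_subset_of_nonneg ?_ fun _ _ _ => by positivity
    intro a ha
    simp only [mem_filter, mem_range, mem_Icc] at ha ⊢
    have : X < W * (X / W + 1) := Nat.lt_mul_div_succ X (by omega)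
    rw [← hq] at this
    refine ⟨by linarith, ha.2⟩
  have h4 : 1 + Real.log q ≤ 1 + Real.log X := by
    rcases Nat.eq_zero_or_pos q with h0 | h0
    · rw [h0]; simpa using Real.log_natCast_nonneg X
    · have : Real.log q ≤ Real.log X := Real.log_le_log (by exact_mod_cast h0) (by exact_mod_cast Nat.div_le_self _ _)
      linarith
  have := mul_le_mul_of_nonneg_left (h2.trans h4) (by positivity : 0 ≤ (W.totient : ℝ) / W)
  linarith

lemma Hs_le (W X : ℕ) : Hs W X ≤ Hr W X := by
  unfold Hs Hr
  refine sum_le_sum_of_subset_of_nonneg ?_ fun _ _ _ => by positivity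
  intro a ha
  simp only [mem_filter] at ha ⊢
  exact ⟨ha.1, ha.2.2⟩

lemma Hs_ge (W X D : ℕ) (hD : 4 ≤ D) (hWD : ∀ q, q.Prime → q ≤ D → q ∣ W) : 3 / 4 * Hr W X ≤ Hs W X := by
  classical
  have e1 : Hr W X = Hs W X + ∑ a ∈ (Icc 1 X).filter (fun a => ¬ Squarefree a ∧ W.Coprime a), 1 / (a : ℝ) := by
    unfold Hr Hs
    rw [← sum_filter_add_sum_filter_not _ (fun a => Squarefree a), filter_filter, filter_filter]
    simp only [and_comm]
  have hr0 : 0 ≤ Hr W X := sum_nonneg fun _ _ => by positivity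
  have h1 : ∑ a ∈ (Icc 1 X).filter (fun a => ¬ Squarefree a ∧ W.Coprime a), 1 / (a : ℝ) ≤
      ∑ d ∈ Ioc D (D + X), ∑ a ∈ (Icc 1 X).filter (fun a => W.Coprime a ∧ d ^ 2 ∣ a), 1 / (a : ℝ) := by
    have e : ∀ d ∈ Ioc D (D + X), ∑ a ∈ (Icc 1 X).filter (fun a => W.Coprime a ∧ d ^ 2 ∣ a), 1 / (a : ℝ) =
        ∑ a ∈ (Icc 1 X).filter (fun a => W.Coprime a), if d ^ 2 ∣ a then 1 / (a : ℝ) else 0 := by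
      intro d _
      rw [← filter_filter, sum_filter]
    rw [sum_congr rfl e, sum_comm]
    have e' : ∑ a ∈ (Icc 1 X).filter (fun a => ¬ Squarefree a ∧ W.Coprime a), 1 / (a : ℝ) =
        ∑ a ∈ (Icc 1 X).filter (fun a => W.Coprime a), if ¬ Squarefree a then 1 / (a : ℝ) else 0 := by
      rw [← sum_filter, filter_filter]
      simp only [and_comm]
    rw [e']
    refine sum_le_sum fun a ha => ?_
    rw [mem_filter, mem_Icc] at ha
    by_cases hs : Squarefree a
    · rw [if_neg (by simpa using hs)]
      exact sum_nonneg fun d _ => by positivity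
    · rw [if_pos hs]
      have h2 : ∃ q, q.Prime ∧ q * q ∣ a := by
        rw [Nat.squarefree_iff_prime_squarefree] at hs
        push Not at hs
        exact hs
      obtain ⟨q, hq, hqa⟩ := h2
      have hqD : D < q := by
        by_contra hle
        have h3 := hWD q hq (by omega)
        have h4 : q ∣ a := (dvd_mul_right q q).trans hqa
        have h5 := Nat.dvd_gcd h3 h4
        rw [ha.2] at h5
        exact hq.one_lt.ne' (Nat.dvd_one.mp h5)
      have hqX : q ≤ X := (Nat.le_of_dvd (by omega) ((dvd_mul_right q q).trans hqa)).trans ha.1.2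
      refine le_trans ?_ (single_le_sum (f := fun d => if d ^ 2 ∣ a then 1 / (a : ℝ) else 0) (fun d _ => by positivity)
        (mem_Ioc.mpr ⟨hqD, by omega⟩ : q ∈ Ioc D (D + X)))
      simp [sq, hqa]
  have h2 : ∀ d ∈ Ioc D (D + X), ∑ a ∈ (Icc 1 X).filter (fun a => W.Coprime a ∧ d ^ 2 ∣ a), 1 / (a : ℝ) ≤ ((d : ℝ) ^ 2)⁻¹ * Hr W X := by
    intro d hd
    have hd0 : 0 < d := by have := (mem_Ioc.mp hd).1; omega
    have hd2 : 0 < d ^ 2 := by positivity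
    have e : ∀ a ∈ (Icc 1 X).filter (fun a => W.Coprime a ∧ d ^ 2 ∣ a), 1 / (a : ℝ) = ((d : ℝ) ^ 2)⁻¹ * (1 / ((a / d ^ 2 : ℕ) : ℝ)) := by
      intro a ha
      obtain ⟨b, rfl⟩ := (mem_filter.mp ha).2.2
      rw [Nat.mul_div_cancel_left _ hd2]; push_cast; rw [one_div, one_div, mul_inv]
    rw [sum_congr rfl e, ← mul_sum]
    refine mul_le_mul_of_nonneg_left ?_ (by positivity)
    unfold Hr
    rw [← sum_image (f := fun b : ℕ => 1 / (b : ℝ)) (g := fun a => a / d ^ 2)]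
    · refine sum_le_sum_of_subset_of_nonneg ?_ fun _ _ _ => by positivity
      intro b hb
      obtain ⟨a, ha, rfl⟩ := mem_image.mp hb
      rw [mem_filter, mem_Icc] at ha ⊢
      obtain ⟨b, rfl⟩ := ha.2.2
      rw [Nat.mul_div_cancel_left _ hd2]
      refine ⟨⟨Nat.pos_of_mul_pos_left ha.1.1, ?_⟩, Nat.Coprime.coprime_mul_left_right ha.2.1⟩
      exact (Nat.le_mul_of_pos_left b hd2).trans ha.1.2
    · intro a ha b hb hab
      obtain ⟨a', rfl⟩ := (mem_filter.mp ha).2.2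
      obtain ⟨b', rfl⟩ := (mem_filter.mp hb).2.2
      simp only [Nat.mul_div_cancel_left _ hd2] at hab
      rw [hab]
  have h3 := h1.trans (sum_le_sum h2)
  rw [← sum_mul] at h3
  have h4 : ∑ d ∈ Ioc D (D + X), ((d : ℝ) ^ 2)⁻¹ ≤ 1 / 4 := by
    refine (sum_Ioc_inv_sq_le_sub (by omega) (by omega)).trans ?_
    have h5 : (0 : ℝ) ≤ ((D + X : ℕ) : ℝ)⁻¹ := by positivity
    have h6 : ((D : ℝ))⁻¹ ≤ 1 / 4 := by
      rw [← one_div]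
      exact one_div_le_one_div_of_le (by norm_num) (by exact_mod_cast hD)
    linarith
  have := mul_le_mul_of_nonneg_right h4 hr0
  linarith

lemma Hs_bounds (W D : ℕ) (hD : 4 ≤ D) (hW : 2 ≤ W) (hWD : ∀ q, q.Prime → q ≤ D → q ∣ W) :
    ∃ Z0 : ℕ, ∀ X ≥ Z0, (W.totient : ℝ) / W / 2 * Real.log X ≤ Hs W X ∧ Hs W X ≤ 2 * ((W.totient : ℝ) / W) * Real.log X := by
  have hW' : (0 : ℝ) < W := by exact_mod_cast (by omega : 0 < W)
  set b : ℝ := (W.totient : ℝ) / W with hb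
  have hb0 : 0 < b := div_pos (by exact_mod_cast Nat.totient_pos.mpr (by omega)) hW'
  have ht : Tendsto (fun X : ℕ => Real.log (X : ℝ)) atTop atTop := Real.tendsto_log_atTop.comp tendsto_natCast_atTop_atTop
  obtain ⟨Z0, hZ⟩ := eventually_atTop.mp ((ht.eventually_ge_atTop (3 * Real.log W)).and ((ht.eventually_ge_atTop (W / b + 1)).and (eventually_ge_atTop 1)))
  refine ⟨Z0, fun X hX => ?_⟩
  obtain ⟨h1, h2, h3⟩ := hZ X hX
  constructor
  · have h4 := Hr_ge W X hW
    have h5 := Hs_ge W X D hD hWD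
    have : 2 / 3 * Real.log X ≤ Real.log X - Real.log W := by linarith
    have := mul_le_mul_of_nonneg_left this hb0.le
    nlinarith
  · have h4 := Hr_le W X hW h3
    have h5 := Hs_le W X
    have h6 := mul_le_mul_of_nonneg_left h2 hb0.le
    have e : b * (W / b + 1) = W + b := by field_simp
    rw [e] at h6
    rw [← hb] at h4
    linarith

end BG

namespace BG
set_option maxHeartbeats 400000
open Finset Filter Topology
variable {n : ℕ}

lemma Hs_Pr (p : Fin n → ℕ) (hp : ∀ t, (p t).Prime) (hi : Function.Injective p) (W X : ℕ) (pW : ∀ t, (p t).Coprime W)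
    (hr : ∀ q : ℕ, q.Prime → q.Coprime W → q ≤ X → ∃ t, p t = q) :
    ∑ T, (if Pr p T ≤ X then 1 / (Pr p T : ℝ) else 0) = Hs W X := by
  rw [← sum_filter, Hs]
  refine sum_nbij (fun T => Pr p T) ?_ ?_ ?_ (fun _ _ => rfl)
  · intro T hT
    rw [mem_filter] at hT
    rw [mem_filter, mem_Icc]
    refine ⟨⟨Pr_pos p hp T, hT.2⟩, ?_, ?_⟩
    · unfold Pr
      refine Finset.squarefree_prod_of_pairwise_isCoprime ?_ (fun t _ => (hp t).squarefree)
      intro a _ b _ hab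
      show IsRelPrime _ _
      rw [← Nat.coprime_iff_isRelPrime]
      exact (Nat.coprime_primes (hp a) (hp b)).2 (fun h => hab (hi h))
    · exact Nat.Coprime.prod_right fun t _ => (pW t).symm
  · intro T _ T' _ h
    exact prod_inj p hp hi h
  · intro a ha
    rw [mem_coe, mem_filter, mem_Icc] at ha
    obtain ⟨⟨h1, h2⟩, h3, h4⟩ := ha
    have key : ∀ q ∈ a.primeFactors, ∃ t, p t = q := by
      intro q hq
      have := Nat.mem_primeFactors.1 hq
      exact hr q this.1 (Nat.Coprime.coprime_dvd_left this.2.1 h4.symm) ((Nat.le_of_dvd h1 this.2.1).trans h2)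
    have h5 : Pr p (univ.filter fun t => p t ∈ a.primeFactors) = a := by
      rw [← Nat.prod_primeFactors_of_squarefree h3]
      unfold Pr
      refine prod_nbij p ?_ hi.injOn ?_ (fun _ _ => rfl)
      · intro t ht; rw [Nat.prod_primeFactors_of_squarefree h3] at ht; exact (mem_filter.1 ht).2
      · intro q hq
        obtain ⟨t, rfl⟩ := key q hq
        rw [Nat.prod_primeFactors_of_squarefree h3]
        exact ⟨t, by simpa using hq, rfl⟩
    refine ⟨_, ?_, h5⟩
    rw [mem_coe, mem_filter, h5]
    exact ⟨mem_univ _, h2⟩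

/-- the dyadic cutoff function -/
noncomputable def gd (Z I a : ℕ) : ℝ := ∑ i ∈ range (I + 1), (1 / 2 : ℝ) ^ (i + 1) * (if a ≤ Z ^ 2 ^ i then 1 else 0)

lemma gd_nonneg (Z I a : ℕ) : 0 ≤ gd Z I a := sum_nonneg fun i _ => by split_ifs <;> positivity

lemma gsum_le (I : ℕ) : ∑ i ∈ range I, (1 / 2 : ℝ) ^ (i + 1) ≤ 1 := by
  have : ∑ i ∈ range I, (1 / 2 : ℝ) ^ (i + 1) = 1 - (1 / 2) ^ I := by
    induction I with
    | zero => simp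
    | succ I ih => rw [sum_range_succ, ih]; ring
  rw [this]; have : (0 : ℝ) ≤ (1 / 2) ^ I := by positivity
  linarith

lemma gd_le (Z I a : ℕ) : gd Z I a ≤ 1 := by
  refine le_trans (sum_le_sum fun i _ => ?_) (gsum_le (I + 1))
  split_ifs
  · simp
  · simp

lemma gd_anti (Z I a b : ℕ) (h : a ≤ b) : gd Z I b ≤ gd Z I a := by
  refine sum_le_sum fun i _ => mul_le_mul_of_nonneg_left ?_ (by positivity)
  split_ifs with h1 h2
  · exact le_rfl
  · omega
  · norm_num
  · exact le_rfl

lemma gd_ne (Z I a : ℕ) (hZ : 1 ≤ Z) (h : gd Z I a ≠ 0) : a ≤ Z ^ 2 ^ I := by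
  by_contra h0
  push Not at h0
  apply h
  refine sum_eq_zero fun i hi => ?_
  have : Z ^ 2 ^ i ≤ Z ^ 2 ^ I := Nat.pow_le_pow_right hZ (Nat.pow_le_pow_right (by norm_num) (by rw [mem_range] at hi; omega))
  rw [if_neg (by omega), mul_zero]

lemma sq_dyadic (I : ℕ) (x : ℕ → ℝ) (hx : ∀ i, x i = 0 ∨ x i = 1) :
    (∑ i ∈ range I, (1 / 2 : ℝ) ^ (i + 1) * x i) ^ 2 ≤ ∑ i ∈ range I, (1 / 4 : ℝ) ^ i * x i := by
  induction I generalizing x with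
  | zero => simp
  | succ I ih =>
    have h01 : ∀ i, 0 ≤ x i ∧ x i ≤ 1 := fun i => by rcases hx i with h | h <;> rw [h] <;> norm_num
    have hS : ∑ i ∈ range (I + 1), (1 / 2 : ℝ) ^ (i + 1) * x i ≤ 1 :=
      le_trans (sum_le_sum fun i _ => mul_le_of_le_one_right (by positivity) (h01 i).2) (gsum_le (I + 1))
    have hS0 : 0 ≤ ∑ i ∈ range (I + 1), (1 / 2 : ℝ) ^ (i + 1) * x i := sum_nonneg fun i _ => mul_nonneg (by positivity) (h01 i).1
    have e2 : ∑ i ∈ range (I + 1), (1 / 4 : ℝ) ^ i * x i = 1 / 4 * ∑ i ∈ range I, (1 / 4 : ℝ) ^ i * x (i + 1) + x 0 := by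
      rw [sum_range_succ', mul_sum]; congr 1
      · exact sum_congr rfl fun i _ => by ring
      · simp
    have hp : 0 ≤ ∑ i ∈ range I, (1 / 4 : ℝ) ^ i * x (i + 1) := sum_nonneg fun i _ => mul_nonneg (by positivity) (h01 _).1
    rcases hx 0 with h | h
    · have e1 : ∑ i ∈ range (I + 1), (1 / 2 : ℝ) ^ (i + 1) * x i = 1 / 2 * ∑ i ∈ range I, (1 / 2 : ℝ) ^ (i + 1) * x (i + 1) := by
        rw [sum_range_succ', mul_sum, h, mul_zero, add_zero]
        exact sum_congr rfl fun i _ => by ring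
      rw [e1, e2, h]
      have := ih (fun i => x (i + 1)) (fun i => hx _)
      rw [mul_pow]; linarith
    · rw [e2, h]; nlinarith

lemma gd_sq (Z I a : ℕ) : gd Z I a ^ 2 ≤ ∑ i ∈ range (I + 1), (1 / 4 : ℝ) ^ i * (if a ≤ Z ^ 2 ^ i then 1 else 0) :=
  sq_dyadic (I + 1) _ fun i => by split_ifs <;> simp

/-- evaluation of the three moments -/
lemma A_eval (p : Fin n → ℕ) (hp : ∀ t, (p t).Prime) (hi : Function.Injective p) (W Z I z : ℕ) (pW : ∀ t, (p t).Coprime W)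
    (hr : ∀ q : ℕ, q.Prime → q.Coprime W → q ≤ z → ∃ t, p t = q) (hZ : 1 ≤ Z) (hz : Z ^ 2 ^ I ≤ z) (b : ℝ) (hb : 0 ≤ b)
    (hH : ∀ X ≥ Z, b / 2 * Real.log X ≤ Hs W X ∧ Hs W X ≤ 2 * b * Real.log X) :
    ((I : ℝ) + 1) * b * Real.log Z / 4 ≤ A1 p (gd Z I) ∧ b * Real.log Z / 8 ≤ A2 p (gd Z I) ∧ A2 p (gd Z I) ≤ 4 * b * Real.log Z
      ∧ A3 p (gd Z I) ≤ 16 * ((I : ℝ) + 1) * Real.log Z * A2 p (gd Z I) := by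
  have hτ : 0 ≤ Real.log Z := Real.log_natCast_nonneg Z
  have hle : ∀ i ∈ range (I + 1), Z ^ 2 ^ i ≤ z := fun i hi =>
    le_trans (Nat.pow_le_pow_right hZ (Nat.pow_le_pow_right (by norm_num) (by rw [mem_range] at hi; omega))) hz
  have hge : ∀ i : ℕ, Z ≤ Z ^ 2 ^ i := fun i => Nat.le_self_pow (by positivity) Z
  have hS : ∀ i ∈ range (I + 1), ∑ T, (if Pr p T ≤ Z ^ 2 ^ i then 1 / (Pr p T : ℝ) else 0) = Hs W (Z ^ 2 ^ i) := fun i h =>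
    Hs_Pr p hp hi W _ pW fun q h1 h2 h3 => hr q h1 h2 (h3.trans (hle i h))
  have hlog : ∀ i : ℕ, Real.log ((Z ^ 2 ^ i : ℕ) : ℝ) = 2 ^ i * Real.log Z := fun i => by push_cast; rw [Real.log_pow]; push_cast; ring
  have hP : ∀ T, (0 : ℝ) < Pr p T := fun T => by exact_mod_cast Pr_pos p hp T
  have hW : ∀ c : ℕ → ℝ, ∑ T, (∑ i ∈ range (I + 1), c i * (if Pr p T ≤ Z ^ 2 ^ i then 1 else 0)) / Pr p T
      = ∑ i ∈ range (I + 1), c i * Hs W (Z ^ 2 ^ i) := by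
    intro c
    rw [sum_congr rfl fun T _ => sum_div _ _ _, sum_comm]
    refine sum_congr rfl fun i h => ?_
    rw [← hS i h, mul_sum]
    refine sum_congr rfl fun T _ => ?_
    split_ifs <;> ring
  have B1 : ((I : ℝ) + 1) * b * Real.log Z / 4 ≤ A1 p (gd Z I) := by
    have : A1 p (gd Z I) = ∑ i ∈ range (I + 1), (1 / 2 : ℝ) ^ (i + 1) * Hs W (Z ^ 2 ^ i) := by
      exact hW fun i => (1 / 2 : ℝ) ^ (i + 1)
    rw [this]
    calc ((I : ℝ) + 1) * b * Real.log Z / 4 = ∑ i ∈ range (I + 1), b * Real.log Z / 4 := by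
          rw [sum_const, card_range, nsmul_eq_mul]; push_cast; ring
      _ ≤ _ := by
        refine sum_le_sum fun i h => ?_
        have := (hH _ (hge i)).1
        rw [hlog] at this
        calc b * Real.log Z / 4 = (1 / 2 : ℝ) ^ (i + 1) * (b / 2 * (2 ^ i * Real.log Z)) := by
              rw [pow_succ, one_div, inv_pow]; field_simp; norm_num
          _ ≤ _ := mul_le_mul_of_nonneg_left this (by positivity)
  have B2 : b * Real.log Z / 8 ≤ A2 p (gd Z I) := by
    have h0 := hS 0 (by simp)
    simp only [pow_zero, pow_one] at h0
    have h1 := (hH Z le_rfl).1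
    rw [← h0] at h1
    have : 1 / 4 * ∑ T, (if Pr p T ≤ Z then 1 / (Pr p T : ℝ) else 0) ≤ A2 p (gd Z I) := by
      rw [A2, mul_sum]
      refine sum_le_sum fun T _ => ?_
      split_ifs with h
      · have hg : 1 / 2 ≤ gd Z I (Pr p T) := by
          have := single_le_sum (f := fun i => (1 / 2 : ℝ) ^ (i + 1) * (if Pr p T ≤ Z ^ 2 ^ i then 1 else 0))
            (fun i _ => by positivity) (mem_range.2 (Nat.succ_pos I))
          simpa [h, gd] using this
        rw [mul_one_div]
        exact div_le_div_of_nonneg_right (by nlinarith) (hP T).le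
      · have := hP T
        rw [mul_zero]; positivity
    linarith
  have B2' : A2 p (gd Z I) ≤ 4 * b * Real.log Z := by
    calc A2 p (gd Z I) ≤ ∑ T, (∑ i ∈ range (I + 1), (1 / 4 : ℝ) ^ i * (if Pr p T ≤ Z ^ 2 ^ i then 1 else 0)) / Pr p T :=
          sum_le_sum fun T _ => div_le_div_of_nonneg_right (gd_sq Z I _) (hP T).le
      _ = ∑ i ∈ range (I + 1), (1 / 4 : ℝ) ^ i * Hs W (Z ^ 2 ^ i) := hW fun i => (1 / 4 : ℝ) ^ i
      _ ≤ ∑ i ∈ range (I + 1), 4 * b * Real.log Z * (1 / 2 : ℝ) ^ (i + 1) := by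
        refine sum_le_sum fun i h => ?_
        have := (hH _ (hge i)).2
        rw [hlog] at this
        refine (mul_le_mul_of_nonneg_left this (by positivity)).trans (le_of_eq ?_)
        have : (1 / 4 : ℝ) ^ i = (1 / 2) ^ i * (1 / 2) ^ i := by rw [← mul_pow]; norm_num
        have h2 : (1 / 2 : ℝ) ^ i * 2 ^ i = 1 := by rw [← mul_pow]; norm_num
        rw [this, pow_succ]; linear_combination (2 * b * Real.log Z * (1 / 2) ^ i) * h2
      _ ≤ _ := by
        rw [← mul_sum]
        exact mul_le_of_le_one_right (by positivity) (gsum_le _)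
  refine ⟨B1, B2, B2', ?_⟩
  have B3 : A3 p (gd Z I) ≤ 2 * ((I : ℝ) + 1) * b * Real.log Z ^ 2 := by
    calc A3 p (gd Z I) ≤ ∑ T, ∑ i ∈ range (I + 1), (1 / 4 : ℝ) ^ i * (2 ^ i * Real.log Z) * (if Pr p T ≤ Z ^ 2 ^ i then 1 / (Pr p T : ℝ) else 0) := by
          refine sum_le_sum fun T _ => ?_
          have hl : 0 ≤ Real.log (Pr p T) := Real.log_natCast_nonneg _
          calc _ ≤ (∑ i ∈ range (I + 1), (1 / 4 : ℝ) ^ i * (if Pr p T ≤ Z ^ 2 ^ i then 1 else 0)) / Pr p T * Real.log (Pr p T) :=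
                mul_le_mul_of_nonneg_right (div_le_div_of_nonneg_right (gd_sq Z I _) (hP T).le) hl
            _ = ∑ i ∈ range (I + 1), (1 / 4 : ℝ) ^ i * Real.log (Pr p T) * (if Pr p T ≤ Z ^ 2 ^ i then 1 / (Pr p T : ℝ) else 0) := by
              rw [sum_div, sum_mul]
              refine sum_congr rfl fun i _ => ?_
              split_ifs <;> ring
            _ ≤ _ := by
              refine sum_le_sum fun i _ => ?_
              split_ifs with h
              · have := hP T
                have h2 : Real.log (Pr p T) ≤ 2 ^ i * Real.log Z := by
                  rw [← hlog]; exact Real.log_le_log this (by exact_mod_cast h)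
                gcongr
              · simp
      _ = ∑ i ∈ range (I + 1), (1 / 4 : ℝ) ^ i * (2 ^ i * Real.log Z) * Hs W (Z ^ 2 ^ i) := by
        rw [sum_comm]
        refine sum_congr rfl fun i h => ?_
        rw [← mul_sum, hS i h]
      _ ≤ ∑ i ∈ range (I + 1), 2 * b * Real.log Z ^ 2 := by
        refine sum_le_sum fun i h => ?_
        have := (hH _ (hge i)).2
        rw [hlog] at this
        refine (mul_le_mul_of_nonneg_left this (by positivity)).trans (le_of_eq ?_)
        have : (1 / 4 : ℝ) ^ i * (2 ^ i * 2 ^ i) = 1 := by rw [← mul_pow, ← mul_pow]; norm_num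
        linear_combination (2 * b * Real.log Z ^ 2) * this
      _ = _ := by rw [sum_const, card_range, nsmul_eq_mul]; push_cast; ring
  refine B3.trans ?_
  have : 16 * ((I : ℝ) + 1) * Real.log Z * (b * Real.log Z / 8) ≤ 16 * ((I : ℝ) + 1) * Real.log Z * A2 p (gd Z I) :=
    mul_le_mul_of_nonneg_left B2 (by positivity)
  linarith

end BG

namespace BG
set_option maxHeartbeats 400000
open Finset Filter Topology

lemma wG_sum {β : Type*} [Fintype β] (w : ℕ → ℝ) (hw : Summable w) (hw0 : ∀ N, 0 ≤ w N) (X : ℕ → β) (G : β → ℝ) (hG : ∀ x, 0 ≤ G x) :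
    Summable fun N => w N * G (X N) :=
  Summable.of_nonneg_of_le (fun N => mul_nonneg (hw0 N) (hG _))
    (fun N => mul_le_mul_of_nonneg_left (single_le_sum (fun x _ => hG x) (mem_univ (X N))) (hw0 N)) (hw.mul_right (∑ x, G x))

lemma S_le {k W : ℕ} {β : Type*} [Fintype β] (h : Fin k → ℕ) (X : ℕ → β) (G : β → ℝ) (hG : ∀ x, 0 ≤ G x) (L : ℝ) (hL : 0 < L) (j y Y v0 : ℕ)
    (hyY : ∀ m, Y + h m ≤ y) (hY : (j : ℝ) ≤ Real.log (Y + 1 : ℕ))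
    (hone : ∀ n, Y < n → n ≡ v0 [MOD W] → ∀ m m', (n + h m).Prime → (n + h m').Prime → m = m') :
    ∑ m, ∑' N, (if (N.Prime ∧ y < N) ∧ N ≡ v0 + h m [MOD W] then v L j N else 0) * G (X (N - h m)) ≤
      ∑' N, (if Y < N ∧ N ≡ v0 [MOD W] then v L j N else 0) * G (X N) := by
  have e1 : ∀ m, ∑' N, (if (N.Prime ∧ y < N) ∧ N ≡ v0 + h m [MOD W] then v L j N else 0) * G (X (N - h m)) =
      ∑' N, (if ((N + h m).Prime ∧ y < N + h m) ∧ N + h m ≡ v0 + h m [MOD W] then v L j (N + h m) else 0) * G (X N) := by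
    intro m
    have := Function.Injective.tsum_eq (g := fun N => N + h m) (add_left_injective (h m))
      (f := fun N => (if (N.Prime ∧ y < N) ∧ N ≡ v0 + h m [MOD W] then v L j N else 0) * G (X (N - h m))) (by
        intro N hN
        have hN' : (N.Prime ∧ y < N) ∧ N ≡ v0 + h m [MOD W] := by
          by_contra hcon
          exact hN (by simp only [if_neg hcon, zero_mul])
        have := hyY m
        exact ⟨N - h m, by show N - h m + h m = N; omega⟩)
    rw [← this]
    simp only [Nat.add_sub_cancel]
  have hs : ∀ m, Summable fun N => (if ((N + h m).Prime ∧ y < N + h m) ∧ N + h m ≡ v0 + h m [MOD W] then v L j (N + h m) else 0) * G (X N) := by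
    intro m
    refine wG_sum _ ?_ (fun N => by split_ifs <;> simp [v_nonneg]) X G hG
    exact (wn_sum (fun N => (N.Prime ∧ y < N) ∧ N ≡ v0 + h m [MOD W]) L hL j).comp_injective (add_left_injective (h m))
  rw [sum_congr rfl fun m _ => e1 m, ← Summable.tsum_finsetSum fun m _ => hs m]
  refine Summable.tsum_le_tsum ?_ (summable_sum fun m _ => hs m) (wG_sum _ (wn_sum _ L hL j) (fun N => by split_ifs <;> simp [v_nonneg]) X G hG)
  intro N
  rw [← sum_mul]
  refine mul_le_mul_of_nonneg_right ?_ (hG _)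
  by_cases hex : ∃ m, ((N + h m).Prime ∧ y < N + h m) ∧ N + h m ≡ v0 + h m [MOD W]
  · obtain ⟨m, hm⟩ := hex
    have h1 : N ≡ v0 [MOD W] := Nat.ModEq.add_right_cancel' (h m) hm.2
    have h2 : Y < N := by have := hyY m; omega
    rw [sum_eq_single m, if_pos hm, if_pos ⟨h2, h1⟩]
    · refine v_antitone L hL j N (N + h m) (by omega) (hY.trans (Real.log_le_log (by positivity) (by exact_mod_cast h2))) (by omega)
    · intro m' _ hne
      rw [if_neg]
      rintro ⟨⟨h3, -⟩, -⟩
      exact hne (hone N h2 h1 m' m h3 hm.1.1)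
    · simp
  · push Not at hex
    rw [sum_eq_zero fun m _ => if_neg (by rintro ⟨h3, h4⟩; exact hex m h3 h4)]
    split_ifs <;> simp [v_nonneg]

lemma root_ex (M z : ℕ) (hM : 1 ≤ M) (hz : 2 ^ M ≤ z) : ∃ Z : ℕ, 2 ≤ Z ∧ Z ^ M ≤ z ∧ z < Z ^ (2 * M) := by
  have hz1 : 2 ≤ z := le_trans (Nat.le_self_pow (by omega) 2) hz
  have h0 : 2 ≤ Nat.findGreatest (fun x => x ^ M ≤ z) z := Nat.le_findGreatest hz1 hz
  refine ⟨Nat.findGreatest (fun x => x ^ M ≤ z) z, h0, Nat.findGreatest_spec (P := fun x => x ^ M ≤ z) hz1 hz, ?_⟩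
  set Z := Nat.findGreatest (fun x => x ^ M ≤ z) z
  have h1 : z < (Z + 1) ^ M := by
    by_contra hcon
    push Not at hcon
    have : Z + 1 ≤ Z := Nat.le_findGreatest (P := fun x => x ^ M ≤ z) ((Nat.le_self_pow (by omega) _).trans hcon) hcon
    omega
  refine h1.trans_le ?_
  rw [pow_mul]
  exact Nat.pow_le_pow_left (by nlinarith) M

/-- enumeration of the primes in an interval -/
lemma enum_primes (D z : ℕ) : ∃ (n : ℕ) (p : Fin n → ℕ), Function.Injective p ∧ (∀ t, (p t).Prime ∧ D < p t ∧ p t ≤ z) ∧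
    (∀ q : ℕ, q.Prime → D < q → q ≤ z → ∃ t, p t = q) := by
  set s := (Ioc D z).filter Nat.Prime
  refine ⟨s.card, fun t => (s.equivFin.symm t : ℕ), ?_, ?_, ?_⟩
  · intro a b hab
    exact s.equivFin.symm.injective (Subtype.ext hab)
  · intro t
    have := (s.equivFin.symm t).2
    rw [mem_filter, mem_Ioc] at this
    exact ⟨this.2, this.1.1, this.1.2⟩
  · intro q h1 h2 h3
    exact ⟨s.equivFin ⟨q, mem_filter.2 ⟨mem_Ioc.2 ⟨h2, h3⟩, h1⟩⟩, by simp⟩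

lemma sum_inv_sq {n : ℕ} (p : Fin n → ℕ) (hi : Function.Injective p) (D z : ℕ) (hD : 1 ≤ D) (hp : ∀ t, D < p t ∧ p t ≤ z) :
    ∑ t, 1 / (p t : ℝ) ^ 2 ≤ 1 / (D : ℝ) := by
  have hmax : D ≤ max D z := le_max_left _ _
  calc ∑ t, 1 / (p t : ℝ) ^ 2 = ∑ q ∈ univ.image p, 1 / (q : ℝ) ^ 2 := (sum_image (f := fun q : ℕ => 1 / (q : ℝ) ^ 2) hi.injOn).symm
    _ ≤ ∑ q ∈ Ioc D (max D z), 1 / (q : ℝ) ^ 2 := by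
      refine sum_le_sum_of_subset_of_nonneg ?_ (fun _ _ _ => by positivity)
      intro q hq
      obtain ⟨t, -, rfl⟩ := mem_image.1 hq
      exact mem_Ioc.2 ⟨(hp t).1, (hp t).2.trans (le_max_right _ _)⟩
    _ ≤ (D : ℝ)⁻¹ - ((max D z : ℕ) : ℝ)⁻¹ := by
      simp only [one_div]
      exact sum_Ioc_inv_sq_le_sub (by omega) hmax
    _ ≤ 1 / D := by
      have : (0 : ℝ) ≤ ((max D z : ℕ) : ℝ)⁻¹ := by positivity
      rw [one_div]; linarith

lemma prod_le_two {n : ℕ} (p : Fin n → ℕ) (D : ℕ) (hD : 4 ≤ D) (hs : ∑ t, 1 / (p t : ℝ) ^ 2 ≤ 1 / (D : ℝ)) : ∏ t, (1 + 2 / (p t : ℝ) ^ 2) ≤ 2 := by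
  have h4 : (4 : ℝ) ≤ D := by exact_mod_cast hD
  calc ∏ t, (1 + 2 / (p t : ℝ) ^ 2) ≤ ∏ t, Real.exp (2 / (p t : ℝ) ^ 2) :=
        prod_le_prod (fun _ _ => by positivity) fun t _ => by rw [add_comm]; exact Real.add_one_le_exp _
    _ = Real.exp (2 * ∑ t, 1 / (p t : ℝ) ^ 2) := by rw [← Real.exp_sum, mul_sum]; congr 1; exact sum_congr rfl fun t _ => by ring
    _ ≤ Real.exp (Real.log 2) := by
      refine Real.exp_le_exp.2 ?_
      have : 1 / (D : ℝ) ≤ 1 / 4 := one_div_le_one_div_of_le (by norm_num) h4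
      have := Real.log_two_gt_d9
      linarith
    _ = 2 := Real.exp_log (by norm_num)

end BG

namespace BG
set_option maxHeartbeats 400000
open Finset Filter Topology

lemma crunch (V L j W φ τ a1 a2 P k I1 : ℝ) (hV : 0 < V) (hL : 0 < L) (hj : 0 < j) (hW : 0 < W) (hφ : 0 < φ)
    (hP : 0 ≤ P) (hk : 0 < k) (hI : 2 ^ 41 ≤ I1) (ha2 : 0 < a2) (h1 : I1 * (φ / W) * τ / 4 ≤ a1) (h2 : a2 ≤ 4 * (φ / W) * τ)
    (h3 : j * L / (40000 * 1024 * k * I1) ≤ τ) : 16 / k * (V * L / W * (P * a2)) ≤ V / (2 * j) / φ * (a1 ^ 2 / 16 * P) := by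
  have hI0 : 0 < I1 := lt_of_lt_of_le (by norm_num) hI
  set u := φ / W * τ with hu
  have hu0 : a2 / 4 ≤ u := by rw [hu]; linarith
  have hup : 0 < u := by linarith
  have h4 : I1 * u / 4 ≤ a1 := by rw [hu]; linarith
  have h5 : φ / W * (j * L / (40000 * 1024 * k * I1)) ≤ u := mul_le_mul_of_nonneg_left h3 (by positivity)
  have h6 : (I1 * u / 4) ^ 2 ≤ a1 ^ 2 := by gcongr
  have h7 : I1 ^ 2 / 64 * (φ / W * (j * L / (40000 * 1024 * k * I1)) * a2) ≤ a1 ^ 2 := by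
    refine le_trans ?_ h6
    have : φ / W * (j * L / (40000 * 1024 * k * I1)) * a2 ≤ u * (4 * u) := mul_le_mul h5 (by linarith) ha2.le hup.le
    calc _ ≤ I1 ^ 2 / 64 * (u * (4 * u)) := mul_le_mul_of_nonneg_left this (by positivity)
      _ = _ := by ring
  calc 16 / k * (V * L / W * (P * a2)) = V * L * P * a2 / (W * k) * 16 := by ring
    _ ≤ V * L * P * a2 / (W * k) * (I1 / (2048 * 40000 * 1024)) := by
      refine mul_le_mul_of_nonneg_left ?_ (by positivity)
      rw [le_div_iff₀ (by norm_num)]; linarith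
    _ = V / (2 * j) / φ * (I1 ^ 2 / 64 * (φ / W * (j * L / (40000 * 1024 * k * I1)) * a2) / 16 * P) := by
      field_simp; ring
    _ ≤ _ := by gcongr

set_option maxHeartbeats 4000000 in
/-- the Maynard and Tao theorem in the form needed here -/
theorem sieve (I k : ℕ) (hk : k = 2 ^ I) (hI : (2 : ℝ) ^ 41 ≤ (I : ℝ) + 1) (h : Fin k → ℕ) (hinj : Function.Injective h) (D : ℕ)
    (hD : 12 * k ^ 2 ≤ D) (hDh : ∀ i, h i ≤ D) (v0 : ℕ) (hv : ∀ m, (v0 + h m).Coprime (primorial D)) (N0 : ℕ) :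
    ∃ N, N0 < N ∧ N ≡ v0 [MOD primorial D] ∧ ∃ m m', m ≠ m' ∧ (N + h m).Prime ∧ (N + h m').Prime := by
  by_contra hcon
  have hk1 : 1 ≤ k := by rw [hk]; exact Nat.one_le_two_pow
  have hkR : (1 : ℝ) ≤ k := by exact_mod_cast hk1
  have hD12 : 12 ≤ D := le_trans (by nlinarith) hD
  have hkD : k ≤ D := le_trans (by nlinarith) hD
  have hWpos : 0 < primorial D := primorial_pos D
  have hWD : ∀ q : ℕ, q.Prime → q ≤ D → q ∣ primorial D := fun q hq hqD => hq.dvd_primorial_iff.2 hqD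
  have hWD' : ∀ q : ℕ, q.Prime → D < q → q.Coprime (primorial D) := fun q hq hqD => by
    rw [hq.coprime_iff_not_dvd, hq.dvd_primorial_iff]; omega
  generalize primorial D = W at *
  have hW2 : 2 ≤ W := Nat.le_of_dvd hWpos (hWD 2 Nat.prime_two (by omega))
  have hWR : (0 : ℝ) < W := by exact_mod_cast hWpos
  have hφR : (0 : ℝ) < W.totient := by exact_mod_cast Nat.totient_pos.2 hWpos
  set b : ℝ := (W.totient : ℝ) / W with hb
  have hb0 : 0 < b := by positivity
  obtain ⟨Z0, hZ0⟩ := Hs_bounds W D (by omega) hW2 hWD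
  set K := (k + 1) ^ 2 - 1 with hK
  have hkK : k ≤ K := by rw [hK]; apply Nat.le_sub_of_add_le; nlinarith
  obtain ⟨C1, hbv⟩ := bv_main (4 * k + 1) K (hk1.trans hkK)
  set M := 1024 * k * (I + 1) with hM
  have hM1 : 1 ≤ M := Nat.mul_pos (by omega) (by omega)
  have hMR : (1 : ℝ) ≤ M := by exact_mod_cast hM1
  have hMk : 2 * k ≤ M := by rw [hM]; nlinarith [Nat.zero_le (k * I)]
  have hlZ0 : 0 ≤ Real.log ((Z0 + 1 : ℕ) : ℝ) := Real.log_natCast_nonneg _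
  obtain ⟨L, hLN, J, z, PR, htm, hEh⟩ := hbv (40000 * M * (Real.log ((Z0 + 1 : ℕ) : ℝ) + 8 / b + 1) + W + k + N0 + D)
  have h8b : 0 < 8 / b := by positivity
  have hMX : 0 ≤ 40000 * M * (Real.log ((Z0 + 1 : ℕ) : ℝ) + 8 / b + 1) := by positivity
  have hL1000 := PR.hL
  have hLp : 0 < L := by linarith
  have hN0R : (0 : ℝ) ≤ N0 := by positivity
  have hDR : (0 : ℝ) ≤ D := by positivity
  have hLz : L ≤ z := le_trans (le_self_pow₀ (by linarith) (by omega)) PR.zL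
  have hWz : W ≤ z := by exact_mod_cast (by linarith : (W : ℝ) ≤ z)
  have hDz : D ≤ z := by exact_mod_cast (by linarith : (D : ℝ) ≤ z)
  have hNz : N0 ≤ z := by exact_mod_cast (by linarith : (N0 : ℝ) ≤ z)
  have hz2 := PR.z2
  have hzR : (2 : ℝ) ≤ z := by exact_mod_cast hz2
  have hlz0 : 0 ≤ Real.log z := Real.log_natCast_nonneg z
  have hJ : (1 : ℝ) ≤ J + 1 := by linarith [(Nat.cast_nonneg J : (0 : ℝ) ≤ J)]
  have hlz1 : L / 20000 ≤ Real.log z := by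
    refine le_trans ?_ PR.lz'
    rw [div_le_div_iff_of_pos_right (by norm_num)]; exact le_mul_of_one_le_left hLp.le hJ
  have hlzM : 2 * M * (Real.log ((Z0 + 1 : ℕ) : ℝ) + 8 / b + 1) ≤ Real.log z := by
    refine le_trans ?_ hlz1
    rw [le_div_iff₀ (by norm_num)]; linarith
  have hz2M : 2 ^ M ≤ z := by
    have : Real.log ((2 ^ M : ℕ) : ℝ) ≤ Real.log z := by
      push_cast; rw [Real.log_pow]
      have h1 := Real.log_two_lt_d9
      have h2 : M * Real.log 2 ≤ M * 1 := mul_le_mul_of_nonneg_left (by linarith) (by linarith)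
      have h3 : 2 * (M : ℝ) * 1 ≤ 2 * M * (Real.log ((Z0 + 1 : ℕ) : ℝ) + 8 / b + 1) := mul_le_mul_of_nonneg_left (by linarith) (by linarith)
      linarith
    exact_mod_cast (Real.log_le_log_iff (by positivity) (by linarith)).1 this
  obtain ⟨Z, hZ2, hZM, hZ2M⟩ := root_ex M z hM1 hz2M
  set τ := Real.log Z with hτ
  have hZp : (0 : ℝ) < Z := by exact_mod_cast (by omega : 0 < Z)
  have t1 : M * τ ≤ Real.log z := by
    rw [hτ, ← Real.log_pow]; exact Real.log_le_log (by positivity) (by exact_mod_cast hZM)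
  have t2 : Real.log z ≤ 2 * M * τ := by
    have : Real.log z ≤ Real.log ((Z : ℝ) ^ (2 * M)) := Real.log_le_log (by linarith) (by exact_mod_cast hZ2M.le)
    rw [Real.log_pow] at this; push_cast at this; linarith
  have t3 : Real.log ((Z0 + 1 : ℕ) : ℝ) + 8 / b + 1 ≤ τ := by
    have := hlzM.trans t2
    exact le_of_mul_le_mul_left this (by positivity)
  have hτ0 : 0 < τ := by linarith
  have hZ0Z : Z0 ≤ Z := by
    have : Z0 + 1 ≤ Z := by exact_mod_cast (Real.log_le_log_iff (by positivity) hZp).1 (by linarith : Real.log ((Z0 + 1 : ℕ) : ℝ) ≤ Real.log Z)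
    omega
  have t4 : ((J : ℝ) + 1) * L / (40000 * 1024 * k * ((I : ℝ) + 1)) ≤ τ := by
    have : (J + 1) * L / 20000 ≤ 2 * M * τ := PR.lz'.trans t2
    rw [hM] at this; push_cast at this
    rw [div_le_iff₀ (by positivity)]; linarith
  obtain ⟨n, p, hi, hp, hr⟩ := enum_primes D z
  have hpp := fun t => (hp t).1
  have S : Sv W h p := ⟨hpp, hi, fun t => hWD' _ (hp t).1 (hp t).2.1, fun i t => (hDh i).trans_lt (hp t).2.1, hinj, hWpos,
    fun t => hkD.trans_lt (hp t).2.1, fun t => by have := (hp t).2.1; omega⟩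
  obtain ⟨B1, B2, B2', B3⟩ := A_eval p hpp hi W Z I z S.pW
    (fun q h1 h2 h3 => hr q h1 (by
      by_contra hcc
      exact ((h1.coprime_iff_not_dvd).1 h2) (hWD q h1 (by omega))) h3) (by omega)
    ((Nat.pow_le_pow_right (by omega) (by rw [← hk]; omega)).trans hZM) b hb0.le (fun X hX => hZ0 X (hZ0Z.trans hX))
  have hg0 := gd_nonneg Z I
  have hsq := sum_inv_sq p hi D z (by omega) (fun t => (hp t).2)
  set g := gd Z I with hg
  have hA2 : 1 ≤ A2 p g := by
    refine le_trans ?_ B2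
    have : 8 / b ≤ τ := by linarith
    rw [div_le_iff₀ hb0] at this
    linarith
  set c := fun r : Fin n → Option (Fin k) => cz p g z r with hc
  have hc0 : ∀ r, z < Nm none p r → c r = 0 := fun r hr => cz_supp r hr
  have hc1 : ∀ r, |c r| ≤ 1 / Nm none p r := fun r => cz_le hg0 (gd_le Z I) r
  have hjl : ((J + 1 : ℕ) : ℝ) ≤ Real.log ((z ^ 59 + 1 : ℕ) : ℝ) := by
    have h1 : Real.log ((z : ℝ) ^ 59) ≤ Real.log ((z ^ 59 + 1 : ℕ) : ℝ) := Real.log_le_log (by positivity) (by push_cast; linarith)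
    rw [Real.log_pow] at h1
    have := PR.lpos
    push_cast at h1 ⊢
    linarith
  have hzz : z ≤ z ^ 59 := Nat.le_self_pow (by norm_num) z
  have hz60 : z ^ 60 = z ^ 59 * z := pow_succ z 59
  -- upper bound
  set V := L ^ (J + 1) with hV
  have hVp : 0 < V := by positivity
  set Q := V * L / W * A2 p g ^ k with hQ
  have hVQ : V ≤ Q := by
    have h1 : 1 ≤ A2 p g ^ k := one_le_pow₀ hA2
    have h2 : 1 ≤ L / W := by rw [le_div_iff₀ hWR]; linarith
    calc V = V * 1 * 1 := by ring
      _ ≤ V * (L / W) * A2 p g ^ k := by gcongr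
      _ = Q := by rw [hQ]; ring
  have hlogL : (1 + Real.log z) ^ (2 * k) ≤ L ^ (4 * k) := by
    calc (1 + Real.log z) ^ (2 * k) ≤ (L ^ 2) ^ (2 * k) := by
          have := PR.ly
          gcongr; linarith
      _ = _ := by rw [← pow_mul]; congr 1; ring
  have hL4z : L ^ (4 * k) ≤ z := by
    refine le_trans (pow_le_pow_right₀ (by linarith) ?_) PR.zL
    have h1 := PR.C1
    have h2 : K ≤ K ^ 2 := Nat.le_self_pow (by norm_num) K
    omega
  have U1 := S1_cmp S hc0 hc1 L hLp (J + 1) (z ^ 59) hjl v0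
  have U2 : ∑' N, (if z ^ 59 < N ∧ N ≡ v0 [MOD W] then v L (J + 1) N else 0) * Phi p c (Xc p h N) ^ 2 ≤ 4 * Q + V := by
    refine U1.trans (add_le_add ?_ ?_)
    · have m1 : (∑' N, if z ^ 59 < N then v L (J + 1) N else 0) ≤ 2 * (V * L) := by
        refine le_trans (Summable.tsum_le_tsum (fun N => ?_) (wn_sum _ L hLp _) (summable_v L hLp (J + 1))) (le_of_le_of_eq (PR.hV (J + 1)) (by rw [hV]; ring))
        split_ifs <;> simp [v_nonneg]
      have m2 : ∑ s, (∏ t, nu1 (p t) (s t)) * c s ^ 2 ≤ 2 * A2 p g ^ k :=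
        (MT1 hg0 hpp).trans (mul_le_mul_of_nonneg_right (prod_le_two p D (by omega) hsq) (by positivity))
      calc _ ≤ (∑' N, if z ^ 59 < N then v L (J + 1) N else 0) / W * (2 * A2 p g ^ k) :=
            mul_le_mul_of_nonneg_left m2 (div_nonneg (tsum_nonneg fun N => by split_ifs <;> simp [v_nonneg]) hWR.le)
        _ ≤ 2 * (V * L) / W * (2 * A2 p g ^ k) := by gcongr
        _ = 4 * Q := by rw [hQ]; ring
    · have e1 : (z * (1 + Real.log z) ^ (2 * k)) ^ 2 ≤ ((z ^ 59 + 1 : ℕ) : ℝ) := by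
        calc (z * (1 + Real.log z) ^ (2 * k)) ^ 2 ≤ ((z : ℝ) * z) ^ 2 := by
              have := hlogL.trans hL4z
              gcongr
          _ = (z : ℝ) ^ 4 := by ring
          _ ≤ (z : ℝ) ^ 59 := pow_le_pow_right₀ (by linarith) (by norm_num)
          _ ≤ _ := by push_cast; linarith
      rw [mul_div_assoc', div_le_iff₀ (by positivity), mul_comm V]
      exact mul_le_mul_of_nonneg_right e1 hVp.le
  -- lower bound
  have U3 : ∀ m, 16 / (k : ℝ) * Q - V / k ≤ ∑' N, (if (N.Prime ∧ z ^ 60 < N) ∧ N ≡ v0 + h m [MOD W] then v L (J + 1) N else 0) * Phi p c (Xc p h (N - h m)) ^ 2 := by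
    intro m
    have hm := hDh m
    refine le_trans (sub_le_sub ?_ ?_) (S2_cmp S hc0 hc1 L hLp (J + 1) (z ^ 60) v0 m (hv m) ?_ ?_ ?_)
    · have mt := MT2 (p := p) (g := g) (z := z) hg0 (gd_anti Z I) (fun a ha => by
          have := gd_ne Z I a (by omega) ha
          rw [← hk] at this
          calc a ^ 2 ≤ (Z ^ k) ^ 2 := Nat.pow_le_pow_left this 2
            _ = Z ^ (2 * k) := by rw [← pow_mul]; congr 1; ring
            _ ≤ Z ^ M := Nat.pow_le_pow_right (by omega) hMk
            _ ≤ z := hZM) hpp (fun t => S.kp t) hz2 (by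
          have hDk : 12 * (k : ℝ) ^ 2 ≤ D := by exact_mod_cast hD
          have hD0 : (0 : ℝ) < D := by exact_mod_cast (by omega : 0 < D)
          calc 3 * (k : ℝ) ^ 2 * ∑ t, 1 / (p t : ℝ) ^ 2 ≤ 3 * (k : ℝ) ^ 2 * (1 / D) := by gcongr
            _ ≤ 1 / 4 := by rw [mul_one_div, div_le_iff₀ hD0]; linarith) (16 * ((I : ℝ) + 1) * τ) (by positivity) B3 (by
          refine le_trans ?_ t1
          rw [hM]; push_cast
          have : 0 ≤ (k : ℝ) * (I + 1) * τ := by positivity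
          linarith) m
      have cr := crunch V L (J + 1) W W.totient τ (A1 p g) (A2 p g) (A2 p g ^ (k - 1)) k (I + 1) hVp hLp (by linarith) hWR hφR
        (by positivity) (by linarith) hI (by linarith) B1 B2' t4
      rw [← pow_succ (A2 p g) (k - 1), Nat.sub_add_cancel hk1] at cr
      refine cr.trans ?_
      exact mul_le_mul (div_le_div_of_nonneg_right htm hφR.le) mt (by positivity)
        (div_nonneg (tsum_nonneg fun N => by split_ifs <;> simp [v_nonneg]) hφR.le)
    · have e2 := (err2 K (hk1.trans hkK) L hLp (J + 1) (z ^ 60) W z hWpos hWz).trans hEh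
      have e3 : 0 ≤ V / L ^ (4 * k + 1) := by positivity
      calc _ ≤ L ^ (4 * k) * (V / L ^ (4 * k + 1)) := by
            refine mul_le_mul hlogL e2 (sum_nonneg fun q _ => mul_nonneg (by positivity) (Eh_nonneg _ _ _ _)) (by positivity)
        _ = V / L := by rw [pow_succ]; field_simp
        _ ≤ V / k := div_le_div_of_nonneg_left hVp.le (by linarith) (by linarith)
    · calc W * z ^ 2 ≤ z * z ^ 2 := Nat.mul_le_mul_right _ hWz
        _ = z ^ 3 := by ring
        _ ≤ z ^ 60 := Nat.pow_le_pow_right (by omega) (by norm_num)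
    · intro t
      exact (hp t).2.2.trans (Nat.le_self_pow (by norm_num) z)
    · exact (hm.trans hDz).trans (Nat.le_self_pow (by norm_num) z)
  have U4 := S_le (W := W) h (Xc p h) (fun w => Phi p c w ^ 2) (fun w => sq_nonneg _) L hLp (J + 1) (z ^ 60) (z ^ 59) v0 (fun m => by
      have := hDh m
      rw [hz60]
      exact le_trans (by omega) (Nat.mul_le_mul_left (z ^ 59) hz2)) hjl (fun N h1 h2 m m' h3 h4 => by
      by_contra hne
      exact hcon ⟨N, by omega, h2, m, m', hne, h3, h4⟩)
  have U5 : ∑ m : Fin k, (16 / (k : ℝ) * Q - V / k) ≤ 4 * Q + V := (sum_le_sum fun m _ => U3 m).trans (U4.trans U2)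
  rw [sum_const, card_univ, Fintype.card_fin, nsmul_eq_mul] at U5
  have : (k : ℝ) * (16 / (k : ℝ) * Q - V / k) = 16 * Q - V := by field_simp
  rw [this] at U5
  linarith

end BG

namespace BG
set_option maxHeartbeats 400000
open Finset Filter Topology

lemma choose_tuple (H : Set ℕ) (hH : H.Infinite) (k : ℕ) :
    ∃ h : Fin k → ℕ, StrictMono h ∧ (∀ i, h i ∈ H) ∧ ∃ r, ∀ i, h i ≡ r [MOD k.factorial] := by
  obtain ⟨r, hr⟩ : ∃ r, (H ∩ {x | x % k.factorial = r}).Infinite := by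
    by_contra hcon
    push Not at hcon
    refine hH (Set.Finite.subset (Set.Finite.biUnion (Set.finite_lt_nat k.factorial) fun r _ => hcon r) ?_)
    intro x hx
    simp only [Set.mem_iUnion]
    exact ⟨x % k.factorial, Nat.mod_lt _ (Nat.factorial_pos k), hx, rfl⟩
  obtain ⟨t, ht, htc⟩ := hr.exists_subset_card_eq k
  refine ⟨fun i => t.orderEmbOfFin htc i, (t.orderEmbOfFin htc).strictMono, fun i => (ht (orderEmbOfFin_mem t htc i)).1, r, fun i => ?_⟩
  have h1 : (t.orderEmbOfFin htc i) % k.factorial = r := (ht (orderEmbOfFin_mem t htc i)).2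
  show _ % _ = _ % _
  rw [h1, ← h1, Nat.mod_mod]

lemma local_res (k : ℕ) (h : Fin k → ℕ) (r : ℕ) (hr : ∀ i, h i ≡ r [MOD k.factorial]) (B : ℕ) (hB : ∀ i, h i ≤ B)
    (q : ℕ → ℕ) (hq : Function.Injective q) (hqB : ∀ m, B < q m) (p : ℕ) (hp : p.Prime) :
    ∃ a, (∀ i, ¬ p ∣ a + h i) ∧ ∀ m ≤ B, (∀ i, h i ≠ m) → q m = p → p ∣ a + m := by
  by_cases hex : ∃ m ≤ B, (∀ i, h i ≠ m) ∧ q m = p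
  · obtain ⟨m, hmB, hm, rfl⟩ := hex
    have hlt : m < q m := hmB.trans_lt (hqB m)
    refine ⟨q m - m, fun i hd => ?_, fun m' _ _ h' => ?_⟩
    · have h1 : q m ∣ q m - m + m := by rw [Nat.sub_add_cancel hlt.le]
      have h2 : h i ≡ m [MOD q m] :=
        Nat.ModEq.add_left_cancel' (q m - m) (((Nat.modEq_zero_iff_dvd.2 hd)).trans (Nat.modEq_zero_iff_dvd.2 h1).symm)
      exact hm i (h2.eq_of_lt_of_lt ((hB i).trans_lt (hqB m)) hlt)
    · rw [hq h', Nat.sub_add_cancel hlt.le]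
  · refine (?_ : ∃ a, ∀ i, ¬ p ∣ a + h i).imp fun a ha => ⟨ha, fun m hm1 hm2 hm3 => absurd ⟨m, hm1, hm2, hm3⟩ hex⟩
    by_cases hpk : p ≤ k
    · have hd : p ∣ k.factorial := (hp.dvd_factorial).2 hpk
      refine ⟨p * (r + 1) - r + 1, fun i hi => ?_⟩
      have hle : r ≤ p * (r + 1) := by nlinarith [hp.two_le]
      have h1 : p * (r + 1) - r + 1 + h i ≡ p * (r + 1) - r + 1 + r [MOD p] := Nat.ModEq.add_left _ ((hr i).of_dvd hd)
      have h2 : p ∣ p * (r + 1) - r + 1 + r := (h1.dvd_iff dvd_rfl).1 hi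
      rw [show p * (r + 1) - r + 1 + r = p * (r + 1) + 1 by omega, Nat.dvd_add_right (Dvd.intro _ rfl)] at h2
      exact hp.one_lt.ne' (Nat.dvd_one.1 h2)
    · have : Fact p.Prime := ⟨hp⟩
      have : ¬ Function.Surjective fun i : Fin k => (-(h i : ZMod p)) := by
        intro hs
        have := Fintype.card_le_of_surjective _ hs
        rw [ZMod.card, Fintype.card_fin] at this
        omega
      rw [Function.Surjective] at this
      push Not at this
      obtain ⟨a, ha⟩ := this
      refine ⟨a.val, fun i hi => ha i ?_⟩
      have := (ZMod.natCast_eq_zero_iff _ _).2 hi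
      push_cast at this
      rw [ZMod.natCast_zmod_val] at this
      exact (eq_neg_of_add_eq_zero_left this).symm

lemma consec (N B : ℕ) (x y : ℕ) (hxy : x < y) (hy : y ≤ B) (hx : (N + x).Prime) (hy' : (N + y).Prime) :
    ∃ n y', Nat.nth Nat.Prime n = N + x ∧ Nat.nth Nat.Prime (n + 1) = N + y' ∧ x < y' ∧ y' ≤ B ∧ (N + y').Prime := by
  have h1 := Nat.nth_count hx
  have h2 := Nat.nth_count hy'
  set n := Nat.count Nat.Prime (N + x)
  set n' := Nat.count Nat.Prime (N + y)
  have mono := Nat.nth_strictMono Nat.infinite_setOfPred_prime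
  have hn : n < n' := by
    rw [← mono.lt_iff_lt, h1, h2]; omega
  have h3 : Nat.nth Nat.Prime n < Nat.nth Nat.Prime (n + 1) := mono (Nat.lt_succ_self n)
  have h4 : Nat.nth Nat.Prime (n + 1) ≤ N + y := by rw [← h2]; exact mono.monotone hn
  have h5 := Nat.prime_nth_prime (n + 1)
  refine ⟨n, Nat.nth Nat.Prime (n + 1) - N, h1, ?_, ?_, ?_, ?_⟩
  · omega
  · omega
  · omega
  · rwa [show N + (Nat.nth Nat.Prime (n + 1) - N) = Nat.nth Nat.Prime (n + 1) by omega]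

theorem KT (H : Set ℕ) (hH : H.Infinite) : ∃ a ∈ H, ∃ b ∈ H, a < b ∧ DePolignac (b - a) := by
  obtain ⟨I, hI⟩ := exists_nat_ge ((2 : ℝ) ^ 41)
  have hI' : (2 : ℝ) ^ 41 ≤ (I : ℝ) + 1 := by linarith
  obtain ⟨k, hk⟩ : ∃ k, k = 2 ^ I := ⟨_, rfl⟩
  obtain ⟨h, hmono, hmem, r, hr⟩ := choose_tuple H hH k
  set B := k + ∑ i, h i with hBdef
  have hB : ∀ i, h i ≤ B := fun i => (single_le_sum (fun i _ => Nat.zero_le (h i)) (mem_univ i)).trans (Nat.le_add_left _ _)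
  have pmono := Nat.nth_strictMono Nat.infinite_setOfPred_prime
  set q : ℕ → ℕ := fun m => Nat.nth Nat.Prime (B + m) with hqdef
  have hq : Function.Injective q := fun a b hab => by have := pmono.injective hab; omega
  have hqB : ∀ m, B < q m := fun m => by have := Nat.add_two_le_nth_prime (B + m); show B < Nat.nth Nat.Prime (B + m); omega
  choose! a ha1 ha2 using local_res k h r hr B hB q hq hqB
  set D := 12 * k ^ 2 + B + q B with hD
  obtain ⟨v0, hv0⟩ := Nat.chineseRemainderOfFinset a (fun p => p) ((range (D + 1)).filter Nat.Prime)
    (fun p hp => (mem_filter.1 hp).2.ne_zero) (fun p hp p' hp' hne => by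
      simp only [coe_filter, Set.mem_ofPred_eq] at hp hp'
      exact (Nat.coprime_primes hp.2 hp'.2).2 hne)
  have hv0' : ∀ p, p.Prime → p ≤ D → v0 ≡ a p [MOD p] := fun p hp hpD => hv0 p (mem_filter.2 ⟨mem_range.2 (by omega), hp⟩)
  have hcop : ∀ m, (v0 + h m).Coprime (primorial D) := by
    intro m
    refine Nat.coprime_of_dvd fun p hp h1 h2 => ?_
    have hpD : p ≤ D := hp.dvd_primorial_iff.1 h2
    exact ha1 p hp m (((Nat.ModEq.add_right (h m) (hv0' p hp hpD)).dvd_iff dvd_rfl).1 h1)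
  have key : ∀ N0, ∃ N, N0 < N ∧ ∃ n, ∃ m m' : Fin k, m < m' ∧ Nat.nth Nat.Prime n = N + h m ∧ Nat.nth Nat.Prime (n + 1) = N + h m' := by
    intro N0
    obtain ⟨N, hN, hNv, m, m', hne, hp, hp'⟩ := sieve I k hk hI' h hmono.injective D (by omega) (fun i => by have := hB i; omega) v0 hcop (N0 + D)
    refine ⟨N, by omega, ?_⟩
    wlog hlt : m < m' generalizing m m'
    · exact this m' m hne.symm hp' hp (lt_of_le_of_ne (not_lt.1 hlt) hne.symm)
    obtain ⟨n, y', h1, h2, h3, h4, h5⟩ := consec N B (h m) (h m') (hmono hlt) (hB m') hp hp'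
    have : ∃ i, h i = y' := by
      by_contra hcon
      push Not at hcon
      have hqp : (q y').Prime := Nat.prime_nth_prime _
      have hqD : q y' ≤ D := by
        have : q y' ≤ q B := pmono.monotone (by omega)
        omega
      have h6 := ha2 _ hqp y' h4 hcon rfl
      have hW : q y' ∣ primorial D := hqp.dvd_primorial_iff.2 hqD
      have h7 : N ≡ a (q y') [MOD q y'] := (hNv.of_dvd hW).trans (hv0' _ hqp hqD)
      have h8 : q y' ∣ N + y' := ((Nat.ModEq.add_right y' h7).dvd_iff dvd_rfl).2 h6
      have := (Nat.prime_dvd_prime_iff_eq hqp h5).1 h8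
      omega
    obtain ⟨i, rfl⟩ := this
    exact ⟨n, m, i, hmono.lt_iff_lt.1 h3, h1, h2⟩
  by_contra hcon
  push Not at hcon
  have hfin : ∀ P : Fin k × Fin k, P.1 < P.2 → {n : ℕ | Nat.nth Nat.Prime (n + 1) - Nat.nth Nat.Prime n = h P.2 - h P.1}.Finite := fun P hP =>
    Set.not_infinite.1 (hcon _ (hmem P.1) _ (hmem P.2) (hmono hP))
  have hU : (⋃ P : Fin k × Fin k, {n : ℕ | P.1 < P.2 ∧ Nat.nth Nat.Prime (n + 1) - Nat.nth Nat.Prime n = h P.2 - h P.1}).Finite := by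
    refine Set.finite_iUnion fun P => ?_
    by_cases hP : P.1 < P.2
    · exact (hfin P hP).subset fun n hn => hn.2
    · exact Set.finite_empty.subset fun n hn => hP hn.1
  refine Set.infinite_of_forall_exists_gt (fun x => ?_) hU
  obtain ⟨N, hN, n, m, m', hlt, h1, h2⟩ := key (Nat.nth Nat.Prime x)
  refine ⟨n, Set.mem_iUnion.2 ⟨(m, m'), hlt, ?_⟩, ?_⟩
  · show _ = h m' - h m
    rw [h1, h2]; omega
  · refine pmono.lt_iff_lt.1 ?_
    show Nat.nth Nat.Prime x < Nat.nth Nat.Prime n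
    rw [h1]; omega

lemma clique_step (R : ℕ → ℕ → Prop) (hR : ∀ T : Set ℕ, T.Infinite → ∃ a ∈ T, ∃ b ∈ T, a < b ∧ R a b) (T : Set ℕ) (hT : T.Infinite) :
    ∃ a ∈ T, {b | b ∈ T ∧ a < b ∧ R a b}.Infinite := by
  by_contra hcon
  push Not at hcon
  obtain ⟨f, hf1, hf2⟩ := exists_seq_of_forall_finset_exists (fun x => x ∈ T) (fun x y => x < y ∧ ¬ R x y) (fun s hs => by
    have hfin : (⋃ x ∈ s, ({b | b ∈ T ∧ x < b ∧ R x b} ∪ {b | b ≤ x})).Finite := by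
      refine Set.Finite.biUnion s.finite_toSet fun x hx => ?_
      exact (hcon x (hs x hx)).union (Set.finite_le_nat x)
    obtain ⟨y, hy, hy'⟩ := (hT.sdiff hfin).nonempty
    refine ⟨y, hy, fun x hx => ?_⟩
    by_contra h0
    apply hy'
    simp only [Set.mem_iUnion]
    refine ⟨x, hx, ?_⟩
    by_cases hxy : x < y
    · left
      exact ⟨hy, hxy, by by_contra h1; exact h0 ⟨hxy, h1⟩⟩
    · right; exact not_lt.1 hxy)
  have hfm : StrictMono f := fun m n hmn => (hf2 m n hmn).1
  obtain ⟨a, ⟨m, rfl⟩, b, ⟨n, rfl⟩, hlt, hab⟩ := hR (Set.range f) (Set.infinite_range_of_injective hfm.injective)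
  exact (hf2 m n (hfm.lt_iff_lt.1 hlt)).2 hab

lemma clique (R : ℕ → ℕ → Prop) (hR : ∀ T : Set ℕ, T.Infinite → ∃ a ∈ T, ∃ b ∈ T, a < b ∧ R a b) (k : ℕ) :
    ∀ T : Set ℕ, T.Infinite → ∃ f : ℕ → ℕ, (∀ i ≤ k, f i ∈ T) ∧ ∀ i j, i < j → j ≤ k → f i < f j ∧ R (f i) (f j) := by
  induction k with
  | zero =>
    intro T hT
    obtain ⟨x, hx⟩ := hT.nonempty
    exact ⟨fun _ => x, fun _ _ => hx, fun i j h1 h2 => by omega⟩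
  | succ k ih =>
    intro T hT
    obtain ⟨a, haT, ha⟩ := clique_step R hR T hT
    obtain ⟨f, hf1, hf2⟩ := ih _ ha
    refine ⟨fun i => if i = 0 then a else f (i - 1), fun i hi => ?_, fun i j hij hj => ?_⟩
    · by_cases h0 : i = 0
      · simp only [h0, if_true]; exact haT
      · simp only [h0, if_false]; exact (hf1 (i - 1) (by omega)).1
    · have hj0 : j ≠ 0 := by omega
      by_cases h0 : i = 0
      · simp only [h0, hj0, if_true, if_false]; exact (hf1 (j - 1) (by omega)).2
      · simp only [h0, hj0, if_false]; exact hf2 (i - 1) (j - 1) (by omega) (by omega)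

theorem final (M : Set ℕ) (hM : M.Infinite) (hM0 : ∀ m ∈ M, 0 < m) (k : ℕ) :
    ∃ a : ℕ → ℕ, (∀ n, 1 ≤ n → n ≤ k → a n ∈ FS M) ∧
      (∀ i j, 1 ≤ i → i ≤ j → j ≤ k → DePolignac (∑ n ∈ Finset.Icc i j, a n)) ∧
      (∀ i j i' j', 1 ≤ i → i ≤ j → j ≤ k → 1 ≤ i' → i' ≤ j' → j' ≤ k →
        (∑ n ∈ Finset.Icc i j, a n) = (∑ n ∈ Finset.Icc i' j', a n) →
        i = i' ∧ j = j') := by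
  obtain ⟨m, hm1, hm2⟩ := exists_seq_of_forall_finset_exists (fun x => x ∈ M) (fun x y => 2 * x < y) (fun s _ => by
    obtain ⟨y, hy, hlt⟩ := hM.exists_gt (2 * ∑ x ∈ s, x)
    exact ⟨y, hy, fun x hx => lt_of_le_of_lt (Nat.mul_le_mul_left 2 (single_le_sum (f := fun x => x) (fun i _ => Nat.zero_le i) hx)) hlt⟩)
  have hpos : ∀ i, 0 < m i := fun i => hM0 _ (hm1 i)
  have hmm : StrictMono m := fun a b hab => by have := hm2 a b hab; omega
  set s : ℕ → ℕ := fun b => ∑ i ∈ range b, m i with hs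
  have hsm : StrictMono s := strictMono_nat_of_lt_succ fun b => by
    simp only [hs, sum_range_succ]; have := hpos b; omega
  have hlt : ∀ b, s b < m b := by
    intro b
    induction b with
    | zero => simpa [hs] using hpos 0
    | succ b ih =>
      have := hm2 b (b + 1) (by omega)
      have e : s (b + 1) = s b + m b := sum_range_succ _ _
      omega
  have hinj : ∀ a b a' b', a < b → a' < b' → s b - s a = s b' - s a' → b ≤ b' := by
    intro a b a' b' h1 h2 h3
    by_contra h4
    have e1 : s (b - 1) + m (b - 1) = s b := by
      rw [← show s (b - 1 + 1) = s (b - 1) + m (b - 1) from sum_range_succ _ _, Nat.sub_add_cancel (by omega)]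
    have e2 : s a ≤ s (b - 1) := hsm.monotone (by omega)
    have e3 := hlt b'
    have e4 : m b' ≤ m (b - 1) := hmm.monotone (by omega)
    omega
  obtain ⟨f, -, hf⟩ := clique (fun a b => DePolignac (s b - s a)) (fun T hT => by
    obtain ⟨_, ⟨x, hx, rfl⟩, _, ⟨y, hy, rfl⟩, h1, h2⟩ := KT (Set.image s T) (hT.image hsm.injective.injOn)
    exact ⟨x, hx, y, hy, hsm.lt_iff_lt.1 h1, h2⟩) k Set.univ Set.infinite_univ
  have hsum : ∀ i j, 1 ≤ i → i ≤ j → j ≤ k → ∑ n ∈ Finset.Icc i j, (s (f n) - s (f (n - 1))) = s (f j) - s (f (i - 1)) := by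
    intro i j hi hij hj
    induction j, hij using Nat.le_induction with
    | base => simp
    | succ j hij ih =>
      rw [sum_Icc_succ_top (by omega), ih (by omega)]
      have h1 := hsm (hf j (j + 1) (by omega) hj).1
      have h2 := hsm (hf (i - 1) j (by omega) (by omega)).1
      simp only [Nat.add_sub_cancel]
      omega
  refine ⟨fun n => s (f n) - s (f (n - 1)), fun n h1 h2 => ?_, fun i j h1 h2 h3 => ?_, fun i j i' j' h1 h2 h3 h1' h2' h3' h => ?_⟩
  · have hl := (hf (n - 1) n (by omega) h2).1
    have hl' := hsm hl
    refine ⟨by show s (f n) - s (f (n - 1)) ≠ 0; omega, (Ico (f (n - 1)) (f n)).image m, ?_, ?_, ?_⟩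
    · exact (nonempty_Ico.2 hl).image m
    · intro x hx
      simp only [coe_image, Set.mem_image] at hx
      obtain ⟨i, -, rfl⟩ := hx
      exact hm1 i
    · rw [sum_image hmm.injective.injOn]
      have := sum_range_add_sum_Ico m hl.le
      show _ = s (f n) - s (f (n - 1))
      simp only [hs]
      omega
  · rw [hsum i j h1 h2 h3]
    exact (hf (i - 1) j (by omega) h3).2
  · rw [hsum i j h1 h2 h3, hsum i' j' h1' h2' h3'] at h
    have g1 := (hf (i - 1) j (by omega) h3).1
    have g2 := (hf (i' - 1) j' (by omega) h3').1
    have e1 : f j = f j' := le_antisymm (hinj _ _ _ _ g1 g2 h) (hinj _ _ _ _ g2 g1 h.symm)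
    have g3 := hsm g1
    have g4 := hsm g2
    rw [e1] at h g3
    have e2 : f (i - 1) = f (i' - 1) := hsm.injective (by omega)
    have finj : ∀ x y, x ≤ k → y ≤ k → f x = f y → x = y := by
      intro x y hx hy hxy
      rcases lt_trichotomy x y with hc | hc | hc
      · have := (hf x y hc hy).1; omega
      · exact hc
      · have := (hf y x hc hx).1; omega
    have := finj _ _ h3 h3' e1
    have := finj _ _ (by omega) (by omega) e2
    omega

end BG

/-- For an IP set `A ⊆ 2ℕ` and any `k ≥ 1`, there are `a 1, …, a k ∈ A` such that
every consecutive sum `a i + ⋯ + a j` (for `1 ≤ i ≤ j ≤ k`) is a de Polignac number,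
and all these sums are pairwise distinct. -/
theorem ip_set_consecutive_sums_de_polignac
    (A : Set ℕ) (hA : IsIPSet A) (hEven : ∀ a ∈ A, Even a ∧ 0 < a)
    (k : ℕ) (hk : 1 ≤ k) :
    ∃ a : ℕ → ℕ, (∀ n, 1 ≤ n → n ≤ k → a n ∈ A) ∧
      (∀ i j, 1 ≤ i → i ≤ j → j ≤ k → DePolignac (∑ n ∈ Finset.Icc i j, a n)) ∧
      (∀ i j i' j', 1 ≤ i → i ≤ j → j ≤ k → 1 ≤ i' → i' ≤ j' → j' ≤ k →
        (∑ n ∈ Finset.Icc i j, a n) = (∑ n ∈ Finset.Icc i' j', a n) →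
        i = i' ∧ j = j') := by
  obtain ⟨M, hM, hM0, rfl⟩ := hA
  exact BG.final M hM hM0 k
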